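/- Let K be a number field whose ring of integers 𝓞_K is a Euclidean domain, let r₁ be the number of real places of K and r₂ the number of complex places of K. Then for every n ≥ 2, the rational group cohomology H^d(SL_n(𝓞_K); ℚ) vanishes in the degree d = r₁·(n(n+1)/2 − 1) + r₂·(n² − 1) − (n − 1) (the virtual cohomological dimension of SL_n(𝓞_K)). (Lee–Szczarba) -/

import Mathlib

open NumberField NumberField.InfinitePlace

/-- A commutative ring *is a Euclidean domain* if it admits a Euclidean domain structure
compatible with its given ring structure. -/
def IsEuclideanDomain (R : Type*) [commR : CommRing R] : Prop :=
  ∃ e : EuclideanDomain R, e.toCommRing = commR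

namespace LS

/-- Rational chains on finite lists. -/
abbrev Ch (τ : Type*) := List τ →₀ ℚ

section Chains
variable {τ : Type*}

/-- Prepending a vertex. -/
noncomputable def cn (x : τ) : Ch τ →ₗ[ℚ] Ch τ := Finsupp.lmapDomain ℚ ℚ (List.cons x)

/-- Boundary of a list. -/
noncomputable def bdL : List τ → Ch τ
  | [] => 0
  | x :: l => Finsupp.single l 1 - cn x (bdL l)

/-- The augmented simplicial boundary. -/
noncomputable def bd : Ch τ →ₗ[ℚ] Ch τ := Finsupp.linearCombination ℚ bdL

@[simp] lemma cn_single (x : τ) (l : List τ) (a : ℚ) :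
    cn x (Finsupp.single l a) = Finsupp.single (x :: l) a := by
  simp [cn]

@[simp] lemma bd_single (l : List τ) (a : ℚ) : bd (Finsupp.single l a) = a • bdL l := by
  simp [bd]

lemma bd_single_nil (a : ℚ) : bd (Finsupp.single ([] : List τ) a) = 0 := by simp [bdL]

lemma bd_cn (x : τ) (c : Ch τ) : bd (cn x c) = c - cn x (bd c) := by
  induction c using Finsupp.induction_linear with
  | zero => simp
  | add f g hf hg => simp only [map_add, hf, hg]; abel
  | single l a => simp [bdL, smul_sub]

lemma bd_bdL (l : List τ) : bd (bdL l) = 0 := by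
  induction l with
  | nil => simp [bdL]
  | cons x l ih => simp [bdL, bd_cn, ih]

@[simp] lemma bd_bd (c : Ch τ) : bd (bd c) = 0 := by
  induction c using Finsupp.induction_linear with
  | zero => simp
  | add f g hf hg => simp only [map_add, hf, hg]; simp
  | single l a => simp [bd_bdL]

/-- Coefficients of the lists with head `x`. -/
noncomputable def tl (x : τ) : Ch τ →ₗ[ℚ] Ch τ :=
  Finsupp.lcomapDomain (List.cons x) (List.cons_injective)

@[simp] lemma tl_apply (x : τ) (c : Ch τ) (l : List τ) : tl x c l = c (x :: l) := rfl

@[simp] lemma tl_cn_self (x : τ) (c : Ch τ) : tl x (cn x c) = c := by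
  ext l
  simp [cn, Finsupp.mapDomain_apply List.cons_injective]

lemma cn_apply_cons [DecidableEq τ] (x y : τ) (c : Ch τ) (l : List τ) :
    cn x c (y :: l) = if x = y then c l else 0 := by
  split_ifs with h
  · subst h; simp [cn, Finsupp.mapDomain_apply List.cons_injective]
  · rw [cn, Finsupp.lmapDomain_apply, Finsupp.mapDomain_of_notMem_range]
    rintro ⟨m, hm⟩
    exact h (List.cons.inj hm).1

lemma cn_apply_nil (x : τ) (c : Ch τ) : cn x c [] = 0 := by
  rw [cn, Finsupp.lmapDomain_apply, Finsupp.mapDomain_of_notMem_range]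
  rintro ⟨m, hm⟩
  exact absurd hm (by simp)

lemma tl_cn_of_ne {x y : τ} (h : x ≠ y) (c : Ch τ) : tl y (cn x c) = 0 := by
  classical
  ext l
  simp [cn_apply_cons, h]

/-- Lists in `X`, pairwise related, of length `k`. -/
def flS (r : τ → τ → Prop) (X : Set τ) (k : ℕ) : Set (List τ) :=
  {l | l.Pairwise r ∧ (∀ x ∈ l, x ∈ X) ∧ l.length = k}

/-- Chains of degree `k` on `X` (degree is the number of vertices). -/
noncomputable def fl (r : τ → τ → Prop) (X : Set τ) (k : ℕ) : Submodule ℚ (Ch τ) :=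
  Finsupp.supported ℚ ℚ (flS r X k)

variable {r : τ → τ → Prop} {X Y : Set τ} {k : ℕ}

lemma mem_fl {c : Ch τ} : c ∈ fl r X k ↔ ∀ l, c l ≠ 0 → l ∈ flS r X k := by
  simp [fl, Finsupp.mem_supported, Set.subset_def]

lemma single_mem_fl {l : List τ} (h : l ∈ flS r X k) (a : ℚ) : Finsupp.single l a ∈ fl r X k :=
  Finsupp.single_mem_supported ℚ a h

lemma fl_mono (h : X ⊆ Y) : fl r X k ≤ fl r Y k :=
  Finsupp.supported_mono fun _ hl => ⟨hl.1, fun x hx => h (hl.2.1 x hx), hl.2.2⟩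

lemma flS_cons {x : τ} {l : List τ} :
    x :: l ∈ flS r X (k + 1) ↔ x ∈ X ∧ l ∈ flS r {y ∈ X | r x y} k := by
  simp only [flS, Set.mem_ofPred_eq, List.pairwise_cons, List.mem_cons, forall_eq_or_imp,
    List.length_cons, Nat.add_right_cancel_iff]
  constructor
  · rintro ⟨⟨a, b⟩, ⟨c, d⟩, e⟩; exact ⟨c, b, fun y hy => ⟨d y hy, a y hy⟩, e⟩
  · rintro ⟨c, b, d, e⟩; exact ⟨⟨fun y hy => (d y hy).2, b⟩, ⟨c, fun y hy => (d y hy).1⟩, e⟩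

lemma flS_zero {l : List τ} : l ∈ flS r X 0 ↔ l = [] := by
  simp only [flS, Set.mem_ofPred_eq]
  constructor
  · rintro ⟨_, _, h⟩; simpa using h
  · rintro rfl; simp

/-- Induction principle for a linear statement on chains. -/
lemma fl_induction {p : (c : Ch τ) → c ∈ fl r X k → Prop} (h0 : p 0 (zero_mem _))
    (ha : ∀ f g hf hg, p f hf → p g hg → p (f + g) (add_mem hf hg))
    (hs : ∀ l (hl : l ∈ flS r X k) (a : ℚ), p (Finsupp.single l a) (single_mem_fl hl a))
    (c : Ch τ) (hc : c ∈ fl r X k) : p c hc := by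
  have key : ∃ h, p c h := by
    rw [← Finsupp.sum_single c]
    refine Finset.sum_induction _ (fun c => ∃ h, p c h) ?_ ⟨_, h0⟩ fun l hl => ?_
    · rintro f g ⟨hf, h1⟩ ⟨hg, h2⟩; exact ⟨_, ha f g hf hg h1 h2⟩
    · exact ⟨_, hs l (mem_fl.1 hc l (by simpa using hl)) _⟩
  exact key.2

lemma cn_mem {x : τ} (hx : x ∈ X) {c : Ch τ} (hc : c ∈ fl r {y ∈ X | r x y} k) :
    cn x c ∈ fl r X (k + 1) := by
  induction c, hc using fl_induction with
  | h0 => simp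
  | ha f g _ _ hf hg => rw [map_add]; exact add_mem hf hg
  | hs l hl a => rw [cn_single]; exact single_mem_fl (flS_cons.2 ⟨hx, hl⟩) a

lemma tl_mem {c : Ch τ} (x : τ) (hc : c ∈ fl r X (k + 1)) : tl x c ∈ fl r {y ∈ X | r x y} k :=
  mem_fl.2 fun l hl => (flS_cons.1 (mem_fl.1 hc (x :: l) hl)).2

lemma tl_eq_zero {c : Ch τ} {x : τ} (hc : c ∈ fl r X (k + 1)) (hx : x ∉ X) : tl x c = 0 := by
  ext l
  by_contra h
  exact hx (flS_cons.1 (mem_fl.1 hc (x :: l) h)).1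

lemma bdL_mem {l : List τ} (hl : l ∈ flS r X (k + 1)) : bdL l ∈ fl r X k := by
  induction l generalizing X k with
  | nil => simp [flS] at hl
  | cons x l ih =>
    rw [flS_cons] at hl
    have h1 : fl r {y ∈ X | r x y} k ≤ fl r X k := fl_mono fun y hy => hy.1
    refine sub_mem (h1 (single_mem_fl hl.2 1)) ?_
    cases k with
    | zero => rw [flS_zero.1 hl.2]; simp [bdL]
    | succ k => exact cn_mem hl.1 (ih hl.2)

lemma bd_mem {c : Ch τ} (hc : c ∈ fl r X (k + 1)) : bd c ∈ fl r X k := by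
  induction c, hc using fl_induction with
  | h0 => simp
  | ha f g _ _ hf hg => rw [map_add]; exact add_mem hf hg
  | hs l hl a => rw [bd_single]; exact Submodule.smul_mem _ _ (bdL_mem hl)

lemma bd_fl_zero {c : Ch τ} (hc : c ∈ fl r X 0) : bd c = 0 := by
  induction c, hc using fl_induction with
  | h0 => simp
  | ha f g _ _ hf hg => rw [map_add, hf, hg, add_zero]
  | hs l hl a => rw [flS_zero.1 hl, bd_single]; simp [bdL]

lemma fl_zero_mono : fl r X 0 ≤ fl r Y 0 :=
  Finsupp.supported_mono fun _ hl => flS_zero.2 (flS_zero.1 hl)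

/-- The set of heads of a chain. -/
noncomputable def hd (c : Ch τ) : Set τ := {x | tl x c ≠ 0}

lemma hd_finite (c : Ch τ) : (hd c).Finite := by
  refine (Set.Finite.image (fun l : List τ => l.head?) c.support.finite_toSet).preimage
    (f := some) (Option.some_injective _).injOn |>.subset ?_
  intro x hx
  obtain ⟨l, hl⟩ := Finsupp.ne_iff.1 hx
  exact ⟨x :: l, by simpa using hl, by simp⟩

lemma hd_subset {c : Ch τ} (hc : c ∈ fl r X (k + 1)) : hd c ⊆ X := by
  intro x hx
  by_contra h
  exact hx (tl_eq_zero hc h)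

/-- Decomposition of a chain of positive degree according to heads. -/
lemma eq_sum_cn {c : Ch τ} (hc : c ∈ fl r X (k + 1)) {s : Finset τ} (hs : hd c ⊆ s) :
    c = ∑ x ∈ s, cn x (tl x c) := by
  classical
  ext l
  cases l with
  | nil =>
    rw [Finsupp.finsetSum_apply]
    simp only [cn_apply_nil, Finset.sum_const_zero]
    by_contra h
    exact absurd (mem_fl.1 hc [] h).2.2 (by simp)
  | cons y l =>
    rw [Finsupp.finsetSum_apply]
    simp only [cn_apply_cons, tl_apply, Finset.sum_ite_eq']
    split_ifs with h
    · rfl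
    · by_contra h'
      exact h (hs (fun h0 => h' (by rw [← tl_apply, h0]; rfl)))

/-- Exactness of the chain complex of `X` in degree `k`. -/
def Ex (r : τ → τ → Prop) (X : Set τ) (k : ℕ) : Prop :=
  ∀ z ∈ fl r X k, bd z = 0 → ∃ w ∈ fl r X (k + 1), bd w = z

lemma fl_inter {c : Ch τ} (h1 : c ∈ fl r X k) (h2 : c ∈ fl r Y k) : c ∈ fl r (X ∩ Y) k :=
  mem_fl.2 fun l hl => ⟨(mem_fl.1 h1 l hl).1,
    fun x hx => ⟨(mem_fl.1 h1 l hl).2.1 x hx, (mem_fl.1 h2 l hl).2.1 x hx⟩, (mem_fl.1 h1 l hl).2.2⟩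

/-- If every flag lies in one of two subsets, chains split. -/
lemma fl_split {X1 X2 : Set τ} (hcov : ∀ l ∈ flS r X k, (∀ x ∈ l, x ∈ X1) ∨ (∀ x ∈ l, x ∈ X2))
    {c : Ch τ} (hc : c ∈ fl r X k) : ∃ a ∈ fl r X1 k, ∃ b ∈ fl r X2 k, c = a + b := by
  induction c, hc using fl_induction with
  | h0 => exact ⟨0, zero_mem _, 0, zero_mem _, by simp⟩
  | ha f g _ _ hf hg =>
    obtain ⟨a, ha, b, hb, rfl⟩ := hf
    obtain ⟨a', ha', b', hb', rfl⟩ := hg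
    exact ⟨a + a', add_mem ha ha', b + b', add_mem hb hb', by abel⟩
  | hs l hl q =>
    rcases hcov l hl with h | h
    · exact ⟨_, single_mem_fl ⟨hl.1, h, hl.2.2⟩ q, 0, zero_mem _, by simp⟩
    · exact ⟨0, zero_mem _, _, single_mem_fl ⟨hl.1, h, hl.2.2⟩ q, by simp⟩

lemma mayerVietoris {X1 X2 : Set τ} (h1 : X1 ⊆ X) (h2 : X2 ⊆ X)
    (hcov : ∀ l : List τ, l.Pairwise r → (∀ x ∈ l, x ∈ X) → (∀ x ∈ l, x ∈ X1) ∨ (∀ x ∈ l, x ∈ X2))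
    (e1 : Ex r X1 k) (e2 : Ex r X2 k) (e12 : ∀ j, k = j + 1 → Ex r (X1 ∩ X2) j) : Ex r X k := by
  intro z hz hbz
  cases k with
  | zero =>
    obtain ⟨w, hw, rfl⟩ := e1 z (fl_zero_mono hz) hbz
    exact ⟨w, fl_mono h1 hw, rfl⟩
  | succ k =>
    obtain ⟨a, ha, b, hb, rfl⟩ := fl_split (fun l hl => hcov l hl.1 hl.2.1) hz
    have hab : bd a = - bd b := by rw [map_add] at hbz; exact eq_neg_of_add_eq_zero_left hbz
    have hm : bd a ∈ fl r (X1 ∩ X2) k :=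
      fl_inter (bd_mem ha) (by rw [hab]; exact neg_mem (bd_mem hb))
    obtain ⟨w, hw, hwe⟩ := e12 k rfl _ hm (bd_bd _)
    obtain ⟨u, hu, hue⟩ := e1 (a - w) (sub_mem ha (fl_mono Set.inter_subset_left hw))
      (by rw [map_sub, hwe, sub_self])
    obtain ⟨v, hv, hve⟩ := e2 (b + w) (add_mem hb (fl_mono Set.inter_subset_right hw))
      (by rw [map_add, hwe, hab]; simp)
    exact ⟨u + v, add_mem (fl_mono h1 hu) (fl_mono h2 hv), by rw [map_add, hue, hve]; abel⟩

/-- The chain complex of `X` is that of a sphere with top degree `m`. -/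
structure Sph (r : τ → τ → Prop) (X : Set τ) (m : ℕ) : Prop where
  len : ∀ l : List τ, l.Pairwise r → (∀ x ∈ l, x ∈ X) → l.length ≤ m
  ex : ∀ k, k ≠ m → Ex r X k
  cyc : ∃ z0 ∈ fl r X m, bd z0 = 0 ∧ z0 ≠ 0 ∧ ∀ z ∈ fl r X m, bd z = 0 → ∃ c : ℚ, z = c • z0

lemma fl_eq_bot_of_len {m : ℕ}
    (h : ∀ l : List τ, l.Pairwise r → (∀ x ∈ l, x ∈ X) → l.length ≤ m) (hk : m < k) {c : Ch τ}
    (hc : c ∈ fl r X k) : c = 0 := by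
  ext l
  by_contra hl
  obtain ⟨a, b, e⟩ := mem_fl.1 hc l hl
  have := h l a b
  omega

lemma sph_empty : Sph r (∅ : Set τ) 0 where
  len l _ h := by
    cases l with
    | nil => simp
    | cons x l => exact absurd (h x (by simp)) (by simp)
  ex k hk := by
    intro z hz _
    refine ⟨0, zero_mem _, ?_⟩
    rw [map_zero, fl_eq_bot_of_len (m := 0) (fun l _ h => ?_) (by omega) hz]
    cases l with
    | nil => simp
    | cons x l => exact absurd (h x (by simp)) (by simp)
  cyc := by
    refine ⟨Finsupp.single [] 1, single_mem_fl (flS_zero.2 rfl) 1, bd_single_nil 1, by simp, ?_⟩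
    intro z hz _
    refine ⟨z [], ?_⟩
    ext l
    by_cases hl : l = []
    · subst hl; simp
    · have : z l = 0 := by
        by_contra h
        exact hl (flS_zero.1 (mem_fl.1 hz l h))
      simp [this, Ne.symm hl]

lemma Sph.suspend {X1 X2 : Set τ} {m : ℕ} (h1 : X1 ⊆ X) (h2 : X2 ⊆ X)
    (hcov : ∀ l : List τ, l.Pairwise r → (∀ x ∈ l, x ∈ X) → (∀ x ∈ l, x ∈ X1) ∨ (∀ x ∈ l, x ∈ X2))
    (hlen : ∀ l : List τ, l.Pairwise r → (∀ x ∈ l, x ∈ X) → l.length ≤ m + 1)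
    (e1 : ∀ k, Ex r X1 k) (e2 : ∀ k, Ex r X2 k) (s : Sph r (X1 ∩ X2) m) : Sph r X (m + 1) where
  len := hlen
  ex k hk := mayerVietoris h1 h2 hcov (e1 k) (e2 k) fun j hj => s.ex j (by omega)
  cyc := by
    have hz1 : ∀ c ∈ fl r X1 (m + 1), bd c = 0 → c = 0 := fun c hc hb => by
      obtain ⟨w, hw, rfl⟩ := e1 _ c hc hb
      rw [fl_eq_bot_of_len hlen (by omega) (fl_mono h1 hw), map_zero]
    have hz2 : ∀ c ∈ fl r X2 (m + 1), bd c = 0 → c = 0 := fun c hc hb => by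
      obtain ⟨w, hw, rfl⟩ := e2 _ c hc hb
      rw [fl_eq_bot_of_len hlen (by omega) (fl_mono h2 hw), map_zero]
    obtain ⟨z0, hz0, hb0, hne, hpr⟩ := s.cyc
    obtain ⟨w1, hw1, hwe1⟩ := e1 m z0 (fl_mono Set.inter_subset_left hz0) hb0
    obtain ⟨w2, hw2, hwe2⟩ := e2 m z0 (fl_mono Set.inter_subset_right hz0) hb0
    refine ⟨w1 - w2, sub_mem (fl_mono h1 hw1) (fl_mono h2 hw2), by rw [map_sub, hwe1, hwe2, sub_self],
      fun h => hne ?_, fun z hz hbz => ?_⟩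
    · have : w1 = w2 := sub_eq_zero.1 h
      have h3 := fl_eq_bot_of_len s.len (Nat.lt_succ_self m) (fl_inter hw1 (this ▸ hw2))
      rw [← hwe1, h3, map_zero]
    · obtain ⟨a, ha, b, hb, rfl⟩ := fl_split (fun l hl => hcov l hl.1 hl.2.1) hz
      have hab : bd a = - bd b := by rw [map_add] at hbz; exact eq_neg_of_add_eq_zero_left hbz
      have hm : bd a ∈ fl r (X1 ∩ X2) m :=
        fl_inter (bd_mem ha) (by rw [hab]; exact neg_mem (bd_mem hb))
      obtain ⟨c, hc⟩ := hpr _ hm (bd_bd _)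
      have ea := hz1 (a - c • w1) (sub_mem ha (Submodule.smul_mem _ _ hw1))
        (by rw [map_sub, map_smul, hwe1, hc, sub_self])
      have eb := hz2 (b + c • w2) (add_mem hb (Submodule.smul_mem _ _ hw2))
        (by rw [map_add, map_smul, hwe2, ← hc, hab]; simp)
      refine ⟨c, ?_⟩
      rw [sub_eq_zero.1 ea, eq_neg_of_add_eq_zero_left eb, smul_sub]; abel

/-- Pushing a chain off a set of vertices which can only occur as heads of flags. -/
lemma push_off {A : Set τ} (hA : ∀ a ∈ A, ∀ y ∈ X ∪ A, ¬ r y a)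
    (hl : ∀ a ∈ A, Ex r {x ∈ X | r a x} k) {z : Ch τ} (hz : z ∈ fl r (X ∪ A) (k + 1))
    (hbz : bd z ∈ fl r X k) : ∃ e ∈ fl r (X ∪ A) (k + 2), z - bd e ∈ fl r X (k + 1) := by
  classical
  have hsub : ∀ a ∈ X ∪ A, ({y ∈ X ∪ A | r a y} : Set τ) = {y ∈ X | r a y} := fun a ha => by
    ext y
    simp only [Set.mem_ofPred_eq]
    exact ⟨fun h => ⟨h.1.resolve_right fun hy => hA y hy a ha h.2, h.2⟩,
      fun h => ⟨Or.inl h.1, h.2⟩⟩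
  have htl : ∀ a, tl a z ∈ fl r {y ∈ X | r a y} k := fun a => by
    by_cases ha : a ∈ X ∪ A
    · rw [← hsub a ha]; exact tl_mem a hz
    · rw [tl_eq_zero hz ha]; exact zero_mem _
  set s := (hd_finite z).toFinset with hs
  have hzs : z = ∑ x ∈ s, cn x (tl x z) := eq_sum_cn hz (by simp [hs])
  have hsX : ∀ a ∈ s, a ∈ X ∪ A := fun a ha => hd_subset hz (by simpa [hs] using ha)
  have hb : ∀ a ∈ A \ X, bd (tl a z) = 0 := by
    intro a ha
    cases k with
    | zero => exact bd_fl_zero (htl a)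
    | succ k =>
    have h0 : tl a (bd z) = 0 := tl_eq_zero hbz ha.2
    have h1 : bd z = ∑ x ∈ s, (tl x z - cn x (bd (tl x z))) := by
      conv_lhs => rw [hzs]
      rw [map_sum]; simp only [bd_cn]
    rw [h1, map_sum] at h0
    by_cases has : a ∈ s
    · rw [Finset.sum_eq_single a] at h0
      · rw [map_sub, tl_cn_self, tl_eq_zero (htl a) (fun h => ha.2 h.1), zero_sub,
          neg_eq_zero] at h0
        exact h0
      · intro b _ hba
        rw [map_sub, tl_cn_of_ne hba, tl_eq_zero (htl b) (fun h => ha.2 h.1), sub_zero]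
      · exact fun h => absurd has h
    · have : tl a z = 0 := by simpa [hs, hd] using has
      rw [this, map_zero]
  have hw : ∀ a, ∃ w, a ∈ A \ X → w ∈ fl r {y ∈ X | r a y} (k + 1) ∧ bd w = tl a z := fun a => by
    by_cases ha : a ∈ A \ X
    · obtain ⟨w, h1, h2⟩ := hl a ha.1 _ (htl a) (hb a ha)
      exact ⟨w, fun _ => ⟨h1, h2⟩⟩
    · exact ⟨0, fun h => absurd h ha⟩
  choose w hw using hw
  refine ⟨- ∑ x ∈ s with x ∉ X, cn x (w x), neg_mem (sum_mem fun a ha => ?_), ?_⟩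
  · obtain ⟨has, haX⟩ := Finset.mem_filter.1 ha
    have haA : a ∈ A := (hsX a has).resolve_left haX
    exact cn_mem (hsX a has) (by rw [hsub a (hsX a has)]; exact (hw a ⟨haA, haX⟩).1)
  · rw [map_neg, sub_neg_eq_add, map_sum]
    have : z + ∑ x ∈ s with x ∉ X, bd (cn x (w x)) =
        ∑ x ∈ s with x ∈ X, cn x (tl x z) + ∑ x ∈ s with x ∉ X, w x := by
      conv_lhs => rw [hzs]
      rw [← Finset.sum_filter_add_sum_filter_not s (fun x => x ∈ X), add_assoc,
        ← Finset.sum_add_distrib]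
      congr 1
      refine Finset.sum_congr rfl fun a ha => ?_
      obtain ⟨has, haX⟩ := Finset.mem_filter.1 ha
      rw [bd_cn, (hw a ⟨(hsX a has).resolve_left haX, haX⟩).2]; abel
    rw [this]
    refine add_mem (sum_mem fun a ha => ?_) (sum_mem fun a ha => ?_)
    · exact cn_mem (Finset.mem_filter.1 ha).2 (htl a)
    · obtain ⟨has, haX⟩ := Finset.mem_filter.1 ha
      exact fl_mono (fun y hy => hy.1) (hw a ⟨(hsX a has).resolve_left haX, haX⟩).1

lemma Ex.of_push {A : Set τ} (hA : ∀ a ∈ A, ∀ y ∈ X ∪ A, ¬ r y a)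
    (hl : ∀ a ∈ A, Ex r {x ∈ X | r a x} k) (h : Ex r (X ∪ A) k) : Ex r X k := by
  intro z hz hbz
  obtain ⟨w, hw, rfl⟩ := h z (fl_mono Set.subset_union_left hz) hbz
  obtain ⟨e, he, h2⟩ := push_off hA hl hw hz
  exact ⟨_, h2, by simp⟩

lemma Ex.push {A : Set τ} (hA : ∀ a ∈ A, ∀ y ∈ X ∪ A, ¬ r y a)
    (hl : ∀ j, k = j + 1 → ∀ a ∈ A, Ex r {x ∈ X | r a x} j) (h : Ex r X k) : Ex r (X ∪ A) k := by
  intro z hz hbz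
  cases k with
  | zero =>
    obtain ⟨w, hw, rfl⟩ := h z (fl_zero_mono hz) hbz
    exact ⟨w, fl_mono Set.subset_union_left hw, rfl⟩
  | succ k =>
    obtain ⟨e, he, h2⟩ := push_off hA (hl k rfl) hz (by rw [hbz]; exact zero_mem _)
    obtain ⟨w, hw, hwe⟩ := h _ h2 (by simp [hbz])
    exact ⟨w + e, add_mem (fl_mono Set.subset_union_left hw) he, by rw [map_add, hwe]; abel⟩

/-- Quillen's fibre lemma for the inclusion of a closed subset of a ranked poset. -/
lemma quillen_aux [IsTrans τ r] (ρ : τ → ℕ) (N : ℕ) :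
    ∀ (m : ℕ) (X Y : Set τ), (∀ a ∈ Y, ∀ b ∈ Y, r a b → ρ a < ρ b) → X ⊆ Y → (∀ x ∈ X, ∀ y ∈ Y, r x y → y ∈ X) → (∀ y ∈ Y, ρ y < N) →
    (∀ y ∈ Y, y ∉ X → N ≤ ρ y + m) → (∀ y ∈ Y, y ∉ X → ∀ k, Ex r {x ∈ X | r y x} k) →
    ((∀ k, Ex r X k) ↔ ∀ k, Ex r Y k) := by
  intro m
  induction m with
  | zero =>
    intro X Y _ hXY _ hN hm _
    have : X = Y := hXY.antisymm fun y hy => by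
      by_contra h
      have := hm y hy h
      have := hN y hy
      omega
    rw [this]
  | succ m ih =>
    intro X Y hρ hXY hcl hN hm hlk
    let Z : Set τ := X ∪ {y ∈ Y | N ≤ ρ y + m}
    let A : Set τ := {y ∈ Y | y ∉ X ∧ ¬ N ≤ ρ y + m}
    have hY : Y = Z ∪ A := by
      ext y
      simp only [Z, A, Set.mem_union, Set.mem_ofPred_eq]
      constructor
      · intro h; tauto
      · rintro ((h | h) | h)
        · exact hXY h
        · exact h.1
        · exact h.1
    have hZY : Z ⊆ Y := by rw [hY]; exact Set.subset_union_left
    have e1 : (∀ k, Ex r X k) ↔ ∀ k, Ex r Z k := by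
      refine ih X Z (fun a ha b hb => hρ a (hZY ha) b (hZY hb)) Set.subset_union_left (fun x hx y hy => hcl x hx y (hZY hy))
        (fun y hy => hN y (hZY hy)) ?_ fun y hy => hlk y (hZY hy)
      rintro y (hy | hy) h
      · exact absurd hy h
      · exact hy.2
    have hA : ∀ a ∈ A, ∀ y ∈ Z ∪ A, ¬ r y a := by
      rintro a ⟨haY, haX, ha⟩ y hy hya
      rw [← hY] at hy
      have hyX : y ∉ X := fun h => haX (hcl y h a haY hya)
      have := hm y hy hyX
      have := hρ _ hy _ haY hya
      omega
    have hlink : ∀ a ∈ A, ∀ k, Ex r {x ∈ Z | r a x} k := by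
      rintro a ⟨haY, haX, ha⟩
      refine (ih {x ∈ X | r a x} {x ∈ Z | r a x}
        (fun b hb c hc => hρ b (hZY hb.1) c (hZY hc.1)) (fun x hx => ⟨Or.inl hx.1, hx.2⟩)
        (fun x hx y hy hxy => ⟨hcl x hx.1 y (hZY hy.1) hxy, hy.2⟩)
        (fun y hy => hN y (hZY hy.1)) ?_ ?_).1 (hlk a haY haX)
      · rintro y ⟨hy | hy, h1⟩ h
        · exact absurd ⟨hy, h1⟩ h
        · exact hy.2
      · rintro y ⟨hy, h1⟩ h k
        have hyX : y ∉ X := fun h2 => h ⟨h2, h1⟩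
        have : ({x ∈ {x ∈ X | r a x} | r y x} : Set τ) = {x ∈ X | r y x} := by
          ext x
          simp only [Set.mem_ofPred_eq]
          exact ⟨fun h => ⟨h.1.1, h.2⟩, fun h => ⟨⟨h.1, _root_.trans h1 h.2⟩, h.2⟩⟩
        rw [this]
        exact hlk y (hZY hy) hyX k
    rw [e1, hY]
    exact ⟨fun h k => (h k).push hA fun j _ a ha => hlink a ha j,
      fun h k => (h k).of_push hA fun a ha => hlink a ha k⟩

lemma quillen [IsTrans τ r] (ρ : τ → ℕ) (N : ℕ) (hρ : ∀ a ∈ Y, ∀ b ∈ Y, r a b → ρ a < ρ b)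
    (hXY : X ⊆ Y) (hcl : ∀ x ∈ X, ∀ y ∈ Y, r x y → y ∈ X) (hN : ∀ y ∈ Y, ρ y < N)
    (hlk : ∀ y ∈ Y, y ∉ X → ∀ k, Ex r {x ∈ X | r y x} k) :
    (∀ k, Ex r X k) ↔ ∀ k, Ex r Y k :=
  quillen_aux ρ N N X Y hρ hXY hcl hN (fun _ _ _ => by omega) hlk

/-- A set with a vertex related to all the others is acyclic. -/
lemma ex_cone {x0 : τ} (h0 : x0 ∈ X) (h : ∀ x ∈ X, x ≠ x0 → r x0 x) (hirr : ∀ x ∈ X, ¬ r x x0)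
    (k : ℕ) : Ex r X k := by
  have hX : X = {x ∈ X | x ≠ x0} ∪ {x0} := by
    ext x; simp only [Set.mem_union, Set.mem_ofPred_eq, Set.mem_singleton_iff]
    constructor
    · intro hx; tauto
    · rintro (hx | rfl); exacts [hx.1, h0]
  have hlink : ({x ∈ {x ∈ X | x ≠ x0} | r x0 x} : Set τ) = {x ∈ X | x ≠ x0} := by
    ext x; simp only [Set.mem_ofPred_eq]
    exact ⟨fun hx => hx.1, fun hx => ⟨hx, h x hx.1 hx.2⟩⟩
  intro z hz hbz
  cases k with
  | zero =>
    have hz' : z = Finsupp.single [] (z []) := by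
      ext l
      by_cases hl : l = []
      · subst hl; simp
      · rw [Finsupp.single_eq_of_ne hl]
        by_contra hne; exact hl (flS_zero.1 (mem_fl.1 hz l hne))
    exact ⟨cn x0 z, cn_mem h0 (fl_zero_mono hz), by rw [bd_cn, hbz]; simp⟩
  | succ k =>
    -- the part of `z` with head `x0` is determined by the rest
    set u := z - cn x0 (tl x0 z) with hu
    have hru : ∀ x ∈ X, ¬ r x x0 := hirr
    have htl : tl x0 z ∈ fl r {y ∈ X | r x0 y} k := tl_mem x0 hz
    have hmem : u ∈ fl r {y ∈ X | r x0 y} (k + 1) := by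
      refine mem_fl.2 fun l hl => ?_
      have hz2 : u ∈ fl r X (k + 1) := sub_mem hz (cn_mem h0 htl)
      obtain ⟨p, q, e⟩ := mem_fl.1 hz2 l hl
      refine ⟨p, fun x hx => ⟨q x hx, h x (q x hx) ?_⟩, e⟩
      rintro rfl
      cases l with
      | nil => simp at hx
      | cons y l =>
        rcases List.mem_cons.1 hx with rfl | hx'
        · apply hl
          rw [hu, Finsupp.sub_apply, ← tl_apply x (cn x _), tl_cn_self]; simp
        · exact hirr y (q y (by simp)) ((List.pairwise_cons.1 p).1 x hx')
    refine ⟨cn x0 u, cn_mem h0 hmem, ?_⟩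
    have hb : bd u = - (tl x0 z - cn x0 (bd (tl x0 z))) := by
      rw [hu, map_sub, hbz, bd_cn, zero_sub]
    have hb1 : bd (tl x0 z) = 0 := by
      cases k with
      | zero => exact bd_fl_zero htl
      | succ k =>
      have h3 : tl x0 (bd u) = 0 := tl_eq_zero (bd_mem hmem) (fun h => hirr x0 h.1 h.2)
      rw [hb, map_neg, map_sub, tl_cn_self,
        tl_eq_zero htl (fun h => hirr x0 h.1 h.2), zero_sub, neg_neg] at h3
      exact h3
    rw [bd_cn, hb, hb1, hu]; simp

end Chains
end LS

namespace LS
section Flip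
variable {τ : Type*} {r : τ → τ → Prop} {X : Set τ} {k : ℕ}

/-- Appending a vertex at the end. -/
noncomputable def sn (x : τ) : Ch τ →ₗ[ℚ] Ch τ := Finsupp.lmapDomain ℚ ℚ (fun l => l ++ [x])

@[simp] lemma sn_single (x : τ) (l : List τ) (a : ℚ) :
    sn x (Finsupp.single l a) = Finsupp.single (l ++ [x]) a := by
  simp [sn]

lemma sn_cn (x y : τ) (c : Ch τ) : sn x (cn y c) = cn y (sn x c) := by
  induction c using Finsupp.induction_linear with
  | zero => simp
  | add f g hf hg => simp only [map_add, hf, hg]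
  | single l a => simp

/-- Reversal of lists. -/
noncomputable def rev : Ch τ →ₗ[ℚ] Ch τ := Finsupp.lmapDomain ℚ ℚ List.reverse

@[simp] lemma rev_single (l : List τ) (a : ℚ) :
    rev (Finsupp.single l a) = Finsupp.single l.reverse a := by
  simp [rev]

lemma rev_rev (c : Ch τ) : rev (rev c) = c := by
  induction c using Finsupp.induction_linear with
  | zero => simp
  | add f g hf hg => simp only [map_add, hf, hg]
  | single l a => simp

lemma rev_cn (x : τ) (c : Ch τ) : rev (cn x c) = sn x (rev c) := by
  induction c using Finsupp.induction_linear with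
  | zero => simp
  | add f g hf hg => simp only [map_add, hf, hg]
  | single l a => simp

lemma bdL_append (l : List τ) (x : τ) :
    bdL (l ++ [x]) = sn x (bdL l) + Finsupp.single l ((-1) ^ l.length) := by
  induction l with
  | nil => simp [bdL]
  | cons y l ih =>
    simp only [List.cons_append, bdL, ih, map_add, map_sub, sn_single, sn_cn, cn_single,
      List.length_cons, pow_succ, mul_neg, mul_one, Finsupp.single_neg]
    abel

lemma bd_rev (l : List τ) : (-1 : ℚ) ^ l.length • bdL l.reverse = - rev (bdL l) := by
  induction l with
  | nil => simp [bdL]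
  | cons x l ih =>
    rw [List.reverse_cons, bdL_append]
    simp only [bdL, map_sub, rev_single, rev_cn, List.length_cons, smul_add, List.length_reverse,
      pow_succ, mul_neg, mul_one, neg_smul, Finsupp.smul_single, smul_eq_mul]
    rw [← mul_pow]
    rw [← map_smul, ih]
    simp only [neg_mul_neg, mul_one, one_pow, map_neg]
    abel

lemma rev_mem {c : Ch τ} (hc : c ∈ fl r X k) : rev c ∈ fl (flip r) X k := by
  induction c, hc using fl_induction with
  | h0 => simp
  | ha f g _ _ hf hg => rw [map_add]; exact add_mem hf hg
  | hs l hl a =>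
    rw [rev_single]
    refine single_mem_fl ⟨?_, ?_, ?_⟩ a
    · rw [List.pairwise_reverse]; exact hl.1
    · simpa using hl.2.1
    · simpa using hl.2.2

lemma bd_rev_eq {c : Ch τ} (hc : c ∈ fl r X k) : bd (rev c) = (-(-1 : ℚ) ^ k) • rev (bd c) := by
  induction c, hc using fl_induction with
  | h0 => simp
  | ha f g _ _ hf hg => simp only [map_add, hf, hg, smul_add]
  | hs l hl a =>
    rw [rev_single, bd_single, bd_single, map_smul, smul_comm]
    congr 1
    have := bd_rev l
    rw [hl.2.2] at this
    rw [neg_smul, ← smul_neg, ← this, smul_smul, ← mul_pow]; simp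

lemma Ex.flip (h : Ex r X k) : Ex (flip r) X k := by
  intro z hz hbz
  have hz' : rev z ∈ fl r X k := rev_mem hz
  obtain ⟨w, hw, hwe⟩ := h _ hz' (by rw [bd_rev_eq hz, hbz, map_zero, smul_zero])
  refine ⟨(-(-1 : ℚ) ^ (k + 1)) • rev w, Submodule.smul_mem _ _ (rev_mem hw), ?_⟩
  rw [map_smul, bd_rev_eq hw, hwe, rev_rev, smul_smul, neg_mul_neg, ← mul_pow]; simp

lemma Sph.flip {m : ℕ} (h : Sph r X m) : Sph (flip r) X m where
  len l hl hX := by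
    have := h.len l.reverse (by rw [List.pairwise_reverse]; exact hl) (by simpa using hX)
    simpa using this
  ex k hk := (h.ex k hk).flip
  cyc := by
    obtain ⟨z0, hz0, hb, hne, hp⟩ := h.cyc
    refine ⟨rev z0, rev_mem hz0, by rw [bd_rev_eq hz0, hb, map_zero, smul_zero],
      fun h => hne (by rw [← rev_rev z0, h, map_zero]), fun z hz hbz => ?_⟩
    obtain ⟨c, hc⟩ := hp (rev z) (rev_mem hz) (by rw [bd_rev_eq hz, hbz, map_zero, smul_zero])
    exact ⟨c, by rw [← map_smul, ← hc, rev_rev]⟩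

end Flip

section Carrier
variable {σ τ : Type*} {r : σ → σ → Prop} {X : Set σ}

lemma bdL_mem_self {l : List σ} {k : ℕ} (hl : l ∈ flS r X (k + 1)) :
    bdL l ∈ fl r {x | x ∈ l} k :=
  bdL_mem ⟨hl.1, fun _ hx => hx, hl.2.2⟩

/-- Linear extension of a function on lists. -/
noncomputable def lift (f : List σ → Ch τ) : Ch σ →ₗ[ℚ] Ch τ := Finsupp.linearCombination ℚ f

@[simp] lemma lift_single (f : List σ → Ch τ) (l : List σ) (a : ℚ) :
    lift f (Finsupp.single l a) = a • f l := by simp [lift]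

lemma map_mem_of_single {M : Type*} [AddCommGroup M] [Module ℚ M] {k : ℕ}
    {φ : Ch σ →ₗ[ℚ] M} {p : Submodule ℚ M}
    (h : ∀ l ∈ flS r X k, φ (Finsupp.single l 1) ∈ p) {c : Ch σ} (hc : c ∈ fl r X k) :
    φ c ∈ p := by
  induction c, hc using fl_induction with
  | h0 => simp
  | ha f g _ _ hf hg => rw [map_add]; exact add_mem hf hg
  | hs l hl a =>
    have : Finsupp.single l a = a • Finsupp.single l (1 : ℚ) := by simp
    rw [this, map_smul]; exact Submodule.smul_mem _ _ (h l hl)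

lemma map_eq_of_single {M : Type*} [AddCommGroup M] [Module ℚ M] {k : ℕ}
    {φ ψ : Ch σ →ₗ[ℚ] M}
    (h : ∀ l ∈ flS r X k, φ (Finsupp.single l 1) = ψ (Finsupp.single l 1)) {c : Ch σ}
    (hc : c ∈ fl r X k) : φ c = ψ c := by
  have := map_mem_of_single (φ := φ - ψ) (p := ⊥) (fun l hl => by simp [h l hl]) hc
  simpa [sub_eq_zero] using this

/-- Exactness of a family of subcomplexes. -/
def Dex (D : ℕ → Submodule ℚ (Ch τ)) : Prop :=
  ∀ k, ∀ z ∈ D k, bd z = 0 → ∃ w ∈ D (k + 1), bd w = z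

open Classical in
/-- A chosen preimage under the boundary. -/
noncomputable def pre (p : Submodule ℚ (Ch τ)) (z : Ch τ) : Ch τ :=
  if h : ∃ w ∈ p, bd w = z then h.choose else 0

lemma pre_spec {p : Submodule ℚ (Ch τ)} {z : Ch τ} (h : ∃ w ∈ p, bd w = z) :
    pre p z ∈ p ∧ bd (pre p z) = z := by
  rw [pre, dif_pos h]; exact h.choose_spec

/-- A chain map is carried by `D`. -/
structure Carried (r : σ → σ → Prop) (X : Set σ) (D : Set σ → ℕ → Submodule ℚ (Ch τ))
    (φ : Ch σ →ₗ[ℚ] Ch τ) : Prop where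
  nil : φ (Finsupp.single [] 1) = Finsupp.single [] 1
  mem : ∀ k, ∀ l ∈ flS r X (k + 1), φ (Finsupp.single l 1) ∈ D {x | x ∈ l} (k + 1)
  comm : ∀ k, ∀ c ∈ fl r X k, bd (φ c) = φ (bd c)

/-- Stagewise construction of a carried chain map. -/
noncomputable def carr (D : Set σ → ℕ → Submodule ℚ (Ch τ)) : ℕ → (Ch σ →ₗ[ℚ] Ch τ)
  | 0 => lift fun _ => Finsupp.single [] 1
  | k + 1 => lift fun l => pre (D {x | x ∈ l} (k + 1)) (carr D k (bdL l))

lemma exists_carried (D : Set σ → ℕ → Submodule ℚ (Ch τ))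
    (hmono : ∀ A B k, A ⊆ B → D A k ≤ D B k)
    (h0 : ∀ A, Finsupp.single [] 1 ∈ D A 0)
    (hD : ∀ l : List σ, l.Pairwise r → (∀ x ∈ l, x ∈ X) → l ≠ [] → Dex (D {x | x ∈ l})) :
    ∃ φ, Carried r X D φ := by
  have hsub : ∀ {k : ℕ} {l l' : List σ}, l' ∈ flS r ({x | x ∈ l} : Set σ) k → {x | x ∈ l'} ⊆ {x | x ∈ l} :=
    fun hl' x hx => hl'.2.1 x hx
  have key : ∀ k, (∀ l ∈ flS r X k, carr D k (Finsupp.single l 1) ∈ D {x | x ∈ l} k) ∧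
      ∀ l ∈ flS r X (k + 1),
        carr D (k + 1) (Finsupp.single l 1) ∈ D {x | x ∈ l} (k + 1) ∧
        bd (carr D (k + 1) (Finsupp.single l 1)) = carr D k (bdL l) := by
    intro k
    induction k with
    | zero =>
      have h1 : ∀ l ∈ flS r X 0, carr D 0 (Finsupp.single l 1) ∈ D {x | x ∈ l} 0 :=
        fun l _ => by simp only [carr, lift_single, one_smul]; exact h0 _
      refine ⟨h1, fun l hl => ?_⟩
      have hne : l ≠ [] := by rintro rfl; simp [flS] at hl
      have hmem : carr D 0 (bdL l) ∈ D {x | x ∈ l} 0 :=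
        map_mem_of_single (X := {x | x ∈ l}) (r := r) (k := 0)
          (fun l' hl' => by simp only [carr, lift_single, one_smul]; exact h0 _) (bdL_mem_self hl)
      have hb : bd (carr D 0 (bdL l)) = 0 := by
        have : carr D 0 (bdL l) ∈ LinearMap.ker (bd (τ := τ)) :=
          map_mem_of_single (X := {x | x ∈ l}) (r := r) (k := 0)
            (fun l' hl' => by
              simp only [carr, lift_single, one_smul, LinearMap.mem_ker]
              exact bd_single_nil 1) (bdL_mem_self hl)
        exact this
      have := pre_spec (hD l hl.1 hl.2.1 hne 0 _ hmem hb)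
      simpa only [carr, lift_single, one_smul] using this
    | succ k ih =>
      refine ⟨fun l hl => (ih.2 l hl).1, fun l hl => ?_⟩
      have hne : l ≠ [] := by rintro rfl; simp [flS] at hl
      have hX : ∀ l' ∈ flS r ({x | x ∈ l} : Set σ) (k + 1), l' ∈ flS r X (k + 1) :=
        fun l' hl' => ⟨hl'.1, fun x hx => hl.2.1 x (hl'.2.1 x hx), hl'.2.2⟩
      have hmem : carr D (k + 1) (bdL l) ∈ D {x | x ∈ l} (k + 1) :=
        map_mem_of_single (X := {x | x ∈ l}) (r := r) (k := k + 1)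
          (fun l' hl' => hmono _ _ _ (hsub hl') (ih.2 l' (hX l' hl')).1) (bdL_mem_self hl)
      have hb : bd (carr D (k + 1) (bdL l)) = 0 := by
        have : (bd ∘ₗ carr D (k + 1)) (bdL l) = (carr D k ∘ₗ bd) (bdL l) :=
          map_eq_of_single (X := {x | x ∈ l}) (r := r) (k := k + 1)
            (fun l' hl' => by simpa using (ih.2 l' (hX l' hl')).2) (bdL_mem_self hl)
        simpa [bd_bdL] using this
      have := pre_spec (hD l hl.1 hl.2.1 hne (k + 1) _ hmem hb)
      simp only [carr, lift_single, one_smul] at this ⊢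
      exact this
  let φ : Ch σ →ₗ[ℚ] Ch τ := lift fun l => carr D l.length (Finsupp.single l 1)
  have hφ : ∀ k, ∀ c ∈ fl r X k, φ c = carr D k c := fun k c hc =>
    map_eq_of_single (fun l hl => by simp [φ, hl.2.2]) hc
  refine ⟨φ, by simp [φ, carr], fun k l hl => ?_, fun k c hc => ?_⟩
  · rw [hφ _ _ (single_mem_fl hl 1)]; exact ((key k).2 l hl).1
  · cases k with
    | zero =>
      rw [bd_fl_zero hc, map_zero]
      have : φ c ∈ LinearMap.ker (bd (τ := τ)) :=
        map_mem_of_single (fun l' hl' => by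
          rw [flS_zero.1 hl']
          simpa [φ, carr] using bd_single_nil (τ := τ) 1) hc
      exact this
    | succ k =>
      rw [hφ _ _ hc, hφ _ _ (bd_mem hc)]
      have : (bd ∘ₗ carr D (k + 1)) c = (carr D k ∘ₗ bd) c :=
        map_eq_of_single (fun l hl => by simpa using ((key k).2 l hl).2) hc
      exact this

/-- Stagewise construction of a carried homotopy. -/
noncomputable def homo (D : Set σ → ℕ → Submodule ℚ (Ch τ)) (f g : Ch σ →ₗ[ℚ] Ch τ) :
    ℕ → (Ch σ →ₗ[ℚ] Ch τ)
  | 0 => 0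
  | k + 1 => lift fun l => pre (D {x | x ∈ l} (k + 2))
      (f (Finsupp.single l 1) - g (Finsupp.single l 1) - homo D f g k (bdL l))

lemma exists_homotopy {D : Set σ → ℕ → Submodule ℚ (Ch τ)}
    (hmono : ∀ A B k, A ⊆ B → D A k ≤ D B k)
    (hD : ∀ l : List σ, l.Pairwise r → (∀ x ∈ l, x ∈ X) → l ≠ [] → Dex (D {x | x ∈ l}))
    {f g : Ch σ →ₗ[ℚ] Ch τ} (hf : Carried r X D f) (hg : Carried r X D g) :
    ∃ H : Ch σ →ₗ[ℚ] Ch τ, (∀ k, ∀ l ∈ flS r X (k + 1), H (Finsupp.single l 1) ∈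
      D {x | x ∈ l} (k + 2)) ∧ ∀ k, ∀ c ∈ fl r X k, bd (H c) = f c - g c - H (bd c) := by
  have hsub : ∀ {k : ℕ} {l l' : List σ}, l' ∈ flS r ({x | x ∈ l} : Set σ) k → {x | x ∈ l'} ⊆ {x | x ∈ l} :=
    fun hl' x hx => hl'.2.1 x hx
  have hfg0 : ∀ c ∈ fl r X 0, f c = g c := fun c hc =>
    map_eq_of_single (fun l hl => by rw [flS_zero.1 hl, hf.nil, hg.nil]) hc
  have hmem0 : ∀ k, ∀ l ∈ flS r X (k + 1),
      f (Finsupp.single l 1) - g (Finsupp.single l 1) ∈ D {x | x ∈ l} (k + 1) :=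
    fun k l hl => sub_mem (hf.mem k l hl) (hg.mem k l hl)
  have hbl : ∀ k, ∀ l ∈ flS r X (k + 1),
      bd (f (Finsupp.single l 1) - g (Finsupp.single l 1)) = f (bdL l) - g (bdL l) :=
    fun k l hl => by
      rw [map_sub, hf.comm _ _ (single_mem_fl hl 1), hg.comm _ _ (single_mem_fl hl 1)]; simp
  have key : ∀ k, ∀ l ∈ flS r X (k + 1),
        homo D f g (k + 1) (Finsupp.single l 1) ∈ D {x | x ∈ l} (k + 2) ∧
        bd (homo D f g (k + 1) (Finsupp.single l 1)) =
          f (Finsupp.single l 1) - g (Finsupp.single l 1) - homo D f g k (bdL l) := by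
    intro k
    induction k with
    | zero =>
      intro l hl
      have hne : l ≠ [] := by rintro rfl; simp [flS] at hl
      have hb := hbl 0 l hl
      rw [hfg0 _ (bdL_mem hl), sub_self] at hb
      have := pre_spec (hD l hl.1 hl.2.1 hne 1 _ (hmem0 0 l hl) hb)
      simpa only [homo, lift_single, one_smul, LinearMap.zero_apply, sub_zero] using this
    | succ k ih =>
      intro l hl
      have hne : l ≠ [] := by rintro rfl; simp [flS] at hl
      have hX : ∀ l' ∈ flS r ({x | x ∈ l} : Set σ) (k + 1), l' ∈ flS r X (k + 1) :=
        fun l' hl' => ⟨hl'.1, fun x hx => hl.2.1 x (hl'.2.1 x hx), hl'.2.2⟩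
      have hmem : homo D f g (k + 1) (bdL l) ∈ D {x | x ∈ l} (k + 2) :=
        map_mem_of_single (X := {x | x ∈ l}) (r := r) (k := k + 1)
          (fun l' hl' => hmono _ _ _ (hsub hl') (ih l' (hX l' hl')).1) (bdL_mem_self hl)
      have hb : bd (homo D f g (k + 1) (bdL l)) = f (bdL l) - g (bdL l) := by
        have : (bd ∘ₗ homo D f g (k + 1)) (bdL l) = (f - g - homo D f g k ∘ₗ bd) (bdL l) :=
          map_eq_of_single (X := {x | x ∈ l}) (r := r) (k := k + 1)
            (fun l' hl' => by simpa using (ih l' (hX l' hl')).2) (bdL_mem_self hl)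
        simpa [bd_bdL] using this
      have := pre_spec (hD l hl.1 hl.2.1 hne (k + 2) _ (sub_mem (hmem0 _ l hl) hmem)
        (by rw [map_sub, hbl _ l hl, hb, sub_self]))
      simp only [homo, lift_single, one_smul] at this ⊢
      exact this
  let H : Ch σ →ₗ[ℚ] Ch τ := lift fun l => homo D f g l.length (Finsupp.single l 1)
  have hH : ∀ k, ∀ c ∈ fl r X k, H c = homo D f g k c := fun k c hc =>
    map_eq_of_single (fun l hl => by simp [H, hl.2.2]) hc
  refine ⟨H, fun k l hl => ?_, fun k c hc => ?_⟩
  · rw [hH _ _ (single_mem_fl hl 1)]; exact (key k l hl).1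
  · cases k with
    | zero =>
      rw [bd_fl_zero hc, map_zero, hfg0 c hc, hH _ _ hc]; simp [homo]
    | succ k =>
      rw [hH _ _ hc, hH _ _ (bd_mem hc)]
      have : (bd ∘ₗ homo D f g (k + 1)) c = (f - g - homo D f g k ∘ₗ bd) c :=
        map_eq_of_single (fun l hl => by simpa using (key k l hl).2) hc
      exact this

end Carrier
end LS

namespace LS
section Conv
variable {V : Type*} [AddCommGroup V] [Module ℝ V]

lemma affine_seg (f : V →ᵃ[ℝ] ℝ) (a b : V) (s : ℝ) :
    f (AffineMap.lineMap a b s) = (1 - s) * f a + s * f b := by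
  rw [AffineMap.apply_lineMap, AffineMap.lineMap_apply]; simp; ring

lemma exists_zero_seg (f : V →ᵃ[ℝ] ℝ) {a b : V} (h : f a * f b ≤ 0) (hb : f b ≠ 0) :
    ∃ s : ℝ, 0 ≤ s ∧ s < 1 ∧ f (AffineMap.lineMap a b s) = 0 := by
  rcases lt_or_gt_of_ne hb with hb | hb
  · have ha : 0 ≤ f a := by by_contra h'; nlinarith
    refine ⟨f a / (f a - f b), by apply div_nonneg <;> linarith, ?_, ?_⟩
    · rw [div_lt_one (by linarith)]; linarith
    · have : f a - f b ≠ 0 := by linarith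
      rw [affine_seg]; field_simp; ring
  · have ha : f a ≤ 0 := by by_contra h'; nlinarith
    refine ⟨f a / (f a - f b), div_nonneg_of_nonpos ha (by linarith), ?_, ?_⟩
    · rw [div_lt_one_of_neg (by linarith)]; linarith
    · have : f a - f b ≠ 0 := by linarith
      rw [affine_seg]; field_simp; ring

lemma _root_.Convex.seg_mem {A : Set V} (hA : Convex ℝ A) {a b : V} (ha : a ∈ A) (hb : b ∈ A)
    {s : ℝ} (h0 : 0 ≤ s) (h1 : s ≤ 1) : AffineMap.lineMap a b s ∈ A :=
  hA.lineMap_mem ha hb ⟨h0, h1⟩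

variable {τ : Type*} [PartialOrder τ]

/-- Types only shrink when entering the interior of a segment towards a larger type. -/
def Tame (A : Set V) (t : V → τ) : Prop :=
  ∀ q ∈ A, ∀ q' ∈ A, t q ≤ t q' → ∀ s : ℝ, 0 ≤ s → s < 1 → t (AffineMap.lineMap q q' s) = t q

lemma Tame.cover {A : Set V} {t : V → τ} (hA : Convex ℝ A) (h : Tame A t) (f : V →ᵃ[ℝ] ℝ)
    {l : List τ} (hl : l.Pairwise (· < ·)) (hlA : ∀ x ∈ l, x ∈ t '' A) :
    (∀ x ∈ l, x ∈ t '' {q ∈ A | 0 ≤ f q}) ∨ (∀ x ∈ l, x ∈ t '' {q ∈ A | f q ≤ 0}) := by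
  by_contra! hc
  obtain ⟨⟨x, hx, hx1⟩, ⟨y, hy, hy1⟩⟩ := hc
  obtain ⟨q, hq, rfl⟩ := hlA x hx
  obtain ⟨q', hq', rfl⟩ := hlA y hy
  have h1 : f q < 0 := by
    by_contra h'; exact hx1 ⟨q, ⟨hq, not_lt.1 h'⟩, rfl⟩
  have h2 : 0 < f q' := by
    by_contra h'; exact hy1 ⟨q', ⟨hq', not_lt.1 h'⟩, rfl⟩
  have hcmp : t q ≤ t q' ∨ t q' ≤ t q := by
    by_contra hn
    push Not at hn
    have h3 : l.Pairwise fun a b => a ≤ b ∨ b ≤ a := hl.imp fun h => Or.inl h.le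
    have := (haveI : Std.Symm (fun a b : τ => a ≤ b ∨ b ≤ a) := ⟨fun _ _ h => h.symm⟩
      List.Pairwise.forall_of_forall (R := fun a b : τ => a ≤ b ∨ b ≤ a)
        (fun _ _ => Or.inl le_rfl) h3 hx hy)
    tauto
  rcases hcmp with hle | hle
  · obtain ⟨s, s0, s1, hs⟩ := exists_zero_seg f (a := q) (b := q') (by nlinarith) h2.ne'
    exact hx1 ⟨_, ⟨hA.seg_mem hq hq' s0 s1.le, hs.ge⟩, h q hq q' hq' hle s s0 s1⟩
  · obtain ⟨s, s0, s1, hs⟩ := exists_zero_seg f (a := q') (b := q) (by nlinarith) h1.ne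
    exact hy1 ⟨_, ⟨hA.seg_mem hq' hq s0 s1.le, hs.le⟩, h q' hq' q hq hle s s0 s1⟩

lemma Tame.inter {A : Set V} {t : V → τ} (hA : Convex ℝ A) (h : Tame A t) (f : V →ᵃ[ℝ] ℝ) :
    t '' {q ∈ A | 0 ≤ f q} ∩ t '' {q ∈ A | f q ≤ 0} = t '' {q ∈ A | f q = 0} := by
  apply Set.Subset.antisymm
  · rintro x ⟨⟨q, ⟨hq, h1⟩, rfl⟩, ⟨q', ⟨hq', h2⟩, he⟩⟩
    by_cases h0 : f q' = 0
    · exact ⟨q', ⟨hq', h0⟩, he⟩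
    obtain ⟨s, s0, s1, hs⟩ := exists_zero_seg f (a := q) (b := q')
      (mul_nonpos_of_nonneg_of_nonpos h1 h2) h0
    exact ⟨_, ⟨hA.seg_mem hq hq' s0 s1.le, hs⟩, h q hq q' hq' he.ge s s0 s1⟩
  · rintro x ⟨q, ⟨hq, h1⟩, rfl⟩
    exact ⟨⟨q, ⟨hq, h1.ge⟩, rfl⟩, ⟨q, ⟨hq, h1.le⟩, rfl⟩⟩

lemma Tame.mono {A B : Set V} {t : V → τ} (h : Tame A t) (hB : B ⊆ A) : Tame B t :=
  fun q hq q' hq' => h q (hB hq) q' (hB hq')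

/-- `f` takes both strict signs on `A`. -/
def Crosses (f : V →ᵃ[ℝ] ℝ) (A : Set V) : Prop := ∃ q ∈ A, ∃ q' ∈ A, f q < 0 ∧ 0 < f q'

lemma conv_fin {t : V → τ} (F : Set (V →ᵃ[ℝ] ℝ)) (m : ℕ) :
    ∀ (A : Set V), Convex ℝ A → A.Nonempty → Tame A t → (t '' A).Finite →
    (∃ F' : Finset (V →ᵃ[ℝ] ℝ), F'.card ≤ m ∧ ∀ f ∈ F, Crosses f A → f ∈ F') →
    (∀ q ∈ A, ∀ q' ∈ A, (∀ f ∈ F, ¬ (f q < 0 ∧ 0 < f q') ∧ ¬ (f q' < 0 ∧ 0 < f q)) →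
      ∃ q'' ∈ A, t q'' ≤ t q ∧ t q'' ≤ t q') →
    (∀ B ⊆ A, Convex ℝ B → ∀ q ∈ B, ∀ q' ∈ B,
      (∀ f ∈ F, ¬ (f q < 0 ∧ 0 < f q') ∧ ¬ (f q' < 0 ∧ 0 < f q)) →
      ∃ q'' ∈ B, t q'' ≤ t q ∧ t q'' ≤ t q') →
    ∀ k, Ex (· < ·) (t '' A) k := by
  classical
  induction m with
  | zero =>
    intro A hA hne hT hfin ⟨F', hc, hF⟩ hdir _ k
    have hF0 : F' = ∅ := Finset.card_eq_zero.1 (Nat.le_zero.1 hc)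
    have hnc : ∀ f ∈ F, ¬ Crosses f A := fun f hf h => by simpa [hF0] using hF f hf h
    obtain ⟨x, hx⟩ := hfin.exists_minimal (hne.image t)
    obtain ⟨⟨q, hq, rfl⟩, hmin⟩ := hx
    have hleast : ∀ y ∈ t '' A, t q ≤ y := by
      rintro y ⟨q', hq', rfl⟩
      obtain ⟨q'', h1, h2, h3⟩ := hdir q hq q' hq' fun f hf =>
        ⟨fun h => hnc f hf ⟨q, hq, q', hq', h⟩, fun h => hnc f hf ⟨q', hq', q, hq, h⟩⟩
      exact (hmin (Set.mem_image_of_mem t h1) h2).trans h3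
    exact ex_cone (x0 := t q) (Set.mem_image_of_mem t hq) (fun x hx hxn => lt_of_le_of_ne (hleast x hx) hxn.symm)
      (fun x hx h => absurd (hleast x hx) h.not_ge) k
  | succ m ih =>
    intro A hA hne hT hfin ⟨F', hc, hF⟩ hdir hdirB
    by_cases hcr : ∃ f ∈ F, Crosses f A
    · obtain ⟨f, hf, hfc⟩ := hcr
      obtain ⟨q, hq, q', hq', hneg, hpos⟩ := hfc
      have hsub : ∀ B ⊆ A, Convex ℝ B → B.Nonempty → (¬ Crosses f B) →
          ∀ k, Ex (· < ·) (t '' B) k := by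
        intro B hB hBc hBn hBf
        refine ih B hBc hBn (hT.mono hB) (hfin.subset (Set.image_mono hB))
          ⟨F'.erase f, ?_, fun g hg hgc => ?_⟩ (hdirB B hB hBc)
          (fun B' hB' => hdirB B' (hB'.trans hB))
        · have := Finset.card_erase_of_mem (hF f hf ⟨q, hq, q', hq', hneg, hpos⟩)
          omega
        · obtain ⟨a, ha, b, hb, h⟩ := hgc
          refine Finset.mem_erase.2 ⟨?_, hF g hg ⟨a, hB ha, b, hB hb, h⟩⟩
          rintro rfl
          exact hBf ⟨a, ha, b, hb, h⟩
      have c1 : Convex ℝ {q ∈ A | 0 ≤ f q} :=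
        hA.inter ((convex_Ici (𝕜 := ℝ) (0 : ℝ)).affine_preimage f)
      have c2 : Convex ℝ {q ∈ A | f q ≤ 0} :=
        hA.inter ((convex_Iic (𝕜 := ℝ) (0 : ℝ)).affine_preimage f)
      have c3 : Convex ℝ {q ∈ A | f q = 0} := by
        have := c1.inter c2
        convert this using 1
        ext x; simp only [Set.mem_ofPred_eq, Set.mem_inter_iff]
        exact ⟨fun h => ⟨⟨h.1, h.2.ge⟩, h.1, h.2.le⟩, fun h => ⟨h.1.1, le_antisymm h.2.2 h.1.2⟩⟩
      have n3 : {q ∈ A | f q = 0}.Nonempty := by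
        obtain ⟨s, s0, s1, hs⟩ := exists_zero_seg f (a := q) (b := q') (by nlinarith) hpos.ne'
        exact ⟨_, hA.seg_mem hq hq' s0 s1.le, hs⟩
      intro k
      refine mayerVietoris (X1 := t '' {q ∈ A | 0 ≤ f q}) (X2 := t '' {q ∈ A | f q ≤ 0})
        (Set.image_mono fun x hx => hx.1) (Set.image_mono fun x hx => hx.1)
        (fun l hl hlA => hT.cover hA f hl hlA) ?_ ?_ fun j _ => ?_
      · refine hsub _ (fun x hx => hx.1) c1 ⟨q', hq', hpos.le⟩ ?_ k
        rintro ⟨a, ha, -, -, h, -⟩; exact absurd ha.2 h.not_ge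
      · refine hsub _ (fun x hx => hx.1) c2 ⟨q, hq, hneg.le⟩ ?_ k
        rintro ⟨-, -, a, ha, -, h⟩; exact absurd ha.2 h.not_ge
      · rw [hT.inter hA f]
        refine hsub _ (fun x hx => hx.1) c3 n3 ?_ j
        rintro ⟨a, ha, -, -, h, -⟩; exact absurd ha.2 h.ne
    · exact ih A hA hne hT hfin ⟨∅, by simp, fun f hf h => absurd ⟨f, hf, h⟩ hcr⟩ hdir hdirB

section Argmin
variable {ι : Type*}

/-- The indices in `I` at which `g` is minimal. -/
def am (I : Set ι) (g : ι → V →ᵃ[ℝ] ℝ) (q : V) : Set ι := {i ∈ I | ∀ j ∈ I, g i q ≤ g j q}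

lemma am_subset {I : Set ι} {g : ι → V →ᵃ[ℝ] ℝ} {q : V} : am I g q ⊆ I := fun _ h => h.1

lemma am_empty {g : ι → V →ᵃ[ℝ] ℝ} {q : V} : am (∅ : Set ι) g q = ∅ :=
  Set.eq_empty_of_subset_empty am_subset

lemma am_nonempty {I : Set ι} (hI : I.Finite) (hne : I.Nonempty) (g : ι → V →ᵃ[ℝ] ℝ) (q : V) :
    (am I g q).Nonempty := by
  obtain ⟨i, hi, h⟩ := hI.exists_minimalFor (fun i => g i q) I hne
  refine ⟨i, hi, fun j hj => ?_⟩
  by_contra hlt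
  exact hlt (h hj (not_le.1 hlt).le)

lemma am_tame {I : Set ι} {g : ι → V →ᵃ[ℝ] ℝ} {q q' : V} (hne : (am I g q).Nonempty ∨ I = ∅)
    (hle : am I g q ⊆ am I g q') {s : ℝ} (h0 : 0 ≤ s) (h1 : s < 1) :
    am I g (AffineMap.lineMap q q' s) = am I g q := by
  rcases hne with ⟨j, hj⟩ | rfl
  · apply Set.Subset.antisymm
    · intro i hi
      refine ⟨hi.1, fun j' hj' => ?_⟩
      have h2 := hi.2 j hj.1
      have h3 := (hle hj).2 i hi.1
      rw [affine_seg, affine_seg] at h2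
      have : g i q ≤ g j q := by
        by_contra h4
        nlinarith
      exact this.trans (hj.2 j' hj')
    · intro i hi
      refine ⟨hi.1, fun j' hj' => ?_⟩
      have h2 := hi.2 j' hj'
      have h3 := (hle hi).2 j' hj'
      rw [affine_seg, affine_seg]
      nlinarith
  · simp [am_empty]

lemma am_mid {I : Set ι} {g : ι → V →ᵃ[ℝ] ℝ} {q q' : V} (hne : (am I g q).Nonempty ∨ I = ∅)
    (h : ∀ i ∈ am I g (AffineMap.lineMap q q' (1 / 2 : ℝ)), ∀ j ∈ am I g q,
      ¬ (g j q < g i q ∧ g i q' < g j q')) :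
    am I g (AffineMap.lineMap q q' (1 / 2 : ℝ)) ⊆ am I g q := by
  rcases hne with ⟨j, hj⟩ | rfl
  · intro i hi
    refine ⟨hi.1, fun j' hj' => ?_⟩
    have h1 := h i hi j hj
    have h2 := hi.2 j hj.1
    rw [affine_seg, affine_seg] at h2
    have : g i q ≤ g j q := by
      by_contra h4
      push Not at h4
      apply h1 ⟨h4, ?_⟩
      by_contra h5
      linarith
    exact this.trans (hj.2 j' hj')
  · simp [am_empty]

lemma tame_union {A : Set V} {S I : Set ι} {g : ι → V →ᵃ[ℝ] ℝ} (dSI : Disjoint S I)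
    (hI : ∀ q ∈ A, (am I g q).Nonempty) : Tame A fun q => S ∪ am I g q := by
  intro q hq q' _ hqq s s0 s1
  dsimp only
  rw [am_tame (Or.inl (hI q hq)) (fun i hi => ?_) s0 s1]
  exact (hqq (Or.inr hi)).resolve_left fun h => dSI.le_bot ⟨h, hi.1⟩

/-- Acyclicity of the poset of types for (unions of) argmin types on a convex set. -/
lemma conv_am {A : Set V} (hA : Convex ℝ A) (hne : A.Nonempty) {S I J : Set ι}
    {g h : ι → V →ᵃ[ℝ] ℝ} (dSI : Disjoint S I) (dSJ : Disjoint S J) (dIJ : Disjoint I J)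
    (hI : (∀ q ∈ A, (am I g q).Nonempty) ∨ I = ∅) (hJ : (∀ q ∈ A, (am J h q).Nonempty) ∨ J = ∅)
    (hfin : ∀ s : Finset V, (s : Set V) ⊆ A → ∃ Φ : Set ι, Φ.Finite ∧
      ∀ q ∈ convexHull ℝ (s : Set V), am I g q ⊆ Φ ∧ am J h q ⊆ Φ) (k : ℕ) :
    Ex (· < ·) ((fun q => S ∪ (am I g q ∪ am J h q)) '' A) k := by
  classical
  set t : V → Set ι := fun q => S ∪ (am I g q ∪ am J h q) with ht
  have hI' : ∀ q ∈ A, (am I g q).Nonempty ∨ I = ∅ := fun q hq => hI.imp_left fun h => h q hq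
  have hJ' : ∀ q ∈ A, (am J h q).Nonempty ∨ J = ∅ := fun q hq => hJ.imp_left fun h => h q hq
  have hle : ∀ q q', t q ≤ t q' → am I g q ⊆ am I g q' ∧ am J h q ⊆ am J h q' := by
    intro q q' hqq
    constructor
    · intro i hi
      rcases hqq (Or.inr (Or.inl hi)) with h1 | h1 | h1
      · exact (dSI.le_bot ⟨h1, hi.1⟩).elim
      · exact h1
      · exact (dIJ.le_bot ⟨hi.1, h1.1⟩).elim
    · intro i hi
      rcases hqq (Or.inr (Or.inr hi)) with h1 | h1 | h1
      · exact (dSJ.le_bot ⟨h1, hi.1⟩).elim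
      · exact (dIJ.le_bot ⟨h1.1, hi.1⟩).elim
      · exact h1
  have hT : Tame A t := by
    intro q hq q' hq' hqq s s0 s1
    simp only [ht]
    rw [am_tame (hI' q hq) (hle q q' hqq).1 s0 s1, am_tame (hJ' q hq) (hle q q' hqq).2 s0 s1]
  have hfinA : ∀ s : Finset V, s.Nonempty → (s : Set V) ⊆ A → ∀ k,
      Ex (· < ·) (t '' convexHull ℝ (s : Set V)) k := by
    intro s hs hsA
    obtain ⟨Φ, hΦ, hsub⟩ := hfin s hsA
    have hhA : convexHull ℝ (s : Set V) ⊆ A := convexHull_min hsA hA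
    set F1 : Set (V →ᵃ[ℝ] ℝ) := (fun p : ι × ι => g p.1 - g p.2) '' (Φ ×ˢ Φ)
    set F2 : Set (V →ᵃ[ℝ] ℝ) := (fun p : ι × ι => h p.1 - h p.2) '' (Φ ×ˢ Φ)
    have hF : (F1 ∪ F2).Finite := ((hΦ.prod hΦ).image _).union ((hΦ.prod hΦ).image _)
    have hdir : ∀ B ⊆ convexHull ℝ (s : Set V), Convex ℝ B → ∀ q ∈ B, ∀ q' ∈ B,
        (∀ f ∈ F1 ∪ F2, ¬ (f q < 0 ∧ 0 < f q') ∧ ¬ (f q' < 0 ∧ 0 < f q)) →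
        ∃ q'' ∈ B, t q'' ≤ t q ∧ t q'' ≤ t q' := by
      intro B hB hBc q hq q' hq' hf
      have hm := hBc.seg_mem hq hq' (s := 1 / 2) (by norm_num) (by norm_num)
      have hsym : (AffineMap.lineMap q' q (1 / 2 : ℝ) : V) = AffineMap.lineMap q q' (1 / 2 : ℝ) := by
        rw [← AffineMap.lineMap_apply_one_sub]; norm_num
      have key : ∀ q ∈ B, ∀ q' ∈ B, (AffineMap.lineMap q q' (1 / 2 : ℝ) : V) ∈ B →
          (∀ f ∈ F1 ∪ F2, ¬ (f q < 0 ∧ 0 < f q')) →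
          t (AffineMap.lineMap q q' (1 / 2 : ℝ)) ≤ t q := by
        intro q hq q' hq' hm hf
        refine Set.union_subset_union_right _ (Set.union_subset_union ?_ ?_)
        · refine am_mid (hI' q (hhA (hB hq))) fun i hi j hj hij => ?_
          refine hf (g j - g i) (Or.inl ⟨(j, i), ⟨(hsub q (hB hq)).1 hj,
            (hsub _ (hB hm)).1 hi⟩, rfl⟩) ⟨?_, ?_⟩
          · simpa using hij.1
          · simpa using hij.2
        · refine am_mid (hJ' q (hhA (hB hq))) fun i hi j hj hij => ?_
          refine hf (h j - h i) (Or.inr ⟨(j, i), ⟨(hsub q (hB hq)).2 hj,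
            (hsub _ (hB hm)).2 hi⟩, rfl⟩) ⟨?_, ?_⟩
          · simpa using hij.1
          · simpa using hij.2
      refine ⟨_, hm, key q hq q' hq' hm fun f h => (hf f h).1, ?_⟩
      rw [← hsym]
      exact key q' hq' q hq (hsym ▸ hm) fun f h => (hf f h).2
    refine conv_fin (t := t) (F1 ∪ F2) hF.toFinset.card _ (convex_convexHull ℝ _)
      ((convexHull_nonempty_iff).2 hs) (hT.mono hhA) ?_
      ⟨hF.toFinset, le_rfl, fun f hf _ => hF.mem_toFinset.2 hf⟩ (hdir _ le_rfl (convex_convexHull ℝ _))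
      hdir
    refine ((hΦ.finite_subsets).image fun x => S ∪ x).subset ?_
    rintro _ ⟨q, hq, rfl⟩
    exact ⟨_, Set.union_subset (hsub q hq).1 (hsub q hq).2, rfl⟩
  intro z hz hbz
  set vs : Set (Set ι) := {x | ∃ l ∈ z.support, x ∈ l} with hvs
  have hvf : vs.Finite := by
    have : vs = ⋃ l ∈ z.support, {x | x ∈ l} := by ext; simp [hvs]
    rw [this]
    exact z.support.finite_toSet.biUnion fun l _ => l.finite_toSet
  have hvA : vs ⊆ t '' A := by
    rintro x ⟨l, hl, hx⟩
    exact (mem_fl.1 hz l (by simpa using hl)).2.1 x hx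
  obtain ⟨q0, hq0⟩ := hne
  obtain ⟨s, hsA, hsv⟩ : ∃ s : Finset V, (s : Set V) ⊆ A ∧ vs ⊆ t '' s := by
    obtain ⟨s, h1, h2⟩ := (Finset.subset_set_image_iff (s := A) (t := hvf.toFinset) (f := t)).1
      (by simpa using hvA)
    refine ⟨s, h1, fun x hx => ?_⟩
    rw [← Finset.coe_image, h2]; simpa using hx
  have hs' : ((insert q0 s : Finset V) : Set V) ⊆ A := by
    rw [Finset.coe_insert]; exact Set.insert_subset hq0 hsA
  have hz' : z ∈ fl (· < ·) (t '' convexHull ℝ ((insert q0 s : Finset V) : Set V)) k := by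
    refine mem_fl.2 fun l hl => ?_
    obtain ⟨a, b, c⟩ := mem_fl.1 hz l hl
    refine ⟨a, fun x hx => ?_, c⟩
    obtain ⟨q, hq, rfl⟩ := hsv ⟨l, by simpa using hl, hx⟩
    exact ⟨q, subset_convexHull ℝ _ (by simp [Finset.mem_coe.1 hq]), rfl⟩
  obtain ⟨w, hw, rfl⟩ := hfinA _ (by simp) hs' k z hz' hbz
  exact ⟨w, fl_mono (Set.image_mono (convexHull_min hs' hA)) hw, rfl⟩

end Argmin
end Conv
end LS

namespace LS
section Sphere
open Filter Topology

lemma length_le_of_rank {τ : Type*} {r : τ → τ → Prop} (ρ : τ → ℕ) {X : Set τ} {a m : ℕ}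
    (hρ : ∀ x ∈ X, ∀ y ∈ X, r x y → ρ x < ρ y) (hX : ∀ x ∈ X, a ≤ ρ x ∧ ρ x < a + m)
    {l : List τ} (hl : l.Pairwise r) (hlX : ∀ x ∈ l, x ∈ X) : l.length ≤ m := by
  have h1 : (l.map ρ).Nodup := by
    rw [List.Nodup, List.pairwise_map]
    exact hl.imp_of_mem fun hx hy h => (hρ _ (hlX _ hx) _ (hlX _ hy) h).ne
  have h2 : (l.map ρ).toFinset ⊆ Finset.Ico a (a + m) := by
    intro i hi
    rw [List.mem_toFinset, List.mem_map] at hi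
    obtain ⟨x, hx, rfl⟩ := hi
    exact Finset.mem_Ico.2 (hX x (hlX x hx))
  have := Finset.card_le_card h2
  rw [List.toFinset_card_of_nodup h1] at this
  simpa using this

variable {V : Type*} [AddCommGroup V] [Module ℝ V] {ι : Type*}

/-- Linear functionals as affine maps. -/
noncomputable def aff (L : ι → V →ₗ[ℝ] ℝ) (i : ι) : V →ᵃ[ℝ] ℝ := (L i).toAffineMap

@[simp] lemma aff_apply (L : ι → V →ₗ[ℝ] ℝ) (i : ι) (h : V) : aff L i h = L i h := rfl

/-- Vectors on which all functionals with index in `Φ` agree. -/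
def Kc (Φ : Set ι) (L : ι → V →ₗ[ℝ] ℝ) : Submodule ℝ V where
  carrier := {h | ∀ i ∈ Φ, ∀ j ∈ Φ, L i h = L j h}
  zero_mem' := by simp
  add_mem' := fun ha hb i hi j hj => by rw [map_add, map_add, ha i hi j hj, hb i hi j hj]
  smul_mem' := fun c a ha i hi j hj => by rw [map_smul, map_smul, ha i hi j hj]

lemma Kc_anti {Φ Ψ : Set ι} {L : ι → V →ₗ[ℝ] ℝ} (h : Φ ⊆ Ψ) : Kc Ψ L ≤ Kc Φ L :=
  fun _ hx i hi j hj => hx i (h hi) j (h hj)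

/-- Perturbing a point refines its argmin set. -/
lemma am_perturb {Φ : Set ι} (hΦ : Φ.Finite) (L : ι → V →ₗ[ℝ] ℝ) (h0 h : V) :
    ∀ᶠ ε in 𝓝[>] (0 : ℝ), am Φ (aff L) (h0 + ε • h) = am (am Φ (aff L) h0) (aff L) h := by
  rcases Φ.eq_empty_or_nonempty with rfl | hne
  · simp [am_empty]
  obtain ⟨m, hm⟩ := am_nonempty hΦ hne (aff L) h0
  have h1 : ∀ j ∈ Φ, ∀ᶠ ε in 𝓝[>] (0 : ℝ), L m h0 < L j h0 → L m (h0 + ε • h) < L j (h0 + ε • h) := by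
    intro j _
    by_cases hj : L m h0 < L j h0
    · have hc : ContinuousAt (fun ε : ℝ => (L j h0 + ε * L j h) - (L m h0 + ε * L m h)) 0 := by
        fun_prop
      have h2 := hc.eventually (lt_mem_nhds (a := 0) (by simpa using hj))
      filter_upwards [nhdsWithin_le_nhds h2] with ε hε _
      simpa [map_add, map_smul] using hε
    · exact Eventually.of_forall fun _ h => absurd h hj
  filter_upwards [(hΦ.eventually_all).2 h1, self_mem_nhdsWithin] with ε hε hpos
  have hpos : 0 < ε := hpos
  have hM : ∀ j ∈ am Φ (aff L) h0, L j h0 = L m h0 := fun j hj =>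
    le_antisymm (hj.2 m hm.1) (hm.2 j hj.1)
  apply Set.Subset.antisymm
  · intro i hi
    have hiM : i ∈ am Φ (aff L) h0 := by
      refine ⟨hi.1, fun j hj => ?_⟩
      have h3 := hi.2 m hm.1
      have h4 : ¬ L m h0 < L i h0 := fun h5 => absurd (hε i hi.1 h5) h3.not_gt
      exact (not_lt.1 h4).trans (hm.2 j hj)
    refine ⟨hiM, fun j hj => ?_⟩
    have h3 := hi.2 j hj.1
    simp only [aff_apply, map_add, map_smul, smul_eq_mul, hM i hiM, hM j hj,
      add_le_add_iff_left] at h3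
    exact le_of_mul_le_mul_left h3 hpos
  · intro i hi
    refine ⟨hi.1.1, fun j hj => ?_⟩
    have key : ∀ j ∈ am Φ (aff L) h0, aff L i (h0 + ε • h) ≤ aff L j (h0 + ε • h) := by
      intro j hj
      have h3 := hi.2 j hj
      simp only [aff_apply, map_add, map_smul, smul_eq_mul, hM i hi.1, hM j hj,
        add_le_add_iff_left] at h3 ⊢
      exact mul_le_mul_of_nonneg_left h3 hpos.le
    by_cases hjM : j ∈ am Φ (aff L) h0
    · exact key j hjM
    · have : L m h0 < L j h0 := by
        by_contra h5
        exact hjM ⟨hj, fun j' hj' => (not_lt.1 h5).trans (hm.2 j' hj')⟩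
      exact (key m hm).trans (hε j hj this).le

/-- The proper argmin types over a subspace. -/
def TW (S Φ : Set ι) (L : ι → V →ₗ[ℝ] ℝ) (W : Set V) : Set (Set ι) :=
  (fun h => S ∪ am Φ (aff L) h) '' W \ {S ∪ Φ}

variable {S Φ : Set ι} {L : ι → V →ₗ[ℝ] ℝ}

lemma am_am {h : V} {M : Set ι} (hM : M ⊆ Φ) (hsub : am Φ (aff L) h ⊆ M)
    (hne : (am Φ (aff L) h).Nonempty) : am M (aff L) h = am Φ (aff L) h := by
  obtain ⟨m, hm⟩ := hne
  apply Set.Subset.antisymm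
  · exact fun i hi => ⟨hM hi.1, fun j hj => (hi.2 m (hsub hm)).trans (hm.2 j hj)⟩
  · exact fun i hi => ⟨hsub hi, fun j hj => hi.2 j (hM hj)⟩

lemma union_am_subset (dS : Disjoint S Φ) {M N : Set ι} (hM : M ⊆ Φ) (h : S ∪ M ⊆ S ∪ N) :
    M ⊆ N :=
  fun _ hi => (h (Or.inr hi)).resolve_left fun hs => dS.le_bot ⟨hs, hM hi⟩

lemma halfspace_ex (hΦ : Φ.Finite) (hne : Φ.Nonempty) (dS : Disjoint S Φ) (W : Submodule ℝ V)
    (f : V →ₗ[ℝ] ℝ) (hfK : ∀ h ∈ Kc Φ L, f h = 0) {h1 : V} (h1W : h1 ∈ W) (h1f : 0 < f h1) (k : ℕ) :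
    Ex (· < ·) (TW S Φ L {h ∈ W | 0 ≤ f h}) k := by
  have hamne : ∀ h, (am Φ (aff L) h).Nonempty := am_nonempty hΦ hne _
  set t : V → Set ι := fun h => S ∪ am Φ (aff L) h with ht
  set A : Set V := {h ∈ W | 0 < f h} with hA
  have hAc : Convex ℝ A := W.convex.inter ((convex_Ioi (𝕜 := ℝ) (0 : ℝ)).linear_preimage f)
  have hT : Tame (Set.univ : Set V) t := tame_union dS fun h _ => hamne h
  have htop : ∀ h, f h ≠ 0 → t h ≠ S ∪ Φ := by
    intro h hf he
    refine hf (hfK h fun i hi j hj => ?_)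
    have hsub := union_am_subset dS (N := am Φ (aff L) h) le_rfl he.ge
    exact le_antisymm ((hsub hi).2 j hj) ((hsub hj).2 i hi)
  have hsubc : ∀ M : Set ι, M ⊆ Φ → M.Nonempty → ∀ k,
      Ex (· < ·) ((fun h => S ∪ am M (aff L) h) '' A) k := by
    intro M hM hMne k
    have := conv_am (S := S) (I := M) (J := ∅) (g := aff L) (h := aff L) hAc ⟨h1, h1W, h1f⟩
      (dS.mono_right hM) (by simp) (by simp)
      (Or.inl fun q _ => am_nonempty (hΦ.subset hM) hMne _ _) (Or.inr rfl)
      (fun s _ => ⟨Φ, hΦ, fun q _ => ⟨am_subset.trans hM, by simp [am_empty]⟩⟩) k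
    simpa only [am_empty, Set.union_empty] using this
  have hXY : t '' A ⊆ TW S Φ L {h ∈ W | 0 ≤ f h} := by
    rintro _ ⟨h, hh, rfl⟩
    exact ⟨⟨h, ⟨hh.1, hh.2.le⟩, rfl⟩, htop h hh.2.ne'⟩
  have hcard : ∀ M ⊆ Φ, ((S ∪ M) ∩ Φ).ncard ≤ Φ.ncard := fun M hM =>
    Set.ncard_le_ncard Set.inter_subset_right hΦ
  have hq := quillen (r := (· > ·)) (X := t '' A) (Y := TW S Φ L {h ∈ W | 0 ≤ f h})
    (fun x => Φ.ncard - (x ∩ Φ).ncard) (Φ.ncard + 1) ?_ hXY ?_ (fun y _ => by omega) ?_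
  · exact (hq.1 (fun k => (hsubc Φ le_rfl hne k).flip) k).flip
  · rintro _ ⟨⟨a, -, rfl⟩, -⟩ _ ⟨⟨b, -, rfl⟩, -⟩ hab
    have hlt : ((S ∪ am Φ (aff L) b) ∩ Φ).ncard < ((S ∪ am Φ (aff L) a) ∩ Φ).ncard := by
      refine Set.ncard_lt_ncard ?_ (hΦ.subset Set.inter_subset_right)
      refine ⟨Set.inter_subset_inter_left _ hab.le, fun hsub => hab.not_ge ?_⟩
      rintro i (hi | hi)
      · exact Or.inl hi
      · exact (hsub ⟨Or.inr hi, hi.1⟩).1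
    have := hcard _ (am_subset (I := Φ) (g := aff L) (q := a))
    have := hcard _ (am_subset (I := Φ) (g := aff L) (q := b))
    dsimp only
    omega
  · rintro _ ⟨h, hh, rfl⟩ _ ⟨⟨h', hh', rfl⟩, -⟩ hlt
    refine ⟨AffineMap.lineMap h' h (1 / 2 : ℝ),
      ⟨W.convex.seg_mem hh'.1 hh.1 (by norm_num) (by norm_num), ?_⟩,
      hT h' trivial h trivial hlt.le (1 / 2) (by norm_num) (by norm_num)⟩
    have := affine_seg f.toAffineMap h' h (1 / 2)
    simp only [LinearMap.coe_toAffineMap] at this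
    rw [this]
    have := hh.2
    have := hh'.2
    linarith
  · rintro _ ⟨⟨h0, hh0, rfl⟩, -⟩ hnot k
    have hf0 : f h0 = 0 := by
      by_contra hne0
      exact hnot ⟨h0, ⟨hh0.1, lt_of_le_of_ne hh0.2 (Ne.symm hne0)⟩, rfl⟩
    have hlink : ({x ∈ t '' A | t h0 > x} : Set (Set ι)) =
        (fun h => S ∪ am (am Φ (aff L) h0) (aff L) h) '' A := by
      ext x
      constructor
      · rintro ⟨⟨h, hh, rfl⟩, hlt⟩
        have hsub : am Φ (aff L) h ⊆ am Φ (aff L) h0 := union_am_subset dS am_subset hlt.le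
        exact ⟨h, hh, by simp only [ht]; rw [am_am am_subset hsub (hamne h)]⟩
      · rintro ⟨h, hh, rfl⟩
        obtain ⟨ε, hε, hpos⟩ := ((am_perturb hΦ L h0 h).and self_mem_nhdsWithin).exists
        have hpos : 0 < ε := hpos
        have hmem : S ∪ am (am Φ (aff L) h0) (aff L) h ∈ t '' A := by
          refine ⟨h0 + ε • h, ⟨W.add_mem hh0.1 (W.smul_mem _ hh.1), ?_⟩, by simp only [ht, hε]⟩
          rw [map_add, map_smul, hf0, zero_add]; exact mul_pos hpos hh.2
        refine ⟨hmem, lt_of_le_of_ne (Set.union_subset_union_right _ am_subset) ?_⟩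
        intro he
        have he' : S ∪ am (am Φ (aff L) h0) (aff L) h = t h0 := he
        rw [he'] at hmem
        exact hnot hmem
    show Ex (· > ·) {x ∈ t '' A | t h0 > x} k
    rw [hlink]
    exact (hsubc _ am_subset (hamne h0) k).flip

/-- The poset of proper argmin types is a sphere. -/
theorem sphere [FiniteDimensional ℝ V] (hΦ : Φ.Finite) (dS : Disjoint S Φ) (m : ℕ) :
    ∀ W : Submodule ℝ V, Module.finrank ℝ W = Module.finrank ℝ ↥(W ⊓ Kc Φ L) + m →
      Sph (· < ·) (TW S Φ L W) m := by
  induction m with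
  | zero =>
    intro W hW
    have hle : W ⊓ Kc Φ L = W := Submodule.eq_of_le_of_finrank_eq inf_le_left (by omega)
    have : TW S Φ L (W : Set V) = ∅ := by
      rw [Set.eq_empty_iff_forall_notMem]
      rintro _ ⟨⟨h, hh, rfl⟩, hne⟩
      refine hne ?_
      have hK : h ∈ Kc Φ L := (hle.ge hh).2
      simp only [Set.mem_singleton_iff]
      congr 1
      exact am_subset.antisymm fun i hi => ⟨hi, fun j hj => (hK i hi j hj).le⟩
    rw [this]; exact sph_empty
  | succ m ih =>
    intro W hW
    have hnle : ¬ W ≤ Kc Φ L := fun h => by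
      rw [inf_eq_left.2 h] at hW; omega
    obtain ⟨h1, h1W, h1K⟩ := SetLike.not_le_iff_exists.1 hnle
    obtain ⟨i, hi, j, hj, hij⟩ : ∃ i ∈ Φ, ∃ j ∈ Φ, L i h1 ≠ L j h1 := by
      by_contra! hc; exact h1K hc
    have hne : Φ.Nonempty := ⟨i, hi⟩
    have hamne : ∀ h, (am Φ (aff L) h).Nonempty := am_nonempty hΦ hne _
    have hT : Tame (W : Set V) fun h => S ∪ am Φ (aff L) h := tame_union dS fun h _ => hamne h
    set f : V →ₗ[ℝ] ℝ := L i - L j with hf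
    have hfK : ∀ h ∈ Kc Φ L, f h = 0 := fun h hh => by simp [hf, hh i hi j hj]
    have hf1 : f h1 ≠ 0 := by simpa [hf, sub_eq_zero] using hij
    obtain ⟨hp, hpW, hpf⟩ : ∃ h ∈ W, 0 < f h := by
      rcases lt_or_gt_of_ne hf1 with h | h
      · exact ⟨-h1, W.neg_mem h1W, by rw [map_neg]; linarith⟩
      · exact ⟨h1, h1W, h⟩
    have hK : W ⊓ LinearMap.ker f ⊓ Kc Φ L = W ⊓ Kc Φ L := by
      ext h
      simp only [Submodule.mem_inf, LinearMap.mem_ker]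
      exact ⟨fun h => ⟨h.1.1, h.2⟩, fun h => ⟨⟨h.1, hfK _ h.2⟩, h.2⟩⟩
    have hdim : Module.finrank ℝ ↥(W ⊓ LinearMap.ker f) + 1 = Module.finrank ℝ W := by
      have h2 := LinearMap.finrank_range_add_finrank_ker (f.domRestrict W)
      have h3 : LinearMap.range (f.domRestrict W) = ⊤ :=
        LinearMap.range_eq_top.2 (LinearMap.surjective (f := f.domRestrict W) (fun h0 => hf1 (by
          have := LinearMap.congr_fun h0 ⟨h1, h1W⟩
          simpa using this)))
      have h4 : Module.finrank ℝ (LinearMap.ker (f.domRestrict W)) =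
          Module.finrank ℝ ↥(W ⊓ LinearMap.ker f) := by
        have h5 : (LinearMap.ker (f.domRestrict W)).map W.subtype = W ⊓ LinearMap.ker f := by
          ext x
          simp only [Submodule.mem_map, LinearMap.mem_ker, Submodule.mem_inf, Submodule.subtype_apply]
          constructor
          · rintro ⟨y, hy, rfl⟩; exact ⟨y.2, hy⟩
          · rintro ⟨hx, hfx⟩; exact ⟨⟨x, hx⟩, hfx, rfl⟩
        rw [← h5]
        exact (LinearEquiv.finrank_eq (Submodule.equivMapOfInjective _ W.injective_subtype _))
      rw [h3, finrank_top, Module.finrank_self] at h2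
      omega
    have hs := ih (W ⊓ LinearMap.ker f) (by rw [hK]; omega)
    have hx : TW S Φ L {h ∈ (W : Set V) | 0 ≤ f h} ∩ TW S Φ L {h ∈ (W : Set V) | f h ≤ 0} =
        TW S Φ L ((W ⊓ LinearMap.ker f : Submodule ℝ V) : Set V) := by
      have := hT.inter W.convex f.toAffineMap
      simp only [LinearMap.coe_toAffineMap] at this
      simp only [TW]
      have hker : ((W ⊓ LinearMap.ker f : Submodule ℝ V) : Set V) = {q | q ∈ (W : Set V) ∧ f q = 0} := rfl
      rw [hker, ← this]
      ext x
      exact ⟨fun h => ⟨⟨h.1.1, h.2.1⟩, h.1.2⟩, fun h => ⟨⟨h.1.1, h.2⟩, ⟨h.1.2, h.2⟩⟩⟩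
    have hsub : ∀ B : Set V, B ⊆ W → TW S Φ L B ⊆ TW S Φ L W := fun B hB =>
      Set.sdiff_subset_sdiff_left (Set.image_mono hB)
    refine Sph.suspend (X1 := TW S Φ L {h ∈ (W : Set V) | 0 ≤ f h})
      (X2 := TW S Φ L {h ∈ (W : Set V) | f h ≤ 0}) (hsub _ fun h hh => hh.1)
      (hsub _ fun h hh => hh.1) (fun l hl hlX => ?_) (fun l hl hlX => ?_)
      (fun k => halfspace_ex hΦ hne dS W f hfK hpW hpf k) (fun k => ?_) (by rw [hx]; exact hs)
    · have := hT.cover W.convex f.toAffineMap hl (fun x hx => (hlX x hx).1)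
      exact this.imp (fun h x hx => ⟨h x hx, (hlX x hx).2⟩) (fun h x hx => ⟨h x hx, (hlX x hx).2⟩)
    · -- strict monotonicity of the dimension of `W ⊓ Kc`
      have key : ∀ a ∈ TW S Φ L (W : Set V), ∀ b : Set ι, b ⊆ S ∪ Φ → a < b →
          Module.finrank ℝ ↥(W ⊓ Kc (b ∩ Φ) L) < Module.finrank ℝ ↥(W ⊓ Kc (a ∩ Φ) L) := by
        rintro _ ⟨⟨h, hh, rfl⟩, -⟩ b hb hab
        refine Submodule.finrank_lt_finrank_of_lt (lt_of_le_of_ne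
          (inf_le_inf_left _ (Kc_anti (Set.inter_subset_inter_left _ hab.le))) fun he => ?_)
        have hmem : h ∈ W ⊓ Kc ((S ∪ am Φ (aff L) h) ∩ Φ) L := by
          refine ⟨hh, ?_⟩
          rintro i ⟨hi | hi, hi'⟩ j ⟨hj | hj, hj'⟩
          · exact (dS.le_bot ⟨hi, hi'⟩).elim
          · exact (dS.le_bot ⟨hi, hi'⟩).elim
          · exact (dS.le_bot ⟨hj, hj'⟩).elim
          · exact le_antisymm (hi.2 j hj') (hj.2 i hi')
        rw [← he] at hmem
        obtain ⟨i, hib, hia⟩ := Set.exists_of_ssubset hab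
        have hiΦ : i ∈ Φ := (hb hib).resolve_left fun hs => hia (Or.inl hs)
        obtain ⟨m, hm⟩ := hamne h
        refine hia (Or.inr ⟨hiΦ, fun j hj => ?_⟩)
        have := hmem.2 i ⟨hib, hiΦ⟩ m ⟨hab.le (Or.inr hm), hm.1⟩
        simp only [aff_apply]
        rw [this]; exact hm.2 j hj
      have hsubΦ : ∀ a ∈ TW S Φ L (W : Set V), a ⊆ S ∪ Φ := by
        rintro _ ⟨⟨h, hh, rfl⟩, -⟩; exact Set.union_subset_union_right _ am_subset
      have hbd : ∀ a ∈ TW S Φ L (W : Set V), Module.finrank ℝ ↥(W ⊓ Kc Φ L) <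
          Module.finrank ℝ ↥(W ⊓ Kc (a ∩ Φ) L) := by
        intro a ha
        have := key a ha (S ∪ Φ) le_rfl (lt_of_le_of_ne (hsubΦ a ha) ha.2)
        have he : (S ∪ Φ) ∩ Φ = Φ := Set.inter_eq_right.2 Set.subset_union_right
        rwa [he] at this
      have hle : ∀ a : Set ι, Module.finrank ℝ ↥(W ⊓ Kc (a ∩ Φ) L) ≤ Module.finrank ℝ W := fun a =>
        Submodule.finrank_mono inf_le_left
      refine length_le_of_rank (r := (· < ·))
        (fun a => Module.finrank ℝ W - Module.finrank ℝ ↥(W ⊓ Kc (a ∩ Φ) L)) (a := 0)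
        (fun x hx y hy hxy => ?_) (fun x hx => ⟨Nat.zero_le _, ?_⟩) hl hlX
      · have := key x hx y (hsubΦ y hy) hxy
        have := hle x
        omega
      · have := hbd x hx
        have := hle x
        omega
    · have := halfspace_ex (L := L) hΦ hne dS W (-f) (fun h hh => by simp [hfK h hh])
        (W.neg_mem hpW) (by simpa using hpf) k
      simpa using this

end Sphere
end LS

namespace LS
section Dcomplex
variable {τ : Type*} {r : τ → τ → Prop} {X Y : Set τ} {k : ℕ}

lemma fl_mono_of {c : Ch τ} (hc : c ∈ fl r X k) (h : X ⊆ Y) : c ∈ fl r Y k := fl_mono h hc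

/-- The sum of all tails. -/
noncomputable def tls : Ch τ →ₗ[ℚ] Ch τ := lift fun l => match l with
  | [] => 0
  | _ :: l => Finsupp.single l 1

@[simp] lemma tls_nil (a : ℚ) : tls (Finsupp.single ([] : List τ) a) = 0 := by simp [tls]

@[simp] lemma tls_cons (x : τ) (l : List τ) (a : ℚ) :
    tls (Finsupp.single (x :: l) a) = Finsupp.single l a := by simp [tls]

lemma tl_bd (x : τ) (c : Ch τ) : tl x (bd c) = tl x (tls c) - bd (tl x c) := by
  induction c using Finsupp.induction_linear with
  | zero => simp
  | add f g hf hg => simp only [map_add, hf, hg]; abel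
  | single l a =>
    rcases l with _ | ⟨y, l⟩
    · have : tl x (Finsupp.single ([] : List τ) a) = 0 := by
        ext l; simp [tl_apply]
      rw [bd_single_nil, tls_nil, this]; simp
    · rw [← cn_single, bd_cn, cn_single, tls_cons, map_sub, ← cn_single]
      by_cases h : y = x
      · subst h; rw [tl_cn_self, tl_cn_self]
      · rw [tl_cn_of_ne h, tl_cn_of_ne h, map_zero]

lemma tls_apply (c : Ch τ) (l : List τ) : tls c l = ∑ᶠ x, c (x :: l) := by
  induction c using Finsupp.induction_linear with
  | zero => simp
  | add f g hf hg =>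
    have hfin : ∀ f : Ch τ, (Function.support fun x => f (x :: l)).Finite := fun f =>
      (f.hasFiniteSupport.preimage (f := fun x => x :: l)
        (fun a _ b _ h => (List.cons.inj h).1)).subset fun x hx => hx
    rw [map_add, Finsupp.add_apply, hf, hg, ← finsum_add_distrib (hfin f) (hfin g)]
    rfl
  | single l' a =>
    rcases l' with _ | ⟨y, l'⟩
    · simp
    · rw [tls_cons]
      by_cases h : l' = l
      · subst h
        rw [finsum_eq_single _ y fun x hx => by simp [Ne.symm hx]]
        simp
      · rw [Finsupp.single_eq_of_ne' h, finsum_eq_zero_of_forall_eq_zero fun x => by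
          rw [Finsupp.single_eq_of_ne']; simp [h]]

/-- Chains on flags of top possible rank whose boundary drops rank. -/
noncomputable def Dk (r : τ → τ → Prop) (rk : τ → ℕ) (X : Set τ) (k : ℕ) : Submodule ℚ (Ch τ) :=
  fl r {x ∈ X | rk x ≤ k} k ⊓ (fl r {x ∈ X | rk x < k} (k - 1)).comap bd

variable {rk : τ → ℕ}

lemma Dk_mono (h : X ⊆ Y) : Dk r rk X k ≤ Dk r rk Y k :=
  inf_le_inf (fl_mono fun _ hx => ⟨h hx.1, hx.2⟩)
    (Submodule.comap_mono (fl_mono fun _ hx => ⟨h hx.1, hx.2⟩))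

lemma nil_mem_Dk : Finsupp.single [] 1 ∈ Dk r rk X 0 := by
  refine ⟨single_mem_fl (flS_zero.2 rfl) 1, ?_⟩
  rw [SetLike.mem_coe, Submodule.mem_comap, bd_single_nil]
  exact zero_mem _

lemma Dk_fl {c : Ch τ} (h : c ∈ Dk r rk X k) : c ∈ fl r X k := fl_mono (fun _ hx => hx.1) h.1

/-- Filling a cycle with controlled ranks. -/
lemma Dk_dex {N : ℕ} (hlt : ∀ a ∈ Y, ∀ b ∈ Y, r a b → rk b < rk a) (hN : ∀ a ∈ Y, rk a ≤ N)
    (hlk : ∀ a ∈ Y, ∀ k, k + 1 ≠ rk a → Ex r {x ∈ Y | r a x} k) (hex : ∀ k, Ex r Y k) :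
    Dex (Dk r rk Y) := by
  intro k z hz hbz
  obtain ⟨w, hw, hwz⟩ := hex k z (Dk_fl hz) hbz
  have key : ∀ m j, k + 1 ≤ j → N ≤ j + m → ∃ w ∈ fl r {x ∈ Y | rk x ≤ j} (k + 1), bd w = z := by
    intro m
    induction m with
    | zero =>
      intro j _ hj
      exact ⟨w, fl_mono_of hw fun x hx => ⟨hx, (hN x hx).trans hj⟩, hwz⟩
    | succ m ih =>
      intro j hkj hj
      obtain ⟨w, hw, hwz⟩ := ih (j + 1) (by omega) (by omega)
      have hu : ({x ∈ Y | rk x ≤ j + 1} : Set τ) = {x ∈ Y | rk x ≤ j} ∪ {x ∈ Y | rk x = j + 1} := by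
        ext x
        simp only [Set.mem_ofPred_eq, Set.mem_union]
        constructor
        · rintro ⟨h1, h2⟩
          rcases Nat.lt_or_ge j (rk x) with h | h
          · exact Or.inr ⟨h1, by omega⟩
          · exact Or.inl ⟨h1, h⟩
        · rintro (⟨h1, h2⟩ | ⟨h1, h2⟩) <;> exact ⟨h1, by omega⟩
      rw [hu] at hw
      have hA : ∀ a ∈ ({x ∈ Y | rk x = j + 1} : Set τ), ∀ y ∈ ({x ∈ Y | rk x ≤ j} : Set τ) ∪
          {x ∈ Y | rk x = j + 1}, ¬ r y a := by
        intro a ha y hy hr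
        rw [← hu] at hy
        have := hlt y hy.1 a ha.1 hr
        have := ha.2
        have := hy.2
        omega
      have hL : ∀ a ∈ ({x ∈ Y | rk x = j + 1} : Set τ),
          Ex r {x ∈ ({x ∈ Y | rk x ≤ j} : Set τ) | r a x} k := by
        intro a ha
        have hs : ({x ∈ ({x ∈ Y | rk x ≤ j} : Set τ) | r a x} : Set τ) = {x ∈ Y | r a x} := by
          ext x
          refine ⟨fun h => ⟨h.1.1, h.2⟩, fun h => ⟨⟨h.1, ?_⟩, h.2⟩⟩
          have := hlt a ha.1 x h.1 h.2
          have := ha.2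
          show rk x ≤ j
          omega
        rw [hs]
        exact hlk a ha.1 k (by rw [ha.2]; omega)
      obtain ⟨e, he, hwe⟩ := push_off hA hL hw
        (by rw [hwz]; exact fl_mono_of hz.1 fun x hx => ⟨hx.1, hx.2.trans (by omega)⟩)
      exact ⟨w - bd e, hwe, by rw [map_sub, bd_bd, sub_zero, hwz]⟩
  obtain ⟨w, hw, hwz⟩ := key N (k + 1) le_rfl (by omega)
  refine ⟨w, ⟨hw, ?_⟩, hwz⟩
  rw [SetLike.mem_coe, Submodule.mem_comap, hwz]
  exact fl_mono_of hz.1 fun x hx => ⟨hx.1, Nat.lt_succ_of_le hx.2⟩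

/-- Strictly decreasing ranks bound the length of a flag. -/
lemma length_le_rk {a m : ℕ} (hlt : ∀ a ∈ Y, ∀ b ∈ Y, r a b → rk b < rk a)
    (hY : ∀ x ∈ Y, a ≤ rk x ∧ rk x < a + m) {l : List τ} (hl : l.Pairwise r)
    (hlX : ∀ x ∈ l, x ∈ Y) : l.length ≤ m := by
  rw [← List.length_reverse]
  refine length_le_of_rank (r := flip r) rk (fun x hx y hy h => hlt y hy x hx h) hY
    (List.pairwise_reverse.2 hl) (by simpa using hlX)

/-- Elements in `Dk` are sums of cones over cycles. -/
lemma Dk_tl {c : Ch τ} (hpos : ∀ x ∈ X, 1 ≤ rk x)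
    (hlt : ∀ a ∈ X, ∀ b ∈ X, r a b → rk b < rk a) (hc : c ∈ Dk r rk X (k + 1)) (x : τ) :
    bd (tl x c) = 0 ∧ (tl x c ≠ 0 → x ∈ X ∧ rk x = k + 1) ∧
      tl x c ∈ fl r {y ∈ X | r x y} k := by
  have hrk : tl x c ≠ 0 → x ∈ X ∧ rk x = k + 1 := by
    intro h
    obtain ⟨l, hl⟩ := Finsupp.ne_iff.1 h
    have hl' := mem_fl.1 hc.1 (x :: l) (by simpa using hl)
    have h2 := flS_cons.1 hl'
    refine ⟨h2.1.1, le_antisymm h2.1.2 ?_⟩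
    have h3 := length_le_rk (Y := {y ∈ X | rk y ≤ rk x}) (r := r) (rk := rk) (a := 1) (m := rk x)
      (fun a ha b hb => hlt a ha.1 b hb.1) (fun y hy => ⟨hpos y hy.1, by have := hy.2; omega⟩)
      hl'.1 (fun y hy => ?_)
    · have := hl'.2.2
      omega
    · rcases List.mem_cons.1 hy with rfl | hy
      · exact ⟨h2.1.1, le_rfl⟩
      · have h4 := h2.2.2.1 y hy
        exact ⟨h4.1.1, (hlt x h2.1.1 y h4.1.1 h4.2).le⟩
  refine ⟨?_, hrk, tl_mem x (Dk_fl hc)⟩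
  by_cases h : tl x c = 0
  · rw [h, map_zero]
  obtain ⟨hxX, hx⟩ := hrk h
  have h1 : tl x (bd c) = 0 := by
    ext l
    by_contra h0
    have := (mem_fl.1 hc.2 (x :: l) h0).2.1 x (List.mem_cons_self ..)
    have := this.2
    omega
  have h2 : tl x (tls c) = 0 := by
    ext l
    rw [tl_apply, tls_apply]
    refine finsum_eq_zero_of_forall_eq_zero fun y => ?_
    by_contra h0
    have h3 := flS_cons.1 (mem_fl.1 hc.1 _ h0)
    have h4 := h3.2.2.1 x (List.mem_cons_self ..)
    have := hlt y h3.1.1 x h4.1.1 h4.2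
    have := h3.1.2
    omega
  have := tl_bd x c
  rw [h1, h2, zero_sub] at this
  exact neg_eq_zero.1 this.symm

end Dcomplex
end LS

namespace LS
section Cond
variable {τ : Type*} {r : τ → τ → Prop} {X Y : Set τ} {k : ℕ}

/-- A chain whose insertion sums all vanish is a cycle. -/
lemma bd_eq_zero_of_sums : ∀ (k : ℕ) (X : Set τ) (c : Ch τ), c ∈ fl r X k →
    (∀ l1 l2 : List τ, l1.length + l2.length + 1 = k → ∑ᶠ x, c (l1 ++ x :: l2) = 0) → bd c = 0 := by
  intro k
  induction k with
  | zero => exact fun X c hc _ => bd_fl_zero hc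
  | succ k ih =>
    intro X c hc h
    have h1 : tls c = 0 := by
      ext l
      rw [tls_apply]
      by_cases hl : l.length = k
      · exact h [] l (by simp [hl])
      · refine finsum_eq_zero_of_forall_eq_zero fun x => ?_
        by_contra h0
        have := (mem_fl.1 hc _ h0).2.2
        simp at this
        exact hl this
    have h2 : ∀ x, tl x (bd c) = 0 := by
      intro x
      rw [tl_bd, h1, map_zero, zero_sub, neg_eq_zero]
      refine ih _ _ (tl_mem x hc) fun l1 l2 hl => ?_
      have := h (x :: l1) l2 (by simp; omega)
      simpa using this
    ext l
    rcases l with _ | ⟨x, l⟩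
    · rcases k with _ | k
      · have h3 : (tls c) [] = 0 := by rw [h1]; rfl
        have h4 : ∀ (c : Ch τ), c ∈ fl r X 1 → bd c = tls c := by
          intro c hc
          refine map_eq_of_single (fun l hl => ?_) hc
          obtain ⟨x, rfl⟩ := List.length_eq_one_iff.1 hl.2.2
          rw [tls_cons, ← cn_single, bd_cn, bd_single_nil, map_zero, sub_zero]
        rw [h4 c hc, h3]; rfl
      · by_contra h0
        have := (mem_fl.1 (bd_mem hc) _ h0).2.2
        simp at this
    · rw [← tl_apply, h2 x]; rfl

/-- A zero-sphere has exactly two points. -/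
lemma Sph.two (h : Sph r X 1) : ∃ x ∈ X, ∃ y ∈ X, x ≠ y ∧ ∀ z ∈ X, z = x ∨ z = y := by
  have hs : ∀ x ∈ X, [x] ∈ flS r X 1 := fun x hx => ⟨by simp, by simpa using hx, rfl⟩
  have hd : ∀ x ∈ X, ∀ y ∈ X, bd (Finsupp.single [x] 1 - Finsupp.single [y] (1 : ℚ)) = 0 := by
    intro x _ y _
    rw [map_sub, ← cn_single, ← cn_single, bd_cn, bd_cn, bd_single_nil]; simp
  obtain ⟨z0, hz0, hb, hne, hz⟩ := h.cyc
  have hx : ∃ x ∈ X, z0 [x] ≠ 0 := by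
    obtain ⟨l, hl⟩ := Finsupp.ne_iff.1 hne
    have hl' := mem_fl.1 hz0 l (by simpa using hl)
    obtain ⟨x, rfl⟩ := List.length_eq_one_iff.1 hl'.2.2
    exact ⟨x, hl'.2.1 x (by simp), by simpa using hl⟩
  obtain ⟨x, hxX, hx⟩ := hx
  have hy : ∃ y ∈ X, x ≠ y := by
    by_contra! hc
    have h1 : z0 = Finsupp.single [x] (z0 [x]) := by
      ext l
      by_cases hl : l = [x]
      · subst hl; simp
      · rw [Finsupp.single_eq_of_ne hl]
        by_contra h0
        have hl' := mem_fl.1 hz0 l h0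
        obtain ⟨y, rfl⟩ := List.length_eq_one_iff.1 hl'.2.2
        exact hl (by rw [hc y (hl'.2.1 y (by simp))])
    rw [h1, ← cn_single, bd_cn, bd_single_nil, map_zero, sub_zero] at hb
    exact hx (by simpa using hb)
  obtain ⟨y, hyX, hxy⟩ := hy
  refine ⟨x, hxX, y, hyX, hxy, fun z hzX => ?_⟩
  by_contra! hc
  obtain ⟨c, hc1⟩ := hz _ (sub_mem (single_mem_fl (hs x hxX) 1) (single_mem_fl (hs y hyX) 1))
    (hd x hxX y hyX)
  obtain ⟨d, hd1⟩ := hz _ (sub_mem (single_mem_fl (hs x hxX) 1) (single_mem_fl (hs z hzX) 1))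
    (hd x hxX z hzX)
  have e1 := DFunLike.congr_fun hc1 [z]
  have e2 := DFunLike.congr_fun hd1 [z]
  have e3 := DFunLike.congr_fun hc1 [x]
  simp [hc.1, hc.2, hxy] at e1 e2 e3
  rcases e1 with e1 | e1
  · rw [e1] at e3; simp at e3
  · rw [e1] at e2; simp at e2

end Cond

section Geometry
/-- The geometric properties of a poset of minimal-vector sets used for duality. -/
structure Geo {K M E ι : Type*} [Field K] [AddCommGroup M] [Module K M] [AddCommGroup E]
    [Module ℝ E] (emb : ι → M) (L : ι → E →ₗ[ℝ] ℝ) (P : Set (Set ι)) (rk : Set ι → ℕ)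
    (N : ℕ) (wr : Set ι → Prop) : Prop where
  fin : ∀ S ∈ P, S.Finite
  ne : ∀ S ∈ P, S.Nonempty
  rk_pos : ∀ S ∈ P, 1 ≤ rk S
  rk_le : ∀ S ∈ P, rk S ≤ N
  rk_lt : ∀ S ∈ P, ∀ T ∈ P, S < T → rk S < rk T
  wr_iff : ∀ S, wr S ↔ Submodule.span K (emb '' S) = ⊤
  span_le : ∀ S ∈ P, Module.finrank K (Submodule.span K (emb '' S)) ≤ rk S
  face0 : ∀ T ∈ P, ∃ h, ∀ v ∈ T, 0 < L v h
  face : ∀ S ∈ P, ∀ T ∈ P, S < T → ∃ h, (∀ v ∈ S, L v h = 0) ∧ ∀ v ∈ T, v ∉ S → 0 < L v h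
  below : ∀ T ∈ P, Sph (· < ·) {S ∈ P | S < T} (rk T - 1)
  between : ∀ S ∈ P, ∀ T ∈ P, S < T → Sph (· < ·) {R ∈ P | S < R ∧ R < T} (rk T - rk S - 1)
  above : ∀ S ∈ P, wr S → Sph (· < ·) {T ∈ P | S < T} (N - rk S)
  above_fin : ∀ S ∈ P, wr S → {T ∈ P | S < T}.Finite
  top : ∀ S ∈ P, wr S → rk S + 1 = N → ∃ h, (∀ v ∈ S, L v h = 0) ∧
    (∃ T ∈ P, S < T ∧ ∀ v ∈ T, v ∉ S → L v h < 0) ∧ (∃ T ∈ P, S < T ∧ ∀ v ∈ T, v ∉ S → 0 < L v h)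
  exU : ∀ U : Submodule K M, U ≠ ⊥ → ∀ k, Ex (· < ·) {S ∈ P | emb '' S ⊆ U} k

end Geometry
end LS

namespace LS
section Lists
variable {τ : Type*} {r : τ → τ → Prop} {X Y : Set τ} {k : ℕ}

lemma flS_insert {l1 l2 : List τ} {x : τ} : l1 ++ x :: l2 ∈ flS r X (k + 1) ↔
    l1 ++ l2 ∈ flS r X k ∧ x ∈ X ∧ (∀ y ∈ l1, r y x) ∧ ∀ y ∈ l2, r x y := by
  simp only [flS, Set.mem_ofPred_eq, List.pairwise_append, List.pairwise_cons, List.mem_append,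
    List.mem_cons, List.length_append, List.length_cons]
  constructor
  · rintro ⟨⟨h1, ⟨h2, h3⟩, h4⟩, h5, h6⟩
    exact ⟨⟨⟨h1, h3, fun a ha b hb => h4 a ha b (Or.inr hb)⟩,
      fun y hy => h5 y (hy.imp id Or.inr), by omega⟩, h5 x (Or.inr (Or.inl rfl)),
      fun y hy => h4 y hy x (Or.inl rfl), h2⟩
  · rintro ⟨⟨⟨h1, h3, h4⟩, h5, h6⟩, hx, h7, h8⟩
    refine ⟨⟨h1, ⟨h8, h3⟩, fun a ha b hb => ?_⟩, fun y hy => ?_, by omega⟩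
    · rcases hb with rfl | hb
      · exact h7 a ha
      · exact h4 a ha b hb
    · rcases hy with hy | rfl | hy
      · exact h5 y (Or.inl hy)
      · exact hx
      · exact h5 y (Or.inr hy)

variable {rk : τ → ℕ}

/-- Lower and upper bounds for the rank of an entry of a flag. -/
lemma rk_bounds {a N : ℕ} (hlt : ∀ a ∈ Y, ∀ b ∈ Y, r a b → rk b < rk a)
    (hY : ∀ x ∈ Y, a ≤ rk x ∧ rk x ≤ N) {l1 l2 : List τ} {x : τ}
    (hl : l1 ++ x :: l2 ∈ flS r Y k) : a + l2.length ≤ rk x ∧ rk x + l1.length ≤ N := by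
  obtain ⟨h1, h2, -⟩ := hl
  rw [List.pairwise_append, List.pairwise_cons] at h1
  have hx : x ∈ Y := h2 x (by simp)
  have hxx := hY x hx
  constructor
  · have := length_le_rk (r := r) (rk := rk) (Y := {y ∈ Y | rk y < rk x}) (a := a) (m := rk x - a)
      (l := l2) (fun a ha b hb => hlt a ha.1 b hb.1)
      (fun y hy => ⟨(hY y hy.1).1, by have := hy.2; omega⟩) h1.2.1.2
      (fun y hy => ⟨h2 y (by simp [hy]), hlt x hx y (h2 y (by simp [hy])) (h1.2.1.1 y hy)⟩)
    omega
  · have := length_le_rk (r := r) (rk := rk) (Y := {y ∈ Y | rk x < rk y}) (a := rk x + 1)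
      (m := N - rk x) (l := l1) (fun a ha b hb => hlt a ha.1 b hb.1)
      (fun y hy => ⟨hy.2, by have := (hY y hy.1).2; omega⟩) h1.1
      (fun y hy => ⟨h2 y (by simp [hy]), hlt y (h2 y (by simp [hy])) x hx
        (h1.2.2 y hy x (by simp))⟩)
    omega

lemma rk_full {a N : ℕ} (hlt : ∀ a ∈ Y, ∀ b ∈ Y, r a b → rk b < rk a)
    (hY : ∀ x ∈ Y, a ≤ rk x ∧ rk x ≤ N) {l1 l2 : List τ} {x : τ}
    (hl : l1 ++ x :: l2 ∈ flS r Y k) (hk : N + 1 ≤ a + k) :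
    rk x = a + l2.length ∧ rk x + l1.length = N := by
  have := rk_bounds hlt hY hl
  have h3 := hl.2.2
  simp only [List.length_append, List.length_cons] at h3
  omega

end Lists

section Sign
variable {K M E ι : Type*} [Field K] [AddCommGroup M] [Module K M] [AddCommGroup E]
    [Module ℝ E] {emb : ι → M} {L : ι → E →ₗ[ℝ] ℝ} {P : Set (Set ι)} {rk : Set ι → ℕ}
    {N : ℕ} {wr : Set ι → Prop}

/-- The sign of a real number as a rational. -/
noncomputable def sg (x : ℝ) : ℚ := ((SignType.sign x : SignType) : ℚ)

lemma sg_mul (x y : ℝ) : sg (x * y) = sg x * sg y := by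
  simp [sg, sign_mul]

lemma sg_pos {x : ℝ} (h : 0 < x) : sg x = 1 := by simp [sg, h]

lemma sg_neg {x : ℝ} (h : x < 0) : sg x = -1 := by simp [sg, h]

/-- The determinant of evaluations against a basis. -/
noncomputable def dd (L : ι → E →ₗ[ℝ] ℝ) (b : Module.Basis (Fin N) ℝ E) (w : Fin N → ι) : ℝ :=
  (Matrix.of fun i k => L (w i) (b k)).det

lemma dd_mul (b : Module.Basis (Fin N) ℝ E) (w : Fin N → ι) (h : Fin N → E) :
    dd L b w * b.det h = (Matrix.of fun i j => L (w i) (h j)).det := by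
  rw [dd, Module.Basis.det_apply, ← Matrix.det_mul]
  congr 1
  ext i j
  rw [Matrix.mul_apply, Matrix.of_apply]
  conv_rhs => rw [← b.sum_repr (h j), map_sum]
  exact Finset.sum_congr rfl fun k _ => by
    simp [Module.Basis.toMatrix_apply, mul_comm]

lemma dd_tri (b : Module.Basis (Fin N) ℝ E) {w : Fin N → ι} {h : Fin N → E}
    (h0 : ∀ i j, j < i → L (w i) (h j) = 0) : dd L b w * b.det h = ∏ i, L (w i) (h i) := by
  rw [dd_mul]
  exact Matrix.det_of_isUpperTriangular (M := Matrix.of fun i j => L (w i) (h j))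
    fun i j hij => h0 i j hij

/-- Entry functions of a list. -/
def ff (N : ℕ) (l : List (Set ι)) (i : Fin N) : Set ι := l.getD i ∅

/-- A choice of new vectors along a flag. -/
def IsPick (f : Fin N → Set ι) (w : Fin N → ι) : Prop := ∀ i, w i ∈ f i ∧ ∀ j, i < j → w i ∉ f j

lemma ff_mem {l : List (Set ι)} (hl : l ∈ flS (· > ·) P N) (i : Fin N) : ff N l i ∈ P := by
  have hi : (i : ℕ) < l.length := by rw [hl.2.2]; exact i.2
  rw [ff, List.getD_eq_getElem _ _ hi]
  exact hl.2.1 _ (List.getElem_mem hi)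

lemma ff_lt {l : List (Set ι)} (hl : l ∈ flS (· > ·) P N) {i j : Fin N} (hij : i < j) :
    ff N l j < ff N l i := by
  have hi : (i : ℕ) < l.length := by rw [hl.2.2]; exact i.2
  have hj : (j : ℕ) < l.length := by rw [hl.2.2]; exact j.2
  rw [ff, ff, List.getD_eq_getElem _ _ hi, List.getD_eq_getElem _ _ hj]
  exact List.pairwise_iff_getElem.1 hl.1 _ _ hi hj hij

lemma ff_le {l : List (Set ι)} (hl : l ∈ flS (· > ·) P N) {i j : Fin N} (hij : i ≤ j) :
    ff N l j ≤ ff N l i := by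
  rcases hij.eq_or_lt with rfl | h
  · exact le_rfl
  · exact (ff_lt hl h).le

variable (geo : Geo (K := K) emb L P rk N wr)
include geo

lemma exists_pick {l : List (Set ι)} (hl : l ∈ flS (· > ·) P N) : ∃ w, IsPick (ff N l) w := by
  have : ∀ i : Fin N, ∃ w ∈ ff N l i, ∀ j, i < j → w ∉ ff N l j := by
    intro i
    by_cases hi : (i : ℕ) + 1 < N
    · obtain ⟨w, hw, hw'⟩ := Set.exists_of_ssubset
        (ff_lt hl (i := i) (j := ⟨i + 1, hi⟩) (by simp [Fin.lt_def]))
      exact ⟨w, hw, fun j hj hwj => hw' (ff_le hl (Fin.le_def.2 (Nat.succ_le_of_lt hj)) hwj)⟩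
    · obtain ⟨w, hw⟩ := geo.ne _ (ff_mem hl i)
      exact ⟨w, hw, fun j hj => absurd j.2 (by have := Fin.lt_def.1 hj; omega)⟩
  choose w h1 h2 using this
  exact ⟨w, fun i => ⟨h1 i, h2 i⟩⟩

lemma exists_adapt {l : List (Set ι)} (hl : l ∈ flS (· > ·) P N) : ∃ h : Fin N → E,
    ∀ i, (∀ j, i < j → ∀ v ∈ ff N l j, L v (h i) = 0) ∧
      ∀ v ∈ ff N l i, (∀ j, i < j → v ∉ ff N l j) → 0 < L v (h i) := by
  have : ∀ i : Fin N, ∃ h : E, (∀ j, i < j → ∀ v ∈ ff N l j, L v h = 0) ∧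
      ∀ v ∈ ff N l i, (∀ j, i < j → v ∉ ff N l j) → 0 < L v h := by
    intro i
    by_cases hi : (i : ℕ) + 1 < N
    · have hlt : i < ⟨i + 1, hi⟩ := by simp [Fin.lt_def]
      obtain ⟨h, h1, h2⟩ := geo.face _ (ff_mem hl ⟨i + 1, hi⟩) _ (ff_mem hl i) (ff_lt hl hlt)
      exact ⟨h, fun j hj v hv => h1 v (ff_le hl (Fin.le_def.2 (Nat.succ_le_of_lt hj)) hv),
        fun v hv hj => h2 v hv (hj _ hlt)⟩
    · obtain ⟨h, h1⟩ := geo.face0 _ (ff_mem hl i)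
      exact ⟨h, fun j hj => absurd j.2 (by have := Fin.lt_def.1 hj; omega), fun v hv _ => h1 v hv⟩
  choose h hh using this
  exact ⟨h, hh⟩

omit geo in
open Classical in
/-- The orientation sign of a full flag. -/
noncomputable def eps (L : ι → E →ₗ[ℝ] ℝ) (P : Set (Set ι)) (b : Module.Basis (Fin N) ℝ E)
    (l : List (Set ι)) : ℚ :=
  if h : l ∈ flS (· > ·) P N ∧ ∃ w, IsPick (ff N l) w then sg (dd L b h.2.choose) else 0

omit geo in
lemma eps_zero {b : Module.Basis (Fin N) ℝ E} {l : List (Set ι)} (h : l ∉ flS (· > ·) P N) :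
    eps L P b l = 0 := by
  rw [eps, dif_neg fun h' => h h'.1]

lemma eps_eq (b : Module.Basis (Fin N) ℝ E) {l : List (Set ι)} (hl : l ∈ flS (· > ·) P N)
    {w : Fin N → ι} (hw : IsPick (ff N l) w) : eps L P b l = sg (dd L b w) ∧
      eps L P b l * eps L P b l = 1 := by
  obtain ⟨h, hh⟩ := exists_adapt geo hl
  have key : ∀ w, IsPick (ff N l) w → sg (dd L b w) * sg (b.det h) = 1 := by
    intro w hw
    rw [← sg_mul, dd_tri b fun i j hij => (hh j).1 i hij _ (hw i).1]
    exact sg_pos (Finset.prod_pos fun i _ => (hh i).2 _ (hw i).1 (hw i).2)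
  have hex := exists_pick geo hl
  have h1 := key _ hex.choose_spec
  have h2 := key w hw
  have h3 : eps L P b l = sg (dd L b hex.choose) := by rw [eps, dif_pos ⟨hl, hex⟩]
  have hne : sg (b.det h) ≠ 0 := fun h0 => by rw [h0, mul_zero] at h1; exact zero_ne_one h1
  have h4 : sg (dd L b hex.choose) = sg (dd L b w) := mul_right_cancel₀ hne (h1.trans h2.symm)
  refine ⟨h3.trans h4, ?_⟩
  rw [h3]
  have h5 : ∀ x : ℝ, sg x ≠ 0 → sg x * sg x = 1 := by
    intro x hx
    rcases lt_trichotomy x 0 with h | h | h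
    · rw [sg_neg h]; norm_num
    · exact absurd (by simp [sg, h]) hx
    · rw [sg_pos h]; norm_num
  exact h5 _ fun h0 => by rw [h0, zero_mul] at h1; exact zero_ne_one h1

omit geo in
lemma ff_insert {l1 l2 : List (Set ι)} {S T : Set ι} {i : Fin N} (hi : (i : ℕ) ≠ l1.length) :
    ff N (l1 ++ S :: l2) i = ff N (l1 ++ T :: l2) i := by
  simp only [ff, List.getD_eq_getElem?_getD]
  congr 1
  rcases lt_or_gt_of_ne hi with h | h
  · rw [List.getElem?_append_left h, List.getElem?_append_left h]
  · rw [List.getElem?_append_right h.le, List.getElem?_append_right h.le]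
    obtain ⟨m, hm⟩ := Nat.exists_eq_add_of_lt h
    have : (i : ℕ) - l1.length = m + 1 := by omega
    rw [this, List.getElem?_cons_succ, List.getElem?_cons_succ]

omit geo in
lemma ff_at {l1 l2 : List (Set ι)} {S : Set ι} {i : Fin N} (hi : (i : ℕ) = l1.length) :
    ff N (l1 ++ S :: l2) i = S := by
  simp [ff, hi]

lemma eps_mid (b : Module.Basis (Fin N) ℝ E) {l1 l2 : List (Set ι)} {S1 S2 : Set ι}
    (h1 : l1 ++ S1 :: l2 ∈ flS (· > ·) P N) (h2 : l1 ++ S2 :: l2 ∈ flS (· > ·) P N)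
    (hne : S1 ≠ S2) (hl : l1 ≠ []) : eps L P b (l1 ++ S1 :: l2) + eps L P b (l1 ++ S2 :: l2) = 0 := by
  have hlen := h1.2.2
  simp only [List.length_append, List.length_cons] at hlen
  have hpos := List.length_pos_iff.2 hl
  set p : Fin N := ⟨l1.length, by omega⟩ with hp
  set q : Fin N := ⟨l1.length - 1, by omega⟩ with hq
  have hqp : q < p := by simp only [hp, hq, Fin.lt_def]; omega
  have hlt : ∀ a ∈ P, ∀ b ∈ P, a > b → rk b < rk a := fun a ha b hb h => geo.rk_lt b hb a ha h
  have hrk1 := (rk_full hlt (fun x hx => ⟨geo.rk_pos x hx, geo.rk_le x hx⟩) h1 (by omega)).1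
  have hrk2 := (rk_full hlt (fun x hx => ⟨geo.rk_pos x hx, geo.rk_le x hx⟩) h2 (by omega)).1
  have hS1 : S1 ∈ P := h1.2.1 _ (by simp)
  have hS2 : S2 ∈ P := h2.2.1 _ (by simp)
  have hn : ∀ A ∈ P, ∀ B ∈ P, A ≠ B → rk A = rk B → ∃ w ∈ A, w ∉ B := by
    intro A hA B hB hne hr
    by_contra! hc
    have := geo.rk_lt A hA B hB (lt_of_le_of_ne hc hne)
    omega
  obtain ⟨w1, hw1, hw1'⟩ := hn S1 hS1 S2 hS2 hne (by omega)
  obtain ⟨w2, hw2, hw2'⟩ := hn S2 hS2 S1 hS1 hne.symm (by omega)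
  obtain ⟨u, hu⟩ := exists_pick geo h1
  set f1 := ff N (l1 ++ S1 :: l2) with hf1
  set f2 := ff N (l1 ++ S2 :: l2) with hf2
  have hoff : ∀ i, i ≠ p → f1 i = f2 i := fun i hi => ff_insert fun h => hi (Fin.ext h)
  have e1 : f1 p = S1 := ff_at rfl
  have e2 : f2 p = S2 := ff_at rfl
  set w := Function.update (Function.update u p w1) q w2 with hw
  have wq : w q = w2 := by simp [hw]
  have wp : w p = w1 := by simp [hw, hqp.ne']
  have wo : ∀ i, i ≠ p → i ≠ q → w i = u i := fun i h h' => by simp [hw, h, h']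
  have hlast : ∀ i, q < i → i ≠ p → p < i := fun i h h' => by
    simp only [hp, hq, Fin.lt_def, ne_eq, Fin.ext_iff] at *; omega
  have hfirst : ∀ i, i < p → i ≠ q → i < q := fun i h h' => by
    simp only [hp, hq, Fin.lt_def, ne_eq, Fin.ext_iff] at *; omega
  have P1 : IsPick f1 w := by
    intro i
    by_cases hip : i = p
    · subst hip
      rw [wp, e1]
      refine ⟨hw1, fun j hj hmem => hw1' ?_⟩
      rw [hoff j hj.ne'] at hmem
      rw [← e2]; exact ff_le h2 hj.le hmem
    by_cases hiq : i = q
    · subst hiq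
      rw [wq]
      refine ⟨?_, fun j hj hmem => hw2' ?_⟩
      · rw [hoff _ hip]; apply ff_le h2 hqp.le; rw [← hf2, e2]; exact hw2
      · rw [← e1]
        by_cases hjp : j = p
        · rwa [hjp] at hmem
        · exact ff_le h1 (hlast j hj hjp).le hmem
    rw [wo i hip hiq]; exact hu i
  have P2 : IsPick f2 (w ∘ Equiv.swap p q) := by
    intro i
    by_cases hip : i = p
    · subst hip
      rw [Function.comp, Equiv.swap_apply_left, wq, e2]
      refine ⟨hw2, fun j hj hmem => hw2' ?_⟩
      rw [← hoff j hj.ne'] at hmem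
      rw [← e1]; exact ff_le h1 hj.le hmem
    by_cases hiq : i = q
    · subst hiq
      rw [Function.comp, Equiv.swap_apply_right, wp]
      refine ⟨?_, fun j hj hmem => hw1' ?_⟩
      · rw [← hoff _ hip]; apply ff_le h1 hqp.le; rw [← hf1, e1]; exact hw1
      · rw [← e2]
        by_cases hjp : j = p
        · rwa [hjp] at hmem
        · exact ff_le h2 (hlast j hj hjp).le hmem
    rw [Function.comp, Equiv.swap_apply_of_ne_of_ne hip hiq, wo i hip hiq, ← hoff i hip]
    refine ⟨(hu i).1, fun j hj hmem => ?_⟩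
    by_cases hjp : j = p
    · rw [hjp] at hmem hj
      have hiq' := hfirst i hj hiq
      refine (hu i).2 q hiq' ?_
      rw [hoff q hqp.ne]; exact ff_le h2 hqp.le hmem
    · rw [← hoff j hjp] at hmem
      exact (hu i).2 j hj hmem
  rw [(eps_eq geo b h1 P1).1, (eps_eq geo b h2 P2).1]
  have : dd L b (w ∘ Equiv.swap p q) = -1 * dd L b w := by
    have := Matrix.det_permute (Equiv.swap p q) (Matrix.of fun i k => L (w i) (b k))
    rw [Equiv.Perm.sign_swap hqp.ne'] at this
    have h3 : dd L b (w ∘ Equiv.swap p q) =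
      ((Matrix.of fun i k => L (w i) (b k)).submatrix (Equiv.swap p q) id).det := rfl
    rw [h3, this]; simp [dd]
  rw [this, sg_mul, sg_neg (by norm_num : (-1 : ℝ) < 0)]
  ring

end Sign
end LS

namespace LS
section Duality
variable {K M E ι : Type*} [Field K] [AddCommGroup M] [Module K M] [AddCommGroup E]
    [Module ℝ E] {emb : ι → M} {L : ι → E →ₗ[ℝ] ℝ} {P : Set (Set ι)} {rk : Set ι → ℕ}
    {N : ℕ} {wr : Set ι → Prop} (geo : Geo (K := K) emb L P rk N wr)
    (b : Module.Basis (Fin N) ℝ E)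
include geo

lemma eps_top_aux {l : List (Set ι)} {S S1 S2 : Set ι}
    (h1 : S1 :: S :: l ∈ flS (· > ·) P N) (h2 : S2 :: S :: l ∈ flS (· > ·) P N) {h : E}
    (h0 : ∀ v ∈ S, L v h = 0) (hm : ∀ v ∈ S1, v ∉ S → L v h < 0)
    (hp : ∀ v ∈ S2, v ∉ S → 0 < L v h) :
    eps L P b (S1 :: S :: l) + eps L P b (S2 :: S :: l) = 0 := by
  have hN : 1 < N := by have := h1.2.2; simp only [List.length_cons] at this; omega
  have : NeZero N := ⟨by omega⟩
  obtain ⟨u, hu⟩ := exists_pick geo h1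
  obtain ⟨t, ht⟩ := exists_pick geo h2
  obtain ⟨k, hk⟩ := exists_adapt geo h1
  set f1 := ff N (S1 :: S :: l) with hf1
  set f2 := ff N (S2 :: S :: l) with hf2
  have z1 : f1 0 = S1 := by simp [hf1, ff]
  have z2 : f2 0 = S2 := by simp [hf2, ff]
  have o1 : f1 ⟨1, hN⟩ = S := by simp [hf1, ff]
  have o2 : f2 ⟨1, hN⟩ = S := by simp [hf2, ff]
  have hoff : ∀ i, i ≠ 0 → f1 i = f2 i := fun i hi =>
    ff_insert (l1 := []) (l2 := S :: l) fun h => hi (Fin.ext (by simpa using h))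
  have h01 : (0 : Fin N) < ⟨1, hN⟩ := by simp [Fin.lt_def]
  have hpos : ∀ i : Fin N, i ≠ 0 → 0 < i := fun i hi => Fin.pos_iff_ne_zero.2 hi
  have hle : ∀ i : Fin N, i ≠ 0 → f1 i ⊆ S := fun i hi => by
    rw [← o1]
    exact ff_le h1 (Fin.le_def.2 (Nat.succ_le_of_lt (Fin.lt_def.1 (hpos i hi))))
  set w := Function.update u 0 (t 0) with hw
  have w0 : w 0 = t 0 := by simp [hw]
  have wo : ∀ i, i ≠ 0 → w i = u i := fun i hi => by simp [hw, hi]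
  have hwp : IsPick f2 w := by
    intro i
    by_cases hi : i = 0
    · subst hi; rw [w0]; exact ht 0
    · rw [wo i hi, ← hoff i hi]
      exact ⟨(hu i).1, fun j hj => by
        rw [← hoff j ((hpos i hi).trans hj).ne']; exact (hu i).2 j hj⟩
  set k' := Function.update k 0 h with hk'
  have k0 : k' 0 = h := by simp [hk']
  have ko : ∀ i, i ≠ 0 → k' i = k i := fun i hi => by simp [hk', hi]
  have tri : ∀ x : Fin N → ι, (∀ i, i ≠ 0 → x i = u i) → ∀ i j, j < i → L (x i) (k' j) = 0 := by
    intro x hx i j hij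
    have hi : i ≠ 0 := fun h => by rw [h] at hij; exact absurd hij (by simp)
    rw [hx i hi]
    by_cases hj : j = 0
    · rw [hj, k0]; exact h0 _ (hle i hi (hu i).1)
    · rw [ko j hj]; exact (hk j).1 i hij _ (hu i).1
  have hprod : ∀ x : Fin N → ι, (∀ i, i ≠ 0 → x i = u i) →
      sg (dd L b x) * sg (b.det k') = sg (L (x 0) h) := by
    intro x hx
    rw [← sg_mul, dd_tri b (tri x hx), ← Finset.mul_prod_erase _ _ (Finset.mem_univ (0 : Fin N)),
      sg_mul, k0, sg_pos (x := ∏ i ∈ _, _), mul_one]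
    refine Finset.prod_pos fun i hi => ?_
    have hi := (Finset.mem_erase.1 hi).1
    rw [hx i hi, ko i hi]
    exact (hk i).2 _ (hu i).1 (hu i).2
  have e1 := hprod u fun _ _ => rfl
  have e2 := hprod w wo
  rw [sg_neg (hm _ (z1 ▸ (hu 0).1) (o1 ▸ (hu 0).2 _ h01))] at e1
  rw [w0, sg_pos (hp _ (z2 ▸ (ht 0).1) (o2 ▸ (ht 0).2 _ h01))] at e2
  rw [(eps_eq geo b h1 hu).1, (eps_eq geo b h2 hwp).1]
  have hne : sg (b.det k') ≠ 0 := fun h => by rw [h, mul_zero] at e2; exact zero_ne_one e2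
  apply mul_right_cancel₀ hne
  rw [add_mul, e1, e2]; norm_num

lemma geo_lt : ∀ a ∈ P, ∀ b ∈ P, a > b → rk b < rk a := fun a ha b hb h => geo.rk_lt b hb a ha h

lemma geo_bd : ∀ x ∈ P, 1 ≤ rk x ∧ rk x ≤ N := fun x hx => ⟨geo.rk_pos x hx, geo.rk_le x hx⟩

lemma eps_top {l : List (Set ι)} {S S1 S2 : Set ι}
    (h1 : S1 :: S :: l ∈ flS (· > ·) P N) (h2 : S2 :: S :: l ∈ flS (· > ·) P N)
    (hne : S1 ≠ S2) (hS : wr S) :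
    eps L P b (S1 :: S :: l) + eps L P b (S2 :: S :: l) = 0 := by
  have hSP : S ∈ P := h1.2.1 S (by simp)
  have hr := (rk_full (l1 := [S1]) (l2 := l) (geo_lt geo) (geo_bd geo) h1 (by omega)).2
  simp only [List.length_singleton] at hr
  have sph := geo.above S hSP hS
  rw [show N - rk S = 1 by omega] at sph
  obtain ⟨x, hx, y, hy, hxy, hall⟩ := sph.two
  obtain ⟨h, h0, ⟨T1, hT1, hlt1, hm⟩, ⟨T2, hT2, hlt2, hp⟩⟩ := geo.top S hSP hS hr
  have hT : T1 ≠ T2 := by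
    rintro rfl
    obtain ⟨v, hv, hv'⟩ := Set.exists_of_ssubset hlt1
    exact lt_asymm (hm v hv hv') (hp v hv hv')
  have i1 : S < S1 := (List.pairwise_cons.1 h1.1).1 S (by simp)
  have i2 : S < S2 := (List.pairwise_cons.1 h2.1).1 S (by simp)
  have a1 := hall S1 ⟨h1.2.1 S1 (by simp), i1⟩
  have a2 := hall S2 ⟨h2.2.1 S2 (by simp), i2⟩
  have a3 := hall T1 ⟨hT1, hlt1⟩
  have a4 := hall T2 ⟨hT2, hlt2⟩
  have : (S1 = T1 ∧ S2 = T2) ∨ (S1 = T2 ∧ S2 = T1) := by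
    rcases a1 with rfl | rfl <;> rcases a2 with rfl | rfl <;> rcases a3 with rfl | rfl <;>
      rcases a4 with rfl | rfl <;> simp_all
  rcases this with ⟨rfl, rfl⟩ | ⟨rfl, rfl⟩
  · exact eps_top_aux geo b h1 h2 h0 hm hp
  · rw [add_comm]; exact eps_top_aux geo b h2 h1 h0 hm hp

/-- Alternating sum relation for the orientation sign. -/
lemma eps_sum {l1 l2 : List (Set ι)} (hl : (l1 ++ l2).length + 1 = N)
    (htop : l1 = [] → ∀ x, x :: l2 ∈ flS (· > ·) P N → ∃ S l, l2 = S :: l ∧ wr S) :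
    ∑ᶠ x, eps L P b (l1 ++ x :: l2) = 0 := by
  by_cases hin : ∃ x, l1 ++ x :: l2 ∈ flS (· > ·) P N
  swap
  · push Not at hin
    simp [eps_zero (hin _)]
  obtain ⟨x0, hx0⟩ := hin
  obtain ⟨n, rfl⟩ : ∃ n, N = n + 1 := ⟨_, hl.symm⟩
  set I : Set (Set ι) := {x | l1 ++ x :: l2 ∈ flS (· > ·) P (n + 1)} with hI
  have hfl := flS_insert.1 hx0
  have key : Sph (· < ·) I 1 := by
    rcases l1.eq_nil_or_concat with rfl | ⟨l1', B, rfl⟩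
    · obtain ⟨S, l, rfl, hS⟩ := htop rfl x0 hx0
      have hSP : S ∈ P := hfl.1.2.1 S (by simp)
      have hr := (rk_full (l1 := [x0]) (l2 := l) (geo_lt geo) (geo_bd geo) hx0 (by omega)).2
      simp only [List.length_singleton] at hr
      have sph := geo.above S hSP hS
      rw [show n + 1 - rk S = 1 by omega] at sph
      convert sph using 1
      ext x
      rw [hI, Set.mem_ofPred_eq, flS_insert]
      refine ⟨fun h => ⟨h.2.1, h.2.2.2 S (by simp)⟩, fun h => ⟨hfl.1, h.1, by simp, ?_⟩⟩
      intro y hy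
      rcases List.mem_cons.1 hy with rfl | hy
      · exact h.2
      · exact lt_trans ((List.pairwise_cons.1 hfl.1.1).1 y hy) h.2
    have hB : B ∈ P := hfl.1.2.1 B (by simp)
    have hx0' : l1' ++ B :: (x0 :: l2) ∈ flS (· > ·) P (n + 1) := by simpa using hx0
    have hrB := (rk_full (geo_lt geo) (geo_bd geo) hx0' (by omega)).1
    have hl1 : ∀ y ∈ l1', y > B := fun y hy =>
      (List.pairwise_append.1 hx0'.1).2.2 y hy B (by simp)
    rcases l2 with _ | ⟨S, l⟩
    · have sph := geo.below B hB
      simp only [List.length_cons, List.length_nil] at hrB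
      rw [show rk B - 1 = 1 by omega] at sph
      convert sph using 1
      ext x
      rw [hI, Set.mem_ofPred_eq, flS_insert]
      refine ⟨fun h => ⟨h.2.1, h.2.2.1 B (by simp)⟩, fun h => ⟨hfl.1, h.1, ?_, by simp⟩⟩
      intro y hy
      simp only [List.concat_eq_append, List.mem_append, List.mem_singleton] at hy
      rcases hy with hy | rfl
      · exact lt_trans h.2 (hl1 y hy)
      · exact h.2
    · have hS : S ∈ P := hfl.1.2.1 S (by simp)
      have hx0'' : (l1' ++ [B, x0]) ++ S :: l ∈ flS (· > ·) P (n + 1) := by simpa using hx0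
      have hrS := (rk_full (geo_lt geo) (geo_bd geo) hx0'' (by omega)).1
      have sph := geo.between S hS B hB (lt_trans (hfl.2.2.2 S (by simp)) (hfl.2.2.1 B (by simp)))
      simp only [List.length_cons] at hrB
      rw [show rk B - rk S - 1 = 1 by omega] at sph
      convert sph using 1
      ext x
      rw [hI, Set.mem_ofPred_eq, flS_insert]
      refine ⟨fun h => ⟨h.2.1, h.2.2.2 S (by simp), h.2.2.1 B (by simp)⟩,
        fun h => ⟨hfl.1, h.1, ?_, ?_⟩⟩
      · intro y hy
        simp only [List.concat_eq_append, List.mem_append, List.mem_singleton] at hy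
        rcases hy with hy | rfl
        · exact lt_trans h.2.2 (hl1 y hy)
        · exact h.2.2
      · intro y hy
        rcases List.mem_cons.1 hy with rfl | hy
        · exact h.2.1
        · exact lt_trans ((List.pairwise_cons.1
            (List.pairwise_append.1 hx0''.1).2.1).1 y hy) h.2.1
  obtain ⟨x, hx, y, hy, hxy, hall⟩ := key.two
  classical
  rw [finsum_eq_sum_of_support_subset (s := {x, y}) _ (fun z hz => by
    have := hall z (by_contra fun h => hz (eps_zero h))
    simpa using this), Finset.sum_pair hxy]
  by_cases h : l1 = []
  · subst h
    obtain ⟨S, l, rfl, hS⟩ := htop rfl x hx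
    exact eps_top geo b hx hy hxy hS
  · exact eps_mid geo b hx hy hxy h

end Duality
end LS

namespace LS
section Aux
variable {τ : Type*} {r : τ → τ → Prop} {X : Set τ} {k m : ℕ}

lemma Sph.mul (s : Sph r X m) {z y : Ch τ} (hz : z ∈ fl r X m) (hbz : bd z = 0) (hz0 : z ≠ 0)
    (hy : y ∈ fl r X m) (hby : bd y = 0) : ∃ c : ℚ, y = c • z := by
  obtain ⟨z0, -, -, -, h⟩ := s.cyc
  obtain ⟨c, rfl⟩ := h z hz hbz
  obtain ⟨d, rfl⟩ := h y hy hby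
  have hc : c ≠ 0 := by rintro rfl; simp at hz0
  exact ⟨d / c, by rw [smul_smul, div_mul_cancel₀ _ hc]⟩

lemma Sph.exists_flag (s : Sph r X m) : ∃ l, l ∈ flS r X m := by
  obtain ⟨z0, hz, -, h0, -⟩ := s.cyc
  obtain ⟨l, hl⟩ := Finsupp.ne_iff.1 h0
  exact ⟨l, mem_fl.1 hz l hl⟩

lemma flS_finite (hX : X.Finite) (k : ℕ) : (flS r X k).Finite := by
  have := hX.to_subtype
  refine ((List.finite_length_eq X k).image (List.map Subtype.val)).subset fun l hl => ?_
  refine ⟨l.attach.map fun x => ⟨x.1, hl.2.1 x.1 x.2⟩, ?_, ?_⟩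
  · simpa using hl.2.2
  · simp [List.map_map, Function.comp_def]

lemma exists_chain (hX : X.Finite) (e : List τ → ℚ) (he : ∀ l, e l ≠ 0 → l ∈ flS r X k) :
    ∃ z ∈ fl r X k, ∀ l, z l = e l :=
  ⟨Finsupp.ofSupportFinite e ((flS_finite hX k).subset he), mem_fl.2 he, fun _ => rfl⟩

lemma flS_split [IsTrans τ r] {l1 l2 : List τ} {x : τ} : l1 ++ x :: l2 ∈ flS r X k ↔
    x ∈ X ∧ l1 ∈ flS r {y ∈ X | r y x} l1.length ∧ l2 ∈ flS r {y ∈ X | r x y} l2.length ∧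
      l1.length + 1 + l2.length = k := by
  simp only [flS, Set.mem_ofPred_eq, List.pairwise_append, List.pairwise_cons, List.mem_append,
    List.mem_cons, List.length_append, List.length_cons]
  constructor
  · rintro ⟨⟨h1, ⟨h2, h3⟩, h4⟩, h5, h6⟩
    exact ⟨h5 x (Or.inr (Or.inl rfl)),
      ⟨h1, fun y hy => ⟨h5 y (Or.inl hy), h4 y hy x (Or.inl rfl)⟩, trivial⟩,
      ⟨h3, fun y hy => ⟨h5 y (Or.inr (Or.inr hy)), h2 y hy⟩, trivial⟩, by omega⟩
  · rintro ⟨hx, ⟨h1, h2, -⟩, ⟨h3, h4, -⟩, hk⟩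
    refine ⟨⟨h1, ⟨fun y hy => (h4 y hy).2, h3⟩, fun a ha b hb => ?_⟩, fun y hy => ?_, by omega⟩
    · rcases hb with rfl | hb
      · exact (h2 a ha).2
      · exact _root_.trans (h2 a ha).2 (h4 b hb).2
    · rcases hy with hy | rfl | hy
      · exact (h2 y hy).1
      · exact hx
      · exact (h4 y hy).1

end Aux

section Duality
variable {K M E ι : Type*} [Field K] [AddCommGroup M] [Module K M] [AddCommGroup E]
    [Module ℝ E] {emb : ι → M} {L : ι → E →ₗ[ℝ] ℝ} {P : Set (Set ι)} {rk : Set ι → ℕ}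
    {N : ℕ} {wr : Set ι → Prop}

/-- Full flags above. -/
def AboveF (P : Set (Set ι)) (rk : Set ι → ℕ) (N : ℕ) (S : Set ι) : Set (List (Set ι)) :=
  flS (· > ·) {T ∈ P | T > S} (N - rk S)

/-- Full flags below. -/
def BelowF (P : Set (Set ι)) (rk : Set ι → ℕ) (S : Set ι) : Set (List (Set ι)) :=
  flS (· > ·) {T ∈ P | S > T} (rk S - 1)

variable (geo : Geo (K := K) emb L P rk N wr) (b : Module.Basis (Fin N) ℝ E)
include geo

lemma glue {S : Set ι} {R T : List (Set ι)} (hS : S ∈ P) :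
    R ++ S :: T ∈ flS (· > ·) P N ↔ R ∈ AboveF P rk N S ∧ T ∈ BelowF P rk S := by
  have h1 := geo.rk_pos S hS
  have h2 := geo.rk_le S hS
  constructor
  · intro h
    have hr := rk_full (geo_lt geo) (geo_bd geo) h (by omega)
    obtain ⟨-, h3, h4, -⟩ := flS_split.1 h
    rw [AboveF, BelowF, show N - rk S = R.length by omega, show rk S - 1 = T.length by omega]
    exact ⟨h3, h4⟩
  · rintro ⟨h3, h4⟩
    have e3 := h3.2.2
    have e4 := h4.2.2
    exact flS_split.2 ⟨hS, ⟨h3.1, h3.2.1, rfl⟩, ⟨h4.1, h4.2.1, rfl⟩, by omega⟩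

omit geo in
lemma wr_up {S T : Set ι} (geo : Geo (K := K) emb L P rk N wr) (h : S ⊆ T) (hS : wr S) : wr T := by
  rw [geo.wr_iff] at hS ⊢
  exact top_le_iff.1 (hS ▸ Submodule.span_mono (Set.image_mono h))

lemma exists_above {S : Set ι} (hS : S ∈ P) (hw : wr S) : ∃ R, R ∈ AboveF P rk N S :=
  (geo.above S hS hw).flip.exists_flag

lemma exists_below {S : Set ι} (hS : S ∈ P) : ∃ T, T ∈ BelowF P rk S :=
  (geo.below S hS).flip.exists_flag

lemma eps_ne {S : Set ι} {R T : List (Set ι)} (hS : S ∈ P) (hR : R ∈ AboveF P rk N S)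
    (hT : T ∈ BelowF P rk S) : eps L P b (R ++ S :: T) * eps L P b (R ++ S :: T) = 1 := by
  have h := (glue geo hS).2 ⟨hR, hT⟩
  obtain ⟨w, hw⟩ := exists_pick geo h
  exact (eps_eq geo b h hw).2

lemma cyc_above {S : Set ι} {T : List (Set ι)} (hS : S ∈ P) (hw : wr S) (hT : T ∈ BelowF P rk S)
    {y : Ch (Set ι)} (hy : y ∈ fl (· > ·) {T ∈ P | T > S} (N - rk S)) (hby : bd y = 0) :
    ∃ c : ℚ, ∀ R, y R = c * eps L P b (R ++ S :: T) := by
  have h1 := geo.rk_pos S hS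
  have h2 := geo.rk_le S hS
  have hTl := hT.2.2
  obtain ⟨z, hz, hze⟩ := exists_chain (r := (· > ·)) (k := N - rk S) (geo.above_fin S hS hw)
    (fun R => eps L P b (R ++ S :: T))
    (fun R hR => ((glue geo hS).1 (by_contra fun h => hR (eps_zero h))).1)
  have hbz : bd z = 0 := by
    refine bd_eq_zero_of_sums _ _ _ hz fun l1 l2 hl => ?_
    simp only [hze]
    have := eps_sum geo b (l1 := l1) (l2 := l2 ++ S :: T)
      (by simp only [List.length_append, List.length_cons]; omega) ?_
    · simpa using this
    · intro _ x hx
      rcases l2 with _ | ⟨B, l⟩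
      · exact ⟨S, T, rfl, hw⟩
      · refine ⟨B, l ++ S :: T, rfl, wr_up geo (S := S) (le_of_lt ?_) hw⟩
        have := (List.pairwise_cons.1 (List.pairwise_cons.1 hx.1).2).1
        exact this S (by simp)
  obtain ⟨R0, hR0⟩ := exists_above geo hS hw
  have hz0 : z ≠ 0 := by
    intro h0
    have := eps_ne geo b hS hR0 hT
    rw [← hze R0, h0] at this
    simp at this
  obtain ⟨c, rfl⟩ := (geo.above S hS hw).flip.mul hz hbz hz0 hy hby
  exact ⟨c, fun R => by simp [hze]⟩

lemma chain_below {S : Set ι} {R : List (Set ι)} (hS : S ∈ P) (hR : R ∈ AboveF P rk N S) :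
    ∃ z ∈ fl (· > ·) {T ∈ P | S > T} (rk S - 1), bd z = 0 ∧
      ∀ T, z T = eps L P b (R ++ S :: T) := by
  have h1 := geo.rk_pos S hS
  have h2 := geo.rk_le S hS
  have hRl := hR.2.2
  obtain ⟨z, hz, hze⟩ := exists_chain (r := (· > ·)) (k := rk S - 1)
    (X := {T ∈ P | S > T}) ((geo.fin S hS).finite_subsets.subset fun T hT => le_of_lt hT.2)
    (fun T => eps L P b (R ++ S :: T))
    (fun T hT => ((glue geo hS).1 (by_contra fun h => hT (eps_zero h))).2)
  refine ⟨z, hz, bd_eq_zero_of_sums _ _ _ hz fun l1 l2 hl => ?_, hze⟩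
  simp only [hze]
  have := eps_sum geo b (l1 := R ++ S :: l1) (l2 := l2)
    (by simp only [List.length_append, List.length_cons]; omega) (by simp)
  simpa using this

lemma cyc_below {S : Set ι} {R : List (Set ι)} (hS : S ∈ P) (hR : R ∈ AboveF P rk N S)
    {y : Ch (Set ι)} (hy : y ∈ fl (· > ·) {T ∈ P | S > T} (rk S - 1)) (hby : bd y = 0) :
    ∃ c : ℚ, ∀ T, y T = c * eps L P b (R ++ S :: T) := by
  obtain ⟨z, hz, hbz, hze⟩ := chain_below geo b hS hR
  obtain ⟨T0, hT0⟩ := exists_below geo hS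
  have hz0 : z ≠ 0 := by
    intro h0
    have := eps_ne geo b hS hR hT0
    rw [← hze T0, h0] at this
    simp at this
  obtain ⟨c, rfl⟩ := (geo.below S hS).flip.mul hz hbz hz0 hy hby
  exact ⟨c, fun R => by simp [hze]⟩

/-- A top-dimensional locally finite cycle on the well-rounded poset. -/
structure LF {ι : Type*} (P : Set (Set ι)) (wr : Set ι → Prop) (m : ℕ) (a : List (Set ι) → ℚ) :
    Prop where
  supp : ∀ l, a l ≠ 0 → l ∈ flS (· > ·) {S ∈ P | wr S} (m + 1)
  sum : ∀ l1 l2 : List (Set ι), l1.length + l2.length = m → ∑ᶠ x, a (l1 ++ x :: l2) = 0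

/-- Well-rounded elements of minimal rank. -/
def Bot (P : Set (Set ι)) (rk : Set ι → ℕ) (wr : Set ι → Prop) (n : ℕ) (S : Set ι) : Prop :=
  S ∈ P ∧ wr S ∧ rk S = n

variable {a : List (Set ι) → ℚ} {n : ℕ}

lemma LF.above (ha : LF P wr (N - n) a) {S : Set ι} (hS : Bot P rk wr n S) {T : List (Set ι)}
    (hT : T ∈ BelowF P rk S) : ∃ c : ℚ, ∀ R, a (R ++ [S]) = c * eps L P b (R ++ S :: T) := by
  obtain ⟨hS, hw, rfl⟩ := hS
  obtain ⟨y, hy, hye⟩ := exists_chain (r := (· > ·)) (k := N - rk S) (geo.above_fin S hS hw)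
    (fun R => a (R ++ [S])) (fun R hR => by
      obtain ⟨-, h1, -, h3⟩ := flS_split.1 (ha.supp _ hR)
      refine ⟨h1.1, fun x hx => ⟨(h1.2.1 x hx).1.1, (h1.2.1 x hx).2⟩, ?_⟩
      simp only [List.length_nil] at h3
      omega)
  obtain ⟨c, hc⟩ := cyc_above geo b hS hw hT hy (bd_eq_zero_of_sums _ _ _ hy fun l1 l2 hl => by
    simp only [hye]
    have := ha.sum l1 (l2 ++ [S]) (by simp only [List.length_append, List.length_singleton]; omega)
    simpa using this)
  exact ⟨c, fun R => by rw [← hye, hc]⟩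

lemma LF.indep (ha : LF P wr (N - n) a) {S : Set ι} (hS : Bot P rk wr n S)
    {y : Ch (Set ι)} (hy : y ∈ fl (· > ·) {T ∈ P | S > T} (rk S - 1)) (hby : bd y = 0)
    {R R' T T' : List (Set ι)} (hR : R ∈ AboveF P rk N S) (hR' : R' ∈ AboveF P rk N S)
    (hT : T ∈ BelowF P rk S) (hT' : T' ∈ BelowF P rk S) :
    y T * (a (R ++ [S]) * eps L P b (R ++ S :: T)) =
      y T' * (a (R' ++ [S]) * eps L P b (R' ++ S :: T')) := by
  obtain ⟨c, hc⟩ := ha.above geo b hS hT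
  obtain ⟨d, hd⟩ := cyc_below geo b hS.1 hR' hy hby
  have e1 := eps_ne geo b hS.1 hR hT
  have e2 := eps_ne geo b hS.1 hR' hT
  have e3 := eps_ne geo b hS.1 hR' hT'
  rw [hc R, hd T, hd T', hc R']
  linear_combination (d * eps L P b (R' ++ S :: T) * c) * e1 -
    (d * eps L P b (R' ++ S :: T) * c) * e3

end Duality
end LS

namespace LS
section Duality
variable {K M E ι : Type*} [Field K] [AddCommGroup M] [Module K M] [AddCommGroup E]
    [Module ℝ E] {emb : ι → M} {L : ι → E →ₗ[ℝ] ℝ} {P : Set (Set ι)} {rk : Set ι → ℕ}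
    {N : ℕ} {wr : Set ι → Prop}

open Classical in
/-- The chosen full flag above. -/
noncomputable def RA (P : Set (Set ι)) (rk : Set ι → ℕ) (N : ℕ) (S : Set ι) : List (Set ι) :=
  if h : ∃ R, R ∈ AboveF P rk N S then h.choose else []

open Classical in
/-- The chosen full flag below. -/
noncomputable def TB (P : Set (Set ι)) (rk : Set ι → ℕ) (S : Set ι) : List (Set ι) :=
  if h : ∃ R, R ∈ BelowF P rk S then h.choose else []

open Classical in
/-- The weight of a minimal well-rounded element. -/
noncomputable def kap (L : ι → E →ₗ[ℝ] ℝ) (P : Set (Set ι)) (rk : Set ι → ℕ) (wr : Set ι → Prop)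
    (n : ℕ) (b : Module.Basis (Fin N) ℝ E) (a : List (Set ι) → ℚ) (S : Set ι) : ℚ :=
  if Bot P rk wr n S then
    a (RA P rk N S ++ [S]) * eps L P b (RA P rk N S ++ S :: TB P rk S) else 0

/-- The functional on minimal chains attached to a locally finite cycle. -/
noncomputable def alp (L : ι → E →ₗ[ℝ] ℝ) (P : Set (Set ι)) (rk : Set ι → ℕ) (wr : Set ι → Prop)
    (n : ℕ) (b : Module.Basis (Fin N) ℝ E) (a : List (Set ι) → ℚ) : Ch (Set ι) →ₗ[ℚ] ℚ :=
  Finsupp.linearCombination ℚ (kap L P rk wr n b a) ∘ₗ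
    Finsupp.lcomapDomain (fun S => S :: TB P rk S) (fun _ _ h => (List.cons.inj h).1)

lemma alp_finsum (n : ℕ) (b : Module.Basis (Fin N) ℝ E) (a : List (Set ι) → ℚ) (c : Ch (Set ι)) :
    alp L P rk wr n b a c = ∑ᶠ S, c (S :: TB P rk S) * kap L P rk wr n b a S := by
  rw [alp, LinearMap.comp_apply, Finsupp.linearCombination_apply, Finsupp.sum,
    finsum_eq_sum_of_support_subset _ (s := (Finsupp.lcomapDomain (R := ℚ)
      (fun S => S :: TB P rk S) (fun _ _ h => (List.cons.inj h).1) c).support)]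
  · rfl
  · intro S hS
    have : c (S :: TB P rk S) ≠ 0 := fun h => hS (by simp [h])
    rw [Finset.mem_coe, Finsupp.mem_support_iff]
    exact this

variable (geo : Geo (K := K) emb L P rk N wr) (b : Module.Basis (Fin N) ℝ E)
  {a : List (Set ι) → ℚ} {n : ℕ}
include geo

lemma RA_mem {S : Set ι} (hS : S ∈ P) (hw : wr S) : RA P rk N S ∈ AboveF P rk N S := by
  have h := exists_above geo hS hw
  rw [RA, dif_pos h]; exact h.choose_spec

lemma TB_mem {S : Set ι} (hS : S ∈ P) : TB P rk S ∈ BelowF P rk S := by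
  have h := exists_below geo hS
  rw [TB, dif_pos h]; exact h.choose_spec

lemma LF.kap (ha : LF P wr (N - n) a) {S : Set ι} (hS : Bot P rk wr n S)
    {y : Ch (Set ι)} (hy : y ∈ fl (· > ·) {T ∈ P | S > T} (n - 1)) (hby : bd y = 0)
    {R T : List (Set ι)} (hR : R ∈ AboveF P rk N S) (hT : T ∈ BelowF P rk S) :
    y (TB P rk S) * kap L P rk wr n b a S = y T * (a (R ++ [S]) * eps L P b (R ++ S :: T)) := by
  rw [LS.kap, if_pos hS]
  have hn := hS.2.2
  exact ha.indep geo b hS (by rwa [hn]) hby (RA_mem geo hS.1 hS.2.1) hR (TB_mem geo hS.1) hT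

lemma alp_nonspan {U : Submodule K M} (hU : U ≠ ⊤) {c : Ch (Set ι)}
    (hc : c ∈ fl (· > ·) {S ∈ P | emb '' S ⊆ U} n) : alp L P rk wr n b a c = 0 := by
  rw [alp_finsum]
  refine finsum_eq_zero_of_forall_eq_zero fun S => ?_
  by_cases h : c (S :: TB P rk S) = 0
  · simp [h]
  have hS := (mem_fl.1 hc _ h).2.1 S (by simp)
  rw [kap, if_neg, mul_zero]
  rintro ⟨-, hw, -⟩
  rw [geo.wr_iff] at hw
  exact hU (top_le_iff.1 (hw ▸ Submodule.span_le.2 hS.2))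

lemma alp_bd_aux (ha : LF P wr (N - n) a) (hmin : ∀ S ∈ P, wr S → n ≤ rk S) {B : Set ι}
    (hB : B ∈ P) (hr : rk B = n + 1) {y : Ch (Set ι)}
    (hy : y ∈ fl (· > ·) {S ∈ P | B > S} n) (hby : bd y = 0) : alp L P rk wr n b a y = 0 := by
  rw [alp_finsum]
  have hBN := geo.rk_le B hB
  by_cases hw : wr B
  swap
  · refine finsum_eq_zero_of_forall_eq_zero fun S => ?_
    by_cases h : y (S :: TB P rk S) = 0
    · simp [h]
    have hS := (mem_fl.1 hy _ h).2.1 S (by simp)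
    rw [kap, if_neg, mul_zero]
    rintro ⟨-, hw', -⟩
    exact hw (wr_up geo (le_of_lt hS.2) hw')
  have hR := RA_mem geo hB hw
  obtain ⟨d, hd⟩ := cyc_below geo b hB hR (y := y) (by rwa [hr, Nat.add_sub_cancel]) hby
  have hRl := hR.2.2
  have hs := ha.sum (RA P rk N B ++ [B]) [] (by
    simp only [List.length_append, List.length_singleton, List.length_nil]; omega)
  have key : ∀ S, y (S :: TB P rk S) * kap L P rk wr n b a S =
      d • a (RA P rk N B ++ [B] ++ S :: []) := by
    intro S
    by_cases hS : Bot P rk wr n S ∧ S < B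
    · obtain ⟨hS, hlt⟩ := hS
      have hT := TB_mem geo hS.1
      have hfl : (RA P rk N B ++ [B]) ++ S :: TB P rk S ∈ flS (· > ·) P N := by
        rw [List.append_assoc]
        refine (glue geo hB (T := S :: TB P rk S)).2 ⟨hR, ?_⟩
        have e := hT.2.2
        have e' := hS.2.2
        refine ⟨List.pairwise_cons.2 ⟨fun x hx => (hT.2.1 x hx).2, hT.1⟩, ?_, ?_⟩
        · intro x hx
          rcases List.mem_cons.1 hx with rfl | hx
          · exact ⟨hS.1, hlt⟩
          · exact ⟨(hT.2.1 x hx).1, lt_trans (hT.2.1 x hx).2 hlt⟩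
        · have := geo.rk_pos S hS.1
          simp only [List.length_cons]; omega
      have hR' := ((glue geo hS.1).1 hfl).1
      obtain ⟨c, hc⟩ := ha.above geo b hS hT
      have e1 := eps_ne geo b hS.1 (RA_mem geo hS.1 hS.2.1) hT
      have e2 := eps_ne geo b hS.1 hR' hT
      rw [kap, if_pos hS, hd, hc, hc, smul_eq_mul]
      simp only [List.append_assoc, List.singleton_append] at e2 ⊢
      linear_combination (d * eps L P b (RA P rk N B ++ B :: S :: TB P rk S) * c) * e1
    · have e1 : y (S :: TB P rk S) * kap L P rk wr n b a S = 0 := by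
        by_cases h : y (S :: TB P rk S) = 0
        · simp [h]
        have hS' := (mem_fl.1 hy _ h).2.1 S (by simp)
        rw [kap, if_neg fun h => hS ⟨h, hS'.2⟩, mul_zero]
      have e2 : a (RA P rk N B ++ [B] ++ S :: []) = 0 := by
        by_contra h
        obtain ⟨h1, h2, -, -⟩ := flS_split.1 (ha.supp _ h)
        have hlt : B > S := (h2.2.1 B (by simp)).2
        have := geo.rk_lt S h1.1 B hB hlt
        have := hmin S h1.1 h1.2
        exact hS ⟨⟨h1.1, h1.2, by omega⟩, hlt⟩
      rw [e1, e2, smul_zero]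
  rw [finsum_congr key, ← smul_finsum, hs, smul_zero]

lemma alp_bd (ha : LF P wr (N - n) a) (hmin : ∀ S ∈ P, wr S → n ≤ rk S) {c : Ch (Set ι)}
    (hc : c ∈ Dk (· > ·) rk P (n + 1)) : alp L P rk wr n b a (bd c) = 0 := by
  have h := Dk_tl geo.rk_pos (geo_lt geo) hc
  have e := eq_sum_cn (Dk_fl hc) (s := (hd_finite c).toFinset) (by simp)
  rw [e, map_sum, map_sum]
  refine Finset.sum_eq_zero fun B _ => ?_
  obtain ⟨h1, h2, h3⟩ := h B
  rw [bd_cn, h1, map_zero, sub_zero]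
  by_cases h0 : tl B c = 0
  · rw [h0, map_zero]
  · exact alp_bd_aux geo b ha hmin (h2 h0).1 (h2 h0).2 h3 h1

/-- The functional detects the locally finite cycle. -/
lemma LF.eq_zero (ha : LF P wr (N - n) a) (hn : 1 ≤ n) (hnN : n ≤ N)
    (hmin : ∀ S ∈ P, wr S → n ≤ rk S)
    (h0 : ∀ c ∈ Dk (· > ·) rk P n, alp L P rk wr n b a c = 0) (l : List (Set ι)) : a l = 0 := by
  by_contra hl
  have hfl := ha.supp l hl
  have hne : l ≠ [] := by rintro rfl; simpa using hfl.2.2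
  obtain ⟨R, S, rfl⟩ := List.eq_nil_or_concat l |>.resolve_left hne
  rw [List.concat_eq_append] at hl hfl
  have hr := rk_full (r := (· > ·)) (Y := {S ∈ P | wr S}) (rk := rk) (a := n) (N := N)
    (fun a ha b hb => geo_lt geo a ha.1 b hb.1) (fun x hx => ⟨hmin x hx.1 hx.2, geo.rk_le x hx.1⟩)
    hfl (by omega)
  obtain ⟨h1, h2, -, h3⟩ := flS_split.1 hfl
  simp only [List.length_nil, add_zero] at hr h3
  have hR : R ∈ AboveF P rk N S :=
    ⟨h2.1, fun x hx => ⟨(h2.2.1 x hx).1.1, (h2.2.1 x hx).2⟩, by omega⟩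
  have hB : Bot P rk wr n S := ⟨h1.1, h1.2, hr.1⟩
  obtain ⟨z, hz, hbz, hze⟩ := chain_below geo b hB.1 hR
  rw [hr.1] at hz
  have hcz : bd (cn S z) = z := by rw [bd_cn, hbz, map_zero, sub_zero]
  obtain ⟨m, rfl⟩ : ∃ m, n = m + 1 := ⟨n - 1, by omega⟩
  have hlt : ∀ x ∈ {T ∈ P | S > T}, x ∈ {x ∈ P | rk x < m + 1} := fun x hx =>
    ⟨hx.1, hr.1 ▸ geo_lt geo S h1.1 x hx.1 hx.2⟩
  have hmem : cn S z ∈ Dk (· > ·) rk P (m + 1) := by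
    refine ⟨cn_mem (X := {x ∈ P | rk x ≤ m + 1}) ⟨h1.1, hr.1.le⟩
      (fl_mono_of hz fun x hx => ?_), ?_⟩
    · exact ⟨⟨hx.1, (hlt x hx).2.le⟩, hx.2⟩
    · rw [SetLike.mem_coe, Submodule.mem_comap, hcz]
      exact fl_mono_of hz hlt
  have e := h0 _ hmem
  classical
  rw [alp_finsum, finsum_eq_single _ S (fun T hT => by
    rw [cn_apply_cons, if_neg hT.symm, zero_mul]), cn_apply_cons, if_pos rfl,
    ha.kap geo b hB hz hbz hR (TB_mem geo h1.1), hze] at e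
  have e1 := eps_ne geo b h1.1 hR (TB_mem geo h1.1)
  apply hl
  linear_combination e - a (R ++ [S]) * e1

end Duality
end LS

namespace LS
section Maps
variable {σ τ : Type*} {r : τ → τ → Prop} {X : Set τ} {k : ℕ}

/-- The map on chains induced by a map of vertices. -/
noncomputable def mp (f : σ → τ) : Ch σ →ₗ[ℚ] Ch τ := Finsupp.lmapDomain ℚ ℚ (List.map f)

@[simp] lemma mp_single (f : σ → τ) (l : List σ) (a : ℚ) :
    mp f (Finsupp.single l a) = Finsupp.single (l.map f) a := by
  simp [mp]

lemma mp_cn (f : σ → τ) (x : σ) (c : Ch σ) : mp f (cn x c) = cn (f x) (mp f c) := by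
  induction c using Finsupp.induction_linear with
  | zero => simp
  | add c d hc hd => simp only [map_add, hc, hd]
  | single l a => simp

lemma mp_bdL (f : σ → τ) (l : List σ) : mp f (bdL l) = bdL (l.map f) := by
  induction l with
  | nil => simp [bdL]
  | cons x l ih => simp only [bdL, map_sub, mp_cn, ih, mp_single, List.map_cons]

lemma mp_bd (f : σ → τ) (c : Ch σ) : mp f (bd c) = bd (mp f c) := by
  induction c using Finsupp.induction_linear with
  | zero => simp
  | add c d hc hd => simp only [map_add, hc, hd]
  | single l a => simp [mp_bdL]

lemma mp_apply {f : σ → τ} (hf : Function.Injective f) (c : Ch σ) (l : List σ) :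
    mp f c (l.map f) = c l := by
  rw [mp, Finsupp.lmapDomain_apply, Finsupp.mapDomain_apply (List.map_injective_iff.2 hf)]

lemma mp_mp {ρ : Type*} (g : τ → ρ) (f : σ → τ) (c : Ch σ) : mp g (mp f c) = mp (g ∘ f) c := by
  induction c using Finsupp.induction_linear with
  | zero => simp
  | add c d hc hd => simp only [map_add, hc, hd]
  | single l a => simp

lemma mp_id (c : Ch τ) : mp id c = c := by
  induction c using Finsupp.induction_linear with
  | zero => simp
  | add c d hc hd => simp only [map_add, hc, hd]
  | single l a => simp

lemma mp_mem {r' : σ → σ → Prop} {Y : Set σ} {f : σ → τ} (hr : ∀ x ∈ Y, ∀ y ∈ Y, r' x y → r (f x) (f y))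
    (hY : ∀ x ∈ Y, f x ∈ X) {c : Ch σ} (hc : c ∈ fl r' Y k) : mp f c ∈ fl r X k := by
  refine map_mem_of_single (fun l hl => ?_) hc
  rw [mp_single]
  refine single_mem_fl ⟨?_, ?_, by simpa using hl.2.2⟩ 1
  · rw [List.pairwise_map]
    exact hl.1.imp_of_mem fun {x y} hx hy h => hr x (hl.2.1 x hx) y (hl.2.1 y hy) h
  · intro x hx
    obtain ⟨y, hy, rfl⟩ := List.mem_map.1 hx
    exact hY y (hl.2.1 y hy)

lemma Dk_map {r' : σ → σ → Prop} {Y : Set σ} {f : σ → τ} {rk : τ → ℕ} {rk' : σ → ℕ}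
    (hr : ∀ x ∈ Y, ∀ y ∈ Y, r' x y → r (f x) (f y))
    (hY : ∀ x ∈ Y, f x ∈ X) (hrk : ∀ x ∈ Y, rk (f x) = rk' x) {c : Ch σ} (hc : c ∈ Dk r' rk' Y k) :
    mp f c ∈ Dk r rk X k := by
  refine ⟨mp_mem (X := {x ∈ X | rk x ≤ k}) (fun x hx y hy => hr x hx.1 y hy.1)
    (fun x hx => ⟨hY x hx.1, by rw [hrk x hx.1]; exact hx.2⟩) hc.1, ?_⟩
  rw [SetLike.mem_coe, Submodule.mem_comap, ← mp_bd]
  exact mp_mem (X := {x ∈ X | rk x < k}) (fun x hx y hy => hr x hx.1 y hy.1)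
    (fun x hx => ⟨hY x hx.1, by rw [hrk x hx.1]; exact hx.2⟩) hc.2

end Maps

section Duality
variable {K M E ι : Type*} [Field K] [AddCommGroup M] [Module K M] [AddCommGroup E]
    [Module ℝ E] {emb : ι → M} {L : ι → E →ₗ[ℝ] ℝ} {P : Set (Set ι)} {rk : Set ι → ℕ}
    {N : ℕ} {wr : Set ι → Prop}

/-- The poset elements contained in a subspace. -/
def PU (emb : ι → M) (P : Set (Set ι)) (U : Submodule K M) : Set (Set ι) :=
  {S ∈ P | emb '' S ⊆ U}

/-- Carrier for chains on vectors. -/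
noncomputable def DA (K : Type*) {M ι : Type*} [Field K] [AddCommGroup M] [Module K M]
    (emb : ι → M) (P : Set (Set ι)) (rk : Set ι → ℕ) (A : Set ι)
    (k : ℕ) : Submodule ℚ (Ch (Set ι)) :=
  Dk (· > ·) rk (PU emb P (Submodule.span K (emb '' A))) k

lemma DA_mono {A B : Set ι} (k : ℕ) (h : A ⊆ B) : DA K emb P rk A k ≤ DA K emb P rk B k :=
  Dk_mono fun _ hS => ⟨hS.1, hS.2.trans (Submodule.span_mono (Set.image_mono h))⟩

/-- Carrier for chains on flags. -/
noncomputable def DB (P : Set (Set ι)) (rk : Set ι → ℕ) (A : Set (Set ι))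
    (k : ℕ) : Submodule ℚ (Ch (Set ι)) :=
  Dk (· > ·) rk {T ∈ P | ∃ S ∈ A, T ⊆ S} k

lemma DB_mono {A B : Set (Set ι)} (k : ℕ) (h : A ⊆ B) : DB P rk A k ≤ DB P rk B k :=
  Dk_mono fun _ hS => ⟨hS.1, hS.2.imp fun _ hT => ⟨h hT.1, hT.2⟩⟩

variable (geo : Geo (K := K) emb L P rk N wr)
include geo

lemma dex_of {Y : Set (Set ι)} (hY : Y ⊆ P) (hdown : ∀ S ∈ Y, ∀ T ∈ P, T < S → T ∈ Y)
    (hex : ∀ k, Ex (· > ·) Y k) : Dex (Dk (· > ·) rk Y) := by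
  refine Dk_dex (N := N) (fun a ha b hb => geo_lt geo a (hY ha) b (hY hb))
    (fun a ha => geo.rk_le a (hY ha)) (fun S hS k hk => ?_) hex
  have : {x ∈ Y | S > x} = {x ∈ P | x < S} := by
    ext x; exact ⟨fun h => ⟨hY h.1, h.2⟩, fun h => ⟨hdown S hS x h.1 h.2, h.2⟩⟩
  rw [this]
  have := geo.rk_pos S (hY hS)
  exact (geo.below S (hY hS)).flip.ex k (by omega)

lemma dex_PU {U : Submodule K M} (hU : U ≠ ⊥) : Dex (Dk (· > ·) rk (PU emb P U)) :=
  dex_of geo (fun _ h => h.1) (fun _ hS _ hT h => ⟨hT, (Set.image_mono h.le).trans hS.2⟩)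
    fun k => (geo.exU U hU k).flip

omit geo in
lemma span_ne_bot {A : Set ι} {v : ι} (hv : v ∈ A) (h0 : emb v ≠ 0) :
    Submodule.span K (emb '' A) ≠ ⊥ := fun h => h0 (by
  have : emb v ∈ Submodule.span K (emb '' A) := Submodule.subset_span ⟨v, hv, rfl⟩
  rwa [h, Submodule.mem_bot] at this)

lemma dex_DA (l : List ι) (hl : ∀ x ∈ l, x ∈ {v | emb v ≠ 0}) (hne : l ≠ []) :
    Dex (DA K emb P rk {x | x ∈ l}) := by
  obtain ⟨v, hv⟩ := List.exists_mem_of_ne_nil l hne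
  exact dex_PU geo (span_ne_bot (A := {x | x ∈ l}) hv (hl v hv))

lemma dex_DB {S : Set ι} {l : List (Set ι)} (hl : (S :: l).Pairwise (· > ·)) (hS : S ∈ P) :
    Dex (DB P rk {x | x ∈ S :: l}) := by
  refine dex_of geo (fun _ h => h.1) (fun T hT R hR h => ⟨hR, ?_⟩) fun k =>
    ex_cone (X := {T ∈ P | ∃ R ∈ {x | x ∈ S :: l}, T ⊆ R}) (x0 := S)
      ⟨hS, S, by simp, subset_rfl⟩ ?_ ?_ k
  · obtain ⟨B, hB, hTB⟩ := hT.2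
    exact ⟨B, hB, h.le.trans hTB⟩
  all_goals
    have key : ∀ x ∈ {T | T ∈ P ∧ ∃ R ∈ {x | x ∈ S :: l}, T ⊆ R}, x ⊆ S := by
      rintro x ⟨-, B, hB, hxB⟩
      rcases List.mem_cons.1 hB with rfl | hB
      · exact hxB
      · exact hxB.trans ((List.pairwise_cons.1 hl).1 B hB).le
  · exact fun x hx hne => lt_of_le_of_ne (key x hx) hne
  · exact fun x hx h => absurd (key x hx) (not_le_of_gt h)

variable (b : Module.Basis (Fin N) ℝ E) {a : List (Set ι) → ℚ} {n : ℕ}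

lemma alp_DA {A : Set ι} (hA : Submodule.span K (emb '' A) ≠ ⊤) {c : Ch (Set ι)}
    (hc : c ∈ DA K emb P rk A n) : alp L P rk wr n b a c = 0 :=
  alp_nonspan geo b hA (Dk_fl hc)

omit geo in
omit [AddCommGroup E] [Module ℝ E] in
lemma span_lt {l : List ι} (hn : Module.finrank K M = n) (hl : l.length < n) :
    Submodule.span K (emb '' {x | x ∈ l}) ≠ ⊤ := by
  classical
  intro h
  have h1 : emb '' {x | x ∈ l} = ((l.toFinset.image emb : Finset M) : Set M) := by
    ext; simp
  rw [h1] at h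
  have h2 := finrank_span_finset_le_card (R := K) (l.toFinset.image emb)
  rw [Set.finrank, h, finrank_top, hn] at h2
  have h3 := (Finset.card_image_le (s := l.toFinset) (f := emb)).trans l.toFinset_card_le
  omega

/-- Two carried maps give the same values of the functional. -/
lemma alp_homotopy (ha : LF P wr (N - n) a) (hmin : ∀ S ∈ P, wr S → n ≤ rk S)
    (hn : Module.finrank K M = n) (h2 : 2 ≤ n) {f g : Ch ι →ₗ[ℚ] Ch (Set ι)}
    (hf : Carried (fun _ _ => True) {v | emb v ≠ 0} (DA K emb P rk) f)
    (hg : Carried (fun _ _ => True) {v | emb v ≠ 0} (DA K emb P rk) g)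
    {l : List ι} (hl : l ∈ flS (fun _ _ => True) {v | emb v ≠ 0} n) :
    alp L P rk wr n b a (f (Finsupp.single l 1)) = alp L P rk wr n b a (g (Finsupp.single l 1)) := by
  obtain ⟨H, h1, h3⟩ := exists_homotopy (fun A B k h => DA_mono k h)
    (fun l _ hl hne => dex_DA geo l hl hne) hf hg
  obtain ⟨m, rfl⟩ : ∃ m, n = m + 1 + 1 := ⟨n - 2, by omega⟩
  have e := h3 _ _ (single_mem_fl hl 1)
  have e1 : alp L P rk wr (m + 1 + 1) b a (bd (H (Finsupp.single l 1))) = 0 :=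
    alp_bd geo b ha hmin (Dk_mono (fun _ h => h.1) (h1 _ l hl))
  have e2 : alp L P rk wr (m + 1 + 1) b a (H (bd (Finsupp.single l 1))) = 0 := by
    rw [bd_single, one_smul]
    have := map_mem_of_single (φ := alp L P rk wr (m + 1 + 1) b a ∘ₗ H) (p := ⊥)
      (r := fun _ _ => True) (X := {x | x ∈ l}) (k := m + 1) (fun l' hl' => by
        rw [Submodule.mem_bot, LinearMap.comp_apply]
        exact alp_DA geo b (span_lt hn (by rw [hl'.2.2]; omega))
          (h1 _ l' ⟨hl'.1, fun x hx => hl.2.1 x (hl'.2.1 x hx), hl'.2.2⟩))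
      (bdL_mem_self hl)
    exact this
  rw [e, map_sub, e2, sub_zero, map_sub, sub_eq_zero] at e1
  exact e1

lemma DB_id_aux {f : Ch (Set ι) →ₗ[ℚ] Ch (Set ι)} (hf : Carried (· > ·) P (DB P rk) f)
    {k : ℕ} (ih : ∀ c ∈ Dk (· > ·) rk P k, f c = c) {S : Set ι} (hS : S ∈ P) (hr : rk S = k + 1)
    {y : Ch (Set ι)} (hy : y ∈ fl (· > ·) {T ∈ P | S > T} k) (hby : bd y = 0) :
    f (cn S y) = cn S y := by
  have hcy : bd (cn S y) = y := by rw [bd_cn, hby, map_zero, sub_zero]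
  have hlt : ∀ x ∈ {T ∈ P | S > T}, rk x < k + 1 := fun x hx =>
    hr ▸ geo_lt geo S hS x hx.1 hx.2
  have hcn : cn S y ∈ fl (· > ·) P (k + 1) := cn_mem hS hy
  have hyk : y ∈ Dk (· > ·) rk P k := by
    refine ⟨fl_mono_of hy fun x hx => ⟨hx.1, Nat.le_of_lt_succ (hlt x hx)⟩, ?_⟩
    rw [SetLike.mem_coe, Submodule.mem_comap, hby]; exact zero_mem _
  set Y : Set (Set ι) := {T ∈ P | T ⊆ S} with hYdef
  have m1 : f (cn S y) ∈ Dk (· > ·) rk Y (k + 1) := by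
    refine map_mem_of_single (φ := f ∘ₗ cn S) (fun l hl => ?_) hy
    rw [LinearMap.comp_apply, cn_single]
    refine Dk_mono ?_ (hf.mem k (S :: l) (flS_cons.2 ⟨hS, hl⟩))
    rintro T ⟨hT, B, hB, hTB⟩
    refine ⟨hT, ?_⟩
    rcases List.mem_cons.1 hB with rfl | hB
    · exact hTB
    · exact hTB.trans (le_of_lt (hl.2.1 B hB).2)
  have m2 : cn S y ∈ Dk (· > ·) rk Y (k + 1) := by
    refine ⟨cn_mem (X := {x ∈ Y | rk x ≤ k + 1}) ⟨⟨hS, subset_rfl⟩, hr.le⟩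
      (fl_mono_of hy fun x hx => ?_), ?_⟩
    · exact ⟨⟨⟨hx.1, le_of_lt hx.2⟩, (hlt x hx).le⟩, hx.2⟩
    · rw [SetLike.mem_coe, Submodule.mem_comap, hcy]
      exact fl_mono_of hy fun x hx => ⟨⟨hx.1, le_of_lt hx.2⟩, hlt x hx⟩
  have m3 := sub_mem m1 m2
  set d := f (cn S y) - cn S y with hdd
  have hbd : bd d = 0 := by
    rw [hdd, map_sub, hf.comm _ _ hcn, hcy, ih y hyk, sub_self]
  have htl := Dk_tl (X := Y) (fun x hx => geo.rk_pos x hx.1)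
    (fun x hx y hy => geo_lt geo x hx.1 y hy.1) m3
  have hhd : hd d ⊆ ({S} : Finset (Set ι)) := by
    intro x (h0 : tl x d ≠ 0)
    obtain ⟨hx, hxr⟩ := (htl x).2.1 h0
    rw [Finset.coe_singleton, Set.mem_singleton_iff]
    by_contra hne
    have := geo.rk_lt x hx.1 S hS (lt_of_le_of_ne hx.2 hne)
    omega
  have he := eq_sum_cn (Dk_fl m3) hhd
  rw [Finset.sum_singleton] at he
  have ht : tl S d = 0 := by
    have := hbd
    rw [he, bd_cn, (htl S).1, map_zero, sub_zero] at this
    exact this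
  rw [ht, map_zero] at he
  exact sub_eq_zero.1 he

lemma DB_id {f : Ch (Set ι) →ₗ[ℚ] Ch (Set ι)} (hf : Carried (· > ·) P (DB P rk) f) :
    ∀ (k : ℕ), ∀ c ∈ Dk (· > ·) rk P k, f c = c := by
  intro k
  induction k with
  | zero =>
    exact fun c hc => map_eq_of_single (ψ := LinearMap.id)
      (fun l hl => by rw [flS_zero.1 hl, hf.nil]; rfl) hc.1
  | succ k ih =>
    intro c hc
    have h := Dk_tl geo.rk_pos (geo_lt geo) hc
    rw [eq_sum_cn (Dk_fl hc) (s := (hd_finite c).toFinset) (by simp), map_sum]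
    refine Finset.sum_congr rfl fun S _ => ?_
    obtain ⟨h1, h2, h3⟩ := h S
    by_cases h0 : tl S c = 0
    · simp [h0]
    · exact DB_id_aux geo hf ih (h2 h0).1 (h2 h0).2 h3 h1

end Duality
end LS

namespace LS
section Duality
variable {K M E ι : Type*} [Field K] [AddCommGroup M] [Module K M] [AddCommGroup E]
    [Module ℝ E] {emb : ι → M} {L : ι → E →ₗ[ℝ] ℝ} {P : Set (Set ι)} {rk : Set ι → ℕ}
    {N : ℕ} {wr : Set ι → Prop} {a : List (Set ι) → ℚ} {n : ℕ}

/-- Orientation-preserving symmetries of the data. -/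
structure Sym {K M E ι : Type*} [Field K] [AddCommGroup M] [Module K M] [AddCommGroup E]
    [Module ℝ E] (emb : ι → M) (L : ι → E →ₗ[ℝ] ℝ) (P : Set (Set ι)) (rk : Set ι → ℕ)
    (a : List (Set ι) → ℚ) (σ : ι ≃ ι) : Prop where
  lin : ∃ e : M ≃ₗ[K] M, ∀ v, emb (σ v) = e (emb v)
  pos : ∃ f : E →ₗ[ℝ] E, 0 < LinearMap.det f ∧ ∀ v h, L (σ v) h = L v (f h)
  mem : ∀ S, σ '' S ∈ P ↔ S ∈ P
  rk : ∀ S, rk (σ '' S) = rk S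
  a : ∀ l, a (l.map (σ '' ·)) = a l

lemma img_inj (σ : ι ≃ ι) : Function.Injective (fun S : Set ι => σ '' S) :=
  Set.image_injective.2 σ.injective

lemma img_lt (σ : ι ≃ ι) {S T : Set ι} : σ '' S < σ '' T ↔ S < T := by
  simp only [Set.ssubset_def, Set.image_subset_image_iff σ.injective]

variable {σ : ι ≃ ι}

lemma map_flS_iff (hP : ∀ S, σ '' S ∈ P ↔ S ∈ P) {l : List (Set ι)} {k : ℕ} :
    l.map (σ '' ·) ∈ flS (· > ·) P k ↔ l ∈ flS (· > ·) P k := by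
  simp only [flS, Set.mem_ofPred_eq, List.pairwise_map, List.length_map, List.mem_map,
    forall_exists_index, and_imp, forall_apply_eq_imp_iff₂, hP, gt_iff_lt, img_lt]

variable (hs : Sym (K := K) emb L P rk a σ)
include hs

lemma Sym.span_img (A : Set ι) : ∃ e : M ≃ₗ[K] M, (∀ v, emb (σ v) = e (emb v)) ∧
    Submodule.span K (emb '' (σ '' A)) = (Submodule.span K (emb '' A)).map (e : M →ₗ[K] M) := by
  obtain ⟨e, he⟩ := hs.lin
  refine ⟨e, he, ?_⟩
  rw [Submodule.map_span, Set.image_image, Set.image_image]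
  simp only [he]; rfl

lemma Sym.PU_iff (A S : Set ι) : σ '' S ∈ PU emb P (Submodule.span K (emb '' (σ '' A))) ↔
    S ∈ PU emb P (Submodule.span K (emb '' A)) := by
  obtain ⟨e, he, h⟩ := hs.span_img A
  rw [PU, PU, Set.mem_ofPred_eq, Set.mem_ofPred_eq, hs.mem, h]
  refine and_congr_right fun _ => ?_
  constructor
  · rintro h1 _ ⟨v, hv, rfl⟩
    obtain ⟨w, hw, hwe⟩ := h1 ⟨σ v, ⟨v, hv, rfl⟩, rfl⟩
    rw [he] at hwe
    exact e.injective hwe ▸ hw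
  · rintro h1 _ ⟨_, ⟨v, hv, rfl⟩, rfl⟩
    rw [he]
    exact ⟨_, h1 ⟨v, hv, rfl⟩, rfl⟩

lemma Sym.symm_rk (S : Set ι) : rk (σ.symm '' S) = rk S := by
  have := hs.rk (σ.symm '' S)
  rwa [Equiv.image_symm_image, eq_comm] at this

variable (geo : Geo (K := K) emb L P rk N wr) (b : Module.Basis (Fin N) ℝ E)
include geo

lemma Sym.map_wr {S : Set ι} (h : wr S) : wr (σ '' S) := by
  obtain ⟨e, he, h'⟩ := hs.span_img S
  rw [geo.wr_iff] at h ⊢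
  rw [h', h, Submodule.map_top, LinearEquiv.range]

omit geo in
lemma Sym.dd (w : Fin N → ι) : sg (dd L b (σ ∘ w)) = sg (dd L b w) := by
  obtain ⟨f, hf, h⟩ := hs.pos
  have h1 := dd_mul (L := L) b w (f ∘ b)
  rw [Module.Basis.det_comp, Module.Basis.det_self, mul_one] at h1
  have h2 : LS.dd L b (σ ∘ w) = LS.dd L b w * LinearMap.det f := by
    rw [h1, LS.dd]
    congr 1
    ext i k
    simp [h]
  rw [h2, sg_mul, sg_pos hf, mul_one]

lemma Sym.eps {l : List (Set ι)} (hl : l ∈ flS (· > ·) P N) :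
    eps L P b (l.map (σ '' ·)) = eps L P b l := by
  obtain ⟨w, hw⟩ := exists_pick geo hl
  have hl' := (map_flS_iff hs.mem (l := l)).2 hl
  have hff : ∀ i, ff N (l.map (σ '' ·)) i = σ '' ff N l i := fun i => by
    have := List.getD_map (l := l) (d := (∅ : Set ι)) (n := i) (f := fun S => σ '' S)
    rwa [Set.image_empty] at this
  have hw' : IsPick (ff N (l.map (σ '' ·))) (σ ∘ w) := fun i => by
    simp only [hff, Function.comp, Set.mem_image, σ.injective.eq_iff, exists_eq_right]
    exact hw i
  rw [(eps_eq geo b hl hw).1, (eps_eq geo b hl' hw').1, hs.dd]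

/-- Invariance of the functional. -/
lemma Sym.alp (ha : LF P wr (N - n) a) (hn : 1 ≤ n) {c : Ch (Set ι)}
    (hc : c ∈ Dk (· > ·) rk P n) :
    alp L P rk wr n b a (mp (σ '' ·) c) = alp L P rk wr n b a c := by
  obtain ⟨m, rfl⟩ : ∃ m, n = m + 1 := ⟨n - 1, by omega⟩
  have hc' : mp (σ '' ·) c ∈ Dk (· > ·) rk P (m + 1) :=
    Dk_map (f := fun S => σ '' S) (r := (· > ·)) (r' := (· > ·)) (rk := rk) (rk' := rk) (Y := P)
      (fun x _ y _ h => (img_lt (S := y) (T := x) σ).2 h) (fun x hx => (hs.mem x).2 hx) (fun x _ => hs.rk x) hc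
  have t1 := Dk_tl geo.rk_pos (geo_lt geo) hc
  have t2 := Dk_tl geo.rk_pos (geo_lt geo) hc'
  rw [alp_finsum, alp_finsum, ← finsum_comp_equiv (Equiv.Set.congr σ)]
  refine finsum_congr fun S => ?_
  rw [show Equiv.Set.congr σ S = σ '' S from rfl]
  by_cases hS : Bot P rk wr (m + 1) S
  · have hS' : Bot P rk wr (m + 1) (σ '' S) :=
      ⟨(hs.mem S).2 hS.1, hs.map_wr geo hS.2.1, (hs.rk S).trans hS.2.2⟩
    have hR := RA_mem geo hS.1 hS.2.1
    have hT := TB_mem geo hS.1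
    have hfl := (glue geo hS.1).2 ⟨hR, hT⟩
    have hfl' := (map_flS_iff hs.mem).2 hfl
    rw [List.map_append, List.map_cons] at hfl'
    obtain ⟨hR', hT'⟩ := (glue geo hS'.1).1 hfl'
    have k1 := ha.kap geo b hS (t1 S).2.2 (t1 S).1 hR hT
    have k2 := ha.kap geo b hS' (t2 (σ '' S)).2.2 (t2 (σ '' S)).1 hR' hT'
    have e1 := hs.eps geo b hfl
    have e2 := hs.a (RA P rk N S ++ [S])
    have e3 := mp_apply (img_inj σ) c (S :: TB P rk S)
    simp only [List.map_append, List.map_cons, List.map_nil] at e1 e2 e3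
    rw [tl_apply] at k1
    rw [tl_apply, tl_apply] at k2
    rw [k1, k2, e1, e2, e3]
  · rw [kap, kap, if_neg, if_neg hS, mul_zero, mul_zero]
    rintro ⟨h1, h2, h3⟩
    refine hS ⟨(hs.mem S).1 h1, ?_, (hs.rk S).symm.trans h3⟩
    obtain ⟨e, he, h'⟩ := hs.span_img S
    rw [geo.wr_iff] at h2 ⊢
    rw [h'] at h2
    exact Submodule.map_injective_of_injective e.injective
      (h2.trans (by rw [Submodule.map_top, LinearEquiv.range]))

omit geo in
lemma Sym.carried {f : Ch ι →ₗ[ℚ] Ch (Set ι)}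
    (hf : Carried (fun _ _ => True) {v | emb v ≠ 0} (DA K emb P rk) f) :
    Carried (fun _ _ => True) {v | emb v ≠ 0} (DA K emb P rk)
      (mp (σ.symm '' ·) ∘ₗ f ∘ₗ mp σ) where
  nil := by simp [hf.nil]
  mem k l hl := by
    have hl' : l.map σ ∈ flS (fun _ _ => True) {v | emb v ≠ 0} (k + 1) := by
      refine ⟨List.pairwise_of_forall fun _ _ => trivial, fun x hx => ?_, by simpa using hl.2.2⟩
      obtain ⟨y, hy, rfl⟩ := List.mem_map.1 hx
      obtain ⟨e, he⟩ := hs.lin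
      have := hl.2.1 y hy
      simpa [he] using this
    have h1 := hf.mem k _ hl'
    rw [LinearMap.comp_apply, LinearMap.comp_apply, mp_single]
    have himg : {x | x ∈ l.map σ} = σ '' {x | x ∈ l} := by
      ext x; simp only [Set.mem_ofPred_eq, List.mem_map, Set.mem_image]
    rw [himg] at h1
    refine Dk_map (Y := PU emb P (Submodule.span K (emb '' (σ '' {x | x ∈ l})))) (X := PU emb P (Submodule.span K (emb '' {x | x ∈ l}))) (f := fun S => σ.symm '' S)
      (rk := rk) (rk' := rk) (r' := (· > ·)) (r := (· > ·)) (fun x _ y _ h => ?_) (fun x hx => ?_)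
      (fun x _ => hs.symm_rk x) h1
    · exact (img_lt σ.symm).2 h
    rw [← hs.PU_iff, Equiv.image_symm_image]
    exact hx
  comm k c hc := by
    have hc' : mp σ c ∈ fl (fun _ _ => True) {v | emb v ≠ 0} k :=
      mp_mem (fun _ _ _ _ _ => trivial) (fun x hx => by
        obtain ⟨e, he⟩ := hs.lin
        have : emb x ≠ 0 := hx
        simpa [he] using this) hc
    simp only [LinearMap.comp_apply]
    rw [← mp_bd, hf.comm _ _ hc', mp_bd]

lemma Sym.theta (ha : LF P wr (N - n) a) (hmin : ∀ S ∈ P, wr S → n ≤ rk S)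
    (hn : Module.finrank K M = n) (h2 : 2 ≤ n) {f : Ch ι →ₗ[ℚ] Ch (Set ι)}
    (hf : Carried (fun _ _ => True) {v | emb v ≠ 0} (DA K emb P rk) f)
    {l : List ι} (hl : l ∈ flS (fun _ _ => True) {v | emb v ≠ 0} n) :
    LS.alp L P rk wr n b a (f (Finsupp.single (l.map σ) 1)) =
      LS.alp L P rk wr n b a (f (Finsupp.single l 1)) := by
  have hf' := hs.carried hf
  have h1 := alp_homotopy geo b ha hmin hn h2 hf' hf hl
  have hm : ((mp (σ.symm '' ·) ∘ₗ f ∘ₗ mp σ) (Finsupp.single l 1)) ∈ Dk (· > ·) rk P n := by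
    obtain ⟨m, rfl⟩ : ∃ m, n = m + 1 := ⟨n - 1, by omega⟩
    exact Dk_mono (fun _ h => h.1) (hf'.mem m l hl)
  rw [← h1, ← hs.alp geo b ha (by omega) hm]
  congr 1
  rw [LinearMap.comp_apply, mp_mp, LinearMap.comp_apply, mp_single]
  conv_lhs => rw [← mp_id (f _)]
  congr 2
  ext1 S
  simp

omit hs in
lemma theta_eq (hX : ∀ S ∈ P, ∀ v ∈ S, emb v ≠ 0) (ha : LF P wr (N - n) a)
    (hmin : ∀ S ∈ P, wr S → n ≤ rk S)
    (hn : Module.finrank K M = n) (h2 : 2 ≤ n) {f : Ch ι →ₗ[ℚ] Ch (Set ι)}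
    (hf : Carried (fun _ _ => True) {v | emb v ≠ 0} (DA K emb P rk) f)
    (h0 : ∀ l ∈ flS (fun _ _ => True) {v | emb v ≠ 0} n,
      LS.alp L P rk wr n b a (f (Finsupp.single l 1)) = 0) {c : Ch (Set ι)}
    (hc : c ∈ Dk (· > ·) rk P n) : LS.alp L P rk wr n b a c = 0 := by
  have hpick : ∀ S : Set ι, ∃ v, S ∈ P → v ∈ S := fun S => by
    by_cases hS : S ∈ P
    · obtain ⟨v, hv⟩ := geo.ne S hS
      exact ⟨v, fun _ => hv⟩
    · by_cases hne : Nonempty ι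
      · exact ⟨hne.some, fun h => absurd h hS⟩
      · exfalso
        have : Nonempty M := ⟨0⟩
        have hbot : ∀ T : Set ι, T ∉ P := fun T hT => hne ⟨(geo.ne T hT).some⟩
        have hMn : (⊤ : Submodule K M) ≠ ⊥ := fun h => by
          have := finrank_top K M
          rw [h, finrank_bot] at this; omega
        obtain ⟨w, hw, hwe⟩ := geo.exU ⊤ hMn 0 (Finsupp.single [] 1)
          (single_mem_fl (flS_zero.2 rfl) 1) (bd_single_nil 1)
        have hw0 : w = 0 := by
          ext l
          by_contra hl
          have := mem_fl.1 hw l hl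
          have hlen := this.2.2
          obtain ⟨x, hx⟩ := List.exists_mem_of_ne_nil l (by rintro rfl; simp at hlen)
          exact hbot x (this.2.1 x hx).1
        rw [hw0, map_zero] at hwe
        have := DFunLike.congr_fun hwe []
        simp at this
  choose v hv using hpick
  set D : Set (Set ι) → ℕ → Submodule ℚ (Ch (Set ι)) := fun A k => DA K emb P rk (⋃₀ A) k with hD
  have hdex : ∀ l : List (Set ι), l.Pairwise (· > ·) → (∀ x ∈ l, x ∈ P) → l ≠ [] →
      Dex (D {x | x ∈ l}) := by
    intro l hl hP hne
    obtain ⟨S, hS⟩ := List.exists_mem_of_ne_nil l hne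
    exact dex_PU geo (span_ne_bot (v := v S) ⟨S, hS, hv S (hP S hS)⟩ (hX S (hP S hS) _ (hv S (hP S hS))))
  obtain ⟨f1, hf1⟩ := exists_carried (r := (· > ·)) (X := P) (DB P rk)
    (fun A B k h => DB_mono k h) (fun A => nil_mem_Dk) (fun l hl hP hne => by
      obtain ⟨S, l, rfl⟩ := List.exists_cons_of_ne_nil hne
      exact dex_DB geo hl (hP S (by simp)))
  have hf1' : Carried (· > ·) P D f1 := by
    refine ⟨hf1.nil, fun k l hl => Dk_mono ?_ (hf1.mem k l hl), hf1.comm⟩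
    rintro T ⟨hT, S, hS, hTS⟩
    refine ⟨hT, fun x hx => Submodule.subset_span (Set.image_mono ?_ hx)⟩
    exact hTS.trans (Set.subset_sUnion_of_mem hS)
  have hmv : ∀ {k l}, l ∈ flS (· > ·) P k → l.map v ∈ flS (fun _ _ => True) {v | emb v ≠ 0} k := by
    intro k l hl
    refine ⟨List.pairwise_of_forall fun _ _ => trivial, fun x hx => ?_, by simpa using hl.2.2⟩
    obtain ⟨S, hS, rfl⟩ := List.mem_map.1 hx
    exact hX S (hl.2.1 S hS) _ (hv S (hl.2.1 S hS))
  have hf2 : Carried (· > ·) P D (f ∘ₗ mp v) := by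
    refine ⟨by simp [hf.nil], fun k l hl => ?_, fun k c hc => ?_⟩
    · rw [LinearMap.comp_apply, mp_single]
      refine DA_mono _ ?_ (hf.mem k _ (hmv hl))
      rintro x hx
      obtain ⟨S, hS, rfl⟩ := List.mem_map.1 hx
      exact ⟨S, hS, hv S (hl.2.1 S hS)⟩
    · rw [LinearMap.comp_apply, hf.comm k (mp v c), LinearMap.comp_apply, mp_bd]
      exact mp_mem (fun _ _ _ _ _ => trivial)
        (fun S hS => hX S hS _ (hv S hS)) hc
  obtain ⟨H, h1, h3⟩ := exists_homotopy (fun A B k h => DA_mono k (Set.sUnion_mono h)) hdex hf1' hf2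
  obtain ⟨m, rfl⟩ : ∃ m, n = m + 1 + 1 := ⟨n - 2, by omega⟩
  have e := h3 _ _ (Dk_fl hc)
  rw [DB_id geo hf1 _ c hc] at e
  have e1 : LS.alp L P rk wr (m + 1 + 1) b a (bd (H c)) = 0 := by
    refine alp_bd geo b ha hmin (map_mem_of_single (fun l hl => ?_) (Dk_fl hc))
    exact Dk_mono (fun _ h => h.1) (h1 _ l hl)
  have e2 : LS.alp L P rk wr (m + 1 + 1) b a (H (bd c)) = 0 := by
    have := map_mem_of_single (φ := LS.alp L P rk wr (m + 1 + 1) b a ∘ₗ H) (p := ⊥)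
      (r := (· > ·)) (X := {x ∈ P | rk x < m + 1 + 1}) (k := m + 1) (fun l hl => by
        rw [Submodule.mem_bot, LinearMap.comp_apply]
        obtain ⟨S, l, rfl⟩ := List.exists_cons_of_ne_nil (l := l) (by rintro rfl; simpa using hl.2.2)
        have hS := hl.2.1 S (by simp)
        refine alp_DA geo b (A := ⋃₀ {x | x ∈ S :: l}) ?_
          (h1 _ _ ⟨hl.1, fun x hx => (hl.2.1 x hx).1, hl.2.2⟩)
        have hU : ⋃₀ {x | x ∈ S :: l} ⊆ S := by
          refine Set.sUnion_subset fun T hT => ?_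
          rcases List.mem_cons.1 hT with rfl | hT
          · exact subset_rfl
          · exact le_of_lt ((List.pairwise_cons.1 hl.1).1 T hT)
        intro htop
        have h4 := wr_up geo hU ((geo.wr_iff _).2 htop)
        have := hmin S hS.1 h4
        have := hS.2
        omega) hc.2
    exact this
  have e3 : LS.alp L P rk wr (m + 1 + 1) b a ((f ∘ₗ mp v) c) = 0 := by
    have := map_mem_of_single (φ := LS.alp L P rk wr (m + 1 + 1) b a ∘ₗ f ∘ₗ mp v) (p := ⊥)
      (fun l hl => by
        rw [Submodule.mem_bot, LinearMap.comp_apply, LinearMap.comp_apply, mp_single]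
        exact h0 _ (hmv hl)) (Dk_fl hc)
    exact this
  rw [e, map_sub, map_sub, e2, e3, sub_zero, sub_zero] at e1
  exact e1

omit hs in
/-- Vanishing of locally finite cycles from vanishing of homogeneous cocycles. -/
theorem duality (b : Module.Basis (Fin N) ℝ E) (hX : ∀ S ∈ P, ∀ v ∈ S, emb v ≠ 0) (ha : LF P wr (N - n) a)
    (hn : Module.finrank K M = n) (h2 : 2 ≤ n) (hnN : n ≤ N) (Sg : Set (ι ≃ ι))
    (hSg : ∀ σ ∈ Sg, Sym (K := K) emb L P rk a σ)
    (HE : ∀ β : List ι → ℚ,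
      (∀ l : List ι, (∀ x ∈ l, emb x ≠ 0) → l.length = n + 1 →
        Finsupp.linearCombination ℚ β (bdL l) = 0) →
      (∀ l : List ι, (∀ x ∈ l, emb x ≠ 0) → l.length = n →
        Submodule.span K (emb '' {x | x ∈ l}) ≠ ⊤ → β l = 0) →
      (∀ σ ∈ Sg, ∀ l : List ι, (∀ x ∈ l, emb x ≠ 0) → l.length = n → β (l.map σ) = β l) →
      ∀ l : List ι, (∀ x ∈ l, emb x ≠ 0) → l.length = n → β l = 0) (l : List (Set ι)) :
    a l = 0 := by
  have hmin : ∀ S ∈ P, wr S → n ≤ rk S := fun S hS hw => by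
    have := geo.span_le S hS
    rwa [(geo.wr_iff S).1 hw, finrank_top, hn] at this
  obtain ⟨f, hf⟩ := exists_carried (r := fun _ _ => True) (X := {v : ι | emb v ≠ 0})
    (DA K emb P rk) (fun A B k h => DA_mono k h) (fun A => nil_mem_Dk)
    (fun l _ hl hne => dex_DA geo l hl hne)
  have hfl : ∀ {k : ℕ} {l : List ι}, (∀ x ∈ l, emb x ≠ 0) → l.length = k →
      l ∈ flS (fun _ _ => True) {v : ι | emb v ≠ 0} k := fun h1 h2 =>
    ⟨List.pairwise_of_forall fun _ _ => trivial, h1, h2⟩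
  refine ha.eq_zero geo b (by omega) hnN hmin (fun c hc => theta_eq geo b hX ha hmin hn h2 hf
    (fun l hl => HE (fun l => alp L P rk wr n b a (f (Finsupp.single l 1))) ?_ ?_ ?_ l hl.2.1 hl.2.2)
    hc) l
  · intro l h1 h2
    have e : Finsupp.linearCombination ℚ (fun l => alp L P rk wr n b a (f (Finsupp.single l 1))) =
        alp L P rk wr n b a ∘ₗ f := by
      ext l; simp
    have h3 := hf.comm _ _ (single_mem_fl (hfl h1 h2) 1)
    rw [bd_single, one_smul] at h3
    rw [e, LinearMap.comp_apply, ← h3]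
    exact alp_bd geo b ha hmin (Dk_mono (fun _ h => h.1) (hf.mem n l (hfl h1 h2)))
  · intro l h1 h3 h4
    obtain ⟨m, rfl⟩ : ∃ m, n = m + 1 := ⟨n - 1, by omega⟩
    exact alp_DA geo b h4 (hf.mem m l (hfl h1 h3))
  · intro σ hσ l h1 h3
    exact (hSg σ hσ).theta geo b ha hmin hn h2 hf (hfl h1 h3)

end Duality
end LS

namespace LS
section Voronoi
open Filter Topology

/-- The properties of the evaluation functionals used to build the Voronoi poset. -/
structure Vor {K M E ι : Type*} [Field K] [AddCommGroup M] [Module K M] [NormedAddCommGroup E]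
    [NormedSpace ℝ E] (emb : ι → M) (L : ι → E →ₗ[ℝ] ℝ) (nm : ι → ℝ) : Prop where
  nm_fin : ∀ B, {v | nm v ≤ B}.Finite
  nm_nonneg : ∀ v, 0 ≤ nm v
  bdd : ∃ B > 0, ∀ v h, |L v h| ≤ B * ‖h‖ * nm v
  mink : ∀ q, ∀ c > 0, (∀ v, emb v ≠ 0 → c ≤ L v q) → ∃ δ > 0, ∀ v, δ * nm v ≤ L v q
  rho : ∀ U : Submodule K M, ∃ ρ, (∀ v, emb v ∈ U → L v ρ = 0) ∧ ∃ c > 0, ∀ v, emb v ∉ U → c ≤ L v ρ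
  recc : ∀ S : Set ι, Submodule.span K (emb '' S) = ⊤ → ∀ h,
    (∀ v, emb v ≠ 0 → 0 ≤ L v h) → (∀ v ∈ S, L v h = 0) → h = 0
  exists_mem : ∀ U : Submodule K M, U ≠ ⊥ → ∃ v, emb v ≠ 0 ∧ emb v ∈ U

/-- `q` is a positive point with minimum `1`, attained exactly on `T`. -/
structure Nf {M E ι : Type*} [AddCommGroup M] [AddCommGroup E] [Module ℝ E]
    (emb : ι → M) (L : ι → E →ₗ[ℝ] ℝ) (T : Set ι) (q : E) : Prop where
  ne : T.Nonempty
  sub : ∀ v ∈ T, emb v ≠ 0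
  one : ∀ v ∈ T, L v q = 1
  lt : ∀ v, emb v ≠ 0 → v ∉ T → 1 < L v q

/-- The Voronoi poset of sets of minimal vectors. -/
def PP {M E ι : Type*} [AddCommGroup M] [AddCommGroup E] [Module ℝ E]
    (emb : ι → M) (L : ι → E →ₗ[ℝ] ℝ) : Set (Set ι) := {T | ∃ q, Nf emb L T q}

/-- Vectors annihilated by all functionals with index in `S`. -/
def Zs {E ι : Type*} [AddCommGroup E] [Module ℝ E] (L : ι → E →ₗ[ℝ] ℝ) (S : Set ι) :
    Submodule ℝ E where
  carrier := {h | ∀ v ∈ S, L v h = 0}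
  zero_mem' := by simp
  add_mem' := fun ha hb v hv => by rw [map_add, ha v hv, hb v hv, add_zero]
  smul_mem' := fun c a ha v hv => by rw [map_smul, ha v hv, smul_zero]

/-- The rank of a set of functionals. -/
noncomputable def rks {E ι : Type*} [AddCommGroup E] [Module ℝ E] (L : ι → E →ₗ[ℝ] ℝ)
    (S : Set ι) : ℕ := Module.finrank ℝ E - Module.finrank ℝ (Zs L S)

lemma mem_Zs {E ι : Type*} [AddCommGroup E] [Module ℝ E] {L : ι → E →ₗ[ℝ] ℝ} {S : Set ι} {h : E} :
    h ∈ Zs L S ↔ ∀ v ∈ S, L v h = 0 := Iff.rfl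

lemma Zs_anti {E ι : Type*} [AddCommGroup E] [Module ℝ E] {L : ι → E →ₗ[ℝ] ℝ} {S T : Set ι}
    (h : S ⊆ T) : Zs L T ≤ Zs L S := fun _ hx v hv => hx v (h hv)

lemma finrank_sup_span {E : Type*} [AddCommGroup E] [Module ℝ E] [FiniteDimensional ℝ E]
    (Z : Submodule ℝ E) {x : E} (hx : x ∉ Z) :
    Module.finrank ℝ (Z ⊔ Submodule.span ℝ {x} : Submodule ℝ E) = Module.finrank ℝ Z + 1 := by
  have h := Submodule.finrank_sup_add_finrank_inf_eq Z (Submodule.span ℝ {x})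
  have h0 : x ≠ 0 := fun h => hx (h ▸ Z.zero_mem)
  have hinf : Z ⊓ Submodule.span ℝ {x} = ⊥ := by
    rw [← disjoint_iff, Submodule.disjoint_span_singleton' h0]
    exact hx
  rw [hinf, finrank_bot, finrank_span_singleton h0] at h
  omega

variable {K M E ι : Type*} [Field K] [AddCommGroup M] [Module K M] [NormedAddCommGroup E]
    [NormedSpace ℝ E] {emb : ι → M} {L : ι → E →ₗ[ℝ] ℝ} {nm : ι → ℝ}
    (V : Vor (K := K) emb L nm)

lemma Nf.min {T : Set ι} {q : E} (h : Nf emb L T q) (v : ι) (hv : emb v ≠ 0) : 1 ≤ L v q := by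
  by_cases hT : v ∈ T
  · exact (h.one v hT).ge
  · exact (h.lt v hv hT).le

lemma Nf.mem_iff {T : Set ι} {q : E} (h : Nf emb L T q) (v : ι) (hv : emb v ≠ 0) :
    v ∈ T ↔ L v q = 1 :=
  ⟨h.one v, fun h1 => by_contra fun hT => (h.lt v hv hT).ne' h1⟩

include V

lemma Vor.nbhd {q : E} {c : ℝ} (hc : 0 < c) (h : ∀ v, emb v ≠ 0 → c ≤ L v q) :
    ∃ η > 0, ∃ δ > 0, ∀ q', ‖q' - q‖ ≤ η → ∀ v, δ * nm v ≤ L v q' := by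
  obtain ⟨δ, hδ, h1⟩ := V.mink q c hc h
  obtain ⟨B, hB, h2⟩ := V.bdd
  refine ⟨δ / (2 * B), by positivity, δ / 2, by positivity, fun q' hq v => ?_⟩
  have h3 := h2 v (q' - q)
  have h4 : B * ‖q' - q‖ * nm v ≤ δ / 2 * nm v := by
    refine mul_le_mul_of_nonneg_right ?_ (V.nm_nonneg v)
    calc B * ‖q' - q‖ ≤ B * (δ / (2 * B)) := by gcongr
      _ = δ / 2 := by field_simp
  have h5 := (abs_le.1 (h3.trans h4)).1
  have h6 := h1 v
  rw [map_sub] at h5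
  linarith

lemma Vor.fin_le {q : E} {δ : ℝ} (hδ : 0 < δ) (h : ∀ v, δ * nm v ≤ L v q) (B : ℝ) :
    {v | L v q ≤ B}.Finite := by
  refine (V.nm_fin (B / δ)).subset fun v hv => ?_
  rw [Set.mem_ofPred_eq, le_div_iff₀ hδ]
  have : L v q ≤ B := hv
  linarith [h v]

lemma Nf.finite {T : Set ι} {q : E} (h : Nf emb L T q) : T.Finite := by
  obtain ⟨δ, hδ, h1⟩ := V.mink q 1 one_pos h.min
  exact (V.fin_le hδ h1 1).subset fun v hv => (h.one v hv).le

/-- Perturbing towards a supporting functional cuts out a face. -/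
lemma Nf.perturb {T S : Set ι} {q h : E} (hq : Nf emb L T q) (hne : S.Nonempty) (hS : S ⊆ T)
    (h0 : ∀ v ∈ S, L v h = 0) (h1 : ∀ v ∈ T, v ∉ S → 0 < L v h) :
    ∃ ε : ℝ, 0 < ε ∧ Nf emb L S (q + ε • h) := by
  obtain ⟨η, hη, δ, hδ, h2⟩ := V.nbhd one_pos hq.min
  have hcont : ∀ v, Tendsto (fun ε : ℝ => L v (q + ε • h)) (𝓝[>] 0) (𝓝 (L v q)) := fun v => by
    have : Tendsto (fun ε : ℝ => L v q + ε * L v h) (𝓝 0) (𝓝 (L v q + 0 * L v h)) :=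
      (continuous_const.add (continuous_id.mul continuous_const)).tendsto 0
    simp only [zero_mul, add_zero] at this
    simp only [map_add, map_smul, smul_eq_mul]
    exact this.mono_left nhdsWithin_le_nhds
  have hev1 : ∀ᶠ ε : ℝ in 𝓝[>] 0, ∀ v ∈ {v | nm v ≤ 1 / δ}, emb v ≠ 0 → v ∉ T →
      1 < L v (q + ε • h) := by
    refine (eventually_all_finite (V.nm_fin _)).2 fun v _ => ?_
    by_cases hv : emb v ≠ 0 ∧ v ∉ T
    · filter_upwards [(hcont v).eventually_const_lt (hq.lt v hv.1 hv.2)] with ε hε _ _ using hε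
    · exact Eventually.of_forall fun ε h1 h2 => absurd ⟨h1, h2⟩ hv
  have hev2 : ∀ᶠ ε : ℝ in 𝓝[>] 0, ‖(q + ε • h) - q‖ ≤ η := by
    have : Tendsto (fun ε : ℝ => ‖(q + ε • h) - q‖) (𝓝 0) (𝓝 ‖(q + (0 : ℝ) • h) - q‖) :=
      Continuous.tendsto (by fun_prop) 0
    simp only [zero_smul, add_zero, sub_self, norm_zero] at this
    exact ((this.mono_left nhdsWithin_le_nhds).eventually_lt_const hη).mono fun _ h => h.le
  have hev3 : ∀ᶠ ε : ℝ in 𝓝[>] 0, 0 < ε := self_mem_nhdsWithin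
  obtain ⟨ε, e1, e2, e3⟩ := (hev1.and (hev2.and hev3)).exists
  refine ⟨ε, e3, hne, fun v hv => hq.sub v (hS hv), fun v hv => ?_, fun v hv hvS => ?_⟩
  · simp [h0 v hv, hq.one v (hS hv)]
  · by_cases hvT : v ∈ T
    · have := mul_pos e3 (h1 v hvT hvS)
      simp only [map_add, map_smul, smul_eq_mul, hq.one v hvT]
      linarith
    · by_cases hv1 : nm v ≤ 1 / δ
      · exact e1 v hv1 hv hvT
      · refine lt_of_lt_of_le ?_ (h2 _ e2 v)
        rw [not_le, div_lt_iff₀' hδ] at hv1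
        exact hv1

omit V in
lemma Nf.sub_pos {S T : Set ι} {q q' : E} (hS : Nf emb L S q) (hT : Nf emb L T q') (h : S ⊆ T) :
    (∀ v ∈ S, L v (q - q') = 0) ∧ ∀ v ∈ T, v ∉ S → 0 < L v (q - q') := by
  refine ⟨fun v hv => ?_, fun v hv hvS => ?_⟩
  · rw [map_sub, hS.one v hv, hT.one v (h hv), sub_self]
  · rw [map_sub, hT.one v hv]
    linarith [hS.lt v (hT.sub v hv) hvS]

/-- Intervals in the Voronoi poset are homology spheres. -/
theorem Vor.interval [FiniteDimensional ℝ E] {R T : Set ι} {q h0 : E} (hq : Nf emb L T q)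
    (hRT : R ⊂ T) (h0R : ∀ v ∈ R, L v h0 = 0) (h0T : ∀ v ∈ T, v ∉ R → 0 < L v h0) {m : ℕ}
    (hm : Module.finrank ℝ (Zs L R) = Module.finrank ℝ (Zs L T) + 1 + m) :
    Sph (· < ·) {S | S ∈ PP emb L ∧ R < S ∧ S < T} m := by
  set Φ := T \ R with hΦ
  set g : ι → E →ₗ[ℝ] ℝ := fun w => (L w h0)⁻¹ • L w with hg
  have hgv : ∀ w h, g w h = (L w h0)⁻¹ * L w h := fun w h => rfl
  have hTf := hq.finite V
  have hΦf : Φ.Finite := hTf.subset Set.sdiff_subset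
  obtain ⟨w1, hw1T, hw1R⟩ := Set.exists_of_ssubset hRT
  have hΦne : Φ.Nonempty := ⟨w1, hw1T, hw1R⟩
  have hU : R ∪ Φ = T := Set.union_sdiff_cancel hRT.1
  have key : {S | S ∈ PP emb L ∧ R < S ∧ S < T} = TW R Φ g (Zs L R) := by
    ext S
    constructor
    · rintro ⟨⟨q2, hS⟩, hRS, hST⟩
      obtain ⟨hz, hp⟩ := hS.sub_pos hq hST.1
      obtain ⟨w0, hw0S, hw0R⟩ := Set.exists_of_ssubset hRS
      have hgz : ∀ w ∈ S, g w (q2 - q) = 0 := fun w hw => by rw [hgv, hz w hw, mul_zero]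
      have hgp : ∀ w ∈ T, w ∉ S → 0 < g w (q2 - q) := fun w hw hwS => by
        rw [hgv]; exact mul_pos (inv_pos.2 (h0T w hw fun h => hwS (hRS.1 h))) (hp w hw hwS)
      refine ⟨⟨q2 - q, fun v hv => hz v (hRS.1 hv), ?_⟩, ?_⟩
      · dsimp only
        refine Set.Subset.antisymm (Set.union_subset hRS.1 ?_) ?_
        · intro w hw
          by_contra hwS
          have h1 := hw.2 w0 ⟨hST.1 hw0S, hw0R⟩
          rw [aff_apply, aff_apply, hgz w0 hw0S] at h1
          exact absurd (hgp w hw.1.1 hwS) (not_lt.2 h1)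
        · intro w hw
          by_cases hwR : w ∈ R
          · exact Or.inl hwR
          · refine Or.inr ⟨⟨hST.1 hw, hwR⟩, fun j hj => ?_⟩
            rw [aff_apply, aff_apply, hgz w hw]
            by_cases hjS : j ∈ S
            · exact (hgz j hjS).ge
            · exact (hgp j hj.1 hjS).le
      · rw [hU]
        exact hST.ne
    · rintro ⟨⟨h, hW, rfl⟩, hne⟩
      obtain ⟨w0, hw0⟩ := am_nonempty hΦf hΦne (aff g) h
      have hsub : R ∪ am Φ (aff g) h ⊆ T := Set.union_subset hRT.1 (am_subset.trans Set.sdiff_subset)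
      refine ⟨?_, ?_, ?_⟩
      · have hL : ∀ w ∈ Φ, L w (h - g w0 h • h0) = L w h0 * (g w h - g w0 h) := fun w hw => by
          have := (h0T w hw.1 hw.2).ne'
          rw [map_sub, map_smul, smul_eq_mul, hgv w h, mul_sub, mul_inv_cancel_left₀ this, mul_comm (g w0 h)]
        suffices h4 : ∃ ε : ℝ, 0 < ε ∧ Nf emb L (R ∪ am Φ (aff g) h) (q + ε • (h - g w0 h • h0)) from
          h4.elim fun ε h4 => ⟨_, h4.2⟩
        refine hq.perturb V ⟨w0, Or.inr hw0⟩ hsub ?_ ?_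
        · rintro v (hv | hv)
          · rw [map_sub, map_smul, hW v hv, h0R v hv, smul_zero, sub_zero]
          · rw [hL v hv.1]
            have h2 := hv.2 w0 hw0.1
            have h3 := hw0.2 v hv.1
            rw [aff_apply, aff_apply] at h2 h3
            rw [h2.antisymm h3, sub_self, mul_zero]
        · intro v hvT hv
          have hvΦ : v ∈ Φ := ⟨hvT, fun h => hv (Or.inl h)⟩
          rw [hL v hvΦ]
          refine mul_pos (h0T v hvT hvΦ.2) ?_
          by_contra hle
          refine hv (Or.inr ⟨hvΦ, fun j hj => ?_⟩)
          have h3 := hw0.2 j hj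
          rw [aff_apply, aff_apply] at h3 ⊢
          linarith
      · exact ⟨Set.subset_union_left, fun h => hw0.1.2 (h (Or.inr hw0))⟩
      · rw [Set.mem_singleton_iff, hU] at hne
        exact lt_of_le_of_ne hsub hne
  rw [key]
  refine sphere hΦf Set.disjoint_sdiff_right m (Zs L R) ?_
  have hh0 : h0 ∉ Zs L T := fun h => (h0T w1 hw1T hw1R).ne' (h w1 hw1T)
  have hK : Zs L R ⊓ Kc Φ g = Zs L T ⊔ Submodule.span ℝ {h0} := by
    apply le_antisymm
    · rintro h ⟨h1, h2⟩
      have : h = (h - g w1 h • h0) + g w1 h • h0 := by abel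
      rw [this]
      refine Submodule.add_mem_sup (fun v hv => ?_)
        (Submodule.smul_mem _ _ (Submodule.mem_span_singleton_self _))
      rw [map_sub, map_smul, smul_eq_mul]
      by_cases hvR : v ∈ R
      · rw [h1 v hvR, h0R v hvR, mul_zero, sub_zero]
      · rw [← h2 v ⟨hv, hvR⟩ w1 ⟨hw1T, hw1R⟩, hgv]
        have := (h0T v hv hvR).ne'
        field_simp
        ring
    · refine sup_le (fun h hh => ⟨Zs_anti hRT.1 hh, fun i hi j hj => ?_⟩) ?_
      · rw [hgv, hgv, hh i hi.1, hh j hj.1, mul_zero, mul_zero]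
      · rw [Submodule.span_singleton_le_iff_mem]
        refine ⟨h0R, fun i hi j hj => ?_⟩
        rw [hgv, hgv, inv_mul_cancel₀ (h0T i hi.1 hi.2).ne', inv_mul_cancel₀ (h0T j hj.1 hj.2).ne']
  rw [hK, finrank_sup_span _ hh0, hm]

end Voronoi
end LS

namespace LS
section Voronoi
open Filter Topology

variable {K M E ι : Type*} [Field K] [AddCommGroup M] [Module K M] [NormedAddCommGroup E]
    [NormedSpace ℝ E] [FiniteDimensional ℝ E] {emb : ι → M} {L : ι → E →ₗ[ℝ] ℝ} {nm : ι → ℝ}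
    (V : Vor (K := K) emb L nm)

/-- Points with minimum at least one, attained on `S`. -/
def FF {M E ι : Type*} [AddCommGroup M] [AddCommGroup E] [Module ℝ E]
    (emb : ι → M) (L : ι → E →ₗ[ℝ] ℝ) (S : Set ι) : Set E :=
  {q | (∀ v ∈ S, L v q = 1) ∧ ∀ v, emb v ≠ 0 → 1 ≤ L v q}

omit [FiniteDimensional ℝ E] in
lemma FF_nf {S : Set ι} (hne : S.Nonempty) (hS : ∀ v ∈ S, emb v ≠ 0) {q : E} (hq : q ∈ FF emb L S) :
    Nf emb L {v | emb v ≠ 0 ∧ L v q = 1} q where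
  ne := hne.imp fun v hv => ⟨hS v hv, hq.1 v hv⟩
  sub _ hv := hv.1
  one _ hv := hv.2
  lt v hv hn := (hq.2 v hv).lt_of_ne fun h => hn ⟨hv, h.symm⟩

lemma FF_closed (S : Set ι) : IsClosed (FF emb L S) := by
  have hc : ∀ v, Continuous (L v) := fun v => (L v).continuous_of_finiteDimensional
  have : FF emb L S = (⋂ v ∈ S, {q | L v q = 1}) ∩ ⋂ v ∈ {v | emb v ≠ 0}, {q | 1 ≤ L v q} := by
    ext q; simp [FF]
  rw [this]
  refine IsClosed.inter (isClosed_biInter fun v _ => ?_) (isClosed_biInter fun v _ => ?_)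
  · exact isClosed_eq (hc v) continuous_const
  · exact isClosed_le continuous_const (hc v)

lemma Zs_lt {S T : Set ι} {h0 : E} (hST : S ⊂ T)
    (h0S : ∀ v ∈ S, L v h0 = 0) (h0T : ∀ v ∈ T, v ∉ S → 0 < L v h0) :
    Module.finrank ℝ (Zs L T) < Module.finrank ℝ (Zs L S) := by
  refine Submodule.finrank_lt_finrank_of_lt (lt_of_le_of_ne (Zs_anti hST.1) fun h => ?_)
  obtain ⟨w, hw, hwS⟩ := Set.exists_of_ssubset hST
  have : h0 ∈ Zs L T := h ▸ h0S
  exact (h0T w hw hwS).ne' (this w hw)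

include V

lemma Vor.FF_bounded {S : Set ι} (hspan : Submodule.span K (emb '' S) = ⊤) :
    ∃ B, ∀ q ∈ FF emb L S, ‖q‖ ≤ B := by
  by_contra! hcon
  choose q hq hqn using fun k : ℕ => hcon (k + 1)
  have hpos : ∀ k, 0 < ‖q k‖ := fun k => lt_trans (by positivity) (hqn k)
  set x : ℕ → E := fun k => ‖q k‖⁻¹ • q k with hx
  have hxs : ∀ k, x k ∈ Metric.sphere (0 : E) 1 := fun k => by
    rw [mem_sphere_zero_iff_norm, hx, norm_smul, norm_inv, norm_norm, inv_mul_cancel₀ (hpos k).ne']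
  obtain ⟨h, hh, φ, hφ, hlim⟩ := (isCompact_sphere (0 : E) 1).tendsto_subseq hxs
  have hc : ∀ v, Continuous (L v) := fun v => (L v).continuous_of_finiteDimensional
  have hL : ∀ v, Tendsto (fun k => L v (x (φ k))) atTop (𝓝 (L v h)) := fun v =>
    ((hc v).tendsto h).comp hlim
  have hinf : Tendsto (fun k => ‖q (φ k)‖⁻¹) atTop (𝓝 0) := by
    refine tendsto_inv_atTop_zero.comp (tendsto_atTop_mono (fun k => ?_) tendsto_natCast_atTop_atTop)
    refine le_trans ?_ (hqn (φ k)).le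
    have : (k : ℝ) ≤ (φ k : ℝ) := by exact_mod_cast hφ.id_le k
    linarith
  have h0 : h = 0 := by
    refine V.recc S hspan h (fun v hv => ?_) fun v hv => ?_
    · refine ge_of_tendsto' (hL v) fun k => ?_
      rw [hx, map_smul, smul_eq_mul]
      exact mul_nonneg (inv_nonneg.2 (norm_nonneg _)) (zero_le_one.trans ((hq _).2 v hv))
    · have : Tendsto (fun k => L v (x (φ k))) atTop (𝓝 0) := by
        refine hinf.congr fun k => ?_
        rw [hx, map_smul, smul_eq_mul, (hq _).1 v hv, mul_one]
      exact tendsto_nhds_unique (hL v) this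
  rw [h0, mem_sphere_zero_iff_norm, norm_zero] at hh
  exact zero_ne_one hh

lemma Vor.FF_compact {S : Set ι} (hspan : Submodule.span K (emb '' S) = ⊤) :
    IsCompact (FF emb L S) := by
  obtain ⟨B, hB⟩ := V.FF_bounded hspan
  exact (isCompact_closedBall (0 : E) B).of_isClosed_subset (FF_closed S)
    fun q hq => mem_closedBall_zero_iff.2 (hB q hq)

lemma Vor.exists_finite {S : Set ι} (hspan : Submodule.span K (emb '' S) = ⊤) :
    ∃ Φ : Set ι, Φ.Finite ∧ ∀ T ∈ PP emb L, S ⊆ T → T ⊆ Φ := by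
  have key : ∃ Φ : Set ι, Φ.Finite ∧ ∀ q ∈ FF emb L S, {v | L v q ≤ 1} ⊆ Φ := by
    refine (V.FF_compact hspan).induction_on (p := fun X => ∃ Φ : Set ι, Φ.Finite ∧ ∀ q ∈ X,
      {v | L v q ≤ 1} ⊆ Φ) ⟨∅, Set.finite_empty, by simp⟩ ?_ ?_ ?_
    · rintro s t hst ⟨Φ, h1, h2⟩
      exact ⟨Φ, h1, fun q hq => h2 q (hst hq)⟩
    · rintro s t ⟨Φ, h1, h2⟩ ⟨Ψ, h3, h4⟩
      refine ⟨Φ ∪ Ψ, h1.union h3, fun q hq => ?_⟩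
      rcases hq with hq | hq
      · exact (h2 q hq).trans Set.subset_union_left
      · exact (h4 q hq).trans Set.subset_union_right
    · intro q hq
      obtain ⟨η, hη, δ, hδ, h⟩ := V.nbhd one_pos hq.2
      refine ⟨Metric.closedBall q η, nhdsWithin_le_nhds (Metric.closedBall_mem_nhds q hη),
        {v | nm v ≤ 1 / δ}, V.nm_fin _, fun q' hq' v hv => ?_⟩
      rw [Set.mem_ofPred_eq, le_div_iff₀' hδ]
      exact (h q' (mem_closedBall_iff_norm.1 hq') v).trans hv
  obtain ⟨Φ, h1, h2⟩ := key
  refine ⟨Φ, h1, ?_⟩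
  rintro T ⟨q, hq⟩ hST v hv
  exact h2 q ⟨fun v hv => hq.one v (hST hv), hq.min⟩ (hq.one v hv).le

lemma Nf.ray {S : Set ι} {q h : E} (hq : Nf emb L S q) (hspan : Submodule.span K (emb '' S) = ⊤)
    (hz : h ∈ Zs L S) (hne : h ≠ 0) :
    ∃ s : ℝ, 0 < s ∧ ∃ T, Nf emb L T (q + s • h) ∧ S < T := by
  set A : Set ℝ := {s | 0 ≤ s ∧ q + s • h ∈ FF emb L S} with hA
  have h0A : (0 : ℝ) ∈ A := ⟨le_rfl, by
    rw [zero_smul, add_zero]; exact ⟨hq.one, hq.min⟩⟩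
  have hcl : IsClosed A := by
    have hcont : Continuous fun s : ℝ => q + s • h := by fun_prop
    exact isClosed_Ici.inter ((FF_closed S).preimage hcont)
  have hbd : BddAbove A := by
    obtain ⟨B, hB⟩ := V.FF_bounded hspan
    refine ⟨(B + ‖q‖) / ‖h‖, fun s hs => ?_⟩
    rw [le_div_iff₀ (norm_pos_iff.2 hne)]
    have h1 := hB _ hs.2
    have h2 : ‖s • h‖ ≤ ‖q + s • h‖ + ‖q‖ := by
      have := norm_sub_le (q + s • h) q
      rwa [add_sub_cancel_left] at this
    rw [norm_smul, Real.norm_of_nonneg hs.1] at h2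
    linarith
  have hs := hcl.csSup_mem ⟨0, h0A⟩ hbd
  set s := sSup A with hsdef
  have hT := FF_nf hq.ne hq.sub hs.2
  set T := {v | emb v ≠ 0 ∧ L v (q + s • h) = 1} with hTdef
  have hST : S ⊆ T := fun v hv => ⟨hq.sub v hv, hs.2.1 v hv⟩
  have hneq : S ≠ T := fun he => by
    rw [← he] at hT
    obtain ⟨ε, hε, h1⟩ := hT.perturb V hT.ne subset_rfl hz fun v hv hv' => absurd hv hv'
    have h2 : s + ε ∈ A := by
      refine ⟨by linarith [hs.1], ?_⟩
      rw [add_smul, ← add_assoc]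
      exact ⟨h1.one, h1.min⟩
    linarith [le_csSup hbd h2]
  refine ⟨s, hs.1.lt_of_ne fun h0 => hneq ?_, T, hT, lt_of_le_of_ne hST hneq⟩
  ext v
  constructor
  · exact fun h => hST h
  · intro hv
    rw [hq.mem_iff v hv.1]
    have := hv.2
    rwa [← h0, zero_smul, add_zero] at this

/-- The part of the Voronoi poset above a well-rounded element is a homology sphere. -/
theorem Vor.above {S : Set ι} {q : E} (hq : Nf emb L S q)
    (hspan : Submodule.span K (emb '' S) = ⊤) :
    Sph (· < ·) {T ∈ PP emb L | S < T} (Module.finrank ℝ (Zs L S)) := by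
  obtain ⟨Φ₀, hΦ₀, hΦ₀'⟩ := V.exists_finite hspan
  set Φ := ⋃₀ {T ∈ PP emb L | S ⊆ T} \ S with hΦ
  have hΦf : Φ.Finite := hΦ₀.subset
    (Set.sdiff_subset.trans (Set.sUnion_subset fun T hT => hΦ₀' T hT.1 hT.2))
  have hdisj : Disjoint S Φ := Set.disjoint_sdiff_right
  have hpos : ∀ w ∈ Φ, 0 < L w q - 1 := by
    rintro w ⟨⟨T, ⟨⟨q', hT⟩, _⟩, hw⟩, hwS⟩
    linarith [hq.lt w (hT.sub w hw) hwS]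
  set g : ι → E →ₗ[ℝ] ℝ := fun w => (L w q - 1)⁻¹ • L w with hg
  have hgv : ∀ w h, g w h = (L w q - 1)⁻¹ * L w h := fun w h => rfl
  have hray : ∀ h ∈ Zs L S, h ≠ 0 → ∃ s : ℝ, 0 < s ∧ ∃ T ∈ PP emb L, Nf emb L T (q + s • h) ∧ S < T ∧
      (∀ w ∈ Φ, -s⁻¹ ≤ g w h) ∧ ∀ w ∈ Φ, (g w h = -s⁻¹ ↔ w ∈ T) := by
    intro h hz hne
    obtain ⟨s, hs, T, hT, hST⟩ := hq.ray V hspan hz hne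
    have hw : ∀ w, L w (q + s • h) = L w q + s * L w h := fun w => by simp
    have hwΦ : ∀ w ∈ Φ, emb w ≠ 0 := by
      rintro w ⟨⟨T, ⟨⟨q', hT⟩, _⟩, hw⟩, hwS⟩
      exact hT.sub w hw
    have heq : ∀ w ∈ Φ, L w (q + s • h) - 1 = s * (L w q - 1) * (g w h - -s⁻¹) := fun w hwf => by
      have := (hpos w hwf).ne'
      rw [hw, hgv]
      field_simp
      ring
    refine ⟨s, hs, T, ⟨_, hT⟩, hT, hST, fun w hwf => ?_, fun w hwf => ?_⟩
    · have h1 := hT.min w (hwΦ w hwf)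
      have h2 := heq w hwf
      have h3 : 0 < s * (L w q - 1) := mul_pos hs (hpos w hwf)
      by_contra hlt
      nlinarith
    · rw [hT.mem_iff w (hwΦ w hwf), ← sub_eq_zero, ← sub_eq_zero (b := (1 : ℝ)), heq w hwf,
        mul_eq_zero, or_iff_right (mul_pos hs (hpos w hwf)).ne']
  have hTΦ : ∀ T ∈ PP emb L, S < T → ∃ w, w ∈ T ∧ w ∈ Φ := fun T hT hST => by
    obtain ⟨w, hw, hwS⟩ := Set.exists_of_ssubset hST
    exact ⟨w, hw, ⟨T, ⟨hT, hST.1⟩, hw⟩, hwS⟩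
  have hK : Zs L S ⊓ Kc Φ g = ⊥ := by
    rw [eq_bot_iff]
    rintro h ⟨h1, h2⟩
    by_contra hne
    obtain ⟨s, hs, T, hTP, hT, hST, -, h4⟩ := hray h h1 hne
    obtain ⟨s', hs', T', hTP', hT', hST', -, h4'⟩ := hray (-h) (neg_mem h1) (neg_ne_zero.2 hne)
    obtain ⟨w, hw, hwΦ⟩ := hTΦ T hTP hST
    obtain ⟨w', hw', hwΦ'⟩ := hTΦ T' hTP' hST'
    have e1 := (h4 w hwΦ).2 hw
    have e2 := (h4' w' hwΦ').2 hw'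
    rw [map_neg, ← h2 w hwΦ w' hwΦ', e1] at e2
    have := inv_pos.2 hs
    have := inv_pos.2 hs'
    linarith
  have key : {T ∈ PP emb L | S < T} = TW S Φ g (Zs L S) := by
    ext T
    constructor
    · rintro ⟨⟨q2, hT⟩, hST⟩
      obtain ⟨w0, hw0T, hw0⟩ := hTΦ T ⟨q2, hT⟩ hST
      have hz : q2 - q ∈ Zs L S := fun v hv => by
        rw [map_sub, hq.one v hv, hT.one v (hST.1 hv), sub_self]
      have hgq : ∀ w ∈ Φ, g w (q2 - q) = (L w q - 1)⁻¹ * (L w q2 - 1) - 1 := fun w hw => by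
        have := (hpos w hw).ne'
        rw [hgv, map_sub]
        field_simp
        ring
      have hgT : ∀ w ∈ Φ, w ∈ T → g w (q2 - q) = -1 := fun w hw hwT => by
        rw [hgq w hw, hT.one w hwT, sub_self, mul_zero, zero_sub]
      have hgnT : ∀ w ∈ Φ, w ∉ T → -1 < g w (q2 - q) := fun w hw hwT => by
        rw [hgq w hw]
        have : emb w ≠ 0 := by
          obtain ⟨⟨T, ⟨⟨q', hT⟩, _⟩, hw⟩, hwS⟩ := hw
          exact hT.sub w hw
        have := mul_pos (inv_pos.2 (hpos w hw)) (sub_pos.2 (hT.lt w this hwT))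
        linarith
      have hTe : S ∪ am Φ (aff g) (q2 - q) = T := by
        refine Set.Subset.antisymm (Set.union_subset hST.1 fun w hw => ?_) fun w hw => ?_
        · by_contra hwT
          have h1 := hw.2 w0 hw0
          rw [aff_apply, aff_apply, hgT w0 hw0 hw0T] at h1
          exact absurd (hgnT w hw.1 hwT) (not_lt.2 h1)
        · by_cases hwS : w ∈ S
          · exact Or.inl hwS
          · have hwΦ : w ∈ Φ := ⟨⟨T, ⟨⟨q2, hT⟩, hST.1⟩, hw⟩, hwS⟩
            refine Or.inr ⟨hwΦ, fun j hj => ?_⟩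
            rw [aff_apply, aff_apply, hgT w hwΦ hw]
            by_cases hjT : j ∈ T
            · exact (hgT j hj hjT).ge
            · exact (hgnT j hj hjT).le
      refine ⟨⟨_, hz, hTe⟩, fun he => ?_⟩
      have hmem : q2 - q ∈ Zs L S ⊓ Kc Φ g := by
        refine ⟨hz, fun i hi j hj => ?_⟩
        have hΦT : Φ ⊆ T := by
          rw [he]; exact Set.subset_union_right
        rw [hgT i hi (hΦT hi), hgT j hj (hΦT hj)]
      rw [hK, Submodule.mem_bot, sub_eq_zero] at hmem
      subst hmem
      refine hST.ne (Set.Subset.antisymm hST.1 fun w hw => ?_)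
      rw [hq.mem_iff w (hT.sub w hw), hT.one w hw]
    · rintro ⟨⟨h, hz, rfl⟩, hne⟩
      have hne0 : h ≠ 0 := by
        rintro rfl
        refine hne ?_
        dsimp only
        rw [Set.mem_singleton_iff]
        congr 1
        exact Set.Subset.antisymm am_subset fun w hw => ⟨hw, fun j _ => by simp⟩
      obtain ⟨s, hs, T, hTP, hT, hST, h3, h4⟩ := hray h hz hne0
      have : S ∪ am Φ (aff g) h = T := by
        obtain ⟨w0, hw0T, hw0⟩ := hTΦ T hTP hST
        refine Set.Subset.antisymm (Set.union_subset hST.1 fun w hw => ?_) fun w hw => ?_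
        · have h1 := hw.2 w0 hw0
          rw [aff_apply, aff_apply, (h4 w0 hw0).2 hw0T] at h1
          exact (h4 w hw.1).1 (h1.antisymm (h3 w hw.1))
        · by_cases hwS : w ∈ S
          · exact Or.inl hwS
          · have hwΦ : w ∈ Φ := ⟨⟨T, ⟨hTP, hST.1⟩, hw⟩, hwS⟩
            refine Or.inr ⟨hwΦ, fun j hj => ?_⟩
            rw [aff_apply, aff_apply, (h4 w hwΦ).2 hw]
            exact h3 j hj
      dsimp only
      rw [this]
      exact ⟨hTP, hST⟩
  rw [key]
  refine sphere hΦf hdisj _ (Zs L S) ?_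
  rw [hK, finrank_bot, zero_add]

end Voronoi
end LS

namespace LS
section Voronoi
open Filter Topology

lemma am_nonempty_of_fin {V ι : Type*} [AddCommGroup V] [Module ℝ V] {I : Set ι}
    {g : ι → V →ᵃ[ℝ] ℝ} {q : V} {v0 : ι} (h0 : v0 ∈ I) (h : {v ∈ I | g v q ≤ g v0 q}.Finite) :
    (am I g q).Nonempty := by
  obtain ⟨v, hv⟩ := am_nonempty h ⟨v0, h0, le_rfl⟩ g q
  refine ⟨v, hv.1.1, fun j hj => ?_⟩
  rcases le_or_gt (g j q) (g v0 q) with h1 | h1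
  · exact hv.2 j ⟨hj, h1⟩
  · exact hv.1.2.trans h1.le

lemma hull_finite {E ι : Type*} [NormedAddCommGroup E] [NormedSpace ℝ E]
    {A : Set E} (hA : Convex ℝ A) (t : E → Set ι)
    (hloc : ∀ q ∈ A, ∃ u ∈ 𝓝 q, ∃ Φ : Set ι, Φ.Finite ∧ ∀ q' ∈ u, q' ∈ A → t q' ⊆ Φ)
    (s : Finset E) (hs : (s : Set E) ⊆ A) :
    ∃ Φ : Set ι, Φ.Finite ∧ ∀ q ∈ convexHull ℝ (s : Set E), t q ⊆ Φ := by
  have hsub := convexHull_min hs hA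
  have hcomp : IsCompact (convexHull ℝ (s : Set E)) :=
    Set.Finite.isCompact_convexHull (𝕜 := ℝ) s.finite_toSet
  refine hcomp.induction_on
    (p := fun X => ∃ Φ : Set ι, Φ.Finite ∧ ∀ q ∈ X, t q ⊆ Φ) ⟨∅, Set.finite_empty, by simp⟩ ?_ ?_ ?_
  · rintro s t hst ⟨Φ, h1, h2⟩
    exact ⟨Φ, h1, fun q hq => h2 q (hst hq)⟩
  · rintro s t ⟨Φ, h1, h2⟩ ⟨Ψ, h3, h4⟩
    refine ⟨Φ ∪ Ψ, h1.union h3, fun q hq => ?_⟩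
    rcases hq with hq | hq
    · exact (h2 q hq).trans Set.subset_union_left
    · exact (h4 q hq).trans Set.subset_union_right
  · intro q hq
    obtain ⟨u, hu, Φ, hΦ, h⟩ := hloc q (hsub hq)
    exact ⟨u ∩ convexHull ℝ s, inter_mem (nhdsWithin_le_nhds hu) self_mem_nhdsWithin, Φ, hΦ,
      fun q' hq' => h q' hq'.1 (hsub hq'.2)⟩

variable {K M E ι : Type*} [Field K] [AddCommGroup M] [Module K M] [NormedAddCommGroup E]
    [NormedSpace ℝ E] [FiniteDimensional ℝ E] {emb : ι → M} {L : ι → E →ₗ[ℝ] ℝ} {nm : ι → ℝ}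
    (V : Vor (K := K) emb L nm)

lemma eventually_lt_of_affine (f : E →ᵃ[ℝ] ℝ) {q : E} {B : ℝ} (h : f q < B) :
    ∀ᶠ q' in 𝓝 q, f q' < B :=
  (f.continuous_of_finiteDimensional.tendsto q).eventually_lt_const h

include V

lemma Vor.exU (U : Submodule K M) (hU : U ≠ ⊥) (k : ℕ) :
    Ex (· < ·) {S ∈ PP emb L | emb '' S ⊆ U} k := by
  obtain ⟨v0, hv0, hv0U⟩ := V.exists_mem U hU
  obtain ⟨ρ, hρ, c, hc, hρ'⟩ := V.rho U
  set I : Set ι := {v | emb v ≠ 0 ∧ emb v ∈ U} with hI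
  set A : Set E := {q | ∃ c > 0, ∀ v, emb v ≠ 0 → c ≤ L v q} with hA
  have hAc : Convex ℝ A := by
    rintro q1 ⟨c1, h1, h1'⟩ q2 ⟨c2, h2, h2'⟩ a b ha hb hab
    refine ⟨min c1 c2, lt_min h1 h2, fun v hv => ?_⟩
    rw [map_add, map_smul, map_smul, smul_eq_mul, smul_eq_mul]
    have e1 := (min_le_left c1 c2).trans (h1' v hv)
    have e2 := (min_le_right c1 c2).trans (h2' v hv)
    calc min c1 c2 = a * min c1 c2 + b * min c1 c2 := by rw [← add_mul, hab, one_mul]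
      _ ≤ _ := by gcongr
  have hAne : A.Nonempty := by
    obtain ⟨ρ, hρ, c, hc, hρ'⟩ := V.rho (⊥ : Submodule K M)
    exact ⟨ρ, c, hc, fun v hv => hρ' v (by simpa using hv)⟩
  have hamne : ∀ q ∈ A, (am I (aff L) q).Nonempty := by
    rintro q ⟨c, hc, h⟩
    obtain ⟨δ, hδ, h1⟩ := V.mink q c hc h
    refine am_nonempty_of_fin (v0 := v0) ⟨hv0, hv0U⟩
      ((V.fin_le hδ h1 (L v0 q)).subset fun v hv => hv.2)
  have key : {S ∈ PP emb L | emb '' S ⊆ U} =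
      (fun q => ∅ ∪ (am I (aff L) q ∪ am ∅ (aff L) q)) '' A := by
    ext S
    simp only [am_empty, Set.union_empty, Set.empty_union]
    constructor
    · rintro ⟨⟨q, hS⟩, hSU⟩
      obtain ⟨w0, hw0⟩ := hS.ne
      have hSI : S ⊆ I := fun v hv => ⟨hS.sub v hv, hSU ⟨v, hv, rfl⟩⟩
      refine ⟨q, ⟨1, one_pos, hS.min⟩, Set.Subset.antisymm (fun v hv => ?_) fun v hv => ?_⟩
      · rw [hS.mem_iff v hv.1.1]
        have := hv.2 w0 (hSI hw0)
        rw [aff_apply, aff_apply, hS.one w0 hw0] at this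
        exact this.antisymm (hS.min v hv.1.1)
      · refine ⟨hSI hv, fun j hj => ?_⟩
        rw [aff_apply, aff_apply, hS.one v hv]
        exact hS.min j hj.1
    · rintro ⟨q, hq, rfl⟩
      obtain ⟨w0, hw0⟩ := hamne q hq
      obtain ⟨c1, hc1, h1⟩ := hq
      have hμ : 0 < L w0 q := hc1.trans_le (h1 w0 hw0.1.1)
      refine ⟨⟨(L w0 q)⁻¹ • (q + (L w0 q / c) • ρ), ⟨⟨w0, hw0⟩, fun v hv => hv.1.1, fun v hv => ?_,
        fun v hv hn => ?_⟩⟩, ?_⟩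
      · rw [map_smul, map_add, map_smul, hρ v hv.1.2, smul_zero, add_zero, smul_eq_mul,
          show L v q = L w0 q from (hv.2 w0 hw0.1).antisymm (hw0.2 v hv.1), inv_mul_cancel₀ hμ.ne']
      · rw [map_smul, map_add, map_smul, smul_eq_mul, smul_eq_mul, ← div_eq_inv_mul,
          one_lt_div hμ]
        by_cases hvU : emb v ∈ U
        · rw [hρ v hvU, mul_zero, add_zero]
          have h2 := hw0.2 v ⟨hv, hvU⟩
          rw [aff_apply, aff_apply] at h2
          refine h2.lt_of_ne fun he => hn ⟨⟨hv, hvU⟩, fun j hj => ?_⟩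
          rw [aff_apply, ← he]; exact hw0.2 j hj
        · have h2 : L w0 q / c * c ≤ L w0 q / c * L v ρ := by gcongr; exact hρ' v hvU
          rw [div_mul_cancel₀ _ hc.ne'] at h2
          linarith [h1 v hv]
      · rintro _ ⟨v, hv, rfl⟩
        exact hv.1.2
  rw [key]
  refine conv_am hAc hAne (Set.empty_disjoint _) (Set.empty_disjoint _) (Set.disjoint_empty _)
    (Or.inl hamne) (Or.inr rfl) (fun s hs => ?_) k
  suffices hloc' : ∀ q ∈ A, ∃ u ∈ 𝓝 q, ∃ Φ : Set ι, Φ.Finite ∧ ∀ q' ∈ u, q' ∈ A →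
      am I (aff L) q' ⊆ Φ from by
    obtain ⟨Φ, h1, h2⟩ := hull_finite hAc (fun q => am I (aff L) q) hloc' s hs
    exact ⟨Φ, h1, fun q hq => ⟨h2 q hq, by rw [am_empty]; exact Set.empty_subset _⟩⟩
  · intro q hq
    obtain ⟨c1, hc1, h1⟩ := hq
    obtain ⟨η, hη, δ, hδ, h2⟩ := V.nbhd hc1 h1
    refine ⟨{q' | q' ∈ Metric.closedBall q η ∧ aff L v0 q' < L v0 q + 1},
      inter_mem (Metric.closedBall_mem_nhds q hη)
      (eventually_lt_of_affine (aff L v0) (by rw [aff_apply]; linarith)),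
      {v | nm v ≤ (L v0 q + 1) / δ}, V.nm_fin _, fun q' hq' _ v hv => ?_⟩
    rw [Set.mem_ofPred_eq, le_div_iff₀' hδ]
    exact (h2 q' (mem_closedBall_iff_norm.1 hq'.1) v).trans
      ((hv.2 v0 ⟨hv0, hv0U⟩).trans hq'.2.le)

lemma Vor.link {S : Set ι} {q0 : E} (hS : Nf emb L S q0) (U : Submodule K M) (hSU : emb '' S ⊆ U)
    (hU : U ≠ ⊤) (k : ℕ) : Ex (· < ·) {T ∈ PP emb L | S ⊆ T ∧ ¬ emb '' T ⊆ U} k := by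
  obtain ⟨v1, hv1⟩ : ∃ v1, emb v1 ∉ U := by
    obtain ⟨W, hW⟩ := U.exists_isCompl
    obtain ⟨v, hv, hvW⟩ := V.exists_mem W (by
      rintro rfl; exact hU (by simpa using hW.sup_eq_top))
    exact ⟨v, fun h => hv (Submodule.disjoint_def.1 hW.disjoint _ h hvW)⟩
  obtain ⟨ρ, hρ, c, hc, hρ'⟩ := V.rho U
  obtain ⟨s0, hs0⟩ := hS.ne
  set I : Set ι := {v | emb v ≠ 0 ∧ emb v ∈ U} with hI
  set J : Set ι := {v | emb v ∉ U} with hJ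
  have hJ0 : ∀ v ∈ J, emb v ≠ 0 := fun v hv h => hv (h ▸ U.zero_mem)
  have hSI : S ⊆ I := fun v hv => ⟨hS.sub v hv, hSU ⟨v, hv, rfl⟩⟩
  have hpos : ∀ w ∈ J, 0 < L w ρ := fun w hw => hc.trans_le (hρ' w hw)
  set r : ι → E →ᵃ[ℝ] ℝ := fun w => ((L w ρ)⁻¹ • L w).toAffineMap +
    AffineMap.const ℝ E (-(L w ρ)⁻¹) with hr
  have hrv : ∀ w q, r w q = (L w ρ)⁻¹ * (L w q - 1) := fun w q => by
    simp [hr]; ring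
  have hrle : ∀ w ∈ J, ∀ q x, r w q ≤ x ↔ L w (q - x • ρ) ≤ 1 := fun w hw q x => by
    rw [hrv, inv_mul_le_iff₀ (hpos w hw), map_sub, map_smul, smul_eq_mul, mul_comm]
    constructor <;> intro h <;> linarith
  have hler : ∀ w ∈ J, ∀ q x, x ≤ r w q ↔ 1 ≤ L w (q - x • ρ) := fun w hw q x => by
    rw [hrv, le_inv_mul_iff₀ (hpos w hw), map_sub, map_smul, smul_eq_mul, mul_comm]
    constructor <;> intro h <;> linarith
  have hIρ : ∀ w ∈ I, ∀ q x, L w (q - x • ρ) = L w q := fun w hw q x => by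
    rw [map_sub, map_smul, hρ w hw.2, smul_zero, sub_zero]
  have hIJ : ∀ v, emb v ≠ 0 → v ∈ I ∨ v ∈ J := fun v hv => by
    by_cases h : emb v ∈ U
    exacts [Or.inl ⟨hv, h⟩, Or.inr h]
  set A : Set E := {q | (∃ t : ℝ, ∃ c' > 0, ∀ v, emb v ≠ 0 → c' ≤ L v (q + t • ρ)) ∧
    (∀ v ∈ S, L v q = 1) ∧ ∀ v ∈ I, 1 ≤ L v q} with hA
  have hAc : Convex ℝ A := by
    rintro q1 ⟨⟨t1, c1, h1, h1'⟩, h3, h5⟩ q2 ⟨⟨t2, c2, h2, h2'⟩, h4, h6⟩ a b ha hb hab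
    refine ⟨⟨a * t1 + b * t2, min c1 c2, lt_min h1 h2, fun v hv => ?_⟩, fun v hv => ?_,
      fun v hv => ?_⟩
    · have e1 := (min_le_left c1 c2).trans (h1' v hv)
      have e2 := (min_le_right c1 c2).trans (h2' v hv)
      calc min c1 c2 = a * min c1 c2 + b * min c1 c2 := by rw [← add_mul, hab, one_mul]
        _ ≤ a * L v (q1 + t1 • ρ) + b * L v (q2 + t2 • ρ) := by gcongr
        _ = _ := by simp only [map_add, map_smul, smul_eq_mul]; ring
    · simp only [map_add, map_smul, smul_eq_mul, h3 v hv, h4 v hv, mul_one, hab]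
    · simp only [map_add, map_smul, smul_eq_mul]
      nlinarith [h5 v hv, h6 v hv]
  have hNA : ∀ T q, S ⊆ T → Nf emb L T q → q ∈ A := fun T q hST hT =>
    ⟨⟨0, 1, one_pos, fun v hv => by rw [zero_smul, add_zero]; exact hT.min v hv⟩,
      fun v hv => hT.one v (hST hv), fun v hv => hT.min v hv.1⟩
  have hamI : ∀ q ∈ A, ∀ v, v ∈ am I (aff L) q ↔ v ∈ I ∧ L v q = 1 := fun q hq v => by
    refine and_congr_right fun hv => ⟨fun h => ?_, fun h j hj => ?_⟩
    · have h1 := h s0 (hSI hs0)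
      rw [aff_apply, aff_apply, hq.2.1 s0 hs0] at h1
      exact h1.antisymm (hq.2.2 v hv)
    · rw [aff_apply, aff_apply, h]
      exact hq.2.2 j hj
  have hloc : ∀ q ∈ A, ∃ x : ℝ, ∃ Φ : Set ι, Φ.Finite ∧ (∃ w ∈ J, r w q < x) ∧ ∃ η > 0, ∀ q',
      ‖q' - q‖ ≤ η → (∀ w ∈ J, r w q' ≤ x → w ∈ Φ) ∧ ∀ w ∈ I, L w q' ≤ 1 → w ∈ Φ := by
    rintro q ⟨⟨t, c', hc', ht⟩, h1, h2⟩
    have hbdd : BddBelow ((fun w => r w q) '' J) := by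
      refine ⟨-t - c⁻¹, ?_⟩
      rintro _ ⟨w, hw, rfl⟩
      dsimp only
      have e1 := ht w (hJ0 w hw)
      rw [map_add, map_smul, smul_eq_mul] at e1
      rw [hrv, le_inv_mul_iff₀ (hpos w hw)]
      have e2 : 1 ≤ L w ρ * c⁻¹ := by
        rw [← div_eq_mul_inv, le_div_iff₀ hc, one_mul]; exact hρ' w hw
      nlinarith
    set c0 := sInf ((fun w => r w q) '' J) with hc0
    have hge : ∀ w ∈ J, c0 ≤ r w q := fun w hw => csInf_le hbdd ⟨w, hw, rfl⟩
    obtain ⟨η, hη, δ, hδ, hn⟩ := V.nbhd (q := q - c0 • ρ) one_pos fun v hv => by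
      rcases hIJ v hv with h | h
      · rw [hIρ v h]; exact h2 v h
      · exact (hler v h _ _).1 (hge v h)
    set ε := η / (2 * (‖ρ‖ + 1)) with hε
    have hε0 : 0 < ε := by positivity
    have hερ : ε * ‖ρ‖ ≤ η / 2 := by
      rw [hε, div_mul_eq_mul_div, div_le_div_iff₀ (by positivity) (by positivity)]
      nlinarith [norm_nonneg ρ]
    have hnear : ∀ q', ‖q' - q‖ ≤ η / 2 → ∀ w, L w (q' - (c0 + ε) • ρ) ≤ 1 → nm w ≤ 1 / δ := by
      intro q' hq' w hw
      rw [le_div_iff₀' hδ]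
      refine (hn _ ?_ w).trans hw
      have : q' - (c0 + ε) • ρ - (q - c0 • ρ) = (q' - q) - ε • ρ := by rw [add_smul]; abel
      rw [this]
      refine (norm_sub_le _ _).trans ?_
      rw [norm_smul, Real.norm_of_nonneg hε0.le]
      linarith
    refine ⟨c0 + ε, {v | nm v ≤ 1 / δ}, V.nm_fin _, ?_, η / 2, by positivity, fun q' hq' =>
      ⟨fun w hw hle => hnear q' hq' w ((hrle w hw _ _).1 hle), fun w hw hle => hnear q' hq' w ?_⟩⟩
    · obtain ⟨_, ⟨w, hw, rfl⟩, h⟩ := exists_lt_of_csInf_lt (Set.Nonempty.image (fun w => r w q)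
        (⟨v1, hv1⟩ : J.Nonempty)) (lt_add_of_pos_right c0 hε0)
      exact ⟨w, hw, h⟩
    · rwa [hIρ w hw]
  have hamJ : ∀ q ∈ A, (am J r q).Nonempty := fun q hq => by
    obtain ⟨x, Φ, hΦ, ⟨w, hw, hwx⟩, η, hη, h⟩ := hloc q hq
    refine am_nonempty_of_fin hw (hΦ.subset fun v hv => ?_)
    exact (h q (by simpa using hη.le)).1 v hv.1 (hv.2.trans hwx.le)
  have key : {T ∈ PP emb L | S ⊆ T ∧ ¬ emb '' T ⊆ U} =
      (fun q => ∅ ∪ (am I (aff L) q ∪ am J r q)) '' A := by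
    ext T
    simp only [Set.empty_union]
    constructor
    · rintro ⟨⟨q, hT⟩, hST, hTU⟩
      have hqA := hNA T q hST hT
      obtain ⟨w0, hw0, hw0J⟩ : ∃ w ∈ T, w ∈ J := by
        by_contra! hcon
        refine hTU ?_
        rintro _ ⟨v, hv, rfl⟩
        exact not_not.1 (hcon v hv)
      have h0 : ∀ w ∈ J, w ∈ T → r w q = 0 := fun w _ hwT => by
        rw [hrv, hT.one w hwT, sub_self, mul_zero]
      have h1 : ∀ w ∈ J, w ∉ T → 0 < r w q := fun w hw hwT => by
        rw [hrv]
        exact mul_pos (inv_pos.2 (hpos w hw)) (sub_pos.2 (hT.lt w (hJ0 w hw) hwT))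
      refine ⟨q, hqA, Set.Subset.antisymm ?_ fun v hv => ?_⟩
      · rintro v (hv | hv)
        · rw [hamI q hqA] at hv
          exact (hT.mem_iff v hv.1.1).2 hv.2
        · by_contra hvT
          have := hv.2 w0 hw0J
          rw [h0 w0 hw0J hw0] at this
          exact absurd (h1 v hv.1 hvT) (not_lt.2 this)
      · rcases hIJ v (hT.sub v hv) with h | h
        · exact Or.inl ((hamI q hqA v).2 ⟨h, hT.one v hv⟩)
        · refine Or.inr ⟨h, fun j hj => ?_⟩
          rw [h0 v h hv]
          by_cases hjT : j ∈ T
          exacts [(h0 j hj hjT).ge, (h1 j hj hjT).le]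
    · rintro ⟨q, hq, rfl⟩
      obtain ⟨w0, hw0⟩ := hamJ q hq
      have hSsub : S ⊆ am I (aff L) q := fun v hv => (hamI q hq v).2 ⟨hSI hv, hq.2.1 v hv⟩
      refine ⟨⟨q - r w0 q • ρ, ⟨⟨w0, Or.inr hw0⟩, ?_, ?_, fun v hv hn => ?_⟩⟩,
        hSsub.trans Set.subset_union_left, fun h => hw0.1 (h ⟨w0, Or.inr hw0, rfl⟩)⟩
      · rintro v (hv | hv)
        exacts [hv.1.1, hJ0 v hv.1]
      · rintro v (hv | hv)
        · rw [hamI q hq] at hv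
          rw [hIρ v hv.1, hv.2]
        · exact ((hrle v hv.1 _ _).1 (hv.2 w0 hw0.1)).antisymm ((hler v hv.1 _ _).1 (hw0.2 v hv.1))
      · rcases hIJ v hv with h | h
        · rw [hIρ v h]
          refine (hq.2.2 v h).lt_of_ne fun he => hn (Or.inl ((hamI q hq v).2 ⟨h, he.symm⟩))
        · by_contra hle
          have := (hrle v h _ _).2 (not_lt.1 hle)
          exact hn (Or.inr ⟨h, fun j hj => this.trans (hw0.2 j hj)⟩)
  rw [key]
  refine conv_am hAc ⟨q0, hNA S q0 subset_rfl hS⟩ (Set.empty_disjoint _) (Set.empty_disjoint _)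
    (show Disjoint I J from Set.disjoint_left.2 fun v h1 h2 => absurd h1.2 h2)
    (Or.inl fun q hq => ⟨s0, (hamI q hq s0).2 ⟨hSI hs0, hq.2.1 s0 hs0⟩⟩) (Or.inl hamJ)
    (fun s hs => ?_) k
  suffices hloc' : ∀ q ∈ A, ∃ u ∈ 𝓝 q, ∃ Φ : Set ι, Φ.Finite ∧ ∀ q' ∈ u, q' ∈ A →
      {v | q' ∈ A ∧ (v ∈ am I (aff L) q' ∨ v ∈ am J r q')} ⊆ Φ from by
    obtain ⟨Φ, h1, h2⟩ := hull_finite hAc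
      (fun q => {v | q ∈ A ∧ (v ∈ am I (aff L) q ∨ v ∈ am J r q)}) hloc' s hs
    have hsub := convexHull_min hs hAc
    exact ⟨Φ, h1, fun q hq => ⟨fun v hv => h2 q hq ⟨hsub hq, Or.inl hv⟩,
      fun v hv => h2 q hq ⟨hsub hq, Or.inr hv⟩⟩⟩
  · intro q hq
    obtain ⟨x, Φ, hΦ, ⟨w, hw, hwx⟩, η, hη, h⟩ := hloc q hq
    refine ⟨{q' | q' ∈ Metric.closedBall q η ∧ r w q' < x},
      inter_mem (Metric.closedBall_mem_nhds q hη) (eventually_lt_of_affine (r w) hwx), Φ, hΦ,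
      fun q' hq' hq'A v hv => ?_⟩
    have h3 := h q' (mem_closedBall_iff_norm.1 hq'.1)
    rcases hv.2 with hv | hv
    · rw [hamI q' hq'A] at hv
      exact h3.2 v hv.1 hv.2.le
    · exact h3.1 v hv.1 ((hv.2 w hw).trans hq'.2.le)

end Voronoi
end LS

namespace LS
section Voronoi

variable {K M E ι : Type*} [Field K] [AddCommGroup M] [Module K M] [NormedAddCommGroup E]
    [NormedSpace ℝ E] [FiniteDimensional ℝ E] {emb : ι → M} {L : ι → E →ₗ[ℝ] ℝ} {nm : ι → ℝ}
    (V : Vor (K := K) emb L nm)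

lemma rks_add (S : Set ι) : rks L S + Module.finrank ℝ (Zs L S) = Module.finrank ℝ E :=
  Nat.sub_add_cancel (Submodule.finrank_le _)

omit [FiniteDimensional ℝ E] in
lemma Zs_empty : Zs L (∅ : Set ι) = ⊤ := by
  ext x; simp [mem_Zs]

include V

lemma Vor.finrank_span_le {S : Set ι} (hS : S.Finite) :
    Module.finrank K (Submodule.span K (emb '' S)) ≤ rks L S := by
  obtain ⟨b, hbS, hspan, hli⟩ := exists_linearIndependent K (emb '' S)
  have hbf : b.Finite := (hS.image emb).subset hbS
  have := hbf.fintype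
  have hv : ∀ x : b, ∃ v, v ∈ S ∧ emb v = x := fun x => hbS x.2
  choose v hvS hvx using hv
  rw [← hspan, finrank_span_set_eq_card hli, Set.toFinset_card]
  set g : E →ₗ[ℝ] (b → ℝ) := LinearMap.pi fun x => L (v x) with hg
  have hρ : ∀ x : b, ∃ ρ, L (v x) ρ ≠ 0 ∧ ∀ y, y ≠ x → L (v y) ρ = 0 := fun x => by
    obtain ⟨ρ, h1, c, hc, h2⟩ := V.rho (Submodule.span K ((↑) '' {y : b | y ≠ x}))
    refine ⟨ρ, (hc.trans_le (h2 _ fun hm => ?_)).ne', fun y hy => h1 _ ?_⟩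
    · rw [hvx] at hm
      exact hli.notMem_span_image (s := {y : b | y ≠ x}) (x := x) (by simp) hm
    · rw [hvx]; exact Submodule.subset_span ⟨y, hy, rfl⟩
  choose ρ h1 h2 using hρ
  have hsurj : LinearMap.range g = ⊤ := by
    classical
    rw [eq_top_iff]
    intro y _
    refine ⟨∑ x, (y x / L (v x) (ρ x)) • ρ x, funext fun x => ?_⟩
    rw [hg, LinearMap.pi_apply, map_sum, Finset.sum_eq_single x]
    · rw [map_smul, smul_eq_mul, div_mul_cancel₀ _ (h1 x)]
    · intro z _ hz
      rw [map_smul, h2 z x hz.symm, smul_zero]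
    · simp
  have h3 := LinearMap.finrank_range_add_finrank_ker g
  rw [hsurj, finrank_top, Module.finrank_fintype_fun_eq_card] at h3
  have h4 : Module.finrank ℝ (Zs L S) ≤ Module.finrank ℝ (LinearMap.ker g) :=
    Submodule.finrank_mono fun h hh => by
      rw [LinearMap.mem_ker]
      exact funext fun x => hh _ (hvS x)
  have h5 := rks_add (L := L) S
  omega

theorem Vor.geo : Geo (K := K) emb L (PP emb L) (rks L) (Module.finrank ℝ E)
    (fun S => Submodule.span K (emb '' S) = ⊤) where
  fin := by rintro S ⟨q, hq⟩; exact hq.finite V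
  ne := by rintro S ⟨q, hq⟩; exact hq.ne
  rk_pos := by
    rintro S ⟨q, hq⟩
    have h1 : Module.finrank ℝ (Zs L S) < Module.finrank ℝ E := by
      refine Submodule.finrank_lt fun h => ?_
      obtain ⟨v, hv⟩ := hq.ne
      have : q ∈ Zs L S := h ▸ Submodule.mem_top
      have := this v hv
      rw [hq.one v hv] at this
      exact one_ne_zero this
    have := rks_add (L := L) S
    omega
  rk_le := fun S _ => Nat.sub_le _ _
  rk_lt := by
    rintro S ⟨q, hq⟩ T ⟨q', hq'⟩ hST
    have h := hq.sub_pos hq' hST.1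
    have := Zs_lt (show S ⊂ T from hST) h.1 h.2
    have h1 := rks_add (L := L) S
    have h2 := rks_add (L := L) T
    omega
  wr_iff := fun S => Iff.rfl
  span_le := by rintro S ⟨q, hq⟩; exact V.finrank_span_le (hq.finite V)
  face0 := by rintro T ⟨q, hq⟩; exact ⟨q, fun v hv => by rw [hq.one v hv]; exact one_pos⟩
  face := by
    rintro S ⟨q, hq⟩ T ⟨q', hq'⟩ hST
    exact ⟨_, hq.sub_pos hq' hST.1⟩
  below := by
    rintro T ⟨q, hq⟩
    have hT : (∅ : Set ι) ⊂ T := Set.empty_ssubset.2 hq.ne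
    have h0 : ∀ v ∈ T, v ∉ (∅ : Set ι) → 0 < L v q :=
      fun v hv _ => by rw [hq.one v hv]; exact one_pos
    have hlt := Zs_lt hT (L := L) (h0 := q) (by simp) h0
    have h := V.interval hq hT (h0 := q) (by simp) h0 (m := rks L T - 1) (by
      have h2 := rks_add (L := L) T
      rw [Zs_empty, finrank_top] at hlt ⊢
      omega)
    have he : {S ∈ PP emb L | S < T} = {S | S ∈ PP emb L ∧ ∅ < S ∧ S < T} := by
      ext S
      constructor
      · rintro ⟨⟨q', hq'⟩, h⟩
        exact ⟨⟨q', hq'⟩, Set.empty_ssubset.2 hq'.ne, h⟩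
      · rintro ⟨h, -, h'⟩; exact ⟨h, h'⟩
    rw [he]; exact h
  between := by
    rintro S ⟨q, hq⟩ T ⟨q', hq'⟩ hST
    have h := hq.sub_pos hq' hST.1
    have hlt := Zs_lt (show S ⊂ T from hST) h.1 h.2
    refine V.interval hq' hST h.1 h.2 ?_
    have h1 := rks_add (L := L) S
    have h2 := rks_add (L := L) T
    omega
  above := by
    rintro S ⟨q, hq⟩ hw
    have h := V.above hq hw
    have h1 := rks_add (L := L) S
    rwa [show Module.finrank ℝ E - rks L S = Module.finrank ℝ (Zs L S) by omega]
  above_fin := by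
    rintro S ⟨q, hq⟩ hw
    obtain ⟨Φ, h1, h2⟩ := V.exists_finite hw
    exact h1.finite_subsets.subset fun T hT => h2 T hT.1 hT.2.1
  top := by
    rintro S ⟨q, hq⟩ hw hrk
    have h1 := rks_add (L := L) S
    have h2 : Module.finrank ℝ (Zs L S) = 1 := by omega
    obtain ⟨⟨h, hh⟩, hne, -⟩ := finrank_eq_one_iff'.1 h2
    have hne' : h ≠ 0 := fun h' => hne (Subtype.ext h')
    have key : ∀ h ∈ Zs L S, h ≠ 0 → ∃ T ∈ PP emb L, S < T ∧ ∀ v ∈ T, v ∉ S → L v h < 0 := by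
      intro h hh hne
      obtain ⟨s, hs, T, hT, hST⟩ := hq.ray V hw hh hne
      refine ⟨T, ⟨_, hT⟩, hST, fun v hv hvS => ?_⟩
      have h3 := hT.one v hv
      rw [map_add, map_smul, smul_eq_mul] at h3
      have h4 := hq.lt v (hT.sub v hv) hvS
      by_contra hc
      have := mul_nonneg hs.le (not_lt.1 hc)
      linarith
    refine ⟨h, hh, key h hh hne', ?_⟩
    obtain ⟨T, hT, hST, h3⟩ := key (-h) ((Zs L S).neg_mem hh) (neg_ne_zero.2 hne')
    refine ⟨T, hT, hST, fun v hv hvS => ?_⟩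
    have := h3 v hv hvS
    rw [map_neg] at this
    linarith
  exU := fun U hU k => V.exU U hU k

/-- The well-rounded part of the Voronoi poset is acyclic. -/
theorem Vor.wr_acyclic [FiniteDimensional K M] [Nontrivial M] (k : ℕ) :
    Ex (· < ·) {S ∈ PP emb L | Submodule.span K (emb '' S) = ⊤} k := by
  have key : ∀ j, j ≤ Module.finrank K M → ∀ k, Ex (· < ·)
      {S ∈ PP emb L | j ≤ Module.finrank K (Submodule.span K (emb '' S))} k := by
    intro j
    induction j with
    | zero =>
      intro _ k
      have := V.exU ⊤ top_ne_bot k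
      simpa using this
    | succ j ih =>
      intro hj
      refine (quillen (rks L) (Module.finrank ℝ E + 1)
        (X := {S ∈ PP emb L | j + 1 ≤ Module.finrank K (Submodule.span K (emb '' S))})
        (Y := {S ∈ PP emb L | j ≤ Module.finrank K (Submodule.span K (emb '' S))})
        (fun a ha b hb hab => V.geo.rk_lt a ha.1 b hb.1 hab)
        (fun S hS => ⟨hS.1, (Nat.le_succ j).trans hS.2⟩)
        (fun S hS T hT hST => ⟨hT.1, hS.2.trans (Submodule.finrank_mono
          (Submodule.span_mono (Set.image_mono hST.1)))⟩)
        (fun S hS => Nat.lt_succ_of_le (V.geo.rk_le S hS.1)) ?_).2 (ih (by omega))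
      rintro S ⟨⟨q, hq⟩, hSj⟩ hSn k
      have hSj' : Module.finrank K (Submodule.span K (emb '' S)) = j := by
        by_contra h
        exact hSn ⟨⟨q, hq⟩, by omega⟩
      have h := V.link hq (Submodule.span K (emb '' S)) Submodule.subset_span (fun h => by
        rw [h, finrank_top] at hSj'; omega) k
      have he : {T ∈ {S ∈ PP emb L | j + 1 ≤ Module.finrank K (Submodule.span K (emb '' S))} |
          S < T} = {T ∈ PP emb L | S ⊆ T ∧ ¬ emb '' T ⊆ (Submodule.span K (emb '' S) : Set M)} := by
        ext T
        constructor
        · rintro ⟨⟨h1, h2⟩, h3⟩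
          refine ⟨h1, h3.1, fun h4 => ?_⟩
          have := Submodule.finrank_mono (Submodule.span_le.2 h4)
          omega
        · rintro ⟨h1, h2, h3⟩
          have hle : Submodule.span K (emb '' S) < Submodule.span K (emb '' T) :=
            lt_of_le_of_ne (Submodule.span_mono (Set.image_mono h2)) fun h => h3 (by
              rw [h]; exact Submodule.subset_span)
          have := Submodule.finrank_lt_finrank_of_lt hle
          refine ⟨⟨h1, ?_⟩, lt_of_le_of_ne h2 ?_⟩
          · omega
          · rintro rfl; exact hle.ne rfl
      rw [he]; exact h
  have := key _ le_rfl k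
  have he : {S ∈ PP emb L | Module.finrank K M ≤ Module.finrank K (Submodule.span K (emb '' S))}
      = {S ∈ PP emb L | Submodule.span K (emb '' S) = ⊤} := by
    ext S
    refine and_congr_right fun _ => ⟨fun h => ?_, fun h => by rw [h, finrank_top]⟩
    exact Submodule.eq_top_of_finrank_eq (le_antisymm (Submodule.finrank_le _) h)
  rwa [he] at this

omit V [FiniteDimensional ℝ E] in
lemma Nf.image {S : Set ι} {q : E} (hq : Nf emb L S q) (σ : ι ≃ ι) (f : E ≃ₗ[ℝ] E)
    (he : ∀ v, emb (σ v) = 0 ↔ emb v = 0) (hf : ∀ v h, L (σ v) h = L v (f h)) :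
    Nf emb L (σ '' S) (f.symm q) where
  ne := hq.ne.image _
  sub := by
    rintro _ ⟨v, hv, rfl⟩
    rw [Ne, he]; exact hq.sub v hv
  one := by
    rintro _ ⟨v, hv, rfl⟩
    rw [hf, f.apply_symm_apply, hq.one v hv]
  lt := by
    intro v hv hvS
    obtain ⟨w, rfl⟩ := σ.surjective v
    rw [hf, f.apply_symm_apply]
    exact hq.lt w (fun h => hv ((he w).2 h)) fun h => hvS ⟨w, h, rfl⟩

omit V [FiniteDimensional ℝ E] in
lemma PP_image (σ : ι ≃ ι) (f : E ≃ₗ[ℝ] E) (he : ∀ v, emb (σ v) = 0 ↔ emb v = 0)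
    (hf : ∀ v h, L (σ v) h = L v (f h)) (S : Set ι) : σ '' S ∈ PP emb L ↔ S ∈ PP emb L := by
  constructor
  · rintro ⟨q, hq⟩
    have := hq.image σ.symm f.symm (fun v => by
      have := he (σ.symm v); rw [σ.apply_symm_apply] at this; exact this.symm) (fun v h => by
      have := hf (σ.symm v) (f.symm h)
      rw [σ.apply_symm_apply, f.apply_symm_apply] at this; exact this.symm)
    rw [σ.symm_image_image] at this
    exact ⟨_, this⟩
  · rintro ⟨q, hq⟩
    exact ⟨_, hq.image σ f he hf⟩

omit V [FiniteDimensional ℝ E] in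
lemma rks_image (σ : ι ≃ ι) (f : E ≃ₗ[ℝ] E) (hf : ∀ v h, L (σ v) h = L v (f h)) (S : Set ι) :
    rks L (σ '' S) = rks L S := by
  have : Zs L (σ '' S) = (Zs L S).comap (f : E →ₗ[ℝ] E) := by
    ext h
    rw [mem_Zs, Submodule.mem_comap, mem_Zs, Set.forall_mem_image]
    exact forall₂_congr fun v _ => by rw [hf]; rfl
  rw [rks, rks, this]
  congr 1
  exact (f.submoduleMap _).finrank_eq.trans (by rw [Submodule.map_comap_eq_of_surjective f.surjective])

end Voronoi
end LS

namespace LS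
section Lattice
open Filter Topology

/-- A quadratic form which is bounded below on nonzero integral vectors is positive definite. -/
lemma quad_posdef {κ : Type*} [Fintype κ] (Q : QuadraticForm ℝ (κ → ℝ)) (hQ : Continuous Q) {c : ℝ}
    (hc : 0 < c) (h : ∀ z : κ → ℤ, z ≠ 0 → c ≤ Q (fun i => (z i : ℝ))) :
    ∃ δ > 0, ∀ x, δ * ‖x‖ ^ 2 ≤ Q x := by
  have hint : ∀ z : κ → ℤ, 0 ≤ Q (fun i => (z i : ℝ)) := fun z => by
    by_cases hz : z = 0
    · subst hz
      have : (fun i => (((0 : κ → ℤ) i : ℤ) : ℝ)) = (0 : κ → ℝ) := by ext; simp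
      rw [this, QuadraticMap.map_zero]
    · exact hc.le.trans (h z hz)
  have hnonneg : ∀ x, 0 ≤ Q x := fun x => by
    have ht : Tendsto (fun k : ℕ => fun i => ((⌊(k : ℝ) * x i⌋ : ℤ) : ℝ) / k) atTop (𝓝 x) := by
      rw [tendsto_pi_nhds]
      intro i
      have h1 : Tendsto (fun k : ℕ => x i - 1 / (k : ℝ)) atTop (𝓝 (x i)) := by
        simpa using tendsto_const_nhds.sub (tendsto_one_div_atTop_nhds_zero_nat (𝕜 := ℝ))
      refine tendsto_of_tendsto_of_tendsto_of_le_of_le' h1 tendsto_const_nhds ?_ ?_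
      · filter_upwards [eventually_gt_atTop 0] with k hk
        have hk' : (0 : ℝ) < k := by exact_mod_cast hk
        rw [le_div_iff₀ hk', sub_mul, one_div, inv_mul_cancel₀ hk'.ne']
        linarith [Int.lt_floor_add_one ((k : ℝ) * x i)]
      · filter_upwards [eventually_gt_atTop 0] with k hk
        have hk' : (0 : ℝ) < k := by exact_mod_cast hk
        rw [div_le_iff₀ hk']
        linarith [Int.floor_le ((k : ℝ) * x i)]
    refine ge_of_tendsto' ((hQ.tendsto x).comp ht) fun k => ?_
    have : (fun i => ((⌊(k : ℝ) * x i⌋ : ℤ) : ℝ) / k)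
        = (k : ℝ)⁻¹ • fun i => ((⌊(k : ℝ) * x i⌋ : ℤ) : ℝ) := by
      ext i; simp [div_eq_inv_mul]
    rw [Function.comp_apply, this, QuadraticMap.map_smul]
    exact mul_nonneg (mul_self_nonneg _) (hint _)
  have hker : ∀ x, Q x = 0 → ∀ y (t : ℝ), Q (y + t • x) = Q y := fun x hx y t => by
    have hexp : ∀ t : ℝ, Q (y + t • x) = Q y + t * QuadraticMap.polar Q y x := fun t => by
      have := QuadraticMap.map_add Q y (t • x)
      rw [this, QuadraticMap.map_smul, hx, QuadraticMap.polar_smul_right, smul_zero, add_zero,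
        smul_eq_mul]
    have hp : QuadraticMap.polar Q y x = 0 := by
      by_contra hp
      have := hnonneg (y + (-(Q y + 1) / QuadraticMap.polar Q y x) • x)
      rw [hexp, div_mul_cancel₀ _ hp] at this
      linarith
    rw [hexp, hp, mul_zero, add_zero]
  have hpos : ∀ x, x ≠ 0 → 0 < Q x := by
    intro x hx
    refine (hnonneg x).lt_of_ne fun h0 => ?_
    have h0 := h0.symm
    have hx' : 0 < ‖x‖ := norm_pos_iff.2 hx
    obtain ⟨ε, hε, hball⟩ := Metric.eventually_nhds_iff.1
      ((hQ.tendsto 0).eventually_lt_const (show Q 0 < c by rw [QuadraticMap.map_zero]; exact hc))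
    obtain ⟨T, hT⟩ := exists_nat_gt (1 / ‖x‖)
    have hT' : 1 < T * ‖x‖ := by rwa [div_lt_iff₀ hx'] at hT
    set y : ℕ → κ → ℝ := fun k i => Int.fract ((k * T : ℝ) * x i) with hy
    obtain ⟨a, -, φ, hφ, hlim⟩ := (isCompact_univ_pi (fun _ : κ => isCompact_Icc (a := (0 : ℝ))
      (b := 1))).tendsto_subseq (x := y) fun k i _ => ⟨Int.fract_nonneg _, (Int.fract_lt_one _).le⟩
    obtain ⟨N, hN⟩ := Metric.cauchySeq_iff'.1 hlim.cauchySeq (min ε 1) (lt_min hε one_pos)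
    have h1 := hN (N + 1) (Nat.le_succ N)
    have hlt : φ N < φ (N + 1) := hφ (Nat.lt_succ_self N)
    set s : ℝ := ((φ (N + 1) : ℝ) - φ N) * T with hs
    have hs1 : (T : ℝ) ≤ s := by
      have : (1 : ℝ) ≤ (φ (N + 1) : ℝ) - φ N := by
        have : (φ N : ℝ) + 1 ≤ φ (N + 1) := by exact_mod_cast hlt
        linarith
      exact le_mul_of_one_le_left (Nat.cast_nonneg _) this
    set z : κ → ℤ := fun i => ⌊((φ (N + 1) * T : ℝ) * x i)⌋ - ⌊((φ N * T : ℝ) * x i)⌋ with hz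
    have hzx : (fun i => (z i : ℝ)) = -(y (φ (N + 1)) - y (φ N)) + s • x := by
      ext i
      simp only [hz, hy, hs, Pi.add_apply, Pi.neg_apply, Pi.sub_apply, Pi.smul_apply, smul_eq_mul,
        Int.fract, Int.cast_sub]
      ring
    have hd : ‖y (φ (N + 1)) - y (φ N)‖ < min ε 1 := by rw [← dist_eq_norm]; exact h1
    have hz0 : z ≠ 0 := by
      intro h0
      have h2 : y (φ (N + 1)) - y (φ N) = s • x := by
        have : (fun i => (z i : ℝ)) = 0 := by ext i; simp [h0]
        rw [this] at hzx
        exact neg_add_eq_zero.1 hzx.symm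
      rw [h2, norm_smul, Real.norm_eq_abs, abs_of_nonneg ((Nat.cast_nonneg T).trans hs1)] at hd
      have := mul_le_mul_of_nonneg_right hs1 hx'.le
      have := hd.trans_le (min_le_right _ _)
      linarith
    have h3 := h z hz0
    rw [hzx, hker x h0] at h3
    have h4 := hball (y := -(y (φ (N + 1)) - y (φ N))) (by
      rw [dist_zero_right, norm_neg]; exact hd.trans_le (min_le_left _ _))
    linarith
  by_cases hne : (Metric.sphere (0 : κ → ℝ) 1).Nonempty
  · obtain ⟨x0, hx0, hmin⟩ := (isCompact_sphere (0 : κ → ℝ) 1).exists_isMinOn hne hQ.continuousOn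
    have hx0' : x0 ≠ 0 := by
      rintro rfl
      simp at hx0
    refine ⟨Q x0, hpos x0 hx0', fun x => ?_⟩
    by_cases hx : x = 0
    · subst hx; simp
    · have hx' : 0 < ‖x‖ := norm_pos_iff.2 hx
      have h1 : Q x0 ≤ Q (‖x‖⁻¹ • x) := hmin (by
        rw [mem_sphere_zero_iff_norm, norm_smul, norm_inv, norm_norm, inv_mul_cancel₀ hx'.ne'])
      rw [QuadraticMap.map_smul, smul_eq_mul] at h1
      calc Q x0 * ‖x‖ ^ 2 ≤ ‖x‖⁻¹ * ‖x‖⁻¹ * Q x * ‖x‖ ^ 2 := by gcongr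
        _ = Q x := by field_simp
  · refine ⟨1, one_pos, fun x => ?_⟩
    by_cases hx : x = 0
    · subst hx; simp
    · refine absurd ⟨‖x‖⁻¹ • x, ?_⟩ hne
      rw [mem_sphere_zero_iff_norm, norm_smul, norm_inv, norm_norm,
        inv_mul_cancel₀ (norm_pos_iff.2 hx).ne']

end Lattice
end LS

namespace LS
section Hermitian
open Matrix ComplexEmbedding

variable {K : Type*} [Field K] [NumberField K] {n : ℕ}

/-- Families of Hermitian matrices indexed by the complex embeddings, compatible with complex
conjugation. -/
noncomputable def HH (K : Type*) [Field K] [NumberField K] (n : ℕ) :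
    Submodule ℝ ((K →+* ℂ) → Fin n → Fin n → ℂ) where
  carrier := {h | ∀ φ i j, star (h φ i j) = h φ j i ∧ h (conjugate φ) i j = h φ j i}
  zero_mem' := by simp
  add_mem' := by
    intro a b ha hb φ i j
    simp only [Pi.add_apply, star_add, (ha φ i j).1, (ha φ i j).2, (hb φ i j).1, (hb φ i j).2,
      and_self]
  smul_mem' := by
    intro c a ha φ i j
    simp only [Pi.smul_apply, star_smul, (ha φ i j).1, (ha φ i j).2, star_trivial, and_self]

/-- The sesquilinear form attached to a matrix at an embedding. -/
noncomputable def sq (φ : K →+* ℂ) (H : Fin n → Fin n → ℂ) (x y : Fin n → K) : ℂ :=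
  star (φ ∘ x) ⬝ᵥ (Matrix.of H *ᵥ (φ ∘ y))

omit [NumberField K] in
lemma sq_eq (φ : K →+* ℂ) (H : Fin n → Fin n → ℂ) (x y : Fin n → K) :
    sq φ H x y = ∑ i, ∑ j, star (φ (x i)) * (H i j * φ (y j)) := by
  simp only [sq, dotProduct, mulVec, Finset.mul_sum, Pi.star_apply, Function.comp_apply, of_apply]

omit [NumberField K] in
lemma sq_add_left (φ : K →+* ℂ) (H : Fin n → Fin n → ℂ) (x x' y : Fin n → K) :
    sq φ H (x + x') y = sq φ H x y + sq φ H x' y := by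
  simp only [sq_eq, Pi.add_apply, map_add, star_add, add_mul, Finset.sum_add_distrib]

omit [NumberField K] in
lemma sq_add_right (φ : K →+* ℂ) (H : Fin n → Fin n → ℂ) (x y y' : Fin n → K) :
    sq φ H x (y + y') = sq φ H x y + sq φ H x y' := by
  simp only [sq_eq, Pi.add_apply, map_add, mul_add, Finset.sum_add_distrib]

omit [NumberField K] in
lemma sq_smul_right (φ : K →+* ℂ) (H : Fin n → Fin n → ℂ) (c : K) (x y : Fin n → K) :
    sq φ H x (c • y) = φ c * sq φ H x y := by
  simp only [sq_eq, Pi.smul_apply, smul_eq_mul, map_mul, Finset.mul_sum]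
  exact Finset.sum_congr rfl fun _ _ => Finset.sum_congr rfl fun _ _ => by ring

omit [NumberField K] in
lemma sq_smul_left (φ : K →+* ℂ) (H : Fin n → Fin n → ℂ) (c : K) (x y : Fin n → K) :
    sq φ H (c • x) y = star (φ c) * sq φ H x y := by
  simp only [sq_eq, Pi.smul_apply, smul_eq_mul, map_mul, star_mul', Finset.mul_sum]
  exact Finset.sum_congr rfl fun _ _ => Finset.sum_congr rfl fun _ _ => by ring

lemma sq_star (h : HH K n) (φ : K →+* ℂ) (x y : Fin n → K) :
    star (sq φ (h.1 φ) x y) = sq φ (h.1 φ) y x := by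
  simp only [sq_eq, star_sum, star_mul', star_star, (h.2 φ _ _).1]
  rw [Finset.sum_comm]
  exact Finset.sum_congr rfl fun _ _ => Finset.sum_congr rfl fun _ _ => by ring

lemma sq_conj (h : HH K n) (φ : K →+* ℂ) (x y : Fin n → K) :
    sq (conjugate φ) (h.1 (conjugate φ)) x y = sq φ (h.1 φ) y x := by
  simp only [sq_eq, conjugate_coe_eq, (h.2 φ _ _).2, RCLike.star_def, Complex.conj_conj]
  rw [Finset.sum_comm]
  exact Finset.sum_congr rfl fun _ _ => Finset.sum_congr rfl fun _ _ => by ring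

/-- The symmetric bilinear form attached to a Hermitian family. -/
noncomputable def SB (h : HH K n) (x y : Fin n → K) : ℂ := ∑ φ, sq φ (h.1 φ) x y

lemma SB_comm (h : HH K n) (x y : Fin n → K) : SB h x y = SB h y x := by
  refine Fintype.sum_equiv (involutive_conjugate K).toPerm _ _ fun φ => ?_
  exact (sq_conj h φ y x).symm

lemma SB_star (h : HH K n) (x y : Fin n → K) : star (SB h x y) = SB h x y := by
  conv_rhs => rw [SB_comm]
  simp only [SB, star_sum, sq_star]

lemma SB_re (h : HH K n) (x y : Fin n → K) : ((SB h x y).re : ℂ) = SB h x y :=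
  Complex.conj_eq_iff_re.1 (SB_star h x y)

lemma SB_add_left (h : HH K n) (x x' y : Fin n → K) : SB h (x + x') y = SB h x y + SB h x' y := by
  simp only [SB, sq_add_left, Finset.sum_add_distrib]

lemma SB_add_right (h : HH K n) (x y y' : Fin n → K) : SB h x (y + y') = SB h x y + SB h x y' := by
  simp only [SB, sq_add_right, Finset.sum_add_distrib]

lemma SB_zsmul_left (h : HH K n) (z : ℤ) (x y : Fin n → K) : SB h (z • x) y = z * SB h x y := by
  simp only [SB, ← Int.cast_smul_eq_zsmul K, sq_smul_left, Finset.mul_sum, map_intCast]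
  simp

lemma SB_zsmul_right (h : HH K n) (z : ℤ) (x y : Fin n → K) : SB h x (z • y) = z * SB h x y := by
  rw [SB_comm, SB_zsmul_left, SB_comm]

/-- Evaluation of the quadratic form of a Hermitian family at a vector. -/
noncomputable def Lk (x : Fin n → K) : HH K n →ₗ[ℝ] ℝ where
  toFun h := (SB h x x).re
  map_add' a b := by
    simp only [SB, sq_eq, Submodule.coe_add, Pi.add_apply, add_mul, mul_add,
      Finset.sum_add_distrib, Complex.add_re]
  map_smul' c a := by
    simp only [SB, sq_eq, Submodule.coe_smul, Pi.smul_apply, RingHom.id_apply, smul_eq_mul,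
      Complex.re_sum, Finset.mul_sum, Complex.real_smul]
    refine Finset.sum_congr rfl fun _ _ => Finset.sum_congr rfl fun _ _ =>
      Finset.sum_congr rfl fun _ _ => ?_
    rw [← Complex.re_ofReal_mul]
    congr 1; ring

lemma Lk_apply (x : Fin n → K) (h : HH K n) : Lk x h = (SB h x x).re := rfl

/-- The substitution action of matrices over `K` on Hermitian families. -/
noncomputable def fa (A : Matrix (Fin n) (Fin n) K) : HH K n →ₗ[ℝ] HH K n where
  toFun h := ⟨fun φ => (A.map φ)ᴴ * Matrix.of (h.1 φ) * A.map φ, fun φ i j => by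
    have h1 : (Matrix.of (h.1 φ))ᴴ = Matrix.of (h.1 φ) := by
      ext i j; exact (h.2 φ j i).1
    have h2 : Matrix.of (h.1 (conjugate φ)) = (Matrix.of (h.1 φ))ᵀ := by
      ext i j; exact (h.2 φ i j).2
    have h3 : A.map (conjugate φ) = (A.map φ).map star := by
      ext i j; simp [conjugate_coe_eq]
    constructor
    · have : ((A.map φ)ᴴ * Matrix.of (h.1 φ) * A.map φ)ᴴ =
          (A.map φ)ᴴ * Matrix.of (h.1 φ) * A.map φ := by
        rw [conjTranspose_mul, conjTranspose_mul, h1, conjTranspose_conjTranspose, mul_assoc]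
      exact congrFun (congrFun this j) i
    · have : ((A.map (conjugate φ))ᴴ * Matrix.of (h.1 (conjugate φ)) * A.map (conjugate φ)) =
          ((A.map φ)ᴴ * Matrix.of (h.1 φ) * A.map φ)ᵀ := by
        rw [h2, h3, transpose_mul, transpose_mul, mul_assoc]
        congr 1
        ext i j; simp
      exact congrFun (congrFun this i) j⟩
  map_add' a b := by
    refine Subtype.ext (funext fun φ => ?_)
    change _ * Matrix.of (a.1 φ + b.1 φ) * _ = _ * _ * _ + _ * _ * _
    rw [← add_mul, ← mul_add]; rfl
  map_smul' c a := by
    refine Subtype.ext (funext fun φ => ?_)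
    change _ * Matrix.of (c • a.1 φ) * _ = c • (_ * _ * _)
    rw [← smul_mul_assoc, ← mul_smul_comm]; rfl

lemma fa_apply (A : Matrix (Fin n) (Fin n) K) (h : HH K n) (φ : K →+* ℂ) :
    Matrix.of ((fa A h).1 φ) = (A.map φ)ᴴ * Matrix.of (h.1 φ) * A.map φ := rfl

lemma fa_one : fa (1 : Matrix (Fin n) (Fin n) K) = LinearMap.id := by
  refine LinearMap.ext fun h => Subtype.ext (funext fun φ => ?_)
  have := fa_apply 1 h φ
  rw [Matrix.map_one _ (map_zero φ) (map_one φ), conjTranspose_one, one_mul, mul_one] at this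
  exact this

lemma fa_mul (A B : Matrix (Fin n) (Fin n) K) : fa (A * B) = fa B ∘ₗ fa A := by
  refine LinearMap.ext fun h => Subtype.ext (funext fun φ => ?_)
  have h1 := fa_apply (A * B) h φ
  have h2 := fa_apply B (fa A h) φ
  rw [Matrix.map_mul, conjTranspose_mul] at h1
  refine Eq.trans h1 (Eq.trans ?_ h2.symm)
  rw [fa_apply A]
  simp only [mul_assoc]
  rfl

lemma Lk_mulVec (A : Matrix (Fin n) (Fin n) K) (x : Fin n → K) (h : HH K n) :
    Lk (A *ᵥ x) h = Lk x (fa A h) := by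
  rw [Lk_apply, Lk_apply, SB, SB]
  congr 1
  refine Finset.sum_congr rfl fun φ _ => ?_
  have h1 : φ ∘ (A *ᵥ x) = A.map φ *ᵥ (φ ∘ x) := by
    ext i; simp [mulVec, dotProduct]
  rw [sq, sq, fa_apply, h1, star_mulVec, ← dotProduct_mulVec]
  simp only [mulVec_mulVec, mul_assoc]

lemma det_fa_mul (A B : Matrix (Fin n) (Fin n) K) :
    LinearMap.det (fa (A * B)) = LinearMap.det (fa A) * LinearMap.det (fa B) := by
  rw [fa_mul, LinearMap.det_comp, mul_comm]

/-- Unipotent substitutions are squares, so they preserve orientation. -/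
lemma det_fa_pos {A : Matrix (Fin n) (Fin n) K} (hA : (A - 1) * (A - 1) = 0) :
    0 < LinearMap.det (fa A) := by
  set N := A - 1 with hN
  set B : Matrix (Fin n) (Fin n) K := 1 + (2⁻¹ : K) • N with hB
  have h1 : B * B = A := by
    rw [hB, add_mul, mul_add, mul_add, one_mul, one_mul, mul_one, smul_mul_smul_comm, hA, smul_zero,
      add_zero, add_assoc, ← add_smul, ← two_mul, mul_inv_cancel₀ two_ne_zero, one_smul, hN]
    abel
  have h2 : B * (1 - (2⁻¹ : K) • N) = 1 := by
    rw [hB, add_mul, mul_sub, mul_sub, one_mul, one_mul, mul_one, smul_mul_smul_comm, hA, smul_zero]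
    abel
  have h3 := det_fa_mul B (1 - (2⁻¹ : K) • N)
  rw [h2, fa_one, LinearMap.det_id] at h3
  have h4 : LinearMap.det (fa B) ≠ 0 := left_ne_zero_of_mul (h3 ▸ one_ne_zero)
  rw [← h1, det_fa_mul]
  exact mul_self_pos.2 h4

end Hermitian
end LS

namespace LS
section VorNF
open Matrix ComplexEmbedding

variable {K : Type*} [Field K] [NumberField K] {n : ℕ}

/-- The inclusion of integral vectors. -/
def em (v : Fin n → 𝓞 K) : Fin n → K := fun i => (v i : K)

omit [NumberField K] in
lemma em_add (v w : Fin n → 𝓞 K) : em (v + w) = em v + em w := by ext i; simp [em]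

omit [NumberField K] in
lemma em_smul (c : 𝓞 K) (v : Fin n → 𝓞 K) : em (c • v) = (c : K) • em v := by ext i; simp [em]

omit [NumberField K] in
lemma em_zsmul (c : ℤ) (v : Fin n → 𝓞 K) : em (c • v) = c • em v := by ext i; simp [em]

omit [NumberField K] in
lemma em_inj : Function.Injective (em : (Fin n → 𝓞 K) → Fin n → K) := fun _ _ h =>
  funext fun i => RingOfIntegers.ext (congrFun h i)

omit [NumberField K] in
lemma em_eq_zero {v : Fin n → 𝓞 K} : em v = 0 ↔ v = 0 := by
  constructor
  · intro h; exact em_inj (h.trans (by ext i; simp [em]))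
  · rintro rfl; ext i; simp [em]

/-- The size of an integral vector. -/
noncomputable def nm (v : Fin n → 𝓞 K) : ℝ := ∑ φ : K →+* ℂ, ∑ i, ‖φ (v i)‖ ^ 2

lemma one_le_sum_norm {x : 𝓞 K} (hx : x ≠ 0) : 1 ≤ ∑ φ : K →+* ℂ, ‖φ x‖ ^ 2 := by
  have : ∃ φ : K →+* ℂ, 1 ≤ ‖φ x‖ := by
    by_contra! h
    obtain ⟨w⟩ := (inferInstance : Nonempty (InfinitePlace K))
    have := one_le_of_lt_one (w := w) hx fun z _ => by
      rw [← norm_embedding_eq]; exact h _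
    rw [← norm_embedding_eq] at this
    exact (h _).not_ge this
  obtain ⟨φ, hφ⟩ := this
  refine (one_le_pow₀ hφ (n := 2)).trans ?_
  exact Finset.single_le_sum (f := fun φ : K →+* ℂ => ‖φ x‖ ^ 2) (fun _ _ => by positivity)
    (Finset.mem_univ φ)

/-- The integral coordinates of an integral vector. -/
noncomputable def co (v : Fin n → 𝓞 K) :
    (Fin n × Module.Free.ChooseBasisIndex ℤ (𝓞 K)) → ℤ :=
  fun p => (RingOfIntegers.basis K).repr (v p.1) p.2

/-- The integral vector with given coordinates. -/
noncomputable def oc (z : (Fin n × Module.Free.ChooseBasisIndex ℤ (𝓞 K)) → ℤ) : Fin n → 𝓞 K :=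
  fun i => ∑ k, z (i, k) • RingOfIntegers.basis K k

lemma oc_co (v : Fin n → 𝓞 K) : oc (co v) = v :=
  funext fun i => (RingOfIntegers.basis K).sum_repr (v i)

lemma oc_ne {z : (Fin n × Module.Free.ChooseBasisIndex ℤ (𝓞 K)) → ℤ} (hz : z ≠ 0) : oc z ≠ 0 := by
  intro h
  refine hz (funext fun p => ?_)
  have := congrFun h p.1
  exact (Fintype.linearIndependent_iff.1 (RingOfIntegers.basis K).linearIndependent)
    (fun k => z (p.1, k)) this p.2

/-- The basis vectors of the lattice of integral vectors. -/
noncomputable def bv (p : Fin n × Module.Free.ChooseBasisIndex ℤ (𝓞 K)) : Fin n → K :=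
  fun i => if i = p.1 then (RingOfIntegers.basis K p.2 : K) else 0

lemma em_oc (z : (Fin n × Module.Free.ChooseBasisIndex ℤ (𝓞 K)) → ℤ) :
    em (oc z) = ∑ p, z p • bv p := by
  ext i
  rw [Finset.sum_apply, Fintype.sum_prod_type, Finset.sum_eq_single i]
  · simp [em, oc, bv]
  · intro j _ hj
    refine Finset.sum_eq_zero fun k _ => ?_
    simp [bv, hj.symm]
  · simp

/-- The real quadratic form extending the evaluation of a Hermitian family. -/
noncomputable def RQ (q : HH K n) :
    QuadraticForm ℝ ((Fin n × Module.Free.ChooseBasisIndex ℤ (𝓞 K)) → ℝ) :=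
  (Matrix.of fun p p' => (SB q (bv p) (bv p')).re).toQuadraticForm'

lemma RQ_apply (q : HH K n) (x : (Fin n × Module.Free.ChooseBasisIndex ℤ (𝓞 K)) → ℝ) :
    RQ q x = ∑ p, ∑ p', x p * (SB q (bv p) (bv p')).re * x p' := by
  simp only [RQ, Matrix.toQuadraticForm', LinearMap.BilinMap.toQuadraticMap_apply,
    Matrix.toLinearMap₂'_apply, smul_eq_mul]
  exact Finset.sum_congr rfl fun p _ => Finset.sum_congr rfl fun p' _ => by
    change x p * (x p' * (SB q (bv p) (bv p')).re) = _; ring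

lemma RQ_cont (q : HH K n) : Continuous (RQ q) := by
  have : (RQ q : _ → ℝ) = fun x => ∑ p, ∑ p', x p * (SB q (bv p) (bv p')).re * x p' :=
    funext (RQ_apply q)
  rw [this]
  fun_prop

lemma SB_zero_left (h : HH K n) (y : Fin n → K) : SB h 0 y = 0 := by
  simpa using SB_add_left h 0 0 y

lemma SB_sum (h : HH K n) {κ : Type*} (s : Finset κ) (f : κ → Fin n → K) (y : Fin n → K) :
    SB h (∑ k ∈ s, f k) y = ∑ k ∈ s, SB h (f k) y := by
  classical
  induction s using Finset.induction_on with
  | empty => simp [SB_zero_left]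
  | insert a s ha ih => rw [Finset.sum_insert ha, Finset.sum_insert ha, SB_add_left, ih]

lemma RQ_int (q : HH K n) (z : (Fin n × Module.Free.ChooseBasisIndex ℤ (𝓞 K)) → ℤ) :
    RQ q (fun p => (z p : ℝ)) = Lk (em (oc z)) q := by
  rw [RQ_apply, Lk_apply, em_oc, SB_sum, Complex.re_sum]
  refine Finset.sum_congr rfl fun p _ => ?_
  rw [SB_comm, SB_sum, Complex.re_sum]
  refine Finset.sum_congr rfl fun p' _ => ?_
  rw [SB_zsmul_left, SB_zsmul_right, SB_comm, ← Complex.ofReal_intCast, ← Complex.ofReal_intCast,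
    Complex.re_ofReal_mul, Complex.re_ofReal_mul]
  ring

lemma nm_le (v : Fin n → 𝓞 K) :
    nm v ≤ (∑ φ : K →+* ℂ, ∑ _i : Fin n, (∑ k, ‖φ (RingOfIntegers.basis K k)‖) ^ 2) *
      ‖fun p => ((co v p : ℤ) : ℝ)‖ ^ 2 := by
  rw [nm, Finset.sum_mul]
  refine Finset.sum_le_sum fun φ _ => ?_
  rw [Finset.sum_mul]
  refine Finset.sum_le_sum fun i _ => ?_
  rw [← mul_pow]
  refine pow_le_pow_left₀ (norm_nonneg _) ?_ 2
  have h1 : (v i : K) = ∑ k, (co v (i, k)) • (RingOfIntegers.basis K k : K) := by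
    have := congrArg (algebraMap (𝓞 K) K) ((RingOfIntegers.basis K).sum_repr (v i))
    rw [map_sum] at this
    refine this.symm.trans ?_
    exact Finset.sum_congr rfl fun k _ => by rw [map_zsmul]; rfl
  rw [h1, map_sum, Finset.sum_mul]
  refine (norm_sum_le _ _).trans (Finset.sum_le_sum fun k _ => ?_)
  rw [map_zsmul, zsmul_eq_mul, norm_mul, mul_comm, Complex.norm_intCast]
  gcongr
  have := norm_le_pi_norm (fun p => ((co v p : ℤ) : ℝ)) (i, k)
  rwa [Real.norm_eq_abs] at this

lemma nm_nonneg (v : Fin n → 𝓞 K) : 0 ≤ nm v :=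
  Finset.sum_nonneg fun _ _ => Finset.sum_nonneg fun _ _ => by positivity

lemma mink (q : HH K n) (c : ℝ) (hc : 0 < c) (h : ∀ v : Fin n → 𝓞 K, em v ≠ 0 → c ≤ Lk (em v) q) :
    ∃ δ > 0, ∀ v : Fin n → 𝓞 K, δ * nm v ≤ Lk (em v) q := by
  obtain ⟨δ, hδ, h1⟩ := quad_posdef (RQ q) (RQ_cont q) hc fun z hz => by
    rw [RQ_int]; exact h _ fun h0 => oc_ne hz (em_eq_zero.1 h0)
  set C := (∑ φ : K →+* ℂ, ∑ _i : Fin n, (∑ k, ‖φ (RingOfIntegers.basis K k)‖) ^ 2) with hC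
  have hC0 : 0 ≤ C := Finset.sum_nonneg fun _ _ => Finset.sum_nonneg fun _ _ => by positivity
  refine ⟨δ / (C + 1), by positivity, fun v => ?_⟩
  have h2 := h1 fun p => ((co v p : ℤ) : ℝ)
  rw [RQ_int, oc_co] at h2
  refine le_trans ?_ h2
  rw [div_mul_eq_mul_div, mul_div_assoc]
  gcongr
  rw [div_le_iff₀ (by positivity)]
  refine (nm_le v).trans ?_
  rw [mul_comm]
  gcongr
  linarith

end VorNF
end LS

namespace LS
section VorNF2
open Matrix ComplexEmbedding

variable {K : Type*} [Field K] [NumberField K] {n : ℕ}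

lemma nm_fin (B : ℝ) : {v : Fin n → 𝓞 K | nm v ≤ B}.Finite := by
  have h1 := (Embeddings.finite_of_norm_le K ℂ (max B 1)).preimage
    (f := fun x : 𝓞 K => (x : K)) RingOfIntegers.coe_injective.injOn
  refine (Set.Finite.pi' (fun _ : Fin n => h1)).subset fun v hv i => ⟨(v i).isIntegral_coe, fun φ => ?_⟩
  have h2 : ‖φ (v i)‖ ^ 2 ≤ nm v :=
    (Finset.single_le_sum (f := fun i => ‖φ (v i)‖ ^ 2) (fun _ _ => by positivity)
      (Finset.mem_univ i)).trans (Finset.single_le_sum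
        (f := fun φ : K →+* ℂ => ∑ i, ‖φ (v i)‖ ^ 2)
        (fun _ _ => Finset.sum_nonneg fun _ _ => by positivity) (Finset.mem_univ φ))
  have h3 : nm v ≤ B := hv
  by_contra! hcon
  have h4 := (le_max_right B 1).trans_lt hcon
  have h5 : ‖φ (v i)‖ ≤ ‖φ (v i)‖ ^ 2 := by nlinarith
  exact absurd ((le_max_left B 1).trans_lt hcon) (by linarith)

lemma Lk_bdd : ∃ B > 0, ∀ (v : Fin n → 𝓞 K) (h : HH K n), |Lk (em v) h| ≤ B * ‖h‖ * nm v := by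
  refine ⟨(∑ _φ : K →+* ℂ, ∑ _i : Fin n, ∑ _j : Fin n, (1 : ℝ)) + 1, by positivity, fun v h => ?_⟩
  have hterm : ∀ φ : K →+* ℂ, ∀ i j, ‖star (φ (em v i)) * (h.1 φ i j * φ (em v j))‖ ≤ 1 * (‖h‖ * nm v) := by
    intro φ i j
    have hle : ∀ i, ‖φ (em v i)‖ ^ 2 ≤ nm v := fun i =>
      (Finset.single_le_sum (f := fun i => ‖φ (v i)‖ ^ 2) (fun _ _ => by positivity)
      (Finset.mem_univ i)).trans (Finset.single_le_sum
        (f := fun φ : K →+* ℂ => ∑ i, ‖φ (v i)‖ ^ 2)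
        (fun _ _ => Finset.sum_nonneg fun _ _ => by positivity) (Finset.mem_univ φ))
    have h1 : ‖φ (em v i)‖ * ‖φ (em v j)‖ ≤ nm v := by
      have := hle i; have := hle j
      nlinarith [sq_nonneg (‖φ (em v i)‖ - ‖φ (em v j)‖)]
    have h2 : ‖h.1 φ i j‖ ≤ ‖h‖ :=
      (norm_le_pi_norm (h.1 φ i) j).trans ((norm_le_pi_norm (h.1 φ) i).trans
        (norm_le_pi_norm h.1 φ))
    rw [norm_mul, norm_mul, norm_star, one_mul]
    calc ‖φ (em v i)‖ * (‖h.1 φ i j‖ * ‖φ (em v j)‖)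
        = ‖h.1 φ i j‖ * (‖φ (em v i)‖ * ‖φ (em v j)‖) := by ring
      _ ≤ ‖h‖ * nm v := by gcongr
  rw [Lk_apply, SB]
  refine (Complex.abs_re_le_norm _).trans ((norm_sum_le _ _).trans ?_)
  have h0 : 0 ≤ ‖h‖ * nm v := mul_nonneg (norm_nonneg _) (nm_nonneg v)
  rw [add_mul, add_mul, mul_assoc, Finset.sum_mul]
  refine le_add_of_le_of_nonneg (Finset.sum_le_sum fun φ _ => ?_) (by rwa [one_mul])
  rw [sq_eq]
  refine (norm_sum_le _ _).trans ?_
  rw [Finset.sum_mul]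
  refine Finset.sum_le_sum fun i _ => (norm_sum_le _ _).trans ?_
  rw [Finset.sum_mul]
  exact Finset.sum_le_sum fun j _ => hterm φ i j

lemma exists_em_mem (U : Submodule K (Fin n → K)) (hU : U ≠ ⊥) :
    ∃ v : Fin n → 𝓞 K, em v ≠ 0 ∧ em v ∈ U := by
  obtain ⟨x, hx, hx0⟩ := Submodule.exists_mem_ne_zero_of_ne_bot hU
  obtain ⟨d, hd⟩ := IsLocalization.exist_integer_multiples_of_finite (nonZeroDivisors (𝓞 K)) x
  choose v hv using hd
  have h1 : em v = ((d : 𝓞 K) : K) • x := by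
    ext i
    exact (hv i).trans (by rw [Algebra.smul_def]; rfl)
  have hd0 : ((d : 𝓞 K) : K) ≠ 0 := by
    rw [Ne, RingOfIntegers.coe_eq_zero_iff]; exact nonZeroDivisors.coe_ne_zero d
  refine ⟨v, ?_, ?_⟩
  · rw [h1]; exact smul_ne_zero hd0 hx0
  · rw [h1]; exact U.smul_mem _ hx

lemma Lk_rho (U : Submodule K (Fin n → K)) : ∃ ρ : HH K n,
    (∀ v : Fin n → 𝓞 K, em v ∈ U → Lk (em v) ρ = 0) ∧
      ∃ c > 0, ∀ v : Fin n → 𝓞 K, em v ∉ U → c ≤ Lk (em v) ρ := by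
  classical
  set f : (Fin n → K) →ₗ[K] (Fin (Module.finrank K ((Fin n → K) ⧸ U)) → K) :=
    (Module.finBasis K ((Fin n → K) ⧸ U)).equivFun.toLinearMap ∘ₗ U.mkQ with hf
  have hfU : ∀ x, f x = 0 ↔ x ∈ U := fun x => by
    rw [hf, LinearMap.comp_apply, LinearEquiv.coe_coe, LinearEquiv.map_eq_zero_iff,
      Submodule.mkQ_apply, Submodule.Quotient.mk_eq_zero]
  obtain ⟨d, hd⟩ := IsLocalization.exist_integer_multiples_of_finite (nonZeroDivisors (𝓞 K))
    (fun p : Fin (Module.finrank K ((Fin n → K) ⧸ U)) × Fin n => f (Pi.single p.2 1) p.1)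
  choose g hg using hd
  have hd0 : ((d : 𝓞 K) : K) ≠ 0 := by
    rw [Ne, RingOfIntegers.coe_eq_zero_iff]; exact nonZeroDivisors.coe_ne_zero d
  have hy : ∀ (v : Fin n → 𝓞 K) k, ((∑ i, g (k, i) * v i : 𝓞 K) : K)
      = ((d : 𝓞 K) : K) * f (em v) k := fun v k => by
    have h1 : em v = ∑ i, (v i : K) • (Pi.single i 1 : Fin n → K) := by
      ext j
      rw [Finset.sum_apply, Finset.sum_eq_single j]
      · rw [Pi.smul_apply, Pi.single_eq_same, smul_eq_mul, mul_one]; rfl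
      · intro i _ hi
        rw [Pi.smul_apply, Pi.single_eq_of_ne hi.symm, smul_zero]
      · simp
    rw [h1, map_sum, Finset.sum_apply, Finset.mul_sum]
    refine (map_sum (algebraMap (𝓞 K) K) _ _).trans (Finset.sum_congr rfl fun i _ => ?_)
    rw [map_mul, hg, map_smul, Pi.smul_apply, smul_eq_mul, Algebra.smul_def]
    change ((d : 𝓞 K) : K) * _ * (v i : K) = _
    ring
  set ρ : HH K n := ⟨fun φ i j => ∑ k, star (φ (g (k, i))) * φ (g (k, j)), fun φ i j => by
    constructor
    · rw [star_sum]
      exact Finset.sum_congr rfl fun k _ => by rw [star_mul', star_star, mul_comm]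
    · refine Finset.sum_congr rfl fun k _ => ?_
      rw [conjugate_coe_eq, conjugate_coe_eq, RCLike.star_def, Complex.conj_conj, mul_comm]⟩ with hρ
  have hL : ∀ v : Fin n → 𝓞 K, Lk (em v) ρ =
      ∑ k, ∑ φ : K →+* ℂ, ‖φ (∑ i, g (k, i) * v i : 𝓞 K)‖ ^ 2 := fun v => by
    rw [Lk_apply, SB, Complex.re_sum, Finset.sum_comm]
    refine Finset.sum_congr rfl fun φ _ => ?_
    have h1 : sq φ (ρ.1 φ) (em v) (em v) =
        ∑ k, star (φ (∑ i, g (k, i) * v i : 𝓞 K)) * φ (∑ i, g (k, i) * v i : 𝓞 K) := by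
      have h2 : ∀ k, φ (∑ i, g (k, i) * v i : 𝓞 K) = ∑ i, φ (g (k, i)) * φ (v i) := fun k => by
        refine (map_sum (φ.comp (algebraMap (𝓞 K) K)) _ _).trans
          (Finset.sum_congr rfl fun i _ => ?_)
        exact map_mul (φ.comp (algebraMap (𝓞 K) K)) _ _
      simp only [h2, star_sum, Finset.sum_mul_sum, star_mul']
      rw [Finset.sum_comm, sq_eq]
      refine Finset.sum_congr rfl fun i _ => ?_
      rw [Finset.sum_comm]
      refine Finset.sum_congr rfl fun j _ => ?_
      change star (φ (v i)) * ((∑ k, star (φ (g (k, i))) * φ (g (k, j))) * φ (v j)) = _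
      rw [Finset.sum_mul, Finset.mul_sum]
      exact Finset.sum_congr rfl fun k _ => by ring
    rw [h1, Complex.re_sum]
    refine Finset.sum_congr rfl fun k _ => ?_
    rw [RCLike.star_def, ← Complex.normSq_eq_conj_mul_self, Complex.ofReal_re,
      Complex.normSq_eq_norm_sq]
  refine ⟨ρ, fun v hv => ?_, 1, one_pos, fun v hv => ?_⟩
  · rw [hL]
    refine Finset.sum_eq_zero fun k _ => Finset.sum_eq_zero fun φ _ => ?_
    rw [hy, (hfU _).2 hv, Pi.zero_apply, mul_zero, map_zero, norm_zero, zero_pow two_ne_zero]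
  · rw [hL]
    obtain ⟨k, hk⟩ : ∃ k, f (em v) k ≠ 0 := by
      by_contra! h
      exact hv ((hfU _).1 (funext h))
    have hk' : (∑ i, g (k, i) * v i : 𝓞 K) ≠ 0 := by
      intro h0
      have h1 := hy v k
      rw [h0] at h1
      exact mul_ne_zero hd0 hk (h1.symm.trans (map_zero (algebraMap (𝓞 K) K)))
    exact (one_le_sum_norm hk').trans (Finset.single_le_sum
      (f := fun k => ∑ φ : K →+* ℂ, ‖φ (∑ i, g (k, i) * v i : 𝓞 K)‖ ^ 2)
      (fun _ _ => Finset.sum_nonneg fun _ _ => by positivity) (Finset.mem_univ k))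

omit [NumberField K] in
lemma sq_single (φ : K →+* ℂ) (H : Fin n → Fin n → ℂ) (i j : Fin n) :
    sq φ H (Pi.single i 1) (Pi.single j 1) = H i j := by
  rw [sq_eq, Finset.sum_eq_single i, Finset.sum_eq_single j]
  · simp
  · intro b _ hb; simp [hb]
  · simp
  · intro b _ hb; simp [hb]
  · simp

lemma sum_embeddings_eq_zero {c : (K →+* ℂ) → ℂ} (h : ∀ x : 𝓞 K, ∑ φ, φ x * c φ = 0)
    (φ : K →+* ℂ) : c φ = 0 := by
  have hinj : Function.Injective (fun φ : K →+* ℂ =>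
      ((φ.comp (algebraMap (𝓞 K) K) : 𝓞 K →+* ℂ) : 𝓞 K →* ℂ)) := fun φ ψ hφ => by
    refine IsLocalization.ringHom_ext (nonZeroDivisors (𝓞 K)) ?_
    exact RingHom.ext fun x => DFunLike.congr_fun hφ x
  refine Fintype.linearIndependent_iff.1
    ((linearIndependent_monoidHom (𝓞 K) ℂ).comp _ hinj) c (funext fun x => ?_) φ
  rw [Finset.sum_apply]
  refine Eq.trans (Finset.sum_congr rfl fun φ _ => ?_) (h x)
  exact mul_comm _ _

lemma Lk_recc (S : Set (Fin n → 𝓞 K)) (hS : Submodule.span K (em '' S) = ⊤) (h : HH K n)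
    (h0 : ∀ v : Fin n → 𝓞 K, em v ≠ 0 → 0 ≤ Lk (em v) h) (h1 : ∀ v ∈ S, Lk (em v) h = 0) :
    h = 0 := by
  have h0' : ∀ v : Fin n → 𝓞 K, 0 ≤ Lk (em v) h := fun v => by
    by_cases hv : em v = 0
    · rw [hv, Lk_apply, SB_zero_left]; simp
    · exact h0 v hv
  have key : ∀ v ∈ S, ∀ w : Fin n → 𝓞 K, SB h (em v) (em w) = 0 := by
    intro v hv w
    have hexp : ∀ z : ℤ, 0 ≤ 2 * z * (SB h (em v) (em w)).re + Lk (em w) h := fun z => by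
      have h2 := h0' (z • v + w)
      have h3 := h1 v hv
      rw [Lk_apply] at h3
      rw [Lk_apply, em_add, em_zsmul, SB_add_left, SB_add_right, SB_add_right, SB_zsmul_left,
        SB_zsmul_right, SB_zsmul_right, SB_zsmul_left, SB_comm h (em w) (em v)] at h2
      simp only [← Complex.ofReal_intCast, Complex.add_re, Complex.re_ofReal_mul, h3] at h2
      rw [Lk_apply]
      linarith
    have hre : (SB h (em v) (em w)).re = 0 := by
      by_contra hb
      obtain ⟨k, hk⟩ := exists_nat_gt (Lk (em w) h / (2 * |(SB h (em v) (em w)).re|))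
      rw [div_lt_iff₀ (by positivity)] at hk
      rcases lt_or_gt_of_ne hb with hb | hb
      · have := hexp k
        rw [abs_of_neg hb] at hk
        push_cast at this
        nlinarith
      · have := hexp (-k)
        rw [abs_of_pos hb] at hk
        push_cast at this
        nlinarith
    rw [← SB_re, hre, Complex.ofReal_zero]
  have key2 : ∀ v ∈ S, ∀ (φ : K →+* ℂ) (j : Fin n),
      sq φ (h.1 φ) (em v) (Pi.single j 1) = 0 := by
    intro v hv φ j
    refine sum_embeddings_eq_zero (c := fun φ => sq φ (h.1 φ) (em v) (Pi.single j 1))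
      (fun x => ?_) φ
    have h2 := key v hv (x • Pi.single j 1)
    have h3 : em (Pi.single j 1 : Fin n → 𝓞 K) = Pi.single j 1 := by
      ext i
      rcases eq_or_ne i j with rfl | hij
      · simp [em]
      · simp [em, hij]
    rw [em_smul, h3, SB] at h2
    simpa only [sq_smul_right] using h2
  refine Subtype.ext (funext fun φ => funext fun i => funext fun j => ?_)
  set W : Submodule K (Fin n → K) :=
    { carrier := {x | sq φ (h.1 φ) x (Pi.single j 1) = 0}
      zero_mem' := by simp [sq_eq]
      add_mem' := by
        intro a b ha hb
        rw [Set.mem_ofPred_eq] at *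
        rw [sq_add_left, ha, hb, add_zero]
      smul_mem' := by
        intro c a ha
        rw [Set.mem_ofPred_eq] at *
        rw [sq_smul_left, ha, mul_zero] } with hW
  have hWtop : W = ⊤ := top_le_iff.1 (hS ▸ Submodule.span_le.2 (by
    rintro _ ⟨v, hv, rfl⟩
    exact key2 v hv φ j))
  have : (Pi.single i 1 : Fin n → K) ∈ W := hWtop ▸ Submodule.mem_top
  rw [← sq_single φ (h.1 φ) i j]
  exact this

/-- Hermitian families over a number field fit the framework of Voronoi reduction. -/
theorem vorNF (K : Type*) [Field K] [NumberField K] (n : ℕ) :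
    Vor (K := K) (M := Fin n → K) (E := HH K n) (ι := Fin n → 𝓞 K) em (fun v => Lk (em v)) nm where
  nm_fin := nm_fin
  nm_nonneg := nm_nonneg
  bdd := Lk_bdd
  mink := mink
  rho := Lk_rho
  recc := Lk_recc
  exists_mem := exists_em_mem

end VorNF2
end LS

namespace LS
section Action
open Matrix ComplexEmbedding

variable {K : Type*} [Field K] [NumberField K] {n : ℕ}

/-- The action of an invertible integral matrix on integral vectors. -/
def act (A : (Matrix (Fin n) (Fin n) (𝓞 K))ˣ) : (Fin n → 𝓞 K) ≃ (Fin n → 𝓞 K) where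
  toFun v := A.1 *ᵥ v
  invFun v := (A⁻¹).1 *ᵥ v
  left_inv v := by
    show (A⁻¹).1 *ᵥ (A.1 *ᵥ v) = v
    rw [mulVec_mulVec, Units.inv_mul, one_mulVec]
  right_inv v := by
    show A.1 *ᵥ ((A⁻¹).1 *ᵥ v) = v
    rw [mulVec_mulVec, Units.mul_inv, one_mulVec]

omit [NumberField K] in
lemma act_apply (A : (Matrix (Fin n) (Fin n) (𝓞 K))ˣ) (v : Fin n → 𝓞 K) : act A v = A.1 *ᵥ v := rfl

omit [NumberField K] in
lemma act_mul (A B : (Matrix (Fin n) (Fin n) (𝓞 K))ˣ) (v : Fin n → 𝓞 K) :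
    act (A * B) v = act A (act B v) := by
  rw [act_apply, act_apply, act_apply, mulVec_mulVec]; rfl

/-- An integral matrix viewed over the field. -/
def mK (A : Matrix (Fin n) (Fin n) (𝓞 K)) : Matrix (Fin n) (Fin n) K := A.map (algebraMap (𝓞 K) K)

omit [NumberField K] in
lemma mK_mul (A B : Matrix (Fin n) (Fin n) (𝓞 K)) : mK (A * B) = mK A * mK B := Matrix.map_mul

omit [NumberField K] in
lemma mK_one : mK (1 : Matrix (Fin n) (Fin n) (𝓞 K)) = 1 :=
  Matrix.map_one _ (map_zero _) (map_one _)

omit [NumberField K] in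
lemma em_mulVec (A : Matrix (Fin n) (Fin n) (𝓞 K)) (v : Fin n → 𝓞 K) :
    em (A *ᵥ v) = mK A *ᵥ em v := by
  ext i
  exact (map_sum (algebraMap (𝓞 K) K) _ _).trans (Finset.sum_congr rfl fun j _ => map_mul _ _ _)

omit [NumberField K] in
lemma mK_mul_inv (A : (Matrix (Fin n) (Fin n) (𝓞 K))ˣ) : mK A.1 * mK (A⁻¹).1 = 1 := by
  rw [← mK_mul, Units.mul_inv, mK_one]

omit [NumberField K] in
lemma mK_inv_mul (A : (Matrix (Fin n) (Fin n) (𝓞 K))ˣ) : mK (A⁻¹).1 * mK A.1 = 1 := by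
  rw [← mK_mul, Units.inv_mul, mK_one]

/-- The linear automorphism of `K^n` given by an integral matrix. -/
noncomputable def eK (A : (Matrix (Fin n) (Fin n) (𝓞 K))ˣ) : (Fin n → K) ≃ₗ[K] (Fin n → K) :=
  LinearEquiv.ofLinearMap (Matrix.mulVecLin (mK A.1)) (Matrix.mulVecLin (mK (A⁻¹).1))
    (by rw [← Matrix.mulVecLin_mul, mK_mul_inv, Matrix.mulVecLin_one])
    (by rw [← Matrix.mulVecLin_mul, mK_inv_mul, Matrix.mulVecLin_one])

omit [NumberField K] in
lemma em_act (A : (Matrix (Fin n) (Fin n) (𝓞 K))ˣ) (v : Fin n → 𝓞 K) :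
    em (act A v) = eK A (em v) := em_mulVec _ _

/-- The substitution automorphism on Hermitian families. -/
noncomputable def fK (A : (Matrix (Fin n) (Fin n) (𝓞 K))ˣ) : HH K n ≃ₗ[ℝ] HH K n :=
  LinearEquiv.ofLinearMap (fa (mK A.1)) (fa (mK (A⁻¹).1))
    (by rw [← fa_mul, mK_inv_mul, fa_one])
    (by rw [← fa_mul, mK_mul_inv, fa_one])

lemma Lk_act (A : (Matrix (Fin n) (Fin n) (𝓞 K))ˣ) (v : Fin n → 𝓞 K) (h : HH K n) :
    Lk (em (act A v)) h = Lk (em v) (fK A h) := by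
  rw [act_apply, em_mulVec, Lk_mulVec]; rfl

variable (K n) in
/-- The Voronoi poset of a number field. -/
def PK : Set (Set (Fin n → 𝓞 K)) :=
  PP (M := Fin n → K) (E := HH K n) em (fun v => Lk (em v))

variable (K n) in
/-- The rank function of the Voronoi poset of a number field. -/
noncomputable def rK : Set (Fin n → 𝓞 K) → ℕ := rks (E := HH K n) (fun v => Lk (em v))

variable (K n) in
/-- Well-roundedness. -/
def wK (S : Set (Fin n → 𝓞 K)) : Prop := Submodule.span K (em '' S) = ⊤

lemma PK_image (A : (Matrix (Fin n) (Fin n) (𝓞 K))ˣ) (S : Set (Fin n → 𝓞 K)) :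
    act A '' S ∈ PK K n ↔ S ∈ PK K n := by
  have h1 : ∀ v : Fin n → 𝓞 K, (em (act A v) : Fin n → K) = 0 ↔ (em v : Fin n → K) = 0 :=
    fun v => by rw [em_act, LinearEquiv.map_eq_zero_iff]
  have h2 := Lk_act A
  unfold PK
  exact PP_image (M := Fin n → K) (E := HH K n) (L := fun v : Fin n → 𝓞 K => Lk (K := K) (em v)) (act A) (fK (K := K) (n := n) A) h1 h2 S

lemma rK_image (A : (Matrix (Fin n) (Fin n) (𝓞 K))ˣ) (S : Set (Fin n → 𝓞 K)) :
    rK K n (act A '' S) = rK K n S := by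
  have h2 := Lk_act A
  have h3 : rks (E := HH K n) (fun v : Fin n → 𝓞 K => Lk (K := K) (em v)) (act A '' S) =
      rks (E := HH K n) (fun v : Fin n → 𝓞 K => Lk (K := K) (em v)) S :=
    rks_image (E := HH K n) (act A) (fK (K := K) (n := n) A) h2 S
  exact h3

omit [NumberField K] in
lemma wK_image (A : (Matrix (Fin n) (Fin n) (𝓞 K))ˣ) (S : Set (Fin n → 𝓞 K)) :
    wK K n (act A '' S) ↔ wK K n S := by
  have h1 : em '' (act A '' S) = (eK A : (Fin n → K) →ₗ[K] (Fin n → K)) '' (em '' S) := by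
    rw [Set.image_image, Set.image_image]
    exact Set.image_congr fun v _ => em_act A v
  rw [wK, wK, h1, Submodule.span_image]
  exact Submodule.map_eq_top_iff

lemma geoK : Geo (K := K) (M := Fin n → K) (E := HH K n) em (fun v => Lk (em v)) (PK K n) (rK K n)
    (Module.finrank ℝ (HH K n)) (wK K n) := (vorNF K n).geo

lemma wrK_acyclic (hn : 1 ≤ n) (k : ℕ) : Ex (· < ·) {S ∈ PK K n | wK K n S} k := by
  have : Nonempty (Fin n) := ⟨⟨0, hn⟩⟩
  exact (vorNF K n).wr_acyclic k

lemma symK {a : List (Set (Fin n → 𝓞 K)) → ℚ} (A : (Matrix (Fin n) (Fin n) (𝓞 K))ˣ)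
    (hA : (A.1 - 1) * (A.1 - 1) = 0) (ha : ∀ l, a (l.map (act A '' ·)) = a l) :
    Sym (K := K) (M := Fin n → K) (E := HH K n) em (fun v => Lk (em v)) (PK K n) (rK K n) a
      (act A) where
  lin := ⟨eK A, em_act A⟩
  pos := ⟨fa (mK A.1), det_fa_pos (by
    have h1 : mK A.1 - 1 = mK (A.1 - 1) := by
      rw [← mK_one]; ext i j; exact (map_sub (algebraMap (𝓞 K) K) _ _).symm
    rw [h1, ← mK_mul, hA]
    ext i j; simp [mK]), Lk_act A⟩
  mem := PK_image A
  rk := rK_image A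
  a := ha

lemma stab_finite {S : Set (Fin n → 𝓞 K)} (hS : S ∈ PK K n) (hw : wK K n S) :
    {A : (Matrix (Fin n) (Fin n) (𝓞 K))ˣ | act A '' S = S}.Finite := by
  have hfin : S.Finite := geoK.fin S hS
  have := hfin.to_subtype
  refine Set.Finite.of_injOn (t := Set.univ) (f := fun A : (Matrix (Fin n) (Fin n) (𝓞 K))ˣ =>
    fun v : S => {w : S | (w : Fin n → 𝓞 K) = act A v}) (fun _ _ => Set.mem_univ _) ?_
    Set.finite_univ
  intro A hA B hB hAB
  have h1 : ∀ v ∈ S, act A v = act B v := fun v hv => by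
    have h2 := congrFun hAB ⟨v, hv⟩
    have h3 : act A v ∈ S := by
      have : act A v ∈ act A '' S := ⟨v, hv, rfl⟩
      rwa [show act A '' S = S from hA] at this
    have h4 : (⟨act A v, h3⟩ : S) ∈ {w : S | (w : Fin n → 𝓞 K) = act A v} := rfl
    have h5 : (⟨act A v, h3⟩ : S) ∈ {w : S | (w : Fin n → 𝓞 K) = act B v} := by
      have h6 : {w : S | (w : Fin n → 𝓞 K) = act A v} = {w : S | (w : Fin n → 𝓞 K) = act B v} := h2
      rwa [h6] at h4
    exact h5
  have h2 : ((eK A : (Fin n → K) ≃ₗ[K] (Fin n → K)) : (Fin n → K) →ₗ[K] (Fin n → K)) = eK B := by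
    refine LinearMap.ext_on hw ?_
    rintro _ ⟨v, hv, rfl⟩
    rw [LinearEquiv.coe_coe, LinearEquiv.coe_coe, ← em_act, ← em_act, h1 v hv]
  have h3 : mK A.1 = mK B.1 := Matrix.toLin'.injective h2
  refine Units.ext (Matrix.ext fun i j => RingOfIntegers.ext ?_)
  exact congrFun (congrFun h3 i) j

lemma finrank_HH_le : Module.finrank ℝ (HH K n) ≤
    nrRealPlaces K * (n * (n + 1) / 2) + nrComplexPlaces K * n ^ 2 := by
  classical
  let T : HH K n →ₗ[ℝ] (({w : InfinitePlace K // IsReal w} × {p : Fin n × Fin n // p.1 ≤ p.2}) ⊕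
      ({w : InfinitePlace K // IsComplex w} × Fin n × Fin n) → ℝ) :=
    { toFun := fun h => Sum.elim (fun p => (h.1 p.1.1.embedding p.2.1.1 p.2.1.2).re)
        (fun p => if p.2.1 ≤ p.2.2 then (h.1 p.1.1.embedding p.2.1 p.2.2).re
          else (h.1 p.1.1.embedding p.2.1 p.2.2).im)
      map_add' := by
        intro a b; ext p
        rcases p with p | p
        · simp
        · by_cases hp : p.2.1 ≤ p.2.2 <;> simp [hp]
      map_smul' := by
        intro c a; ext p
        rcases p with p | p
        · simp
        · by_cases hp : p.2.1 ≤ p.2.2 <;> simp [hp] }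
  have hinj : Function.Injective T := by
    rw [← LinearMap.ker_eq_bot, LinearMap.ker_eq_bot']
    intro h hT
    have h1 : ∀ w : InfinitePlace K, ∀ i j, h.1 w.embedding i j = 0 := by
      intro w
      have hH := fun i j => (h.2 w.embedding i j).1
      have hre : ∀ i j, (h.1 w.embedding i j).re = (h.1 w.embedding j i).re := fun i j => by
        rw [← hH i j]; simp
      have him : ∀ i j, (h.1 w.embedding i j).im = -(h.1 w.embedding j i).im := fun i j => by
        rw [← hH j i]; simp
      rcases isReal_or_isComplex w with hw | hw
      · have hc : conjugate w.embedding = w.embedding := isReal_iff.1 hw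
        have h2 : ∀ i j, i ≤ j → (h.1 w.embedding i j).re = 0 := fun i j hij =>
          congrFun hT (Sum.inl (⟨w, hw⟩, ⟨(i, j), hij⟩))
        intro i j
        have h3 := (h.2 w.embedding i j).2
        rw [hc] at h3
        refine Complex.ext ?_ ?_
        · rcases le_total i j with hij | hij
          · exact h2 i j hij
          · rw [hre]; exact h2 j i hij
        · have := him i j
          rw [← h3] at this
          rw [Complex.zero_im]; linarith
      · have h2 : ∀ i j, i ≤ j → (h.1 w.embedding i j).re = 0 := fun i j hij => by
          have := congrFun hT (Sum.inr (⟨w, hw⟩, (i, j)))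
          simpa [T, hij] using this
        have h3 : ∀ i j, ¬ i ≤ j → (h.1 w.embedding i j).im = 0 := fun i j hij => by
          have := congrFun hT (Sum.inr (⟨w, hw⟩, (i, j)))
          simpa [T, hij] using this
        intro i j
        refine Complex.ext ?_ ?_
        · rcases le_total i j with hij | hij
          · exact h2 i j hij
          · rw [hre]; exact h2 j i hij
        · rw [Complex.zero_im]
          rcases lt_trichotomy i j with hij | rfl | hij
          · rw [him, h3 j i hij.not_ge, neg_zero]
          · have := him i i; linarith
          · exact h3 i j hij.not_ge
    refine Subtype.ext (funext fun φ => funext fun i => funext fun j => ?_)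
    change h.1 φ i j = 0
    rcases mk_eq_iff.1 (mk_embedding (mk φ)) with h2 | h2
    · rw [← h2]; exact h1 _ i j
    · rw [← h2, (h.2 _ i j).2]; exact h1 _ j i
  have h2 := LinearMap.finrank_le_finrank_of_injective hinj
  rw [Module.finrank_fintype_fun_eq_card, Fintype.card_sum, Fintype.card_prod, Fintype.card_prod,
    Fintype.card_prod, Fintype.card_fin, ← Fintype.card_congr (Sym2.sortEquiv (α := Fin n)),
    Sym2.card, Fintype.card_fin, Nat.choose_two_right, Nat.add_sub_cancel, mul_comm (n + 1) n,
    ← pow_two] at h2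
  exact h2

end Action
end LS

namespace LS
section Euclid
open Matrix

variable {R : Type*} [CommRing R] {m : ℕ}

/-- Drop row `i` and put the row `x` in front. -/
def ins (x : Fin (m + 1) → R) (b : Matrix (Fin (m + 1)) (Fin (m + 1)) R) (i : Fin (m + 1)) :
    Matrix (Fin (m + 1)) (Fin (m + 1)) R :=
  Matrix.of (Fin.cons x fun j => b (i.succAbove j))

omit [CommRing R] in
lemma ins_zero (x : Fin (m + 1) → R) (b : Matrix (Fin (m + 1)) (Fin (m + 1)) R)
    (i : Fin (m + 1)) : ins x b i 0 = x := rfl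

omit [CommRing R] in
lemma ins_succ (x : Fin (m + 1) → R) (b : Matrix (Fin (m + 1)) (Fin (m + 1)) R)
    (i : Fin (m + 1)) (j : Fin m) : ins x b i j.succ = b (i.succAbove j) := rfl

lemma ins_ne_zero {x : Fin (m + 1) → R} (hx : x ≠ 0)
    {b : Matrix (Fin (m + 1)) (Fin (m + 1)) R} (hb : ∀ i, b i ≠ 0) (i j : Fin (m + 1)) :
    ins x b i j ≠ 0 := by
  refine Fin.cases hx (fun j => ?_) j
  rw [ins_succ]; exact hb _

omit [CommRing R] in
lemma updateRow_eq_ins (b : Matrix (Fin (m + 1)) (Fin (m + 1)) R) (x : Fin (m + 1) → R)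
    (i : Fin (m + 1)) : b.updateRow i x = (ins x b i).submatrix i.cycleRange id := by
  ext j k
  rw [submatrix_apply, id]
  refine Fin.succAboveCases i ?_ (fun l => ?_) j
  · rw [updateRow_self, Fin.cycleRange_self, ins_zero]
  · rw [updateRow_ne (Fin.succAbove_ne i l), Fin.cycleRange_succAbove, ins_succ]

lemma det_ins (b : Matrix (Fin (m + 1)) (Fin (m + 1)) R) (x : Fin (m + 1) → R)
    (i : Fin (m + 1)) :
    (ins x b i).det = (b.updateRow i x).det ∨ (ins x b i).det = -(b.updateRow i x).det := by
  rw [updateRow_eq_ins, det_permute]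
  rcases Int.units_eq_one_or (Equiv.Perm.sign i.cycleRange) with h | h <;> simp [h]

/-- Functions on integral frames behaving like cocycles modulo degenerate frames. -/
structure Coc (f : Matrix (Fin m) (Fin m) R → ℚ) : Prop where
  coc : ∀ c : Fin (m + 1) → Fin m → R, (∀ i, c i ≠ 0) →
    ∑ i : Fin (m + 1), (-1) ^ (i : ℕ) * f (Matrix.of fun j => c (i.succAbove j)) = 0
  deg : ∀ b : Matrix (Fin m) (Fin m) R, (∀ i, b i ≠ 0) → b.det = 0 → f b = 0
  inv : ∀ b A : Matrix (Fin m) (Fin m) R, (∀ i, b i ≠ 0) → A.det = 1 →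
    (A - 1) * (A - 1) = 0 → f (b * Aᵀ) = f b

lemma row_ne_zero {b : Matrix (Fin m) (Fin m) R} (hb : b.det ≠ 0) (i : Fin m) :
    b i ≠ 0 := fun h => hb (det_eq_zero_of_row_eq_zero i fun j => congrFun h j)

lemma Coc.ins {f : Matrix (Fin (m + 1)) (Fin (m + 1)) R → ℚ} (hf : Coc f)
    (x : Fin (m + 1) → R) (hx : x ≠ 0) (b : Matrix (Fin (m + 1)) (Fin (m + 1)) R)
    (hb : ∀ i, b i ≠ 0) : f b = ∑ i : Fin (m + 1), (-1) ^ (i : ℕ) * f (ins x b i) := by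
  have h := hf.coc (Fin.cons x b) (Fin.cases hx hb)
  rw [Fin.sum_univ_succ] at h
  have h2 : ∀ i : Fin (m + 1), (Matrix.of fun j =>
      (Fin.cons x b : Fin (m + 2) → Fin (m + 1) → R) (i.succ.succAbove j)) = LS.ins x b i := by
    intro i
    ext j k
    refine Fin.cases ?_ (fun l => ?_) j
    · rw [ins_zero, Matrix.of_apply, Fin.succ_succAbove_zero]; rfl
    · rw [ins_succ, Matrix.of_apply, Fin.succ_succAbove_succ]; rfl
  have h3 : (Matrix.of fun j => (Fin.cons x b : Fin (m + 2) → Fin (m + 1) → R)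
      ((0 : Fin (m + 2)).succAbove j)) = b := by
    ext j k; rfl
  simp only [h2, h3, Fin.val_zero, pow_zero, one_mul, Fin.val_succ, pow_succ, mul_neg, mul_one,
    neg_mul, Finset.sum_neg_distrib] at h
  linarith

lemma Coc.line {f : Matrix (Fin (m + 1)) (Fin (m + 1)) R → ℚ} (hf : Coc f)
    (b : Matrix (Fin (m + 1)) (Fin (m + 1)) R) (hb : ∀ i, b i ≠ 0) (u : R) (k : Fin (m + 1))
    (hu : u • b k ≠ 0) : f b = (-1) ^ (k : ℕ) * f (LS.ins (u • b k) b k) := by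
  rw [hf.ins _ hu b hb]
  refine Finset.sum_eq_single k (fun i _ hik => ?_) (by simp)
  rw [hf.deg _ (ins_ne_zero hu hb i), mul_zero]
  have h2 : (b.updateRow i (u • b k)).det = 0 := by
    rw [det_updateRow_smul, det_zero_of_row_eq hik (by
      rw [updateRow_self, updateRow_ne (Ne.symm hik)]), mul_zero]
  have h1 := det_ins b (u • b k) i
  rwa [h2, neg_zero, or_self] at h1

lemma Coc.neg {f : Matrix (Fin (m + 1)) (Fin (m + 1)) R → ℚ} (hf : Coc f)
    (b : Matrix (Fin (m + 1)) (Fin (m + 1)) R) (hb : ∀ i, b i ≠ 0) :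
    f b = f (b.updateRow 0 (-b 0)) := by
  have h := hf.line b hb (-1) 0 (by rw [neg_one_smul]; exact neg_ne_zero.2 (hb 0))
  rw [Fin.val_zero, pow_zero, one_mul, neg_one_smul] at h
  rw [h, updateRow_eq_ins]
  congr 1
  ext i j
  rw [submatrix_apply, Fin.cycleRange_zero]; rfl

lemma Coc.swap {f : Matrix (Fin (m + 2)) (Fin (m + 2)) R → ℚ} (hf : Coc f)
    (b : Matrix (Fin (m + 2)) (Fin (m + 2)) R) (hb : ∀ i, b i ≠ 0) :
    f b = -f ((b.updateRow 0 (b 1)).updateRow 1 (b 0)) := by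
  have h := hf.line b hb 1 1 (by rw [one_smul]; exact hb 1)
  rw [Fin.val_one, pow_one, neg_one_mul, one_smul] at h
  rw [h]
  congr 2
  ext i j
  refine Fin.cases ?_ (Fin.cases ?_ fun i => ?_) i
  · rw [ins_zero, updateRow_ne (by simp), updateRow_self]
  · rw [ins_succ, Fin.succAbove_ne_zero_zero one_ne_zero]
    exact (congrFun (updateRow_self (M := b.updateRow 0 (b 1)) (i := 1)) j).symm
  · rw [ins_succ, updateRow_ne (by simp [Fin.ext_iff]), updateRow_ne (by simp [Fin.ext_iff])]
    rfl

lemma Coc.add_row {f : Matrix (Fin m) (Fin m) R → ℚ} (hf : Coc f)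
    (b : Matrix (Fin m) (Fin m) R) (hb0 : ∀ i, b i ≠ 0) (hb : IsUnit b.det) {i j : Fin m}
    (hij : i ≠ j) (c : R) : f b = f (b.updateRow i (b i + c • b j)) := by
  have h1 : b * b⁻¹ = 1 := mul_nonsing_inv b hb
  have h2 : b⁻¹ * b = 1 := nonsing_inv_mul b hb
  have h3 : (b⁻¹ * transvection i j c * b)ᵀ.det = 1 := by
    rw [det_transpose, det_mul, det_mul, det_transvection_of_ne _ _ hij, mul_one, ← det_mul, h2,
      det_one]
  have h4 : b⁻¹ * transvection i j c * b - 1 = b⁻¹ * single i j c * b := by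
    rw [transvection, mul_add, add_mul, mul_one, h2]; abel
  have h5 := hf.inv b (b⁻¹ * transvection i j c * b)ᵀ hb0 h3 (by
    rw [← transpose_one, ← transpose_sub, ← transpose_mul, h4]
    have : b⁻¹ * single i j c * b * (b⁻¹ * single i j c * b) =
        b⁻¹ * (single i j c * (b * b⁻¹) * single i j c) * b := by
      simp only [Matrix.mul_assoc]
    rw [this, h1, mul_one, single_mul_single_of_ne _ _ _ _ hij.symm, mul_zero, zero_mul,
      transpose_zero])
  rw [transpose_transpose, ← Matrix.mul_assoc, ← Matrix.mul_assoc, h1, one_mul] at h5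
  rw [← h5]
  congr 1
  ext k l
  by_cases hk : k = i
  · subst hk
    rw [transvection_mul_apply_same, updateRow_self]; rfl
  · rw [transvection_mul_apply_of_ne _ _ _ _ hk, updateRow_ne hk]

lemma Coc.unit {f : Matrix (Fin (m + 2)) (Fin (m + 2)) R → ℚ} (hf : Coc f)
    (b : Matrix (Fin (m + 2)) (Fin (m + 2)) R) (hb0 : ∀ b : Matrix (Fin (m + 2)) (Fin (m + 2)) R,
      IsUnit b.det → ∀ i, b i ≠ 0) (hb : IsUnit b.det) : f b = 0 := by
  have h01 : (0 : Fin (m + 2)) ≠ 1 := Fin.zero_ne_one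
  have key : ∀ (b : Matrix (Fin (m + 2)) (Fin (m + 2)) R) (i j : Fin (m + 2)) (c : R),
      IsUnit b.det → i ≠ j → IsUnit (b.updateRow i (b i + c • b j)).det ∧
      f b = f (b.updateRow i (b i + c • b j)) := fun b i j c hb hij =>
    ⟨by rwa [det_updateRow_add_smul_self _ hij], hf.add_row b (hb0 b hb) hb hij c⟩
  obtain ⟨u1, e1⟩ := key b 1 0 1 hb h01.symm
  set b1 := b.updateRow 1 (b 1 + (1 : R) • b 0) with hb1
  obtain ⟨u2, e2⟩ := key b1 0 1 (-1) u1 h01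
  set b2 := b1.updateRow 0 (b1 0 + (-1 : R) • b1 1) with hb2
  obtain ⟨u3, e3⟩ := key b2 1 0 1 u2 h01.symm
  set b3 := b2.updateRow 1 (b2 1 + (1 : R) • b2 0) with hb3
  have e4 := hf.neg b3 (hb0 b3 u3)
  have e5 := hf.swap b (hb0 b hb)
  have h10 : b1 0 = b 0 := updateRow_ne h01
  have h11 : b1 1 = b 1 + (1 : R) • b 0 := updateRow_self
  have h20 : b2 0 = b1 0 + (-1 : R) • b1 1 := updateRow_self
  have h21 : b2 1 = b1 1 := updateRow_ne h01.symm
  have h30 : b3 0 = b2 0 := updateRow_ne h01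
  have h31 : b3 1 = b2 1 + (1 : R) • b2 0 := updateRow_self
  have e6 : b3.updateRow 0 (-b3 0) = (b.updateRow 0 (b 1)).updateRow 1 (b 0) := by
    ext i j
    by_cases hi0 : i = 0
    · subst hi0
      rw [updateRow_self, updateRow_ne h01, updateRow_self, h30, h20, h10, h11]
      simp
    by_cases hi1 : i = 1
    · subst hi1
      rw [updateRow_self, updateRow_ne h01.symm, h31, h21, h20, h10, h11]
      simp
    · rw [updateRow_ne hi0, updateRow_ne hi1, updateRow_ne hi0, hb3, updateRow_ne hi1, hb2,
        updateRow_ne hi0, hb1, updateRow_ne hi1]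
  rw [e6] at e4
  linarith

lemma Coc.eq_zero [IsDomain R] {f : Matrix (Fin (m + 2)) (Fin (m + 2)) R → ℚ} (hf : Coc f)
    {r : R → R → Prop} (hr : WellFounded r) (hq : ∀ a b : R, b ≠ 0 → ∃ q, r (a - b * q) b)
    (b : Matrix (Fin (m + 2)) (Fin (m + 2)) R) (hb : ∀ i, b i ≠ 0) : f b = 0 := by
  suffices H : ∀ (d : R) (b : Matrix (Fin (m + 2)) (Fin (m + 2)) R), (∀ i, b i ≠ 0) →
      (b.det = d ∨ b.det = -d) → f b = 0 from H _ b hb (Or.inl rfl)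
  intro d
  induction d using hr.induction with
  | _ d IH =>
  intro b hb hd
  by_cases h0 : b.det = 0
  · exact hf.deg b hb h0
  by_cases hu : IsUnit b.det
  · exact hf.unit b (fun b hu => row_ne_zero hu.ne_zero) hu
  have hdvd : ∀ x, b.det ∣ x ↔ d ∣ x := fun x => by
    rcases hd with h | h <;> simp [h]
  have hd0 : d ≠ 0 := by
    rintro rfl; simp at hd; exact h0 hd
  obtain ⟨x, hx⟩ : ∃ x : Fin (m + 2) → R, ¬ ∀ i, d ∣ (b.updateRow i x).det := by
    by_contra! hx
    refine hu ?_
    have h1 : ∀ i j, ∃ c, b.adjugate j i = b.det * c := fun i j => by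
      rw [adjugate_apply]; exact (hdvd _).2 (hx _ _)
    choose c hc using h1
    have h2 : b * Matrix.of (fun j i => c i j) = 1 := by
      have h3 := mul_adjugate b
      rw [show b.adjugate = b.det • Matrix.of (fun j i => c i j) by ext j i; exact hc i j,
        Matrix.mul_smul] at h3
      exact smul_right_injective _ h0 h3
    exact isUnit_det_of_right_inverse h2
  choose q hq using fun i => hq (b.updateRow i x).det d hd0
  obtain ⟨s, hs⟩ : ∃ s : R, d = s * b.det := by
    rcases hd with h | h
    · exact ⟨1, by rw [h, one_mul]⟩
    · exact ⟨-1, by rw [h]; ring⟩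
  have hy : ∀ i, (b.updateRow i (x - ∑ j, (s * q j) • b j)).det =
      (b.updateRow i x).det - d * q i := by
    intro i
    have h1 := cramer_transpose_apply b
    rw [← h1, ← h1, map_sub, Pi.sub_apply, map_sum, Finset.sum_apply, Finset.sum_eq_single i]
    · rw [map_smul, Pi.smul_apply, h1 (b i), updateRow_eq_self, smul_eq_mul, hs]; ring
    · intro j _ hj
      rw [map_smul, Pi.smul_apply, h1 (b j), det_zero_of_row_eq hj.symm (by
        rw [updateRow_self, updateRow_ne hj]), smul_zero]
    · simp
  have hx0 : x - ∑ j, (s * q j) • b j ≠ 0 := by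
    intro h
    refine hx fun i => ?_
    have := hy i
    rw [h, det_eq_zero_of_row_eq_zero i (fun j => by rw [updateRow_self]; rfl)] at this
    exact ⟨q i, (sub_eq_zero.1 this.symm)⟩
  rw [hf.ins _ hx0 b hb]
  refine Finset.sum_eq_zero fun i _ => ?_
  rw [IH _ (hq i) _ (ins_ne_zero hx0 hb i), mul_zero]
  rw [← hy i]
  exact det_ins _ _ _

end Euclid
end LS

namespace LS
section Euclid
open Matrix

lemma bdL_ofFn {τ : Type*} : ∀ {m : ℕ} (c : Fin (m + 1) → τ), bdL (List.ofFn c) =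
    ∑ i : Fin (m + 1), Finsupp.single (List.ofFn fun j => c (i.succAbove j)) ((-1 : ℚ) ^ (i : ℕ))
  | 0, c => by simp [bdL]
  | m + 1, c => by
    have h1 : ∀ i : Fin (m + 1), (List.ofFn fun j => c (i.succ.succAbove j)) =
        c 0 :: List.ofFn fun j => c (i.succAbove j).succ := fun i => by
      rw [List.ofFn_succ]
      simp
    rw [List.ofFn_succ, bdL, bdL_ofFn (fun i => c i.succ), map_sum, Fin.sum_univ_succ (n := m + 1),
      sub_eq_add_neg, ← Finset.sum_neg_distrib]
    refine congrArg₂ _ (by simp) (Finset.sum_congr rfl fun i _ => ?_)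
    rw [cn_single, h1, ← Finsupp.single_neg, Fin.val_succ, pow_succ, mul_neg_one]

/-- The rings whose division admits a well-founded remainder. -/
def Euc (R : Type*) [CommRing R] : Prop :=
  ∃ r : R → R → Prop, WellFounded r ∧ ∀ a b : R, b ≠ 0 → ∃ q, r (a - b * q) b

lemma euc_of_euclideanDomain (R : Type*) [e : EuclideanDomain R] : Euc R :=
  ⟨EuclideanDomain.r, EuclideanDomain.r_wellFounded, fun a b hb => ⟨a / b, by
    have h := EuclideanDomain.mod_lt a hb
    rwa [EuclideanDomain.mod_eq_sub_mul_div] at h⟩⟩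

variable {K : Type*} [Field K] [NumberField K] {n : ℕ}

omit [NumberField K] in
lemma span_rows_ne_top {b : Matrix (Fin n) (Fin n) (𝓞 K)} (hb : b.det = 0) :
    Submodule.span K (em '' Set.range b) ≠ (⊤ : Submodule K (Fin n → K)) := by
  intro h
  have h1 : em '' Set.range b = Set.range (mK b).row := by
    exact (Set.range_comp em b.row).symm
  have h2 : LinearIndependent K (mK b).row :=
    linearIndependent_of_top_le_span_of_card_eq_finrank (by rw [← h1, h]) (by simp)
  have h3 := (Matrix.isUnit_iff_isUnit_det _).1 (linearIndependent_rows_iff_isUnit.1 h2)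
  have h4 : (mK b).det = algebraMap (𝓞 K) K b.det := (RingHom.map_det _ _).symm
  rw [h4, hb, map_zero] at h3
  exact h3.ne_zero rfl

theorem kill (hE : Euc (𝓞 K)) (h2 : 2 ≤ n) (hnN : n ≤ Module.finrank ℝ (HH K n))
    {a : List (Set (Fin n → 𝓞 K)) → ℚ}
    (ha : LF (PK K n) (wK K n) (Module.finrank ℝ (HH K n) - n) a)
    (hinv : ∀ A : (Matrix (Fin n) (Fin n) (𝓞 K))ˣ, A.1.det = 1 →
      ∀ l, a (l.map (act A '' ·)) = a l) (l : List (Set (Fin n → 𝓞 K))) : a l = 0 := by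
  obtain ⟨r, hr, hq⟩ := hE
  have hX : ∀ S ∈ PK K n, ∀ v ∈ S, (em v : Fin n → K) ≠ 0 := fun S hS v hv => by
    obtain ⟨q, hq⟩ := hS
    exact hq.sub v hv
  refine duality geoK (Module.finBasis ℝ (HH K n)) hX ha (by simp) h2 hnN
    {σ | ∃ A : (Matrix (Fin n) (Fin n) (𝓞 K))ˣ, (A.1 - 1) * (A.1 - 1) = 0 ∧ A.1.det = 1 ∧
      act A = σ} ?_ ?_ l
  · rintro _ ⟨A, h1, h2, rfl⟩
    exact symK A h1 (hinv A h2)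
  intro β hc hd hi l hl hln
  obtain ⟨m, rfl⟩ := Nat.exists_eq_add_of_le' h2
  have hz : ∀ v : Fin (m + 2) → 𝓞 K, (em v : Fin (m + 2) → K) ≠ 0 ↔ v ≠ 0 := fun v =>
    em_eq_zero.not
  simp only [hz] at hc hd hi hl
  obtain ⟨b, rfl⟩ : ∃ b : Fin (m + 2) → Fin (m + 2) → 𝓞 K, List.ofFn b = l := by
    exact ⟨fun i => l.get (i.cast hln.symm), List.ext_getElem (by simp [hln]) fun i h1 h2 => by
      rw [List.getElem_ofFn]; rfl⟩
  have hmem : ∀ {k : ℕ} {c : Fin k → Fin (m + 2) → 𝓞 K}, (∀ x ∈ List.ofFn c, x ≠ 0) ↔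
      ∀ i, c i ≠ 0 := fun {k c} => List.forall_mem_ofFn_iff
  have hf : Coc (fun b : Matrix (Fin (m + 2)) (Fin (m + 2)) (𝓞 K) =>
      β (List.ofFn fun i => b i)) := by
    constructor
    · intro c h0
      have h1 := hc (List.ofFn c) (hmem.2 h0) (by simp)
      rw [bdL_ofFn, map_sum] at h1
      simp only [Finsupp.linearCombination_single, smul_eq_mul] at h1
      exact h1
    · intro b hb hb0
      refine hd _ (hmem.2 hb) (by simp) ?_
      have := span_rows_ne_top hb0
      have h1 : {x | x ∈ List.ofFn fun i => b i} = Set.range b := by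
        ext x; exact List.mem_ofFn
      rwa [h1]
    · intro b A hb hA hA2
      have h1 := hi (act (nonsingInvUnit A (by rw [hA]; exact isUnit_one))) ⟨_, hA2, hA, rfl⟩
        (List.ofFn fun i => b i) (hmem.2 hb) (by simp)
      rw [← h1, List.map_ofFn]
      congr 1
      refine congrArg _ (funext fun i => funext fun j => ?_)
      rw [mul_apply]
      exact Finset.sum_congr rfl fun k _ => mul_comm _ _
  exact hf.eq_zero hr hq b (hmem.1 hl)

end Euclid
end LS

namespace LS
section Averaging

variable {G α : Type*} [Group G] [MulAction G α]

variable (G) in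
/-- The number of group elements moving one point to another. -/
noncomputable def kk (s t : α) : ℚ := Nat.card {g : G // g • s = t}

lemma kk_smul_left (h : G) (s t : α) : kk G (h • s) t = kk G s t := by
  rw [kk, kk, Nat.card_congr]
  exact (Equiv.mulRight h).subtypeEquiv fun g => by simp [mul_smul]

lemma kk_smul_right (h : G) (s t : α) : kk G s (h • t) = kk G s t := by
  rw [kk, kk, Nat.card_congr]
  exact (Equiv.mulLeft h⁻¹).subtypeEquiv fun g => by
    simp [mul_smul, inv_smul_eq_iff]

lemma exists_of_kk_ne_zero {s t : α} (h : kk G s t ≠ 0) : ∃ g : G, g • s = t := by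
  by_contra! hg
  refine h ?_
  have : IsEmpty {g : G // g • s = t} := ⟨fun g => hg g.1 g.2⟩
  rw [kk, Nat.card_of_isEmpty, Nat.cast_zero]

lemma finite_trans {s : α} (hs : {g : G | g • s = s}.Finite) (t : α) :
    {g : G | g • s = t}.Finite := by
  by_cases h : ∃ g0 : G, g0 • s = t
  · obtain ⟨g0, rfl⟩ := h
    refine (hs.image (g0 * ·)).subset fun g hg => ⟨g0⁻¹ * g, ?_, by simp⟩
    change (g0⁻¹ * g) • s = s
    rw [mul_smul, inv_smul_eq_iff]; exact hg
  · push Not at h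
    convert Set.finite_empty
    ext g; simpa using h g

lemma kk_self_ne_zero {s : α} (hs : {g : G | g • s = s}.Finite) : kk G s s ≠ 0 := by
  have : Finite {g : G // g • s = s} := hs
  have : Nonempty {g : G // g • s = s} := ⟨1, one_smul _ _⟩
  exact Nat.cast_ne_zero.2 Nat.card_pos.ne'

variable (G) in
/-- A chosen point in every orbit. -/
noncomputable def orep (s : α) : α := (Quotient.mk (MulAction.orbitRel G α) s).out

lemma orep_eq (s : α) : ∃ g : G, g • orep G s = s := by
  have h : (MulAction.orbitRel G α).r (orep G s) s := Quotient.mk_out (s := MulAction.orbitRel G α) s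
  obtain ⟨g, hg⟩ := MulAction.orbitRel_apply.1 h
  exact ⟨g⁻¹, by rw [inv_smul_eq_iff]; exact hg.symm⟩

lemma orep_smul (g : G) (s : α) : orep G (g • s) = orep G s := by
  unfold orep
  congr 1
  exact Quotient.sound (s := MulAction.orbitRel G α) ⟨g, rfl⟩

lemma sum_eq_zero_of_average {S : Set α} (hS : ∀ (g : G) s, s ∈ S → g • s ∈ S)
    (hfin : ∀ s ∈ S, {g : G | g • s = s}.Finite) {f : α → ℚ}
    (hf : ∀ (g : G) s, s ∈ S → f (g • s) = f s) {c : α →₀ ℚ} (hc : ∀ s, c s ≠ 0 → s ∈ S)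
    (h0 : ∀ t, Finsupp.linearCombination ℚ (fun s => kk G s t) c = 0) :
    Finsupp.linearCombination ℚ f c = 0 := by
  classical
  have hin : ∀ s, s ∈ S → orep G s ∈ S := fun s hs => by
    obtain ⟨g, hg⟩ := orep_eq (G := G) s
    have := hS g⁻¹ s hs
    rwa [← hg, inv_smul_smul] at this
  rw [Finsupp.linearCombination_apply, Finsupp.sum, ← Finset.sum_fiberwise_of_maps_to
    (t := c.support.image (orep G)) (g := orep G) fun s hs => Finset.mem_image_of_mem _ hs]
  refine Finset.sum_eq_zero fun q hq => ?_
  obtain ⟨s0, hs0, rfl⟩ := Finset.mem_image.1 hq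
  have hq : orep G s0 ∈ S := hin s0 (hc s0 (Finsupp.mem_support_iff.1 hs0))
  have hoo : orep G (orep G s0) = orep G s0 := by
    obtain ⟨g, hg⟩ := orep_eq (G := G) s0
    rw [← orep_smul g (orep G s0), hg]
  set q := orep G s0
  have h1 : ∀ s ∈ c.support.filter (fun s => orep G s = q), c s • f s =
      (f q / kk G q q) * (c s • kk G s q) := fun s hs => by
    obtain ⟨hs1, hs2⟩ := Finset.mem_filter.1 hs
    obtain ⟨g, hg⟩ := orep_eq (G := G) s
    rw [hs2] at hg
    rw [← hg, kk_smul_left, hf g q hq]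
    have := kk_self_ne_zero (hfin q hq)
    rw [smul_eq_mul, smul_eq_mul]
    field_simp
  rw [Finset.sum_congr rfl h1, ← Finset.mul_sum]
  have h2 := h0 q
  rw [Finsupp.linearCombination_apply, Finsupp.sum,
    ← Finset.sum_filter_add_sum_filter_not _ (fun s => orep G s = q)] at h2
  rw [Finset.sum_eq_zero (s := c.support.filter fun s => ¬ orep G s = q), add_zero] at h2
  · rw [h2, mul_zero]
  · intro s hs
    by_contra h
    obtain ⟨g, hg⟩ := exists_of_kk_ne_zero (right_ne_zero_of_smul h)
    refine (Finset.mem_filter.1 hs).2 ?_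
    rw [← orep_smul g s, hg, hoo]

/-- Equivariant lifting along a surjection over a field of characteristic zero. -/
lemma exists_equivariant_lift {A B : Type*} [AddCommGroup A] [Module ℚ A] [AddCommGroup B]
    [Module ℚ B] (ρA : Representation ℚ G A) (ρB : Representation ℚ G B) (p : A →ₗ[ℚ] B)
    (hp : ∀ g a, p (ρA g a) = ρB g (p a)) (hs : Function.Surjective p) {S : Set α}
    (hS : ∀ (g : G) s, s ∈ S → g • s ∈ S) (hfin : ∀ s ∈ S, {g : G | g • s = s}.Finite)
    (f : α → B) (hf : ∀ (g : G) s, s ∈ S → f (g • s) = ρB g (f s)) :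
    ∃ φ : α → A, (∀ s ∈ S, p (φ s) = f s) ∧ ∀ (g : G) s, s ∈ S → φ (g • s) = ρA g (φ s) := by
  classical
  choose u hu using hs
  have hin : ∀ s, s ∈ S → orep G s ∈ S := fun s hs => by
    obtain ⟨g, hg⟩ := orep_eq (G := G) s
    have := hS g⁻¹ s hs
    rwa [← hg, inv_smul_smul] at this
  have hT : ∀ s ∈ S, {g : G | g • orep G s = s}.Finite := fun s hs =>
    finite_trans (hfin _ (hin s hs)) s
  let T : α → Finset G := fun s => if hs : s ∈ S then (hT s hs).toFinset else ∅
  have mT : ∀ s ∈ S, ∀ g, g ∈ T s ↔ g • orep G s = s := fun s hs g => by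
    simp only [T, dif_pos hs, Set.Finite.mem_toFinset, Set.mem_ofPred_eq]
  have cT : ∀ s ∈ S, ((T s).card : ℚ) ≠ 0 := fun s hs => by
    obtain ⟨g, hg⟩ := orep_eq (G := G) s
    exact Nat.cast_ne_zero.2 (Finset.card_ne_zero.2 ⟨g, (mT s hs g).2 hg⟩)
  have tT : ∀ (h : G) s, s ∈ S → T (h • s) = (T s).map (Equiv.mulLeft h).toEmbedding := by
    intro h s hs
    ext g
    rw [mT _ (hS h s hs), Finset.mem_map_equiv, mT s hs, orep_smul]
    simp [mul_smul, inv_smul_eq_iff]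
  refine ⟨fun s => ((T s).card : ℚ)⁻¹ • ∑ g ∈ T s, ρA g (u (f (orep G s))), fun s hs => ?_,
    fun h s hs => ?_⟩
  · rw [map_smul, map_sum, Finset.sum_congr rfl (g := fun _ => f s), Finset.sum_const,
      ← Nat.cast_smul_eq_nsmul ℚ, smul_smul, inv_mul_cancel₀ (cT s hs), one_smul]
    intro g hg
    rw [hp, hu, ← hf g _ (hin s hs), (mT s hs g).1 hg]
  · simp only [tT h s hs, Finset.card_map, Finset.sum_map, orep_smul, map_smul, map_sum]
    congr 1
    refine Finset.sum_congr rfl fun g _ => ?_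
    simp [map_mul]

end Averaging
end LS

namespace LS
section Resolution
open CategoryTheory

variable {G : Type} [Group G]

lemma rep_exact {A B C : Rep.{0} ℚ G} (f : A ⟶ B) (g : B ⟶ C) (w : f ≫ g = 0)
    (h : ∀ b, g.hom b = 0 → ∃ a, f.hom a = b) : (ShortComplex.mk f g w).Exact := by
  apply (forget₂ (Rep.{0} ℚ G) (ModuleCat ℚ)).reflects_exact_of_faithful
  rw [ShortComplex.moduleCat_exact_iff]
  intro x hx
  exact h x hx

/-- An exact augmented complex of projective representations. -/
structure PRes (G : Type) [Group G] where
  X : ℕ → Rep.{0} ℚ G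
  d : ∀ i, X (i + 1) ⟶ X i
  dd : ∀ i, d (i + 1) ≫ d i = 0
  ε : X 0 ⟶ Rep.trivial ℚ G ℚ
  dε : d 0 ≫ ε = 0
  proj : ∀ i, Projective (X i)
  ex : ∀ i b, (d i).hom b = 0 → ∃ a, (d (i + 1)).hom a = b
  exε : ∀ b, ε.hom b = 0 → ∃ a, (d 0).hom a = b
  surj : Function.Surjective ε.hom

/-- The underlying complex. -/
noncomputable def PRes.cx (P : PRes G) : ChainComplex (Rep.{0} ℚ G) ℕ := ChainComplex.of P.X P.d P.dd

lemma PRes.cx_d (P : PRes G) (i : ℕ) : P.cx.d (i + 1) i = P.d i := ChainComplex.of_d _ _ _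

/-- The underlying augmentation. -/
noncomputable def PRes.aug (P : PRes G) :
    P.cx ⟶ (ChainComplex.single₀ (Rep.{0} ℚ G)).obj (Rep.trivial ℚ G ℚ) :=
  (ChainComplex.toSingle₀Equiv P.cx (Rep.trivial ℚ G ℚ)).symm
    ⟨P.ε, by rw [P.cx_d]; exact P.dε⟩

lemma PRes.aug_zero (P : PRes G) : P.aug.f 0 = P.ε :=
  ChainComplex.toSingle₀Equiv_symm_apply_f_zero (C := P.cx) (X := Rep.trivial ℚ G ℚ) P.ε _

lemma PRes.quasi (P : PRes G) : QuasiIso P.aug where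
  quasiIsoAt m := by
    cases m with
    | zero =>
      rw [ChainComplex.quasiIsoAt₀_iff, ShortComplex.quasiIso_iff_of_zeros' _ rfl rfl rfl]
      constructor
      · have h := rep_exact (P.d 0) P.ε P.dε P.exε
        convert h using 2
        · rfl
        · rfl
        · rfl
        · exact heq_of_eq (P.cx_d 0)
        · exact heq_of_eq P.aug_zero
      · rw [Rep.epi_iff_surjective]
        exact P.surj
    | succ m =>
      rw [quasiIsoAt_iff_exactAt' (hL := ChainComplex.exactAt_succ_single_obj ..),
          HomologicalComplex.exactAt_iff' _ (m + 2) (m + 1) m (by simp) (by simp)]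
      have h := rep_exact (P.d (m + 1)) (P.d m) (P.dd m) (P.ex m)
      convert h using 2
      · rfl
      · rfl
      · rfl
      · exact heq_of_eq (P.cx_d (m + 1))
      · exact heq_of_eq (P.cx_d m)

/-- The associated projective resolution. -/
noncomputable def PRes.res (P : PRes G) : ProjectiveResolution (Rep.trivial ℚ G ℚ) where
  complex := P.cx
  projective := P.proj
  π := P.aug
  quasiIso := P.quasi

lemma PRes.subsingleton (P : PRes G) (m : ℕ)
    (h : ∀ f : P.X (m + 1) ⟶ Rep.trivial ℚ G ℚ, ∃ g : P.X m ⟶ Rep.trivial ℚ G ℚ, f = P.d m ≫ g) :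
    Subsingleton (groupCohomology (Rep.trivial ℚ G ℚ) (m + 1)) := by
  suffices Limits.IsZero (groupCohomology (Rep.trivial ℚ G ℚ) (m + 1)) from
    ModuleCat.subsingleton_of_isZero this
  refine Limits.IsZero.of_iso ?_ (groupCohomologyIso (Rep.trivial ℚ G ℚ) (m + 1) P.res)
  rw [← HomologicalComplex.exactAt_iff_isZero_homology,
    HomologicalComplex.exactAt_iff' _ m (m + 1) (m + 2) (by simp) (by simp),
    ShortComplex.moduleCat_exact_iff]
  intro x hx
  obtain ⟨g, hg⟩ := h x
  refine ⟨g, ?_⟩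
  have h1 : x = P.cx.d (m + 1) m ≫ g := by rw [P.cx_d]; exact hg
  exact h1.symm

end Resolution
end LS

namespace LS
section ListRes
open CategoryTheory

variable {G τ : Type} [Group G] [MulAction G τ] {r : τ → τ → Prop} {X : Set τ}

/-- An equivariant linear map as an intertwining map. -/
def mkInt {V W : Type*} [AddCommGroup V] [AddCommGroup W] [Module ℚ V] [Module ℚ W]
    {ρ : Representation ℚ G V} {σ : Representation ℚ G W} (f : V →ₗ[ℚ] W)
    (hf : ∀ g v, f (ρ g v) = σ g (f v)) : ρ.IntertwiningMap σ :=
  { f with isIntertwining' := fun g => LinearMap.ext (hf g) }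

/-- The diagonal action on lists. -/
instance listAct : MulAction G (List τ) where
  smul g l := l.map (g • ·)
  one_smul l := (List.map_congr_left fun x _ => one_smul G x).trans (List.map_id' l)
  mul_smul g h l := by
    change l.map ((g * h) • ·) = (l.map (h • ·)).map (g • ·)
    rw [List.map_map]
    exact List.map_congr_left fun x _ => mul_smul g h x

lemma list_smul_def (g : G) (l : List τ) : g • l = l.map (g • ·) := rfl

variable (G r X) in
/-- Invariance of an order relation and of a set of vertices, with finite stabilizers. -/
structure GInv : Prop where
  rel : ∀ (g : G) x y, r x y → r (g • x) (g • y)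
  mem : ∀ (g : G) x, x ∈ X → g • x ∈ X
  fin : ∀ x ∈ X, {g : G | g • x = x}.Finite

lemma GInv.flS_smul (h : GInv G r X) {k : ℕ} (g : G) (l : List τ) (hl : l ∈ flS r X k) :
    g • l ∈ flS r X k := by
  refine ⟨?_, ?_, by simpa [list_smul_def] using hl.2.2⟩
  · rw [list_smul_def, List.pairwise_map]
    exact hl.1.imp (h.rel g _ _)
  · intro x hx
    obtain ⟨y, hy, rfl⟩ := List.mem_map.1 hx
    exact h.mem g y (hl.2.1 y hy)

lemma GInv.fin_stab (h : GInv G r X) {k : ℕ} (l : List τ) (hl : l ∈ flS r X (k + 1)) :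
    {g : G | g • l = l}.Finite := by
  cases l with
  | nil => simp [flS] at hl
  | cons x l =>
    refine (h.fin x (hl.2.1 x (by simp))).subset fun g hg => ?_
    exact (List.cons.inj (show g • x :: l.map (g • ·) = x :: l from hg)).1

lemma GInv.mp_mem (h : GInv G r X) {k : ℕ} (g : G) {c : Ch τ} (hc : c ∈ fl r X k) :
    mp (g • ·) c ∈ fl r X k :=
  LS.mp_mem (X := X) (fun x _ y _ => h.rel g x y) (h.mem g) hc

/-- The representation on chains. -/
noncomputable def GInv.rho (h : GInv G r X) (k : ℕ) : Representation ℚ G (fl r X k) where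
  toFun g := (mp (g • ·)).restrict fun _ => h.mp_mem g
  map_one' := by
    refine LinearMap.ext fun c => Subtype.ext ?_
    change mp (fun x => (1 : G) • x) c.1 = c.1
    simp only [one_smul]
    exact mp_id _
  map_mul' g g' := by
    refine LinearMap.ext fun c => Subtype.ext ?_
    change mp _ c.1 = mp _ (mp _ c.1)
    rw [mp_mp]
    congr 2
    funext x
    exact mul_smul g g' x

lemma GInv.rho_apply (h : GInv G r X) {k : ℕ} (g : G) (c : fl r X k) :
    (h.rho k g c : Ch τ) = mp (g • ·) c.1 := rfl

variable (r X) in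
/-- The restricted boundary. -/
noncomputable def bdR (k : ℕ) : fl r X (k + 1) →ₗ[ℚ] fl r X k := bd.restrict fun _ => bd_mem

lemma GInv.bdR_rho (h : GInv G r X) {k : ℕ} (g : G) (c : fl r X (k + 1)) :
    bdR r X k (h.rho (k + 1) g c) = h.rho k g (bdR r X k c) :=
  Subtype.ext (mp_bd _ _).symm

/-- The augmentation. -/
noncomputable def epsR (r : τ → τ → Prop) (X : Set τ) : fl r X 1 →ₗ[ℚ] ℚ :=
  Finsupp.lapply [] ∘ₗ (fl r X 0).subtype ∘ₗ bdR r X 0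

lemma fl_zero_eq {c : Ch τ} (hc : c ∈ fl r X 0) : c = Finsupp.single [] (c []) := by
  ext l
  by_cases hl : l = []
  · subst hl; simp
  · rw [Finsupp.single_eq_of_ne hl]
    by_contra h0
    exact hl (flS_zero.1 (mem_fl.1 hc l h0))

lemma epsR_eq_zero {c : fl r X 1} (h : epsR r X c = 0) : bdR r X 0 c = 0 := by
  refine Subtype.ext ?_
  rw [fl_zero_eq (bdR r X 0 c).2]
  change Finsupp.single [] (epsR r X c) = 0
  rw [h, Finsupp.single_zero]

lemma mp_apply_nil {σ : Type*} (f : σ → τ) (c : Ch σ) : mp f c [] = c [] := by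
  induction c using Finsupp.induction_linear with
  | zero => simp
  | add c d hc hd => simp only [map_add, Finsupp.add_apply, hc, hd]
  | single l a => cases l <;> simp

lemma GInv.epsR_rho (h : GInv G r X) (g : G) (c : fl r X 1) :
    epsR r X (h.rho 1 g c) = epsR r X c := by
  change (bdR r X 0 (h.rho 1 g c) : Ch τ) [] = (bdR r X 0 c : Ch τ) []
  rw [h.bdR_rho, h.rho_apply, mp_apply_nil]

lemma GInv.projective (h : GInv G r X) (k : ℕ) : Projective (Rep.of (h.rho (k + 1))) where
  factors {A B} f p hp := by
    classical
    rw [Rep.epi_iff_surjective] at hp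
    let u : List τ → B := fun l =>
      if hl : l ∈ flS r X (k + 1) then f.hom ⟨Finsupp.single l 1, single_mem_fl hl 1⟩ else 0
    have hu : ∀ l (hl : l ∈ flS r X (k + 1)),
        u l = f.hom ⟨Finsupp.single l 1, single_mem_fl hl 1⟩ := fun l hl => dif_pos hl
    obtain ⟨φ, h1, h2⟩ := exists_equivariant_lift A.ρ B.ρ p.hom.toLinearMap
      (fun g a => Rep.hom_comm_apply p g a) hp (S := flS r X (k + 1)) h.flS_smul h.fin_stab u
      (fun g l hl => by
        rw [hu l hl, hu _ (h.flS_smul g l hl), ← Rep.hom_comm_apply]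
        refine congrArg f.hom (Subtype.ext ?_)
        exact (mp_single _ _ _).symm)
    refine ⟨Rep.ofHom (mkInt
      (Finsupp.linearCombination ℚ φ ∘ₗ (fl r X (k + 1)).subtype) fun g c => ?_), ?_⟩
    · change Finsupp.linearCombination ℚ φ (mp (g • ·) c.1) =
        A.ρ g (Finsupp.linearCombination ℚ φ c.1)
      refine map_eq_of_single (φ := Finsupp.linearCombination ℚ φ ∘ₗ mp (g • ·))
        (ψ := A.ρ g ∘ₗ Finsupp.linearCombination ℚ φ) (fun l hl => ?_) c.2
      simp only [LinearMap.comp_apply, mp_single, Finsupp.linearCombination_single, one_smul]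
      exact h2 g l hl
    · refine Rep.hom_ext (Representation.IntertwiningMap.ext (LinearMap.ext fun c => ?_))
      have h3 : ∀ (c : Ch τ) (hc : c ∈ fl r X (k + 1)),
          p.hom (Finsupp.linearCombination ℚ φ c) = f.hom ⟨c, hc⟩ := by
        intro c hc
        induction c, hc using fl_induction with
        | h0 =>
          rw [map_zero, map_zero]
          exact (map_zero f.hom).symm
        | ha c d hc hd ic id => rw [map_add, map_add, ic, id, ← map_add]; rfl
        | hs l hl a =>
          have e : (⟨Finsupp.single l a, single_mem_fl hl a⟩ : fl r X (k + 1)) =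
              a • ⟨Finsupp.single l 1, single_mem_fl hl 1⟩ := Subtype.ext (by simp)
          have e1 := h1 l hl
          rw [hu l hl] at e1
          rw [Finsupp.linearCombination_single, map_smul, e]
          exact (congrArg (a • ·) e1).trans (map_smul f.hom _ _).symm
      exact h3 c.1 c.2

/-- The resolution by chains on an acyclic poset. -/
noncomputable def GInv.pres (h : GInv G r X) (hex : ∀ k, Ex r X k) : PRes G where
  X k := Rep.of (h.rho (k + 1))
  d k := Rep.ofHom (mkInt (bdR r X (k + 1)) fun g c =>
    h.bdR_rho g c)
  dd k := by
    refine Rep.hom_ext (Representation.IntertwiningMap.ext (LinearMap.ext fun c => Subtype.ext ?_))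
    exact bd_bd c.1
  ε := Rep.ofHom (mkInt (epsR r X) fun g c =>
    h.epsR_rho g c)
  dε := by
    refine Rep.hom_ext (Representation.IntertwiningMap.ext (LinearMap.ext fun c => ?_))
    change bd (bd c.1) [] = 0
    rw [bd_bd, Finsupp.zero_apply]
  proj k := h.projective k
  ex k b hb := by
    obtain ⟨w, hw, e⟩ := hex _ b.1 b.2 (congrArg Subtype.val hb)
    exact ⟨⟨w, hw⟩, Subtype.ext e⟩
  exε b hb := by
    obtain ⟨w, hw, e⟩ := hex _ b.1 b.2 (congrArg Subtype.val (epsR_eq_zero hb))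
    exact ⟨⟨w, hw⟩, Subtype.ext e⟩
  surj q := by
    obtain ⟨w, hw, e⟩ := hex 0 (Finsupp.single [] q) (single_mem_fl (flS_zero.2 rfl) q) (bd_single_nil q)
    refine ⟨⟨w, hw⟩, ?_⟩
    change bd w [] = q
    rw [e]; simp

end ListRes
end LS

namespace LS
section TopVanishing
open CategoryTheory

lemma lc_bdL {τ : Type*} (κ : List τ → ℚ) (s : List τ) :
    Finsupp.linearCombination ℚ κ (bdL s) =
      ∑ j ∈ Finset.range s.length, (-1 : ℚ) ^ j * κ (s.eraseIdx j) := by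
  induction s generalizing κ with
  | nil => simp [bdL]
  | cons x l ih =>
    have h : ∀ c : Ch τ, Finsupp.linearCombination ℚ κ (cn x c) =
        Finsupp.linearCombination ℚ (fun l => κ (x :: l)) c := fun c => by
      induction c using Finsupp.induction_linear with
      | zero => simp
      | add c d hc hd => simp only [map_add, hc, hd]
      | single l a => simp
    rw [bdL, map_sub, h, ih, List.length_cons, Finset.sum_range_succ', add_comm,
      sub_eq_add_neg, ← Finset.sum_neg_distrib]
    simp [pow_succ]

lemma eraseIdx_ne {α : Type*} {l : List α} (hl : l.Nodup) {i j : ℕ} (hi : i < l.length)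
    (hij : i ≠ j) : l.eraseIdx i ≠ l.eraseIdx j := by
  intro h
  have h1 : l[i] ∈ l.eraseIdx j := List.mem_eraseIdx_iff_getElem.2 ⟨i, hi, hij, rfl⟩
  rw [← h, List.mem_eraseIdx_iff_getElem] at h1
  obtain ⟨k, hk, hki, e⟩ := h1
  exact hki ((hl.getElem_inj_iff).1 e)

variable {G τ : Type} [Group G] [MulAction G τ] {r : τ → τ → Prop} {X : Set τ}

lemma smul_append_cons (g : G) (s1 s2 : List τ) (y : τ) :
    g • (s1 ++ y :: s2) = g • s1 ++ (g • y) :: g • s2 := by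
  simp [list_smul_def]

lemma smul_append (g : G) (s1 s2 : List τ) : g • (s1 ++ s2) = g • s1 ++ g • s2 := by
  simp [list_smul_def]

lemma finsum_kk {s1 s2 l1 l2 : List τ} {y : τ} (h : s1.length = l1.length)
    (hfin : {g : G | g • (s1 ++ s2) = l1 ++ l2}.Finite) :
    (Function.support fun x => kk G (s1 ++ y :: s2) (l1 ++ x :: l2)).Finite ∧
    ∑ᶠ x, kk G (s1 ++ y :: s2) (l1 ++ x :: l2) = kk G (s1 ++ s2) (l1 ++ l2) := by
  classical
  have hl : ∀ g : G, (g • s1).length = l1.length := fun g => by simpa [list_smul_def] using h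
  have key : ∀ (g : G) x, g • (s1 ++ y :: s2) = l1 ++ x :: l2 ↔
      g • (s1 ++ s2) = l1 ++ l2 ∧ g • y = x := fun g x => by
    rw [smul_append_cons, smul_append]
    constructor
    · intro e
      obtain ⟨e1, e2⟩ := List.append_inj e (hl g)
      obtain ⟨e3, e4⟩ := List.cons.inj e2
      exact ⟨by rw [e1, e4], e3⟩
    · rintro ⟨e, rfl⟩
      obtain ⟨e1, e2⟩ := List.append_inj e (hl g)
      rw [e1, e2]
  have h1 : kk G (s1 ++ s2) (l1 ++ l2) = (hfin.toFinset.card : ℚ) := by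
    rw [kk, ← Set.ncard_eq_toFinset_card _ hfin]; rfl
  have h2 : ∀ x, kk G (s1 ++ y :: s2) (l1 ++ x :: l2) =
      ((hfin.toFinset.filter fun g => g • y = x).card : ℚ) := fun x => by
    rw [kk, ← Set.ncard_coe_finset]
    congr 1
    change Set.ncard {g : G | g • (s1 ++ y :: s2) = l1 ++ x :: l2} = _
    congr 1
    ext g
    simp [key]
  have h3 : (Function.support fun x => kk G (s1 ++ y :: s2) (l1 ++ x :: l2)) ⊆
      (hfin.toFinset.image (· • y) : Finset τ) := fun x hx => by
    obtain ⟨g, hg⟩ := exists_of_kk_ne_zero hx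
    rw [key] at hg
    rw [Finset.coe_image]
    exact ⟨g, by simpa using hg.1, hg.2⟩
  refine ⟨(Finset.finite_toSet _).subset h3, ?_⟩
  rw [finsum_eq_sum_of_support_subset _ h3, h1, Finset.card_eq_sum_card_image (· • y), Nat.cast_sum]
  exact Finset.sum_congr rfl fun x _ => h2 x

lemma lc_kk_mp (g : G) (R : List τ) (c : Ch τ) :
    Finsupp.linearCombination ℚ (fun s => kk G s R) (mp (g • ·) c) =
      Finsupp.linearCombination ℚ (fun s => kk G s R) c := by
  induction c using Finsupp.induction_linear with
  | zero => simp
  | add c d hc hd => simp only [map_add, hc, hd]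
  | single l a =>
    rw [mp_single, Finsupp.linearCombination_single, Finsupp.linearCombination_single,
      ← kk_smul_left g l R]
    rfl

lemma GInv.cycle_sum (h : GInv G r X) {m : ℕ} {rk : τ → ℕ} (hrk : ∀ (g : G) x, rk (g • x) = rk x)
    {ρ0 : List ℕ} (hρ : ρ0.Nodup) (hX : ∀ l ∈ flS r X (m + 2), l.map rk = ρ0)
    {c : Ch τ} (hc : c ∈ fl r X (m + 2))
    (hbd : ∀ R : List τ, Finsupp.linearCombination ℚ (fun s => kk G s R) (bd c) = 0)
    (l1 l2 : List τ) (hl : l1.length + l2.length = m + 1) :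
    ∑ᶠ x, Finsupp.linearCombination ℚ (fun s => kk G s (l1 ++ x :: l2)) c = 0 := by
  have hmap : ∀ {s R : List τ}, kk G s R ≠ 0 → s.map rk = R.map rk := fun {s R} hk => by
    obtain ⟨g, rfl⟩ := exists_of_kk_ne_zero hk
    simp [list_smul_def, hrk, Function.comp_def]
  have herase : ∀ (l : List τ) j, (l.eraseIdx j).map rk = (l.map rk).eraseIdx j := fun l j =>
    (List.eraseIdx_map rk l j).symm
  have hcs : ∀ s ∈ c.support, s ∈ flS r X (m + 2) := fun s hs =>
    mem_fl.1 hc s (Finsupp.mem_support_iff.1 hs)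
  have hE : ∀ x, (l1 ++ x :: l2).eraseIdx l1.length = l1 ++ l2 := fun x => by
    rw [List.eraseIdx_append_of_length_le le_rfl]; simp
  by_cases hR : (l1 ++ l2).map rk = ρ0.eraseIdx l1.length
  · have hsplit : ∀ s ∈ c.support, ∃ s1 y s2, s = s1 ++ y :: s2 ∧ s1.length = l1.length := by
      intro s hs
      have h1 : l1.length < s.length := by rw [(hcs s hs).2.2]; omega
      exact ⟨s.take l1.length, s[l1.length], s.drop (l1.length + 1), by simp, by simp; omega⟩
    have hfib : ∀ s ∈ c.support,
        (Function.support fun x => kk G s (l1 ++ x :: l2)).Finite ∧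
        ∑ᶠ x, kk G s (l1 ++ x :: l2) = (-1 : ℚ) ^ l1.length *
          Finsupp.linearCombination ℚ (fun s => kk G s (l1 ++ l2)) (bdL s) := by
      intro s hs
      obtain ⟨s1, y, s2, rfl, h1⟩ := hsplit s hs
      have h2 := hcs _ hs
      have h3 : s1 ++ s2 ∈ flS r X (m + 1) := by
        refine ⟨h2.1.sublist (by simp), fun x hx => h2.2.1 x ?_, ?_⟩
        · simp only [List.mem_append, List.mem_cons] at hx ⊢; tauto
        · have := h2.2.2
          simp only [List.length_append, List.length_cons] at this ⊢
          omega
      obtain ⟨f1, f2⟩ := finsum_kk (G := G) (y := y) h1 (finite_trans (h.fin_stab _ h3) (l1 ++ l2))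
      refine ⟨f1, ?_⟩
      rw [f2, lc_bdL, Finset.sum_eq_single_of_mem l1.length]
      · rw [← mul_assoc, ← mul_pow, ← h1, List.eraseIdx_append_of_length_le le_rfl]
        simp
      · simp [h1]
      · intro j hj hj1
        by_contra h0
        have h4 := hmap (right_ne_zero_of_mul h0)
        rw [herase, hX _ h2, hR] at h4
        refine eraseIdx_ne hρ ?_ hj1 h4
        rw [← hX _ h2, List.length_map]
        exact Finset.mem_range.1 hj
    simp only [Finsupp.linearCombination_apply, Finsupp.sum, smul_eq_mul]
    rw [finsum_sum_comm _ _ fun s hs => (hfib s hs).1.subset fun x hx => right_ne_zero_of_mul hx]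
    have h5 := hbd (l1 ++ l2)
    rw [bd, Finsupp.linearCombination_apply ℚ (v := bdL), Finsupp.sum, map_sum] at h5
    rw [Finset.sum_congr rfl (g := fun s => (-1 : ℚ) ^ l1.length *
      Finsupp.linearCombination ℚ (fun s => kk G s (l1 ++ l2)) (c s • bdL s)), ← Finset.mul_sum, h5,
      mul_zero]
    intro s hs
    rw [← mul_finsum (fun x => kk G s (l1 ++ x :: l2)) (c s), (hfib s hs).2, map_smul, smul_eq_mul]
    ring
  · refine (finsum_congr fun x => ?_).trans finsum_zero
    rw [Finsupp.linearCombination_apply, Finsupp.sum]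
    refine Finset.sum_eq_zero fun s hs => ?_
    by_contra h0
    have h1 := hmap (right_ne_zero_of_smul h0)
    rw [hX s (hcs s hs)] at h1
    exact hR (by rw [h1, ← herase, hE])

theorem GInv.top_vanish (h : GInv G r X) (hex : ∀ k, Ex r X k) {m : ℕ} {rk : τ → ℕ}
    (hrk : ∀ (g : G) x, rk (g • x) = rk x)
    {ρ0 : List ℕ} (hρ : ρ0.Nodup) (hX : ∀ l ∈ flS r X (m + 2), l.map rk = ρ0)
    (hkill : ∀ a : List τ → ℚ, (∀ l, a l ≠ 0 → l ∈ flS r X (m + 2)) →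
      (∀ l1 l2 : List τ, l1.length + l2.length = m + 1 → ∑ᶠ x, a (l1 ++ x :: l2) = 0) →
      (∀ (g : G) l, a (g • l) = a l) → ∀ l, a l = 0) :
    Subsingleton (groupCohomology (Rep.trivial ℚ G ℚ) (m + 1)) := by
  classical
  refine (h.pres hex).subsingleton m fun F => ?_
  let F' : fl r X (m + 2) →ₗ[ℚ] ℚ := F.hom.toLinearMap
  have hF : ∀ (g : G) c, F' (h.rho (m + 2) g c) = F' c := fun g c => Rep.hom_comm_apply F g c
  let W : Submodule ℚ (fl r X (m + 1)) :=
    Submodule.span ℚ {w | ∃ (g : G) (v : fl r X (m + 1)), w = h.rho (m + 1) g v - v}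
  let q : fl r X (m + 2) →ₗ[ℚ] (fl r X (m + 1) ⧸ W) := W.mkQ ∘ₗ bdR r X (m + 1)
  have hq : F' ∈ (LinearMap.ker q).dualAnnihilator := by
    rw [Submodule.mem_dualAnnihilator]
    intro c hc
    have hc' : bdR r X (m + 1) c ∈ W := by
      rw [LinearMap.mem_ker, LinearMap.comp_apply, Submodule.mkQ_apply,
        Submodule.Quotient.mk_eq_zero] at hc
      exact hc
    have hbd : ∀ R : List τ,
        Finsupp.linearCombination ℚ (fun s => kk G s R) (bd c.1) = 0 := fun R => by
      let ψ : fl r X (m + 1) →ₗ[ℚ] ℚ :=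
        Finsupp.linearCombination ℚ (fun s => kk G s R) ∘ₗ (fl r X (m + 1)).subtype
      have : W ≤ LinearMap.ker ψ := by
        refine Submodule.span_le.2 ?_
        rintro _ ⟨g, v, rfl⟩
        change ψ _ = 0
        rw [map_sub, sub_eq_zero]
        exact lc_kk_mp g R v.1
      exact this hc'
    have ha := hkill (fun T => Finsupp.linearCombination ℚ (fun s => kk G s T) c.1)
      (fun T hT => by
        rw [Finsupp.linearCombination_apply, Finsupp.sum] at hT
        obtain ⟨s, hs, h0⟩ := Finset.exists_ne_zero_of_sum_ne_zero hT
        obtain ⟨g, rfl⟩ := exists_of_kk_ne_zero (right_ne_zero_of_smul h0)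
        exact h.flS_smul g s (mem_fl.1 c.2 s (Finsupp.mem_support_iff.1 hs)))
      (h.cycle_sum hrk hρ hX c.2 hbd) (fun g T => by simp only [kk_smul_right])
    let f : List τ → ℚ := fun l =>
      if hl : l ∈ flS r X (m + 2) then F' ⟨Finsupp.single l 1, single_mem_fl hl 1⟩ else 0
    have hf : ∀ l (hl : l ∈ flS r X (m + 2)),
        f l = F' ⟨Finsupp.single l 1, single_mem_fl hl 1⟩ := fun l hl => dif_pos hl
    have h1 : ∀ (z : Ch τ) (hz : z ∈ fl r X (m + 2)),
        F' ⟨z, hz⟩ = Finsupp.linearCombination ℚ f z := by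
      intro z hz
      induction z, hz using fl_induction with
      | h0 => rw [map_zero]; exact map_zero F'
      | ha y z hy hz iy iz => rw [map_add, ← iy, ← iz, ← map_add]; rfl
      | hs l hl a =>
        have e : (⟨Finsupp.single l a, single_mem_fl hl a⟩ : fl r X (m + 2)) =
            a • ⟨Finsupp.single l 1, single_mem_fl hl 1⟩ := Subtype.ext (by simp)
        rw [e, map_smul, Finsupp.linearCombination_single, hf l hl]
    rw [show c = ⟨c.1, c.2⟩ from rfl, h1]
    refine sum_eq_zero_of_average (G := G) (S := flS r X (m + 2)) h.flS_smul h.fin_stab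
      (fun g l hl => ?_) (mem_fl.1 c.2) ha
    rw [hf l hl, hf _ (h.flS_smul g l hl),
      ← hF g ⟨Finsupp.single l 1, single_mem_fl hl 1⟩]
    refine congrArg F' (Subtype.ext ?_)
    exact (mp_single _ _ _).symm
  rw [← LinearMap.range_dualMap_eq_dualAnnihilator_ker] at hq
  obtain ⟨g, hg⟩ := hq
  refine ⟨Rep.ofHom (mkInt (g ∘ₗ W.mkQ) fun a v => ?_), ?_⟩
  · change g (W.mkQ _) = g (W.mkQ v)
    congr 1
    exact (Submodule.Quotient.eq W).2 (Submodule.subset_span ⟨a, v, rfl⟩)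
  · refine Rep.hom_ext (Representation.IntertwiningMap.ext ?_)
    exact hg.symm

end TopVanishing
end LS

namespace LS
section TopK
variable {K : Type} [Field K] [NumberField K] {n : ℕ}

lemma rank_list {l : List ℕ} (hl : l.Pairwise (· > ·)) {n N : ℕ} (h : ∀ x ∈ l, n ≤ x ∧ x ≤ N) :
    l.length ≤ N + 1 - n ∧
      (l.length = N + 1 - n → l = (List.range' n (N + 1 - n)).reverse) := by
  have hnd : l.Nodup := hl.imp fun h => h.ne'
  have h1 : l.toFinset ⊆ Finset.Icc n N := fun x hx =>
    Finset.mem_Icc.2 (h x (List.mem_toFinset.1 hx))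
  have h2 : l.toFinset.card = l.length := List.toFinset_card_of_nodup hnd
  have h3 : (Finset.Icc n N).card = N + 1 - n := by simp
  refine ⟨h2 ▸ h3 ▸ Finset.card_le_card h1, fun h4 => ?_⟩
  have h5 : l.toFinset = Finset.Icc n N := Finset.eq_of_subset_of_card_le h1 (by omega)
  refine List.Perm.eq_of_pairwise (le := (· > ·)) (fun a b _ _ h1 h2 => absurd h1 (lt_asymm h2)) hl ?_ ?_
  · rw [List.pairwise_reverse]; exact List.pairwise_lt_range'
  · rw [List.perm_ext_iff_of_nodup hnd (List.nodup_reverse.2 List.nodup_range')]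
    intro x
    rw [← List.mem_toFinset, h5, List.mem_reverse, List.mem_range'_1, Finset.mem_Icc]
    omega

lemma le_rK {S : Set (Fin n → 𝓞 K)} (hS : S ∈ PK K n) (hw : wK K n S) : n ≤ rK K n S := by
  have h := geoK (K := K) (n := n)
  have h1 := h.span_le S hS
  rw [(h.wr_iff S).1 hw, finrank_top, Module.finrank_fin_fun] at h1
  exact h1

lemma le_finrank (hn : 1 ≤ n) : n ≤ Module.finrank ℝ (HH K n) := by
  obtain ⟨w, hw, e⟩ := wrK_acyclic (K := K) hn 0 (Finsupp.single [] 1)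
    (single_mem_fl (flS_zero.2 rfl) 1) (bd_single_nil 1)
  have hw0 : w ≠ 0 := by
    rintro rfl
    rw [map_zero] at e
    have := DFunLike.congr_fun e []
    simp at this
  obtain ⟨l, hl⟩ := Finsupp.ne_iff.1 hw0
  obtain ⟨_, h1, h2⟩ := mem_fl.1 hw l hl
  obtain ⟨S, rfl⟩ := List.length_eq_one_iff.1 h2
  obtain ⟨hS, hw⟩ := h1 S (by simp)
  exact (le_rK hS hw).trans ((geoK (K := K) (n := n)).rk_le S hS)

/-- The action on sets of vectors through a homomorphism to the general linear group. -/
noncomputable abbrev setAct {G : Type} [Group G] (ψ : G →* (Matrix (Fin n) (Fin n) (𝓞 K))ˣ) :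
    MulAction G (Set (Fin n → 𝓞 K)) where
  smul g S := act (ψ g) '' S
  one_smul S := by
    change act (ψ 1) '' S = S
    rw [map_one]
    have : ∀ v : Fin n → 𝓞 K, act (1 : (Matrix (Fin n) (Fin n) (𝓞 K))ˣ) v = v := fun v => by
      rw [act_apply]; simp
    simp [this]
  mul_smul g h S := by
    change act (ψ (g * h)) '' S = act (ψ g) '' (act (ψ h) '' S)
    rw [Set.image_image, map_mul]
    simp only [act_mul]

theorem group_vanish (hE : Euc (𝓞 K)) (h2 : 2 ≤ n) {G : Type} [Group G]
    (ψ : G →* (Matrix (Fin n) (Fin n) (𝓞 K))ˣ) (hψ : Function.Injective ψ)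
    (hsl : ∀ A : (Matrix (Fin n) (Fin n) (𝓞 K))ˣ, A.1.det = 1 → ∃ g, ψ g = A) (m : ℕ)
    (hm : Module.finrank ℝ (HH K n) - n ≤ m + 1) :
    Subsingleton (groupCohomology (Rep.trivial ℚ G ℚ) (m + 1)) := by
  let := setAct ψ
  have hdef : ∀ (g : G) (S : Set (Fin n → 𝓞 K)), g • S = act (ψ g) '' S := fun _ _ => rfl
  have hgeo := geoK (K := K) (n := n)
  have hnN : n ≤ Module.finrank ℝ (HH K n) := le_finrank (by omega)
  have hinv : GInv G (· > ·) {S ∈ PK K n | wK K n S} :=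
    { rel := fun g S T h => (act (ψ g)).injective.image_strictMono h
      mem := fun g S hS => ⟨(PK_image (ψ g) S).2 hS.1, (wK_image (ψ g) S).2 hS.2⟩
      fin := fun S hS => (stab_finite hS.1 hS.2).preimage hψ.injOn }
  have hlist : ∀ k, ∀ l ∈ flS (· > ·) {S ∈ PK K n | wK K n S} k,
      (l.map (rK K n)).length ≤ Module.finrank ℝ (HH K n) + 1 - n ∧
      ((l.map (rK K n)).length = Module.finrank ℝ (HH K n) + 1 - n →
        l.map (rK K n) = (List.range' n (Module.finrank ℝ (HH K n) + 1 - n)).reverse) := by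
    intro k l hl
    refine rank_list ?_ ?_
    · rw [List.pairwise_map]
      exact hl.1.imp_of_mem fun {S T} hS hT h =>
        hgeo.rk_lt T (hl.2.1 T hT).1 S (hl.2.1 S hS).1 h
    · intro x hx
      obtain ⟨S, hS, rfl⟩ := List.mem_map.1 hx
      obtain ⟨h3, h4⟩ := hl.2.1 S hS
      exact ⟨le_rK h3 h4, hgeo.rk_le S h3⟩
  refine hinv.top_vanish (fun k => (wrK_acyclic (by omega) k).flip) (rk := rK K n)
    (fun g S => rK_image (ψ g) S)
    (ρ0 := (List.range' n (Module.finrank ℝ (HH K n) + 1 - n)).reverse)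
    (List.nodup_reverse.2 List.nodup_range') (fun l hl => ?_) fun a ha1 ha2 ha3 l => ?_
  · obtain ⟨h3, h4⟩ := hlist _ l hl
    refine h4 (le_antisymm h3 ?_)
    rw [List.length_map, hl.2.2]; omega
  · rcases hm.lt_or_eq with hm | hm
    · by_contra h0
      have h3 := (hlist _ l (ha1 l h0)).1
      rw [List.length_map, (ha1 l h0).2.2] at h3
      omega
    · refine kill hE h2 hnN (a := a) ⟨fun l hl => ?_, fun l1 l2 h => ha2 l1 l2 (by omega)⟩
        (fun A hA l => ?_) l
      · rw [hm]; exact ha1 l hl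
      · obtain ⟨g, rfl⟩ := hsl A hA
        exact ha3 g l

end TopK
end LS

namespace LS
section Central
open CategoryTheory

variable {G : Type} [Group G]

lemma coh_iff {P : ProjectiveResolution (Rep.trivial ℚ G ℚ)} (A : Rep.{0} ℚ G) (j : ℕ) :
    Subsingleton (groupCohomology A (j + 1)) ↔
      ∀ f : P.complex.X (j + 1) ⟶ A, P.complex.d (j + 2) (j + 1) ≫ f = 0 →
        ∃ g : P.complex.X j ⟶ A, f = P.complex.d (j + 1) j ≫ g := by
  have h1 : Subsingleton (groupCohomology A (j + 1)) ↔
      Limits.IsZero (groupCohomology A (j + 1)) := ModuleCat.isZero_iff_subsingleton.symm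
  rw [h1, (groupCohomologyIso A (j + 1) P).isZero_iff,
    ← HomologicalComplex.exactAt_iff_isZero_homology,
    HomologicalComplex.exactAt_iff' _ j (j + 1) (j + 2) (by simp) (by simp),
    ShortComplex.moduleCat_exact_iff]
  constructor
  · intro h f hf
    obtain ⟨g, hg⟩ := h f hf
    exact ⟨g, hg.symm⟩
  · intro h f hf
    obtain ⟨g, hg⟩ := h f hf
    exact ⟨g, hg.symm⟩

/-- The endomorphism given by a central element. -/
noncomputable def cen (t : G) (ht : ∀ g, g * t = t * g) (A : Rep.{0} ℚ G) : A ⟶ A :=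
  Rep.ofHom (mkInt (A.ρ t) fun g v => by
    rw [← Module.End.mul_apply, ← Module.End.mul_apply, ← map_mul, ← map_mul, ht])

lemma cen_comm (t : G) (ht : ∀ g, g * t = t * g) {A B : Rep.{0} ℚ G} (f : A ⟶ B) :
    cen t ht A ≫ f = f ≫ cen t ht B := by
  refine Rep.hom_ext (Representation.IntertwiningMap.ext (LinearMap.ext fun v => ?_))
  exact Rep.hom_comm_apply f t v

/-- The chain endomorphism given by a central element. -/
noncomputable def cenC (t : G) (ht : ∀ g, g * t = t * g) (X : ChainComplex (Rep.{0} ℚ G) ℕ) :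
    X ⟶ X where
  f i := cen t ht (X.X i)
  comm' _ _ _ := cen_comm t ht _

lemma cen_trivial (t : G) (ht : ∀ g, g * t = t * g) :
    cen t ht (Rep.trivial ℚ G ℚ) = 𝟙 _ :=
  Rep.hom_ext (Representation.IntertwiningMap.ext (LinearMap.ext fun _ => rfl))

/-- A central element acts on a resolution of the trivial module homotopically trivially. -/
noncomputable def cenHtpy (t : G) (ht : ∀ g, g * t = t * g)
    (P : ProjectiveResolution (Rep.trivial ℚ G ℚ)) :
    Homotopy (cenC t ht P.complex) (𝟙 P.complex) :=
  ProjectiveResolution.liftHomotopy (P := P) (Q := P) (𝟙 _) _ _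
    (by
      apply HomologicalComplex.to_single_hom_ext
      have h1 := cen_comm t ht (P.π.f 0)
      have h2 : cen t ht (((ChainComplex.single₀ (Rep.{0} ℚ G)).obj (Rep.trivial ℚ G ℚ)).X 0)
          = 𝟙 _ := cen_trivial t ht
      rw [h2] at h1
      have h3 : (cenC t ht P.complex).f 0 ≫ P.π.f 0 = P.π.f 0 := h1.trans (Category.comp_id _)
      simpa using h3)
    (by simp)

lemma shift_vanish (t : G) (ht : ∀ g, g * t = t * g) (C : Rep.{0} ℚ G)
    (i : Rep.trivial ℚ G ℚ ⟶ C) (hi : Function.Injective i.hom)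
    (hex : ∀ v, C.ρ t v = v → ∃ q, i.hom q = v) (hit : ∀ q, C.ρ t (i.hom q) = i.hom q)
    (hs : ∀ v, ∃ w, C.ρ t w - w = v) (j : ℕ)
    (h : Subsingleton (groupCohomology (Rep.trivial ℚ G ℚ) (j + 2))) :
    Subsingleton (groupCohomology C (j + 1)) := by
  let P := Rep.barResolution ℚ G
  rw [coh_iff (P := P)] at h ⊢
  intro f hf
  let δ : C ⟶ C := cen t ht C - 𝟙 C
  have hδ : ∀ v, δ.hom v = C.ρ t v - v := fun v => rfl
  have w : i ≫ δ = 0 := by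
    refine Rep.hom_ext (Representation.IntertwiningMap.ext (LinearMap.ext fun v => ?_))
    exact sub_eq_zero.2 (hit v)
  have hE := rep_exact i δ w fun v hv => hex v (sub_eq_zero.1 hv)
  have : Epi δ := (Rep.epi_iff_surjective _).2 hs
  have hm : Mono i := (Rep.mono_iff_injective _).2 hi
  have := P.projective (j + 1)
  have e1 : Projective.factorThru f δ ≫ δ = f := Projective.factorThru_comp f δ
  set f' := Projective.factorThru f δ
  have e2 : (P.complex.d (j + 2) (j + 1) ≫ f') ≫ δ = 0 := by rw [Category.assoc, e1, hf]
  have : Mono (ShortComplex.mk i δ w).f := hm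
  have e3 := hE.lift_f _ e2
  set c := hE.lift _ e2
  obtain ⟨c', hc'⟩ := h c (by
    rw [← cancel_mono (ShortComplex.mk i δ w).f, Category.assoc, e3]
    simp)
  set f'' := f' - c' ≫ i with hf''
  have e4 : P.complex.d (j + 2) (j + 1) ≫ f'' = 0 := by
    rw [hf'', Preadditive.comp_sub, ← e3, hc', Category.assoc]
    exact sub_self _
  have e5 : f'' ≫ δ = f := by
    rw [hf'', Preadditive.sub_comp, e1, Category.assoc, w]
    simp
  have hc := (cenHtpy t ht P).comm (j + 1)
  have e6 : cen t ht (P.complex.X (j + 1)) = (dNext (j + 1)) (cenHtpy t ht P).hom +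
    (prevD (j + 1)) (cenHtpy t ht P).hom + 𝟙 _ := hc
  rw [dNext_eq (cenHtpy t ht P).hom (show (ComplexShape.down ℕ).Rel (j + 1) j from rfl),
    prevD_eq (cenHtpy t ht P).hom (show (ComplexShape.down ℕ).Rel (j + 2) (j + 1) from rfl)] at e6
  refine ⟨(cenHtpy t ht P).hom j (j + 1) ≫ f'', ?_⟩
  calc f = f'' ≫ δ := e5.symm
    _ = cen t ht _ ≫ f'' - f'' := by
      rw [cen_comm, Preadditive.comp_sub, Category.comp_id]
    _ = _ := by
      rw [e6]
      simp only [Preadditive.add_comp, Category.assoc, e4, Limits.comp_zero, Category.id_comp,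
        add_zero, add_sub_cancel_right]

end Central
end LS

namespace LS

lemma int_primitive (H : ℤ → ℚ) : ∃ F : ℤ → ℚ, ∀ k, F (k + 1) - F k = H k := by
  refine ⟨fun k => ∑ i ∈ Finset.range k.toNat, H i -
    ∑ i ∈ Finset.range (-k).toNat, H (-(i : ℤ) - 1), fun k => ?_⟩
  obtain ⟨a, rfl | rfl⟩ : ∃ a : ℕ, k = a ∨ k = -(a : ℤ) - 1 := by
    rcases le_or_gt 0 k with h | h
    · exact ⟨k.toNat, Or.inl (by omega)⟩
    · exact ⟨(-k - 1).toNat, Or.inr (by omega)⟩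
  · have h1 : ((a : ℤ) + 1).toNat = a + 1 := by omega
    have h2 : (-((a : ℤ) + 1)).toNat = 0 := by omega
    have h3 : (a : ℤ).toNat = a := by omega
    have h4 : (-(a : ℤ)).toNat = 0 := by omega
    simp only [h1, h2, h3, h4, Finset.sum_range_succ, Finset.range_zero, Finset.sum_empty]
    ring
  · have h1 : (-(a : ℤ) - 1 + 1).toNat = 0 := by omega
    have h2 : (-(-(a : ℤ) - 1 + 1)).toNat = a := by omega
    have h3 : (-(a : ℤ) - 1).toNat = 0 := by omega
    have h4 : (-(-(a : ℤ) - 1)).toNat = a + 1 := by omega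
    simp only [h1, h2, h3, h4, Finset.sum_range_succ, Finset.range_zero, Finset.sum_empty]
    ring

section Step
open CategoryTheory

variable {G : Type} [Group G]

lemma ker_vanish (φ : G →* Multiplicative ℤ) (t : G) (ht : ∀ g, g * t = t * g)
    (hφ : φ t = Multiplicative.ofAdd 1) (j : ℕ)
    (h : Subsingleton (groupCohomology (Rep.trivial ℚ G ℚ) (j + 2))) :
    Subsingleton (groupCohomology (Rep.trivial ℚ φ.ker ℚ) (j + 1)) := by
  let C := Rep.coind φ.ker.subtype (Rep.trivial ℚ φ.ker ℚ)
  have hC : ∀ (v : C) (s x : G), φ s = 1 → v.1 (s * x) = v.1 x := fun v s x hs => v.2 ⟨s, hs⟩ x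
  have hmk : ∀ f : G → ℚ, (∀ s x, φ s = 1 → f (s * x) = f x) → ∃ v : C, v.1 = f :=
    fun f hf => ⟨⟨f, fun s x => hf s.1 x s.2⟩, rfl⟩
  have hρ : ∀ (g : G) (v : C) (x : G), (C.ρ g v).1 x = v.1 (x * g) := fun g v x => rfl
  have hφk : ∀ k : ℤ, φ (t ^ k) = Multiplicative.ofAdd k := fun k => by
    rw [map_zpow, hφ, ← ofAdd_zsmul, smul_eq_mul, mul_one]
  have hval : ∀ (v : C) (x : G), v.1 x = v.1 (t ^ (φ x).toAdd) := fun v x => by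
    have h1 : φ (x * (t ^ (φ x).toAdd)⁻¹) = 1 := by
      rw [map_mul, map_inv, hφk, ofAdd_toAdd, mul_inv_cancel]
    have h2 := hC v _ (t ^ (φ x).toAdd) h1
    rw [inv_mul_cancel_right] at h2
    exact h2
  let i : Rep.trivial ℚ G ℚ ⟶ C := Rep.ofHom (mkInt
    { toFun := fun q => ⟨fun _ => q, fun _ _ => rfl⟩
      map_add' := fun _ _ => rfl
      map_smul' := fun _ _ => rfl } fun _ _ => rfl)
  have hi : ∀ (q : ℚ) (x : G), (i.hom q : C).1 x = q := fun _ _ => rfl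
  have key : Subsingleton (groupCohomology C (j + 1)) := by
    refine shift_vanish t ht C i ?_ ?_ ?_ ?_ j h
    · intro a b hab
      exact congrFun (congrArg Subtype.val hab) 1
    · intro v hv
      have h1 : ∀ x, v.1 (x * t) = v.1 x := fun x => congrFun (congrArg Subtype.val hv) x
      have h2 : ∀ k : ℤ, v.1 (t ^ k) = v.1 1 := fun k => by
        induction k using Int.induction_on with
        | zero => rw [zpow_zero]
        | succ k ih => rw [zpow_add_one, h1, ih]
        | pred k ih => rw [← ih, ← h1 (t ^ (-(k : ℤ) - 1)), ← zpow_add_one, sub_add_cancel]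
      refine ⟨v.1 1, Subtype.ext (funext fun x => ?_)⟩
      rw [hval v x, h2]
      rfl
    · intro q
      rfl
    · intro v
      obtain ⟨F, hF⟩ := int_primitive fun k => v.1 (t ^ k)
      obtain ⟨w, hw⟩ := hmk (fun x => F (φ x).toAdd) fun s x hs => by rw [map_mul, hs, one_mul]
      refine ⟨w, Subtype.ext (funext fun x => ?_)⟩
      have h1 : w.1 (x * t) - w.1 x = v.1 x := by
        rw [hw, hval v x, ← hF]
        simp only [map_mul, hφ, toAdd_mul, toAdd_ofAdd]
      exact h1
  exact (groupCohomology.coindIso (Rep.trivial ℚ φ.ker ℚ) (j + 1)).toLinearEquiv.toEquiv.symm.subsingleton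

lemma equiv_vanish {H : Type} [Group H] (e : G ≃* H) (j : ℕ)
    (h : Subsingleton (groupCohomology (Rep.trivial ℚ H ℚ) j)) :
    Subsingleton (groupCohomology (Rep.trivial ℚ G ℚ) j) :=
  (groupCohomology.mapIso (A := Rep.trivial ℚ G ℚ) (B := Rep.trivial ℚ H ℚ) e.symm
    (LinearEquiv.refl ℚ ℚ) (fun _ => rfl) j).toLinearEquiv.toEquiv.symm.subsingleton

lemma prod_vanish (j : ℕ)
    (h : Subsingleton (groupCohomology (Rep.trivial ℚ (G × Multiplicative ℤ) ℚ) (j + 2))) :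
    Subsingleton (groupCohomology (Rep.trivial ℚ G ℚ) (j + 1)) := by
  have h1 := ker_vanish (MonoidHom.snd G (Multiplicative ℤ)) (1, Multiplicative.ofAdd 1)
    (fun g => by ext <;> simp [mul_comm]) rfl j h
  refine equiv_vanish (H := (MonoidHom.snd G (Multiplicative ℤ)).ker) ?_ (j + 1) h1
  exact
    { toFun := fun g => ⟨(g, 1), rfl⟩
      invFun := fun x => x.1.1
      left_inv := fun _ => rfl
      right_inv := fun x => Subtype.ext (Prod.ext rfl x.2.symm)
      map_mul' := fun _ _ => rfl }

/-- Splitting off one factor of a free abelian group. -/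
def splitZ (G : Type) [Group G] (r : ℕ) :
    (G × (Fin r → Multiplicative ℤ)) × Multiplicative ℤ ≃* G × (Fin (r + 1) → Multiplicative ℤ) where
  toFun x := (x.1.1, Fin.cons x.2 x.1.2)
  invFun x := ((x.1, Fin.tail x.2), x.2 0)
  left_inv x := by simp
  right_inv x := by simp
  map_mul' x y := by
    refine Prod.ext rfl (funext fun i => ?_)
    refine Fin.cases ?_ (fun i => ?_) i <;> simp

lemma pow_vanish (r : ℕ) : ∀ j : ℕ,
    Subsingleton (groupCohomology (Rep.trivial ℚ (G × (Fin r → Multiplicative ℤ)) ℚ) (j + r + 1)) →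
    Subsingleton (groupCohomology (Rep.trivial ℚ G ℚ) (j + 1)) := by
  induction r with
  | zero =>
    intro j h
    refine equiv_vanish (H := G × (Fin 0 → Multiplicative ℤ)) ?_ (j + 1) h
    exact
      { toFun := fun g => (g, 1)
        invFun := fun x => x.1
        left_inv := fun _ => rfl
        right_inv := fun x => Prod.ext rfl (Subsingleton.elim _ _)
        map_mul' := fun _ _ => Prod.ext rfl (Subsingleton.elim _ _) }
  | succ r ih =>
    intro j h
    exact ih j (prod_vanish (j + r) (equiv_vanish (splitZ G r) _ h))

end Step
end LS

namespace LS
section Units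

lemma euc_of_isEuclideanDomain {R : Type} [CommRing R] (h : IsEuclideanDomain R) : Euc R := by
  obtain ⟨e, rfl⟩ := h
  exact euc_of_euclideanDomain R

variable (K : Type) [Field K] [NumberField K] (n : ℕ)

/-- The free part of the unit group. -/
noncomputable def unitHom : (Fin (Units.rank K) → Multiplicative ℤ) →* (𝓞 K)ˣ where
  toFun z := ∏ i, Units.fundSystem K i ^ (z i).toAdd
  map_one' := by simp
  map_mul' z w := by simp [zpow_add, Finset.prod_mul_distrib]

lemma unitHom_eq_one {z : Fin (Units.rank K) → Multiplicative ℤ} (k : ℕ) (hk : k ≠ 0)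
    (h : unitHom K z ^ k = 1) : z = 1 := by
  have h1 : unitHom K z ∈ Units.torsion K :=
    (CommGroup.mem_torsion _).2 (isOfFinOrder_iff_pow_eq_one.2 ⟨k, Nat.pos_of_ne_zero hk, h⟩)
  have h2 := Units.fun_eq_repr (K := K) (x := unitHom K z) (ζ := 1)
    (f := fun i => (z i).toAdd) (one_mem _) (by rw [one_mul]; rfl)
  rw [(QuotientGroup.eq_one_iff _).2 h1] at h2
  funext i
  have h3 := congrFun h2 i
  simpa using h3

/-- Special linear matrices times scalars, inside the general linear group. -/
noncomputable def slHom : Matrix.SpecialLinearGroup (Fin n) (𝓞 K) ×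
    (Fin (Units.rank K) → Multiplicative ℤ) →* (Matrix (Fin n) (Fin n) (𝓞 K))ˣ where
  toFun x := Matrix.SpecialLinearGroup.toGL x.1 *
    Units.map (Matrix.scalar (Fin n)).toMonoidHom (unitHom K x.2)
  map_one' := by simp
  map_mul' x y := by
    have h : Commute (Units.map (Matrix.scalar (Fin n)).toMonoidHom (unitHom K x.2))
        (Matrix.SpecialLinearGroup.toGL y.1) :=
      Units.ext (Matrix.scalar_commute _ (fun _ => Commute.all _ _) _).eq
    simp only [Prod.fst_mul, Prod.snd_mul, map_mul]
    rw [mul_assoc, mul_assoc, h.left_comm]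

lemma slHom_val (x) : (slHom K n x).1 = x.1.1 * Matrix.scalar (Fin n) (unitHom K x.2).1 := rfl

lemma slHom_injective (hn : n ≠ 0) : Function.Injective (slHom K n) := by
  rw [injective_iff_map_eq_one]
  intro x hx
  have h1 : x.1.1 * Matrix.scalar (Fin n) (unitHom K x.2).1 = 1 := congrArg Units.val hx
  have h2 := congrArg Matrix.det h1
  rw [Matrix.det_mul, x.1.2, one_mul, Matrix.det_one, Matrix.scalar_apply, Matrix.det_diagonal,
    Finset.prod_const, Finset.card_univ, Fintype.card_fin] at h2
  have h3 : x.2 = 1 := unitHom_eq_one K n hn (Units.ext h2)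
  refine Prod.ext (Subtype.ext ?_) h3
  rw [h3] at h1
  simpa using h1

end Units

lemma degree_arith {r s n a b d : ℕ} (ha : n + 1 ≤ a) (hb : n + 1 ≤ b) (hrs : 1 ≤ r + s)
    (hd : d = r * (a - 1) + s * (b - 1) - (n - 1)) (hn : 2 ≤ n) :
    1 ≤ d ∧ d + (r + s - 1) = r * a + s * b - n := by
  obtain ⟨a, rfl⟩ := Nat.exists_eq_add_of_le ha
  obtain ⟨b, rfl⟩ := Nat.exists_eq_add_of_le hb
  obtain ⟨t, ht⟩ := Nat.exists_eq_add_of_le hrs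
  rw [show n + 1 + a - 1 = n + a by omega, show n + 1 + b - 1 = n + b by omega] at hd
  have h1 : r * (n + 1 + a) + s * (n + 1 + b) = r * (n + a) + s * (n + b) + (r + s) := by ring
  have h2 : r * (n + a) + s * (n + b) = (1 + t) * n + r * a + s * b := by rw [← ht]; ring
  have h3 : (1 + t) * n = n + t * n := by ring
  omega

end LS

/-- **Lee–Szczarba.** If the ring of integers of a number field `K` is Euclidean, then for
every `n ≥ 2` the rational cohomology of `SL_n(𝓞_K)` vanishes in its virtual cohomological
dimension `r₁·(n(n+1)/2 − 1) + r₂·(n² − 1) − (n − 1)`. -/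
theorem sln_ringOfIntegers_euclidean_top_cohomology_vanishes
    (K : Type) [Field K] [NumberField K]
    (hEucl : IsEuclideanDomain (RingOfIntegers K)) (n : ℕ) (hn : 2 ≤ n) :
    Subsingleton
      (groupCohomology
        (Rep.trivial ℚ (Matrix.SpecialLinearGroup (Fin n) (RingOfIntegers K)) ℚ)
        (nrRealPlaces K * (n * (n + 1) / 2 - 1) + nrComplexPlaces K * (n ^ 2 - 1)
          - (n - 1))) := by
  have hcard := card_eq_nrRealPlaces_add_nrComplexPlaces K
  have hr : Units.rank K = nrRealPlaces K + nrComplexPlaces K - 1 := by rw [Units.rank, hcard]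
  have hpos : 1 ≤ nrRealPlaces K + nrComplexPlaces K := by
    rw [← hcard]; exact Fintype.card_pos
  generalize hd : nrRealPlaces K * (n * (n + 1) / 2 - 1) + nrComplexPlaces K * (n ^ 2 - 1)
    - (n - 1) = d
  have ha : n + 1 ≤ n * (n + 1) / 2 := by
    rw [Nat.le_div_iff_mul_le two_pos]; nlinarith
  have hb : n + 1 ≤ n ^ 2 := by nlinarith
  obtain ⟨h1, h2⟩ := LS.degree_arith ha hb hpos hd.symm hn
  obtain ⟨j, rfl⟩ := Nat.exists_eq_add_of_le' h1
  refine LS.pow_vanish (Units.rank K) j (LS.group_vanish (LS.euc_of_isEuclideanDomain hEucl) hn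
    (LS.slHom K n) (LS.slHom_injective K n (by omega)) (fun A hA => ⟨(⟨A.1, hA⟩, 1), ?_⟩) _ ?_)
  · refine Units.ext ?_
    rw [LS.slHom_val]
    simp
  · have h3 := LS.finrank_HH_le (K := K) (n := n)
    omega
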